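/- Let ε > 0, X ≥ 2, 1 ≤ Y ≤ X^{100}, and 1 ≤ M ≤ X^{100}. Then 𝒮_R(|𝓜(q)² A₂(q)|; F) ≪ X^ε ( X (M/Y)^{2/3} + X^{5/6} M ), where the implied constant depends only on ε, on F, and on the implied constants in the bound λ(𝔟) ≪_ε N(𝔟)^{−1+ε} on the mollifier coefficients. -/

import Mathlib

noncomputable section

open Complex

namespace CubicPaper

/-- `ω = e^{2πi/3}`. -/
def ωc : ℂ := Complex.exp (2 * Real.pi * Complex.I / 3)

/-- The ring of Eisenstein integers `ℤ[ω]`, realized as a subring of `ℂ`. -/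
def Eis : Subring ℂ := Subring.closure {ωc}

/-- `ω` as an Eisenstein integer. -/
def ωE : Eis := ⟨ωc, Subring.subset_closure (Set.mem_singleton _)⟩

/-- The ramified prime `λ = 1 + 2ω`. -/
def lam : Eis := 1 + 2 * ωE

/-- The norm `N(x) = |x|²`. -/
def Nm (x : Eis) : ℝ := Complex.normSq (x : ℂ)

/-- The norm as a natural number. -/
def NmN (x : Eis) : ℕ := ⌊Nm x⌋₊

/-- `Rep x` : `x` is the canonical generator `λ^k c`, `c ≡ 1 (mod 3)`, of a nonzero ideal;
nonzero ideals of `ℤ[ω]` are in bijection with elements satisfying `Rep`. -/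
def Rep (x : Eis) : Prop := ∃ (k : ℕ) (c : Eis), (3 : Eis) ∣ (c - 1) ∧ x = lam ^ k * c

/-- `ě(z) = e^{2πi(z + z̄)}`. -/
def eE (z : ℂ) : ℂ := Complex.exp (2 * Real.pi * Complex.I * (z + (starRingEnd ℂ) z))

/-- Characterizing axioms of the cubic residue symbol; `χ b a` denotes `(a/b)₃`
(the lower entry `b ≡ 1 (mod 3)` comes first). -/
structure IsCubicSymbol (χ : Eis → Eis → Eis) : Prop where
  one_bot : ∀ a, χ 1 a = 1
  mul_bot : ∀ b₁ b₂ a, (3 : Eis) ∣ (b₁ - 1) → (3 : Eis) ∣ (b₂ - 1) →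
    χ (b₁ * b₂) a = χ b₁ a * χ b₂ a
  prime_vals : ∀ π a, Prime π → (3 : Eis) ∣ (π - 1) →
    χ π a = 0 ∨ χ π a = 1 ∨ χ π a = ωE ∨ χ π a = ωE ^ 2
  prime_congr : ∀ π a, Prime π → (3 : Eis) ∣ (π - 1) →
    π ∣ (a ^ ((NmN π - 1) / 3) - χ π a)
  prime_eq_zero : ∀ π a, Prime π → (3 : Eis) ∣ (π - 1) → (χ π a = 0 ↔ π ∣ a)

/-- Characterizing axioms of the Möbius function on `ℤ[ω]`. -/
structure IsMoebius (μ : Eis → ℤ) : Prop where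
  isUnit : ∀ u : Eis, IsUnit u → μ u = 1
  prime_mul : ∀ p x, Prime p → ¬ p ∣ x → μ (p * x) = - μ x
  eq_zero : ∀ x : Eis, ¬ Squarefree x → μ x = 0

/-- The cubic Gauss sum `g₃(m, c) = ∑_{d mod c} χ_c(d) ě(md/c)`. -/
def g₃ (χ : Eis → Eis → Eis) (m c : Eis) : ℂ :=
  ∑ᶠ d : Eis ⧸ Ideal.span {c}, ((χ c d.out : Eis) : ℂ) * eE (((m * d.out : Eis) : ℂ) / (c : ℂ))

/-- The normalized cubic Gauss sum `g̃₃(m, c) = N(c)^{-1/2} g₃(m, c)`. -/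
def g₃n (χ : Eis → Eis → Eis) (m c : Eis) : ℂ :=
  ((Real.sqrt (Nm c) : ℂ))⁻¹ * g₃ χ m c

/-- Euler's totient on `ℤ[ω]`. -/
def phiE (b : Eis) : ℕ := Nat.card {x : Eis ⧸ Ideal.span {b} // IsUnit x}

/-- The kernel `Φ_j(y) = (1/2πi)∫_{(2)} (2π)^{-jw} y^{-w} (Γ(1/2+w)/Γ(1/2))^j dw/w`. -/
def Φ (j : ℕ) (y : ℝ) : ℂ :=
  (1 / (2 * Real.pi)) * ∫ t : ℝ,
    (2 * Real.pi : ℂ) ^ (-((j : ℂ) * (2 + t * Complex.I))) *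
    (y : ℂ) ^ (-(2 + t * Complex.I)) *
    (Complex.Gamma (1 / 2 + (2 + t * Complex.I)) / Complex.Gamma (1 / 2)) ^ j /
    (2 + t * Complex.I)

/-- `A₁(q)`, the sum appearing in the approximate functional equation for `L(1/2, χ_q)`. -/
def A₁ (χ : Eis → Eis → Eis) (q : Eis) : ℂ :=
  ∑' n : {x : Eis // Rep x},
    ((χ q n.1 : Eis) : ℂ) * (Nm n.1 : ℂ) ^ (-(1/2 : ℂ)) *
      Φ 1 (Nm n.1 / Real.sqrt (3 * Nm q))

/-- `A₂(q)`, the double sum appearing in the approximate functional equation for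
`|L(1/2, χ_q)|²`. -/
def A₂ (χ : Eis → Eis → Eis) (q : Eis) : ℂ :=
  ∑' p : {x : Eis // Rep x} × {x : Eis // Rep x},
    ((χ q p.1.1 : Eis) : ℂ) * (starRingEnd ℂ) ((χ q p.2.1 : Eis) : ℂ) *
      ((Nm p.1.1 * Nm p.2.1 : ℝ) : ℂ) ^ (-(1/2 : ℂ)) *
      Φ 2 (Nm p.1.1 * Nm p.2.1 / (3 * Nm q))

/-- `M_Y(q) = ∑_{𝔩² ∣ q, N(𝔩) ≤ Y} μ(𝔩)` (sum over nonzero ideals `𝔩`, i.e. over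
canonical generators). -/
def MY (μ : Eis → ℤ) (Y : ℝ) (q : Eis) : ℤ :=
  ∑ᶠ l ∈ {l : Eis | Rep l ∧ l ^ 2 ∣ q ∧ Nm l ≤ Y}, μ l

/-- `R_Y(q) = ∑_{𝔩² ∣ q, N(𝔩) > Y} μ(𝔩)`. -/
def RY (μ : Eis → ℤ) (Y : ℝ) (q : Eis) : ℤ :=
  ∑ᶠ l ∈ {l : Eis | Rep l ∧ l ^ 2 ∣ q ∧ Y < Nm l}, μ l

/-- The mollifier `𝓜(q) = ∑_𝔟 λ(𝔟) √N(𝔟) χ_q(𝔟)` attached to coefficients `lm`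
(supported on canonical generators of squarefree ideals coprime to 3). -/
def Moll (χ : Eis → Eis → Eis) (lm : Eis → ℂ) (q : Eis) : ℂ :=
  ∑ᶠ b : Eis, lm b * (Real.sqrt (Nm b) : ℂ) * ((χ q b : Eis) : ℂ)

/-- `𝒮_M(β; F) = ∑_{q ≡ 1 (9)} M_Y(q) β_q F(N(q)/X)`. -/
def SM (μ : Eis → ℤ) (Y X : ℝ) (F : ℝ → ℝ) (β : Eis → ℂ) : ℂ :=
  ∑ᶠ q ∈ {q : Eis | (9 : Eis) ∣ (q - 1)}, (MY μ Y q : ℂ) * β q * (F (Nm q / X) : ℂ)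

/-- `𝒮_R(|β|; F) = ∑_{q ≡ 1 (9)} |R_Y(q)| ‖β_q‖ F(N(q)/X)`. -/
def SR (μ : Eis → ℤ) (Y X : ℝ) (F : ℝ → ℝ) (β : Eis → ℂ) : ℝ :=
  ∑ᶠ q ∈ {q : Eis | (9 : Eis) ∣ (q - 1)}, |(RY μ Y q : ℝ)| * ‖β q‖ * F (Nm q / X)

/-- A test function: Schwartz (here: smooth), compactly supported in `(1,2)`,
with `0 ≤ F ≤ 1`. -/
structure IsTestFn (F : ℝ → ℝ) : Prop where
  smooth : ContDiff ℝ (⊤ : ℕ∞) F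
  supp : ∀ t, F t ≠ 0 → 1 < t ∧ t < 2
  nonneg : ∀ t, 0 ≤ F t
  le_one : ∀ t, F t ≤ 1

/-- `F̌(0) = ∫₀^∞ F(t) dt`. -/
def Fcheck0 (F : ℝ → ℝ) : ℝ := ∫ t in Set.Ioi (0:ℝ), F t

/-- `F̌'(0) = ∫₀^∞ F(t) log t dt`. -/
def Fcheck'0 (F : ℝ → ℝ) : ℝ := ∫ t in Set.Ioi (0:ℝ), F t * Real.log t

/-- The Dedekind zeta function of `ℚ(ω)` (at real `s > 1`). -/
def zetaK (s : ℝ) : ℝ := ∑' n : {x : Eis // Rep x}, (Nm n.1) ^ (-s)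

/-- Product of `f(N(𝔭))` over the prime ideals `𝔭 ∤ 3` of `ℤ[ω]`, i.e. over primes
`π ≡ 1 (mod 3)` (one in each associate class). -/
def primeProd (f : ℝ → ℝ) : ℝ :=
  ∏' π : {p : Eis // Prime p ∧ (3 : Eis) ∣ (p - 1)}, f (Nm π.1)

/-- Product of `f(N(𝔭))` over the prime ideals `𝔭 ∤ 3` dividing `x` (a finite product). -/
def primeDivProd (f : ℝ → ℝ) (x : Eis) : ℝ :=
  ∏ᶠ π ∈ {p : Eis | Prime p ∧ (3 : Eis) ∣ (p - 1) ∧ p ∣ x}, f (Nm π)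

/-- The Hecke `L`-series `∑_𝔫 χ_q(𝔫) N(𝔫)^{-s}` (convergent for `Re(s) > 1`). -/
def heckeSeries (χ : Eis → Eis → Eis) (q : Eis) (s : ℂ) : ℂ :=
  ∑' n : {x : Eis // Rep x}, ((χ q n.1 : Eis) : ℂ) * (Nm n.1 : ℂ) ^ (-s)

/-- `L` is the (unique) entire continuation of the Hecke `L`-series of `χ_q`. -/
def IsHeckeL (χ : Eis → Eis → Eis) (q : Eis) (L : ℂ → ℂ) : Prop :=
  Differentiable ℂ L ∧ ∀ s : ℂ, 1 < s.re → L s = heckeSeries χ q s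

/-- Membership in the family `F₃` of conductors of primitive cubic Hecke characters
congruent to `1 (mod 9)`. -/
def memF₃ (q : Eis) : Prop :=
  ∃ q₁ q₂ : Eis, (3 : Eis) ∣ (q₁ - 1) ∧ (3 : Eis) ∣ (q₂ - 1) ∧ Squarefree (q₁ * q₂) ∧
    NmN (q₁ * q₂ ^ 2) % 9 = 1 ∧ q = q₁ * q₂ ^ 2 ∧ (9 : Eis) ∣ (q - 1) ∧ q ≠ 1

/-- `ψ_α(r, s) = ∑_{c ≡ 1 (3), (c, α) = 1} g₃(r, c) N(c)^{-s}`. -/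
def ψa (χ : Eis → Eis → Eis) (α r : Eis) (s : ℂ) : ℂ :=
  ∑' c : {c : Eis // (3 : Eis) ∣ (c - 1) ∧ IsCoprime c α},
    g₃ χ r c.1 * (Nm c.1 : ℂ) ^ (-s)

/-- `ψ(r, s) = ∑_{c ≡ 1 (3)} g₃(r, c) N(c)^{-s}`. -/
def ψ₀ (χ : Eis → Eis → Eis) (r : Eis) (s : ℂ) : ℂ :=
  ∑' c : {c : Eis // (3 : Eis) ∣ (c - 1)}, g₃ χ r c.1 * (Nm c.1 : ℂ) ^ (-s)

/-- `Δ_α(s) = ∏_{π ≡ 1 (3) prime, π ∣ α} (1 - N(π)^{2-3s})`. -/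
def Δprod (α : Eis) (s : ℂ) : ℂ :=
  ∏ᶠ π ∈ {p : Eis | Prime p ∧ (3 : Eis) ∣ (p - 1) ∧ p ∣ α},
    (1 - (Nm π : ℂ) ^ ((2 : ℂ) - 3 * s))

/-- `Ψ` is the (unique) continuation of `ψ(r, ·)` to the strip `1 < Re(s) < 2`,
holomorphic away from `s = 4/3`. -/
def IsPsiContinuation (χ : Eis → Eis → Eis) (r : Eis) (Ψ : ℂ → ℂ) : Prop :=
  (∀ s : ℂ, 1 < s.re → s.re < 2 → s ≠ 4/3 → DifferentiableAt ℂ Ψ s) ∧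
  (∀ s : ℂ, 3/2 < s.re → s.re < 2 → Ψ s = ψ₀ χ r s)


/-! ### Basic structure of the Eisenstein integers -/

lemma ωc_eq : ωc = -(1/2 : ℂ) + (Real.sqrt 3 / 2 : ℝ) * I := by
  have h : (2 * Real.pi * I / 3 : ℂ) = ((Real.pi - Real.pi / 3 : ℝ) : ℂ) * I := by
    push_cast; ring
  rw [ωc, h, Complex.exp_mul_I, ← Complex.ofReal_cos, ← Complex.ofReal_sin, Real.cos_pi_sub,
    Real.sin_pi_sub, Real.cos_pi_div_three, Real.sin_pi_div_three]
  push_cast; ring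

lemma ωc_sq : ωc ^ 2 = -1 - ωc := by
  have h3 : ((Real.sqrt 3 : ℝ) : ℂ) ^ 2 = 3 := by
    rw [← Complex.ofReal_pow, Real.sq_sqrt (by norm_num)]; norm_num
  rw [ωc_eq]
  push_cast
  ring_nf
  rw [h3, I_sq]
  ring

lemma ωE_sq : ωE ^ 2 = -1 - ωE := by
  apply Subtype.ext
  simp only [ωE]
  push_cast
  exact ωc_sq

lemma ωE_mul_self : ωE * ωE = -1 - ωE := by rw [← pow_two, ωE_sq]

lemma ωE_cube : ωE ^ 3 = 1 := by
  linear_combination (ωE - 1) * ωE_sq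

lemma lam_sq : lam ^ 2 = -3 := by
  unfold lam
  linear_combination 4 * ωE_sq

/-- `a + bω`. -/
def mk (a b : ℤ) : Eis := (a : Eis) + (b : Eis) * ωE

lemma mk_mul (a b c d : ℤ) : mk a b * mk c d = mk (a * c - b * d) (a * d + b * c - b * d) := by
  unfold mk
  push_cast
  linear_combination (b * d : Eis) * ωE_sq

lemma mk_add (a b c d : ℤ) : mk a b + mk c d = mk (a + c) (b + d) := by
  unfold mk; push_cast; ring

lemma mk_neg (a b : ℤ) : - mk a b = mk (-a) (-b) := by
  unfold mk; push_cast; ring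

lemma mk_sub (a b c d : ℤ) : mk a b - mk c d = mk (a - c) (b - d) := by
  unfold mk; push_cast; ring

lemma intCast_eq_mk (a : ℤ) : (a : Eis) = mk a 0 := by unfold mk; simp

lemma one_eq_mk : (1 : Eis) = mk 1 0 := by unfold mk; simp
lemma zero_eq_mk : (0 : Eis) = mk 0 0 := by unfold mk; simp
lemma three_eq_mk : (3 : Eis) = mk 3 0 := by unfold mk; simp
lemma lam_eq_mk : lam = mk 1 2 := by unfold mk lam; simp
lemma ωE_eq_mk : ωE = mk 0 1 := by unfold mk; simp

lemma coe_mk (a b : ℤ) : ((mk a b : Eis) : ℂ) = a + b * ωc := by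
  unfold mk; push_cast; rfl

lemma exists_mk (x : Eis) : ∃ a b : ℤ, x = mk a b := by
  obtain ⟨x, hx⟩ := x
  have : ∀ y ∈ Subring.closure {ωc}, ∃ a b : ℤ, y = a + b * ωc := by
    intro y hy
    induction hy using Subring.closure_induction with
    | mem y hy => exact ⟨0, 1, by simp at hy; simp [hy]⟩
    | zero => exact ⟨0, 0, by simp⟩
    | one => exact ⟨1, 0, by simp⟩
    | add y z _ _ h1 h2 =>
      obtain ⟨a, b, rfl⟩ := h1
      obtain ⟨c, d, rfl⟩ := h2
      exact ⟨a + c, b + d, by push_cast; ring⟩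
    | neg y _ h1 =>
      obtain ⟨a, b, rfl⟩ := h1
      exact ⟨-a, -b, by push_cast; ring⟩
    | mul y z _ _ h1 h2 =>
      obtain ⟨a, b, rfl⟩ := h1
      obtain ⟨c, d, rfl⟩ := h2
      refine ⟨a * c - b * d, a * d + b * c - b * d, ?_⟩
      push_cast
      linear_combination (b * d : ℂ) * ωc_sq
  obtain ⟨a, b, h⟩ := this x hx
  exact ⟨a, b, Subtype.ext (by rw [coe_mk]; exact h)⟩

lemma Nm_mk (a b : ℤ) : Nm (mk a b) = ((a ^ 2 - a * b + b ^ 2 : ℤ) : ℝ) := by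
  have h3 : (Real.sqrt 3) ^ 2 = 3 := Real.sq_sqrt (by norm_num)
  rw [Nm, coe_mk, ωc_eq, Complex.normSq_apply]
  simp
  linear_combination (b^2 / 4 : ℝ) * h3

lemma Nm_nonneg (x : Eis) : 0 ≤ Nm x := Complex.normSq_nonneg _

lemma Nm_mul (x y : Eis) : Nm (x * y) = Nm x * Nm y := by
  simp [Nm]

lemma Nm_pow (x : Eis) (n : ℕ) : Nm (x ^ n) = Nm x ^ n := by
  simp [Nm]

@[simp] lemma Nm_one : Nm 1 = 1 := by simp [Nm]
@[simp] lemma Nm_zero : Nm 0 = 0 := by simp [Nm]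
@[simp] lemma Nm_neg (x : Eis) : Nm (-x) = Nm x := by simp [Nm]

lemma Nm_eq_zero {x : Eis} : Nm x = 0 ↔ x = 0 := by
  simp [Nm]

lemma Nm_pos {x : Eis} (hx : x ≠ 0) : 0 < Nm x :=
  lt_of_le_of_ne (Nm_nonneg x) (fun h => hx (Nm_eq_zero.1 h.symm))

lemma Nm_int (x : Eis) : ∃ n : ℤ, Nm x = n := by
  obtain ⟨a, b, rfl⟩ := exists_mk x
  exact ⟨_, Nm_mk a b⟩

lemma Nm_nat (x : Eis) : (NmN x : ℝ) = Nm x := by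
  obtain ⟨n, hn⟩ := Nm_int x
  have h0 : 0 ≤ n := by
    have := Nm_nonneg x
    rw [hn] at this; exact_mod_cast this
  lift n to ℕ using h0
  rw [NmN, hn]
  simp

lemma one_le_Nm {x : Eis} (hx : x ≠ 0) : 1 ≤ Nm x := by
  have h := Nm_pos hx
  rw [← Nm_nat] at h ⊢
  exact_mod_cast h

lemma NmN_mul (x y : Eis) : NmN (x * y) = NmN x * NmN y := by
  have h : ((NmN (x * y) : ℕ) : ℝ) = ((NmN x * NmN y : ℕ) : ℝ) := by
    push_cast; rw [Nm_nat, Nm_nat, Nm_nat, Nm_mul]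
  exact_mod_cast h

lemma Nm_le_of_dvd {x y : Eis} (h : x ∣ y) (hy : y ≠ 0) : Nm x ≤ Nm y := by
  obtain ⟨z, rfl⟩ := h
  rw [Nm_mul]
  have hz : z ≠ 0 := by rintro rfl; simp at hy
  nlinarith [one_le_Nm hz, Nm_nonneg x]

lemma mk_inj {a b c d : ℤ} (h : mk a b = mk c d) : a = c ∧ b = d := by
  have h1 : Nm (mk a b - mk c d) = 0 := by rw [h, sub_self, Nm_zero]
  rw [mk_sub, Nm_mk] at h1
  have h2 : (a - c) ^ 2 - (a - c) * (b - d) + (b - d) ^ 2 = 0 := by exact_mod_cast h1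
  have h3 : b - d = 0 := by
    have : (b - d)^2 ≤ 0 := by nlinarith [sq_nonneg (2 * (a - c) - (b - d))]
    nlinarith [pow_eq_zero_iff (two_ne_zero) |>.1 (le_antisymm this (sq_nonneg (b-d)))]
  have h4 : a - c = 0 := by
    rw [h3] at h2
    have : (a - c)^2 = 0 := by linarith
    exact pow_eq_zero_iff (two_ne_zero) |>.1 this
  constructor <;> omega

/-- `ℤ[ω] ≃ ℤ × ℤ`. -/
def eisEquiv : ℤ × ℤ ≃ Eis :=
  Equiv.ofBijective (fun p => mk p.1 p.2)
    ⟨fun p q h => Prod.ext (mk_inj h).1 (mk_inj h).2, fun x => by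
      obtain ⟨a, b, h⟩ := exists_mk x
      exact ⟨(a, b), h.symm⟩⟩

lemma eisEquiv_apply (p : ℤ × ℤ) : eisEquiv p = mk p.1 p.2 := rfl

/-- conjugation -/
def conjE : Eis →+* Eis :=
  RingHom.codRestrict ((starRingEnd ℂ).comp Eis.subtype) Eis (by
    intro x
    obtain ⟨a, b, rfl⟩ := exists_mk x
    have : (starRingEnd ℂ) ((mk a b : Eis) : ℂ) = ((mk (a - b) (-b) : Eis) : ℂ) := by
      rw [coe_mk, coe_mk, ωc_eq]
      simp [map_ofNat]
      ring
    simp only [RingHom.comp_apply, Subring.subtype_apply]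
    rw [this]
    exact Subtype.coe_prop _)

lemma coe_conjE (x : Eis) : ((conjE x : Eis) : ℂ) = (starRingEnd ℂ) (x : ℂ) := rfl

lemma conjE_conjE (x : Eis) : conjE (conjE x) = x := by
  apply Subtype.ext; simp [coe_conjE]

lemma mul_conjE (x : Eis) : x * conjE x = ((NmN x : ℕ) : Eis) := by
  apply Subtype.ext
  push_cast
  rw [coe_conjE, Complex.mul_conj]
  have := Nm_nat x
  rw [Nm] at this
  exact_mod_cast this.symm

lemma Nm_conjE (x : Eis) : Nm (conjE x) = Nm x := by
  simp [Nm, coe_conjE]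

lemma conjE_ω : conjE ωE = ωE ^ 2 := by
  rw [ωE_sq]
  apply Subtype.ext
  rw [coe_conjE]
  simp only [ωE]
  push_cast
  rw [ωc_eq]; simp [map_ofNat]; ring

/-- Conjugation as equiv. -/
def conjEquiv : Eis ≃+* Eis :=
  RingEquiv.ofRingHom conjE conjE (by ext x; simp [conjE_conjE]) (by ext x; simp [conjE_conjE])

lemma conjEquiv_apply (x : Eis) : conjEquiv x = conjE x := rfl

/-- Euclidean division. -/
lemma exists_div (x y : Eis) (hy : y ≠ 0) : ∃ q : Eis, Nm (x - y * q) < Nm y := by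
  obtain ⟨a, b, hab⟩ := exists_mk (x * conjE y)
  set n : ℤ := (NmN y : ℤ) with hn
  have hn0 : (0:ℝ) < n := by
    rw [hn]; push_cast; rw [Nm_nat]; exact Nm_pos hy
  set q := mk (round ((a:ℝ) / n)) (round ((b:ℝ)/n)) with hq
  refine ⟨q, ?_⟩
  have hyy : y * conjE y = mk n 0 := by
    rw [mul_conjE, ← intCast_eq_mk, hn]; simp
  have h1 : (x - y * q) * conjE y = mk (a - n * round ((a:ℝ) / n)) (b - n * round ((b:ℝ)/n)) := by
    have : (x - y * q) * conjE y = x * conjE y - (y * conjE y) * q := by ring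
    rw [this, hab, hyy, hq, mk_mul, mk_sub]
    congr 1 <;> ring
  have h2 : Nm (x - y * q) * Nm y = Nm ((x - y * q) * conjE y) := by rw [Nm_mul, Nm_conjE]
  rw [h1, Nm_mk] at h2
  have hA := abs_sub_round ((a:ℝ) / n)
  have hB := abs_sub_round ((b:ℝ) / n)
  set u := (a:ℝ)/n - round ((a:ℝ)/n)
  set v := (b:ℝ)/n - round ((b:ℝ)/n)
  have hu : ((a - n * round ((a:ℝ) / n) : ℤ) : ℝ) = n * u := by
    simp only [u]; push_cast; field_simp
  have hv : ((b - n * round ((b:ℝ) / n) : ℤ) : ℝ) = n * v := by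
    simp only [v]; push_cast; field_simp
  have h3 : Nm (x - y * q) * Nm y = n^2 * (u ^2 - u * v + v ^ 2) := by
    rw [h2]; push_cast at hu hv ⊢; rw [hu, hv]; ring
  have hNy : Nm y = n := by rw [hn]; push_cast; rw [Nm_nat]
  rw [hNy] at h3 ⊢
  have h4 : u ^ 2 - u * v + v ^ 2 < 1 := by
    rw [abs_le] at hA hB
    nlinarith
  have h5 : Nm (x - y * q) = n * (u ^2 - u * v + v ^ 2) := by
    have : (n:ℝ) ≠ 0 := hn0.ne'
    field_simp at h3 ⊢
    nlinarith
  rw [h5]; nlinarith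

instance : IsPrincipalIdealRing Eis where
  principal I := by
    classical
    by_cases hI : I = ⊥
    · subst hI; exact ⟨⟨0, by simp⟩⟩
    obtain ⟨x0, hx0, hx00⟩ := Submodule.exists_mem_ne_zero_of_ne_bot hI
    have hex : ∃ n : ℕ, ∃ x ∈ I, x ≠ 0 ∧ NmN x = n := ⟨_, x0, hx0, hx00, rfl⟩
    obtain ⟨y, hyI, hy0, hyn⟩ := Nat.find_spec hex
    refine ⟨⟨y, ?_⟩⟩
    apply le_antisymm
    · intro x hx
      obtain ⟨q, hq⟩ := exists_div x y hy0
      have hmem : x - y * q ∈ I := I.sub_mem hx (I.mul_mem_right _ hyI)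
      have : x - y * q = 0 := by
        by_contra hne
        have h1 := Nat.find_min' hex ⟨_, hmem, hne, rfl⟩
        rw [← hyn] at h1
        have h2 : Nm y ≤ Nm (x - y * q) := by
          rw [← Nm_nat, ← Nm_nat]; exact_mod_cast h1
        linarith
      rw [sub_eq_zero] at this
      rw [this]
      exact Ideal.mem_span_singleton.2 ⟨q, rfl⟩
    · rw [Submodule.span_singleton_le_iff_mem]; exact hyI

lemma isUnit_iff_Nm {u : Eis} : IsUnit u ↔ Nm u = 1 := by
  constructor
  · rintro ⟨v, rfl⟩
    have h : Nm (v : Eis) * Nm ((v⁻¹ : Eisˣ) : Eis) = 1 := by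
      rw [← Nm_mul]; simp
    have h1 := one_le_Nm (v.ne_zero)
    have h2 := one_le_Nm (v⁻¹).ne_zero
    nlinarith
  · intro h
    have : NmN u = 1 := by
      have h2 := Nm_nat u
      rw [h] at h2; exact_mod_cast h2
    have h3 := mul_conjE u
    rw [this] at h3
    exact IsUnit.of_mul_eq_one (conjE u) (by simpa using h3)

/-- The six units. -/
lemma unit_cases {u : Eis} (hu : IsUnit u) :
    u = 1 ∨ u = -1 ∨ u = ωE ∨ u = -ωE ∨ u = ωE ^ 2 ∨ u = -ωE ^ 2 := by
  rw [isUnit_iff_Nm] at hu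
  obtain ⟨a, b, rfl⟩ := exists_mk u
  rw [Nm_mk] at hu
  have h : a ^ 2 - a * b + b ^ 2 = 1 := by exact_mod_cast hu
  have ha : a ^ 2 ≤ 1 := by nlinarith [sq_nonneg (a - 2 * b)]
  have hb : b ^ 2 ≤ 1 := by nlinarith [sq_nonneg (b - 2 * a)]
  have ha1 : -1 ≤ a := by nlinarith
  have ha2 : a ≤ 1 := by nlinarith
  have hb1 : -1 ≤ b := by nlinarith
  have hb2 : b ≤ 1 := by nlinarith
  rw [ωE_sq]
  interval_cases a <;> interval_cases b <;> simp [mk] at h ⊢ <;> ring_nf <;> simp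

/-- primary -/
def P1 (a : Eis) : Prop := (3 : Eis) ∣ a - 1

lemma P1_one : P1 1 := by simp [P1]

lemma P1.mul {a b : Eis} (ha : P1 a) (hb : P1 b) : P1 (a * b) := by
  obtain ⟨x, hx⟩ := ha
  obtain ⟨y, hy⟩ := hb
  refine ⟨a * y + x, ?_⟩
  linear_combination a * hy + hx

lemma P1.pow {a : Eis} (ha : P1 a) (n : ℕ) : P1 (a ^ n) := by
  induction n with
  | zero => simpa using P1_one
  | succ n ih => rw [pow_succ]; exact ih.mul ha

lemma P1_of_mul {a b : Eis} (ha : P1 a) (hab : P1 (a * b)) : P1 b := by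
  obtain ⟨x, hx⟩ := ha
  obtain ⟨y, hy⟩ := hab
  refine ⟨y - x * b, ?_⟩
  linear_combination hy - b * hx

lemma three_dvd_mk {a b : ℤ} : (3 : Eis) ∣ mk a b ↔ 3 ∣ a ∧ 3 ∣ b := by
  constructor
  · rintro ⟨z, hz⟩
    obtain ⟨c, d, rfl⟩ := exists_mk z
    rw [three_eq_mk, mk_mul] at hz
    obtain ⟨h1, h2⟩ := mk_inj hz
    constructor <;> omega
  · rintro ⟨⟨c, rfl⟩, d, rfl⟩
    exact ⟨mk c d, by rw [three_eq_mk, mk_mul]; congr 1 <;> ring⟩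

lemma P1_mk {a b : ℤ} : P1 (mk a b) ↔ 3 ∣ a - 1 ∧ 3 ∣ b := by
  rw [P1, one_eq_mk, mk_sub, three_dvd_mk]; simp

lemma lam_dvd_mk {a b : ℤ} : lam ∣ mk a b ↔ 3 ∣ a + b := by
  constructor
  · rintro ⟨z, hz⟩
    obtain ⟨c, d, rfl⟩ := exists_mk z
    rw [lam_eq_mk, mk_mul] at hz
    obtain ⟨h1, h2⟩ := mk_inj hz
    omega
  · rintro ⟨k, hk⟩
    refine ⟨mk (2 * k - a) (k - a), ?_⟩
    rw [lam_eq_mk, mk_mul]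
    congr 1 <;> omega

lemma P1.not_lam_dvd {a : Eis} (ha : P1 a) : ¬ lam ∣ a := by
  obtain ⟨x, y, rfl⟩ := exists_mk a
  rw [P1_mk] at ha
  rw [lam_dvd_mk]; omega

lemma P1.ne_zero {a : Eis} (ha : P1 a) : a ≠ 0 := by
  rintro rfl
  exact ha.not_lam_dvd (dvd_zero _)

/-- each element prime to `λ` has an associate `≡ 1 mod 3` -/
lemma exists_unit_P1 {x : Eis} (hx : ¬ lam ∣ x) : ∃ u : Eis, IsUnit u ∧ P1 (u * x) := by
  obtain ⟨a, b, rfl⟩ := exists_mk x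
  rw [lam_dvd_mk] at hx
  have hω : IsUnit ωE := IsUnit.of_pow_eq_one ωE_cube (by norm_num)
  have key : ∀ c d : ℤ, Nm (mk c d) = 1 → P1 (mk c d * mk a b) →
      ∃ u : Eis, IsUnit u ∧ P1 (u * mk a b) := fun c d h1 h2 => ⟨mk c d, isUnit_iff_Nm.2 h1, h2⟩
  have e1 : P1 (mk 1 0 * mk a b) ∨ P1 (mk (-1) 0 * mk a b) ∨ P1 (mk 0 1 * mk a b) ∨
      P1 (mk 0 (-1) * mk a b) ∨ P1 (mk (-1) (-1) * mk a b) ∨ P1 (mk 1 1 * mk a b) := by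
    simp only [mk_mul, P1_mk]
    have ha : a % 3 = 0 ∨ a % 3 = 1 ∨ a % 3 = 2 := by omega
    have hb : b % 3 = 0 ∨ b % 3 = 1 ∨ b % 3 = 2 := by omega
    rcases ha with ha | ha | ha <;> rcases hb with hb | hb | hb <;>
    first
    | (exfalso; omega)
    | (left; constructor <;> omega)
    | (right; left; constructor <;> omega)
    | (right; right; left; constructor <;> omega)
    | (right; right; right; left; constructor <;> omega)
    | (right; right; right; right; left; constructor <;> omega)
    | (right; right; right; right; right; constructor <;> omega)
  rcases e1 with h | h | h | h | h | h <;> exact key _ _ (by rw [Nm_mk]; norm_num) h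

lemma P1_unit {u : Eis} (hu : IsUnit u) (h : P1 u) : u = 1 := by
  have h6 := unit_cases hu
  rw [ωE_sq] at h6
  rcases h6 with rfl | rfl | rfl | rfl | rfl | rfl
  · rfl
  all_goals
    exfalso
    simp only [one_eq_mk, ωE_eq_mk, mk_neg, mk_sub, P1_mk] at h
    omega

lemma P1_assoc {a b : Eis} (ha : P1 a) (hb : P1 b) (h : Associated a b) : a = b := by
  obtain ⟨u, rfl⟩ := h
  have := P1_unit u.isUnit (P1_of_mul ha hb)
  rw [this, mul_one]

lemma lam_prime : Prime lam := by
  rw [← irreducible_iff_prime]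
  have hN : Nm lam = 3 := by rw [lam_eq_mk, Nm_mk]; norm_num
  have hNN : NmN lam = 3 := by
    have := Nm_nat lam; rw [hN] at this; exact_mod_cast this
  constructor
  · rw [isUnit_iff_Nm, hN]; norm_num
  · intro a b hab
    have h1 := NmN_mul a b
    rw [← hab, hNN] at h1
    have h2 : NmN a ∣ 3 := ⟨_, h1⟩
    rcases (Nat.dvd_prime Nat.prime_three).1 h2 with h | h
    · left; rw [isUnit_iff_Nm, ← Nm_nat, h]; simp
    · right
      have : NmN b = 1 := by rw [h] at h1; omega
      rw [isUnit_iff_Nm, ← Nm_nat, this]; simp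

lemma Nm_lam : Nm lam = 3 := by rw [lam_eq_mk, Nm_mk]; norm_num

lemma lam_dvd_three : lam ∣ (3 : Eis) := ⟨-lam, by linear_combination lam_sq⟩

lemma P1.isCoprime_three {a : Eis} (ha : P1 a) : IsCoprime a 3 := by
  obtain ⟨x, hx⟩ := ha
  exact ⟨1, -x, by linear_combination hx⟩

lemma P1.isCoprime_lam {a : Eis} (ha : P1 a) : IsCoprime a lam :=
  ha.isCoprime_three.of_isCoprime_of_dvd_right lam_dvd_three

/-- decomposition `x = u λ^j c`. -/
lemma exists_decomp {x : Eis} (hx : x ≠ 0) :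
    ∃ (u : Eis) (j : ℕ) (c : Eis), IsUnit u ∧ P1 c ∧ x = u * lam ^ j * c := by
  obtain ⟨j, y, hy, rfl⟩ := WfDvdMonoid.max_power_factor hx lam_prime.irreducible
  obtain ⟨u, hu, hc⟩ := exists_unit_P1 hy
  obtain ⟨v, hv⟩ := hu.exists_left_inv
  refine ⟨v, j, u * y, IsUnit.of_mul_eq_one u hv, hc, ?_⟩
  linear_combination (-lam ^ j * y) * hv

/-- Induction principle for `P1`. -/
lemma P1.induction {Q : Eis → Prop} (h1 : Q 1)
    (hm : ∀ p a, Prime p → P1 p → P1 a → Q a → Q (p * a)) : ∀ a, P1 a → Q a := by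
  have key : ∀ n : ℕ, ∀ a, P1 a → NmN a = n → Q a := by
    intro n
    induction n using Nat.strong_induction_on with
    | _ n ih =>
      intro a ha han
      by_cases hu : IsUnit a
      · rw [P1_unit hu ha]; exact h1
      obtain ⟨p, hp, hpa⟩ := WfDvdMonoid.exists_irreducible_factor hu ha.ne_zero
      have hp' : ¬ lam ∣ p := fun h => ha.not_lam_dvd (h.trans hpa)
      obtain ⟨u, hu', hup⟩ := exists_unit_P1 hp'
      have hup_dvd : u * p ∣ a := (hu'.mul_left_dvd).2 hpa
      obtain ⟨b, rfl⟩ := hup_dvd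
      have hb := P1_of_mul hup ha
      have hprime : Prime (u * p) := by
        have : Associated p (u * p) := by
          obtain ⟨v, rfl⟩ := hu'
          exact ⟨v, mul_comm _ _⟩
        exact this.prime hp.prime
      apply hm _ _ hprime hup hb
      refine ih (NmN b) ?_ b hb rfl
      rw [← han, NmN_mul]
      have hb1 : 1 ≤ NmN b := by
        have := one_le_Nm hb.ne_zero
        rw [← Nm_nat] at this; exact_mod_cast this
      have hp2 : 2 ≤ NmN (u * p) := by
        have h0 : 1 ≤ NmN (u * p) := by
          have := one_le_Nm hup.ne_zero
          rw [← Nm_nat] at this; exact_mod_cast this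
        have h1 : NmN (u * p) ≠ 1 := by
          intro h
          apply hprime.not_isUnit
          rw [isUnit_iff_Nm, ← Nm_nat, h]; simp
        omega
      nlinarith
  intro a ha
  exact key _ a ha rfl

/-! ### The cubic symbol: first properties -/

/-- linear coordinates -/
def eisLin : (Fin 2 → ℤ) ≃ₗ[ℤ] Eis where
  toFun v := mk (v 0) (v 1)
  map_add' v w := by rw [mk_add]; rfl
  map_smul' c v := by
    simp only [mk, Pi.smul_apply, smul_eq_mul, RingHom.id_apply, zsmul_eq_mul]
    push_cast; ring
  invFun x := ![(eisEquiv.symm x).1, (eisEquiv.symm x).2]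
  left_inv v := by
    have : mk (v 0) (v 1) = eisEquiv (v 0, v 1) := rfl
    simp only [this, Equiv.symm_apply_apply]
    ext i; fin_cases i <;> rfl
  right_inv x := by
    have := eisEquiv.apply_symm_apply x
    exact this

/-- The basis `1, ω`. -/
def eisBasis : Module.Basis (Fin 2) ℤ Eis := Module.Basis.ofEquivFun eisLin.symm

instance : Module.Free ℤ Eis := Module.Free.of_basis eisBasis
instance : Module.Finite ℤ Eis := Module.Finite.of_basis eisBasis

lemma eisBasis_zero : eisBasis 0 = 1 := by
  simp [eisBasis, eisLin, mk]

lemma eisBasis_one : eisBasis 1 = ωE := by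
  simp [eisBasis, eisLin, mk]

lemma eisBasis_repr (a b : ℤ) : eisBasis.repr (mk a b) = Finsupp.equivFunOnFinite.symm ![a, b] := by
  have h : mk a b = a • eisBasis 0 + b • eisBasis 1 := by
    rw [eisBasis_zero, eisBasis_one]; simp [mk]
  rw [h, map_add, map_smul, map_smul]
  ext i
  fin_cases i <;> simp

lemma algNorm_mk (a b : ℤ) : Algebra.norm ℤ (mk a b) = a ^ 2 - a * b + b ^ 2 := by
  rw [Algebra.norm_eq_matrix_det eisBasis, Matrix.det_fin_two]
  simp only [Algebra.leftMulMatrix_eq_repr_mul]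
  rw [eisBasis_zero, eisBasis_one]
  have h1 : mk a b * 1 = mk a b := mul_one _
  have h2 : mk a b * ωE = mk (-b) (a - b) := by
    rw [ωE_eq_mk, mk_mul]; congr 1 <;> ring
  rw [h1, h2, eisBasis_repr, eisBasis_repr]
  simp
  ring

lemma algNorm_eq (x : Eis) : (Algebra.norm ℤ x).natAbs = NmN x := by
  obtain ⟨a, b, rfl⟩ := exists_mk x
  have h := Nm_nat (mk a b)
  rw [Nm_mk] at h
  rw [algNorm_mk]
  have h2 : ((NmN (mk a b) : ℤ)) = a ^ 2 - a * b + b ^ 2 := by exact_mod_cast h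
  rw [← h2]; simp

lemma card_quot (r : Eis) : Nat.card (Eis ⧸ Ideal.span {r}) = NmN r := by
  have h := Ideal.absNorm_span_singleton r
  rw [Ideal.absNorm_apply, algNorm_eq] at h
  rw [← h]; rfl

lemma finite_quot {r : Eis} (hr : r ≠ 0) : Finite (Eis ⧸ Ideal.span {r}) := by
  apply Nat.finite_of_card_ne_zero
  rw [card_quot]
  have := one_le_Nm hr
  rw [← Nm_nat] at this
  have h : 1 ≤ NmN r := by exact_mod_cast this
  omega

lemma NmN_ne_zero {r : Eis} (hr : r ≠ 0) : NmN r ≠ 0 := by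
  have := one_le_Nm hr
  rw [← Nm_nat] at this
  have h : 1 ≤ NmN r := by exact_mod_cast this
  omega

lemma P1.NmN_mod {a : Eis} (ha : P1 a) : NmN a % 3 = 1 := by
  obtain ⟨x, y, rfl⟩ := exists_mk a
  have h := Nm_nat (mk x y)
  rw [Nm_mk] at h
  have h2 : ((NmN (mk x y) : ℤ)) = x ^ 2 - x * y + y ^ 2 := by exact_mod_cast h
  rw [P1_mk] at ha
  obtain ⟨⟨k, hk⟩, l, hl⟩ := ha
  have hx : x = 3 * k + 1 := by omega
  have : ((NmN (mk x y) : ℤ)) = 3 * (3 * k^2 + 2 * k - (3 * k + 1) * l + 3 * l^2) + 1 := by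
    rw [h2, hx, hl]; ring
  omega

/-- possible values of the symbol -/
def Val (v : Eis) : Prop := v = 0 ∨ v = 1 ∨ v = ωE ∨ v = ωE ^ 2

lemma Val.mul {v w : Eis} (hv : Val v) (hw : Val w) : Val (v * w) := by
  have h4 : ωE ^ 2 * ωE ^ 2 = ωE := by linear_combination ωE * ωE_cube
  have h3 : ωE * ωE ^ 2 = 1 := by linear_combination ωE_cube
  have h3' : ωE ^ 2 * ωE = 1 := by linear_combination ωE_cube
  have h2 : ωE * ωE = ωE ^ 2 := by ring
  rcases hv with rfl | rfl | rfl | rfl <;> rcases hw with rfl | rfl | rfl | rfl <;>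
    simp [Val, h4, h3, h3', h2]

lemma Val.pow3 {v : Eis} (hv : Val v) : v ^ 3 = 0 ∧ v = 0 ∨ v ^ 3 = 1 := by
  rcases hv with rfl | rfl | rfl | rfl
  · left; simp
  · right; simp
  · right; exact ωE_cube
  · right; linear_combination (ωE^3 + 1) * ωE_cube

lemma Val.pow4 {v : Eis} (hv : Val v) : v ^ 4 = v := by
  rcases hv.pow3 with ⟨h, h'⟩ | h
  · rw [h']; simp
  · linear_combination v * h

lemma Val.conj {v : Eis} (hv : Val v) : conjE v = v ^ 2 := by
  rcases hv with rfl | rfl | rfl | rfl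
  · simp
  · simp
  · exact conjE_ω
  · rw [map_pow, conjE_ω]

lemma Val.val_conj {v : Eis} (hv : Val v) : Val (conjE v) := by
  rw [hv.conj, pow_two]; exact hv.mul hv

lemma Val.sub_dvd {v w : Eis} (hv : Val v) (hw : Val w) (h : v ≠ w) : v - w ∣ 3 := by
  have key : ∀ d : Eis, NmN d ∣ 3 → d ∣ 3 := by
    intro d hd
    have h1 : d ∣ ((NmN d : ℕ) : Eis) := ⟨_, (mul_conjE d).symm⟩
    refine h1.trans ?_
    have : ((3 : ℕ) : Eis) = 3 := by norm_num
    rw [← this]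
    exact Nat.cast_dvd_cast hd
  apply key
  have h2 : ωE ^ 2 = mk (-1) (-1) := by rw [ωE_sq, one_eq_mk, ωE_eq_mk, mk_neg, mk_sub]; rfl
  have key2 : ∀ a b : ℤ, (a ^ 2 - a * b + b ^ 2 = 1 ∨ a ^ 2 - a * b + b ^ 2 = 3) →
      NmN (mk a b) ∣ 3 := by
    intro a b hab
    have h := Nm_nat (mk a b)
    rw [Nm_mk] at h
    have h2 : ((NmN (mk a b) : ℤ)) = a ^ 2 - a * b + b ^ 2 := by exact_mod_cast h
    rcases hab with hab | hab
    · rw [hab] at h2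
      have : NmN (mk a b) = 1 := by exact_mod_cast h2
      rw [this]; norm_num
    · rw [hab] at h2
      have : NmN (mk a b) = 3 := by exact_mod_cast h2
      rw [this]
  rw [Val, h2] at hv hw
  rw [zero_eq_mk, one_eq_mk, ωE_eq_mk] at hv hw
  rcases hv with rfl | rfl | rfl | rfl <;> rcases hw with rfl | rfl | rfl | rfl <;>
    first
    | (exfalso; exact h rfl)
    | (rw [mk_sub]; apply key2; norm_num)

lemma Val.eq_of_dvd {v w b : Eis} (hv : Val v) (hw : Val w) (hb : P1 b) (hb' : ¬ IsUnit b)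
    (h : b ∣ v - w) : v = w := by
  by_contra hne
  have := h.trans (hv.sub_dvd hw hne)
  exact hb' (hb.isCoprime_three.isUnit_of_dvd this)

lemma Val.norm_le {v : Eis} (hv : Val v) : ‖(v : ℂ)‖ ≤ 1 := by
  rcases hv.pow3 with ⟨_, h'⟩ | h
  · rw [h']; simp
  · have : ‖(v : ℂ)‖ ^ 3 = 1 := by
      rw [← norm_pow]
      have h2 : (v : ℂ) ^ 3 = 1 := by exact_mod_cast congrArg (Subtype.val) h
      rw [h2]; simp
    exact ((pow_eq_one_iff_of_nonneg (norm_nonneg _) (by norm_num)).1 this).le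

lemma Val.norm_eq {v : Eis} (hv : Val v) (h0 : v ≠ 0) : ‖(v : ℂ)‖ = 1 := by
  rcases hv.pow3 with ⟨_, h'⟩ | h
  · exact absurd h' h0
  · have : ‖(v : ℂ)‖ ^ 3 = 1 := by
      rw [← norm_pow]
      have h2 : (v : ℂ) ^ 3 = 1 := by exact_mod_cast congrArg (Subtype.val) h
      rw [h2]; simp
    exact (pow_eq_one_iff_of_nonneg (norm_nonneg _) (by norm_num)).1 this

lemma Nat_pred_div (a : Eis) (ha : P1 a) : 3 * ((NmN a - 1) / 3) = NmN a - 1 := by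
  have := ha.NmN_mod
  omega

namespace IsCubicSymbol
variable {χ : Eis → Eis → Eis}

lemma prime_mul (hχ : IsCubicSymbol χ) {p : Eis} (hp : Prime p) (hp1 : P1 p) (x y : Eis) :
    χ p (x * y) = χ p x * χ p y := by
  have h1 := hχ.prime_congr p x hp hp1
  have h2 := hχ.prime_congr p y hp hp1
  have h3 := hχ.prime_congr p (x * y) hp hp1
  have v1 : Val (χ p x) := hχ.prime_vals p x hp hp1
  have v2 : Val (χ p y) := hχ.prime_vals p y hp hp1
  have v3 : Val (χ p (x * y)) := hχ.prime_vals p _ hp hp1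
  apply v3.eq_of_dvd (v1.mul v2) hp1 hp.not_isUnit
  obtain ⟨a, ha⟩ := h1
  obtain ⟨b, hb⟩ := h2
  obtain ⟨c, hc⟩ := h3
  rw [mul_pow] at hc
  refine ⟨a * y ^ ((NmN p - 1) / 3) + χ p x * b - c, ?_⟩
  linear_combination (y ^ ((NmN p - 1) / 3)) * ha + χ p x * hb - hc

lemma prime_periodic (hχ : IsCubicSymbol χ) {p : Eis} (hp : Prime p) (hp1 : P1 p) {x y : Eis} (h : p ∣ x - y) :
    χ p x = χ p y := by
  have h1 := hχ.prime_congr p x hp hp1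
  have h2 := hχ.prime_congr p y hp hp1
  have v1 : Val (χ p x) := hχ.prime_vals p x hp hp1
  have v2 : Val (χ p y) := hχ.prime_vals p y hp hp1
  apply v1.eq_of_dvd v2 hp1 hp.not_isUnit
  have h3 := h.trans (sub_dvd_pow_sub_pow x y ((NmN p - 1) / 3))
  have : χ p x - χ p y = (y ^ ((NmN p - 1) / 3) - χ p y) - (x ^ ((NmN p - 1) / 3) - χ p x)
    + (x ^ ((NmN p - 1) / 3) - y ^ ((NmN p - 1) / 3)) := by ring
  rw [this]
  exact dvd_add (dvd_sub h2 h1) h3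

lemma val (hχ : IsCubicSymbol χ) {b : Eis} (hb : P1 b) (x : Eis) : Val (χ b x) := by
  revert b
  apply P1.induction
  · rw [hχ.one_bot]; right; left; rfl
  · intro p a hp hp1 ha ih
    rw [hχ.mul_bot p a x hp1 ha]
    exact Val.mul (hχ.prime_vals p x hp hp1) ih

lemma map_mul' (hχ : IsCubicSymbol χ) {b : Eis} (hb : P1 b) (x y : Eis) : χ b (x * y) = χ b x * χ b y := by
  revert b
  apply P1.induction
  · simp [hχ.one_bot]
  · intro p a hp hp1 ha ih
    rw [hχ.mul_bot p a _ hp1 ha, hχ.mul_bot p a _ hp1 ha, hχ.mul_bot p a _ hp1 ha, ih,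
      hχ.prime_mul hp hp1]
    ring

lemma periodic (hχ : IsCubicSymbol χ) {b : Eis} (hb : P1 b) {x y : Eis} (h : b ∣ x - y) : χ b x = χ b y := by
  revert b
  apply P1.induction
  · simp [hχ.one_bot]
  · intro p a hp hp1 ha ih h
    rw [hχ.mul_bot p a _ hp1 ha, hχ.mul_bot p a _ hp1 ha, ih ((dvd_mul_left _ _).trans h),
      hχ.prime_periodic hp hp1 ((dvd_mul_right _ _).trans h)]

lemma eq_zero_iff (hχ : IsCubicSymbol χ) {b : Eis} (hb : P1 b) (x : Eis) : χ b x = 0 ↔ ¬ IsCoprime b x := by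
  revert b
  apply P1.induction
  · simp [hχ.one_bot, isCoprime_one_left]
  · intro p a hp hp1 ha ih
    rw [hχ.mul_bot p a _ hp1 ha, mul_eq_zero, ih, hχ.prime_eq_zero p x hp hp1,
      IsCoprime.mul_left_iff, hp.irreducible.coprime_iff_not_dvd]
    tauto

lemma ne_zero_iff (hχ : IsCubicSymbol χ) {b : Eis} (hb : P1 b) (x : Eis) : χ b x ≠ 0 ↔ IsCoprime b x := by
  rw [Ne, hχ.eq_zero_iff hb]; simp

lemma map_one' (hχ : IsCubicSymbol χ) {b : Eis} (hb : P1 b) : χ b 1 = 1 := by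
  have h1 := hχ.map_mul' hb 1 1
  have h2 : χ b 1 ≠ 0 := (hχ.ne_zero_iff hb 1).2 isCoprime_one_right
  rw [mul_one] at h1
  exact (mul_eq_left₀ h2).1 h1.symm

lemma map_neg_one (hχ : IsCubicSymbol χ) {b : Eis} (hb : P1 b) : χ b (-1) = 1 := by
  have h1 := hχ.map_mul' hb (-1) (-1)
  rw [neg_one_mul, neg_neg, hχ.map_one' hb] at h1
  have h4 := (hχ.val hb (-1)).pow4
  have : χ b (-1) ^ 4 = 1 := by linear_combination (-1 - χ b (-1) ^ 2) * h1
  rw [← h4, this]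

lemma map_neg (hχ : IsCubicSymbol χ) {b : Eis} (hb : P1 b) (x : Eis) : χ b (-x) = χ b x := by
  rw [← neg_one_mul, hχ.map_mul' hb, hχ.map_neg_one hb, one_mul]

lemma map_pow (hχ : IsCubicSymbol χ) {b : Eis} (hb : P1 b) (x : Eis) (n : ℕ) : χ b (x ^ n) = χ b x ^ n := by
  induction n with
  | zero => simp [hχ.map_one' hb]
  | succ n ih => rw [pow_succ, hχ.map_mul' hb, ih, pow_succ]

lemma bot_pow (hχ : IsCubicSymbol χ) {b : Eis} (hb : P1 b) (x : Eis) (n : ℕ) : χ (b ^ n) x = χ b x ^ n := by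
  induction n with
  | zero => simp [hχ.one_bot]
  | succ n ih => rw [pow_succ, hχ.mul_bot _ _ _ (hb.pow n) hb, ih, pow_succ]

lemma conj_conj (hχ : IsCubicSymbol χ) {b : Eis} (hb : P1 b) (x : Eis) : χ (conjE b) (conjE x) = conjE (χ b x) := by
  have hP : ∀ a, P1 a → P1 (conjE a) := by
    rintro a ⟨z, hz⟩
    refine ⟨conjE z, ?_⟩
    have := congrArg conjE hz
    simpa [map_ofNat] using this
  revert b
  apply P1.induction
  · simp [hχ.one_bot]
  · intro p a hp hp1 ha ih
    rw [_root_.map_mul conjE, hχ.mul_bot _ _ _ (hP p hp1) (hP a ha), hχ.mul_bot _ _ _ hp1 ha, ih,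
      _root_.map_mul conjE]
    congr 1
    have hcp : Prime (conjE p) := by
      have := (MulEquiv.prime_iff (conjEquiv : Eis ≃+* Eis) (p := p)).2 hp
      exact this
    have v1 : Val (χ (conjE p) (conjE x)) := hχ.prime_vals _ _ hcp (hP p hp1)
    have v2 : Val (conjE (χ p x)) := Val.val_conj (hχ.prime_vals _ _ hp hp1)
    apply v1.eq_of_dvd v2 (hP p hp1) hcp.not_isUnit
    have h1 := hχ.prime_congr _ (conjE x) hcp (hP p hp1)
    have h2 := hχ.prime_congr p x hp hp1
    have hN : NmN (conjE p) = NmN p := by unfold NmN; rw [Nm_conjE]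
    rw [hN] at h1
    obtain ⟨c, hc⟩ := h1
    obtain ⟨d, hd⟩ := h2
    have hd' := congrArg conjE hd
    simp only [_root_.map_mul, _root_.map_pow, map_sub] at hd'
    refine ⟨conjE d - c, ?_⟩
    linear_combination hd' - hc

end IsCubicSymbol

lemma P1.conj {a : Eis} (ha : P1 a) : P1 (conjE a) := by
  obtain ⟨z, hz⟩ := ha
  refine ⟨conjE z, ?_⟩
  have := congrArg conjE hz
  simpa [map_ofNat] using this

/-! ### Cubic reciprocity -/

lemma mk_eq_zero_iff {b x : Eis} : Ideal.Quotient.mk (Ideal.span {b}) x = 0 ↔ b ∣ x := by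
  rw [Ideal.Quotient.eq_zero_iff_mem, Ideal.mem_span_singleton]

lemma mk_eq_iff {b x y : Eis} :
    Ideal.Quotient.mk (Ideal.span {b}) x = Ideal.Quotient.mk (Ideal.span {b}) y ↔ b ∣ x - y := by
  rw [Ideal.Quotient.eq, Ideal.mem_span_singleton]

lemma isUnit_mk_iff {b x : Eis} :
    IsUnit (Ideal.Quotient.mk (Ideal.span {b}) x) ↔ IsCoprime b x := by
  constructor
  · intro h
    obtain ⟨y, hy⟩ := h.exists_right_inv
    obtain ⟨y, rfl⟩ := Ideal.Quotient.mk_surjective y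
    rw [← map_mul, ← map_one (Ideal.Quotient.mk (Ideal.span {b})), mk_eq_iff] at hy
    obtain ⟨z, hz⟩ := hy
    exact ⟨-z, y, by linear_combination hz⟩
  · rintro ⟨u, v, h⟩
    refine IsUnit.of_mul_eq_one (Ideal.Quotient.mk (Ideal.span {b}) v) ?_
    rw [← map_mul, ← map_one (Ideal.Quotient.mk (Ideal.span {b})), mk_eq_iff]
    exact ⟨-u, by linear_combination h⟩

lemma dvd_out_sub (b x : Eis) : b ∣ (Ideal.Quotient.mk (Ideal.span {b}) x).out - x := by
  rw [← mk_eq_iff]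
  exact Quotient.out_eq _

/-- The symbol as a multiplicative character. -/
def mchar {χ : Eis → Eis → Eis} (hχ : IsCubicSymbol χ) {b : Eis} (hb : P1 b) :
    MulChar (Eis ⧸ Ideal.span {b}) Eis where
  toFun x := χ b x.out
  map_one' := by
    rw [← hχ.map_one' hb]
    exact hχ.periodic hb (dvd_out_sub b 1)
  map_mul' x y := by
    obtain ⟨x, rfl⟩ := Ideal.Quotient.mk_surjective x
    obtain ⟨y, rfl⟩ := Ideal.Quotient.mk_surjective y
    rw [← map_mul, hχ.periodic hb (dvd_out_sub b _), hχ.periodic hb (dvd_out_sub b x),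
      hχ.periodic hb (dvd_out_sub b y), hχ.map_mul' hb]
  map_nonunit' x hx := by
    obtain ⟨x, rfl⟩ := Ideal.Quotient.mk_surjective x
    rw [isUnit_mk_iff] at hx
    change χ b _ = 0
    rw [hχ.periodic hb (dvd_out_sub b x), hχ.eq_zero_iff hb]
    exact hx

lemma mchar_mk {χ : Eis → Eis → Eis} (hχ : IsCubicSymbol χ) {b : Eis} (hb : P1 b) (x : Eis) :
    mchar hχ hb (Ideal.Quotient.mk _ x) = χ b x :=
  hχ.periodic hb (dvd_out_sub b x)

lemma mchar_cube {χ : Eis → Eis → Eis} (hχ : IsCubicSymbol χ) {b : Eis} (hb : P1 b) :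
    (mchar hχ hb) ^ 3 = 1 := by
  apply MulChar.ext
  intro u
  obtain ⟨x, hx⟩ := Ideal.Quotient.mk_surjective (u : Eis ⧸ Ideal.span {b})
  rw [MulChar.pow_apply_coe, MulChar.one_apply_coe, ← hx, mchar_mk]
  have hu : IsUnit (Ideal.Quotient.mk (Ideal.span {b}) x) := by rw [hx]; exact u.isUnit
  rw [isUnit_mk_iff, ← hχ.ne_zero_iff hb] at hu
  rcases (hχ.val hb x).pow3 with ⟨_, h⟩ | h
  · exact absurd h hu
  · exact h

section Prime
variable {χ : Eis → Eis → Eis} (hχ : IsCubicSymbol χ) {p : Eis} (hp : Prime p) (hp1 : P1 p)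

/-- residue field -/
abbrev resField (hp : Prime p) : Field (Eis ⧸ Ideal.span {p}) :=
  haveI : (Ideal.span {p}).IsMaximal :=
    PrincipalIdealRing.isMaximal_of_irreducible hp.irreducible
  Ideal.Quotient.field _

lemma four_le (hp : Prime p) (hp1 : P1 p) : 4 ≤ NmN p := by
  have h1 := hp1.NmN_mod
  have h2 : NmN p ≠ 1 := by
    intro h
    apply hp.not_isUnit
    rw [isUnit_iff_Nm, ← Nm_nat, h]; simp
  omega

lemma exists_nontriv (hχ : IsCubicSymbol χ) (hp : Prime p) (hp1 : P1 p) : ∃ x : Eis, IsCoprime p x ∧ χ p x ≠ 1 := by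
  let := resField hp
  have := finite_quot hp.ne_zero
  let := Fintype.ofFinite (Eis ⧸ Ideal.span {p})
  classical
  by_contra hcon
  push Not at hcon
  obtain ⟨g, hg⟩ := IsCyclic.exists_generator (α := (Eis ⧸ Ideal.span {p})ˣ)
  have ho : orderOf g = NmN p - 1 := by
    rw [orderOf_eq_card_of_forall_mem_zpowers hg, Nat.card_units, card_quot]
  obtain ⟨x, hx⟩ := Ideal.Quotient.mk_surjective (g : Eis ⧸ Ideal.span {p})
  have hu : IsUnit (Ideal.Quotient.mk (Ideal.span {p}) x) := by rw [hx]; exact g.isUnit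
  rw [isUnit_mk_iff] at hu
  have h1 := hcon x hu
  have h2 := hχ.prime_congr p x hp hp1
  rw [h1, ← mk_eq_iff, map_pow, hx, map_one] at h2
  have h3 : g ^ ((NmN p - 1) / 3) = 1 := by
    apply Units.ext
    push_cast; exact h2
  have h4 := orderOf_dvd_of_pow_eq_one h3
  rw [ho] at h4
  have h5 := four_le hp hp1
  have := Nat.le_of_dvd (by omega) h4
  omega

lemma mchar_order (hχ : IsCubicSymbol χ) (hp : Prime p) (hp1 : P1 p) : orderOf (mchar hχ hp1) = 3 := by
  have : Fact (Nat.Prime 3) := ⟨Nat.prime_three⟩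
  apply orderOf_eq_prime (mchar_cube hχ hp1)
  intro h
  obtain ⟨x, hx, hx1⟩ := exists_nontriv hχ hp hp1
  apply hx1
  rw [← mchar_mk hχ hp1, h, MulChar.one_apply]
  exact isUnit_mk_iff.2 hx

lemma ω_prim : IsPrimitiveRoot ωE 3 := by
  have : Fact (Nat.Prime 3) := ⟨Nat.prime_three⟩
  rw [IsPrimitiveRoot.iff_orderOf]
  apply orderOf_eq_prime ωE_cube
  intro h
  rw [ωE_eq_mk, one_eq_mk] at h
  have := (mk_inj h).1
  norm_num at this

lemma conj_val_inv {v : Eis} (hv : Val v) (h0 : v ≠ 0) : v * conjE v = 1 := by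
  rw [hv.conj]
  rcases hv.pow3 with ⟨_, h'⟩ | h
  · exact absurd h' h0
  · linear_combination h

lemma mchar_inv : (mchar hχ hp1)⁻¹ = (mchar hχ hp1).ringHomComp conjE := by
  rw [inv_eq_iff_mul_eq_one]
  apply MulChar.ext
  intro u
  obtain ⟨x, hx⟩ := Ideal.Quotient.mk_surjective (u : Eis ⧸ Ideal.span {p})
  rw [MulChar.mul_apply, MulChar.one_apply_coe, MulChar.ringHomComp_apply, ← hx, mchar_mk]
  have hu : IsUnit (Ideal.Quotient.mk (Ideal.span {p}) x) := by rw [hx]; exact u.isUnit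
  rw [isUnit_mk_iff, ← hχ.ne_zero_iff hp1] at hu
  exact conj_val_inv (hχ.val hp1 x) hu

lemma jacobi_eq (hχ : IsCubicSymbol χ) (hp : Prime p) (hp1 : P1 p) [Fintype (Eis ⧸ Ideal.span {p})] :
    jacobiSum (mchar hχ hp1) (mchar hχ hp1) = -p := by
  let := resField hp
  classical
  have hcard : Fintype.card (Eis ⧸ Ideal.span {p}) = NmN p := by
    rw [← Nat.card_eq_fintype_card, card_quot]
  set c := mchar hχ hp1 with hc
  have h4 := four_le hp hp1
  have hmod := hp1.NmN_mod
  -- divisibility by `p`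
  have hdvd : p ∣ jacobiSum c c := by
    rw [← mk_eq_zero_iff, ← jacobiSum_ringHomComp, jacobiSum]
    set m := (NmN p - 1) / 3 with hm
    have hval : ∀ x, (c.ringHomComp (Ideal.Quotient.mk (Ideal.span {p}))) x = x ^ m := by
      intro x
      obtain ⟨x, rfl⟩ := Ideal.Quotient.mk_surjective x
      rw [MulChar.ringHomComp_apply, hc, mchar_mk, ← map_pow, eq_comm, mk_eq_iff]
      exact hχ.prime_congr p x hp hp1
    simp_rw [hval]
    have hexp : ∀ x : Eis ⧸ Ideal.span {p}, x ^ m * (1 - x) ^ m =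
        ∑ j ∈ Finset.range (m + 1), ((-1) ^ j * (m.choose j : Eis ⧸ Ideal.span {p})) * x ^ (m + j) := by
      intro x
      have : (1 - x) = (-x) + 1 := by ring
      rw [this, add_pow, Finset.mul_sum]
      apply Finset.sum_congr rfl
      intro j _
      rw [one_pow, neg_pow, pow_add]; ring
    simp_rw [hexp]
    rw [Finset.sum_comm]
    apply Finset.sum_eq_zero
    intro j hj
    rw [← Finset.mul_sum, FiniteField.sum_pow_lt_card_sub_one, mul_zero]
    rw [hcard]
    have := Finset.mem_range.1 hj
    omega
  have h3 : P1 (-(jacobiSum c c)) := by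
    obtain ⟨z, _, hz⟩ := exists_jacobiSum_eq_neg_one_add (n := 3) (by norm_num)
      (mchar_cube hχ hp1) (mchar_cube hχ hp1) (by rw [hcard]; omega) ω_prim
    refine ⟨z * ωE, ?_⟩
    rw [hc, hz]
    linear_combination (-z) * ωE_sq
  have hN : NmN (jacobiSum c c) = NmN p := by
    have hne : ∀ d : MulChar (Eis ⧸ Ideal.span {p}) Eis, d ≠ 1 → d.ringHomComp Eis.subtype ≠ 1 := by
      intro d hd h
      apply hd
      apply MulChar.ext
      intro u
      have := congrArg (fun f => f (u : Eis ⧸ Ideal.span {p})) h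
      simp only [MulChar.ringHomComp_apply, MulChar.one_apply_coe] at this
      rw [MulChar.one_apply_coe]
      exact Subtype.ext this
    have ho := mchar_order hχ hp hp1
    have hc1 : c ≠ 1 := by
      intro h; rw [← hc, h, orderOf_one] at ho; norm_num at ho
    have hc2 : c * c ≠ 1 := by
      intro h
      rw [← pow_two] at h
      have := orderOf_dvd_of_pow_eq_one h
      rw [ho] at this; norm_num at this
    have hmul : (c.ringHomComp Eis.subtype) * (c.ringHomComp Eis.subtype) =
        (c * c).ringHomComp Eis.subtype := by
      apply MulChar.ext; intro u
      simp [MulChar.ringHomComp_apply, MulChar.mul_apply]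
    have hinv : (c.ringHomComp Eis.subtype)⁻¹ = (c.ringHomComp conjE).ringHomComp Eis.subtype := by
      rw [← mchar_inv hχ hp1, MulChar.ringHomComp_inv]
    have hch : ringChar ℂ ≠ ringChar (Eis ⧸ Ideal.span {p}) := by
      rw [ringChar.eq_zero]
      intro h
      have hprime : (ringChar (Eis ⧸ Ideal.span {p})).Prime :=
        CharP.char_is_prime (Eis ⧸ Ideal.span {p}) _
      rw [← h] at hprime
      exact Nat.not_prime_zero hprime
    have h := jacobiSum_mul_jacobiSum_inv hch (hne c hc1) (hne c hc1)
      (by rw [hmul]; exact hne _ hc2)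
    rw [hinv, jacobiSum_ringHomComp, jacobiSum_ringHomComp, jacobiSum_ringHomComp, hcard] at h
    have h' : (jacobiSum c c) * conjE (jacobiSum c c) = ((NmN p : ℕ) : Eis) := by
      apply Subtype.ext
      push_cast
      exact h
    rw [mul_conjE] at h'
    have h'' := congrArg (fun x : Eis => Nm x) h'
    have hcast : ((NmN (jacobiSum c c) : ℕ) : ℂ) = ((NmN p : ℕ) : ℂ) := by
      exact_mod_cast congrArg (Subtype.val) h'
    exact_mod_cast hcast
  obtain ⟨u, hu⟩ := hdvd
  rw [hu, NmN_mul] at hN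
  have hu1 : NmN u = 1 := by
    have : NmN p ≠ 0 := by omega
    exact (mul_eq_left₀ this).1 hN
  have huu : IsUnit u := by rw [isUnit_iff_Nm, ← Nm_nat, hu1]; simp
  have : -u = 1 := by
    apply P1_unit huu.neg
    apply P1_of_mul hp1
    rw [mul_neg, ← hu]; exact h3
  rw [hu]
  linear_combination (-p) * this

end Prime


lemma conj_prime {p : Eis} (hp : Prime p) : Prime (conjE p) :=
  (MulEquiv.prime_iff (conjEquiv : Eis ≃+* Eis) (p := p)).2 hp

lemma P1_prime_dvd_eq {p r : Eis} (hp : Prime p) (hr : Prime r) (hp1 : P1 p) (hr1 : P1 r)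
    (h : p ∣ r) : p = r :=
  P1_assoc hp1 hr1 (hp.irreducible.associated_of_dvd hr.irreducible h)

/-- The relation obtained from the Frobenius action on the Gauss sum. -/
lemma gauss_relation {χ : Eis → Eis → Eis} (hχ : IsCubicSymbol χ) {p r : Eis} (hp : Prime p)
    (hp1 : P1 p) (hr : Prime r) (hr1 : P1 r) (hpr : p ≠ r) (hpr' : conjE p ≠ r) :
    χ p r * χ p (conjE r) * (χ r p ^ 2 * χ r (conjE p)) = 1 := by
  classical
  let _ := resField hp
  let _ := resField hr
  have := finite_quot hp.ne_zero
  have := finite_quot hr.ne_zero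
  let _ := Fintype.ofFinite (Eis ⧸ Ideal.span {p})
  let _ := Fintype.ofFinite (Eis ⧸ Ideal.span {r})
  have hcardp : Fintype.card (Eis ⧸ Ideal.span {p}) = NmN p := by
    rw [← Nat.card_eq_fintype_card, card_quot]
  have hcardr : Fintype.card (Eis ⧸ Ideal.span {r}) = NmN r := by
    rw [← Nat.card_eq_fintype_card, card_quot]
  obtain ⟨n, hlp, hln⟩ := FiniteField.card (Eis ⧸ Ideal.span {r})
    (ringChar (Eis ⧸ Ideal.span {r}))
  rw [hcardr] at hln
  set l := ringChar (Eis ⧸ Ideal.span {r}) with hl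
  have hnp : ¬ p ∣ r := fun h => hpr (P1_prime_dvd_eq hp hr hp1 hr1 h)
  have hnp' : ¬ p ∣ conjE r := by
    intro h
    apply hpr'
    have h2 : conjE p ∣ conjE (conjE r) := map_dvd conjE h
    rw [conjE_conjE] at h2
    exact P1_prime_dvd_eq (conj_prime hp) hr hp1.conj hr1 h2
  have hnr : ¬ p ∣ ((NmN r : ℕ) : Eis) := by
    rw [← mul_conjE]
    intro h
    rcases hp.dvd_or_dvd h with h | h
    · exact hnp h
    · exact hnp' h
  have hnr2 : ¬ r ∣ -(p * conjE p * p) := by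
    intro h
    rw [dvd_neg] at h
    rcases hr.dvd_or_dvd h with h | h
    · rcases hr.dvd_or_dvd h with h | h
      · exact hpr (P1_prime_dvd_eq hr hp hr1 hp1 h).symm
      · exact hpr' (P1_prime_dvd_eq hr (conj_prime hp) hr1 hp1.conj h).symm
    · exact hpr (P1_prime_dvd_eq hr hp hr1 hp1 h).symm
  have hchar : l ≠ ringChar (Eis ⧸ Ideal.span {p}) := by
    intro h
    apply hnr
    rw [← mk_eq_zero_iff, hln, map_natCast, Nat.cast_pow, h, ringChar.Nat.cast_ringChar,
      zero_pow n.ne_zero]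
  let Ψ := AddChar.FiniteField.primitiveChar (Eis ⧸ Ideal.span {p}) (Eis ⧸ Ideal.span {r}) hchar
  let R' := CyclotomicField Ψ.n (Eis ⧸ Ideal.span {r})
  let ψ : AddChar (Eis ⧸ Ideal.span {p}) R' := Ψ.char
  let φ : Eis →+* R' := (algebraMap (Eis ⧸ Ideal.span {r}) R').comp (Ideal.Quotient.mk _)
  have hφ : ∀ x, φ x = 0 ↔ r ∣ x := by
    intro x
    simp only [φ, RingHom.comp_apply]
    rw [map_eq_zero, mk_eq_zero_iff]
  have hφ1 : ∀ x, φ x = 1 → r ∣ x - 1 := by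
    intro x hx
    rw [← hφ, map_sub, hx, map_one, sub_self]
  have : Fact l.Prime := ⟨hlp⟩
  have : CharP (Eis ⧸ Ideal.span {r}) l := ringChar.charP _
  have : CharP R' l := charP_of_injective_algebraMap
    (algebraMap (Eis ⧸ Ideal.span {r}) R').injective l
  set c := (mchar hχ hp1).ringHomComp φ with hc
  have hc3 : c ^ 3 = 1 := by
    rw [hc, MulChar.ringHomComp_pow, mchar_cube]
    apply MulChar.ext; intro u; simp [MulChar.ringHomComp_apply]
  have hco : orderOf c = 3 := by
    have : Fact (Nat.Prime 3) := ⟨Nat.prime_three⟩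
    apply orderOf_eq_prime hc3
    intro h
    obtain ⟨x, hx, hx1⟩ := exists_nontriv hχ hp hp1
    apply hx1
    have h2 : c (Ideal.Quotient.mk _ x) = 1 := by
      rw [h, MulChar.one_apply]; exact isUnit_mk_iff.2 hx
    rw [hc, MulChar.ringHomComp_apply, mchar_mk] at h2
    exact (hχ.val hp1 x).eq_of_dvd (Or.inr (Or.inl rfl)) hr1 hr.not_isUnit (hφ1 _ h2)
  set g := gaussSum c ψ with hg
  have hg3 : g ^ 3 = φ (-(p * conjE p * p)) := by
    have h := gaussSum_pow_eq_prod_jacobiSum (χ := c) (ψ := ψ) (by rw [hco]; norm_num) Ψ.prim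
    rw [hco] at h
    simp only [Nat.reduceSub, Finset.prod_Ico_succ_top (le_refl 1), Finset.Ico_self,
      Finset.prod_empty, one_mul, pow_one] at h
    rw [h, hcardp, hc, jacobiSum_ringHomComp, jacobi_eq hχ hp hp1, mul_conjE]
    have : (-1 : Eis ⧸ Ideal.span {p}) = Ideal.Quotient.mk _ (-1) := by simp
    rw [this, MulChar.ringHomComp_apply, mchar_mk, hχ.map_neg_one hp1]
    simp only [map_one, map_neg, map_mul, map_natCast]
    ring
  have hg0 : g ≠ 0 := by
    intro h
    rw [h, zero_pow (by norm_num), eq_comm, hφ] at hg3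
    exact hnr2 hg3
  have hfrob : ∀ k : ℕ, g ^ (l ^ k) = gaussSum (c ^ (l ^ k)) (ψ ^ (l ^ k)) := by
    intro k
    induction k with
    | zero => simp [hg]
    | succ k ih => rw [pow_succ, pow_mul, ih, gaussSum_frob l, ← pow_mul, ← pow_mul]
  have h1 := hfrob n
  rw [← hln] at h1
  have hcN : c ^ (NmN r) = c := by
    have : NmN r = 3 * ((NmN r - 1) / 3) + 1 := by
      have := Nat_pred_div r hr1
      have := hr1.NmN_mod
      omega
    rw [this, pow_succ, pow_mul, hc3, one_pow, one_mul]
  have hu : IsUnit ((NmN r : ℕ) : Eis ⧸ Ideal.span {p}) := by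
    have : ((NmN r : ℕ) : Eis ⧸ Ideal.span {p}) = Ideal.Quotient.mk _ ((NmN r : ℕ) : Eis) := by simp
    rw [this, isUnit_mk_iff, hp.irreducible.coprime_iff_not_dvd]
    exact hnr
  have h2 := gaussSum_mulShift c ψ hu.unit
  rw [hu.unit_spec, ← AddChar.pow_mulShift] at h2
  rw [hcN] at h1
  rw [← h1] at h2
  have h3 : c ((NmN r : ℕ) : Eis ⧸ Ideal.span {p}) * (g ^ 3) ^ ((NmN r - 1) / 3) = 1 := by
    rw [← pow_mul, Nat_pred_div r hr1]
    apply mul_right_cancel₀ hg0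
    rw [mul_assoc, ← pow_succ, one_mul, Nat.sub_add_cancel, h2]
    exact Nat.one_le_iff_ne_zero.2 (NmN_ne_zero hr.ne_zero)
  have hcv : c ((NmN r : ℕ) : Eis ⧸ Ideal.span {p}) = φ (χ p r * χ p (conjE r)) := by
    have : ((NmN r : ℕ) : Eis ⧸ Ideal.span {p}) = Ideal.Quotient.mk _ ((NmN r : ℕ) : Eis) := by simp
    rw [this, hc, MulChar.ringHomComp_apply, mchar_mk, ← mul_conjE, hχ.map_mul' hp1]
  rw [hcv, hg3, ← map_pow, ← map_mul] at h3
  have h4 := hφ1 _ h3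
  have h5 := hχ.prime_congr r (-(p * conjE p * p)) hr hr1
  have v1 : Val (χ p r * χ p (conjE r)) := (hχ.val hp1 _).mul (hχ.val hp1 _)
  have v2 := hχ.val hr1 (-(p * conjE p * p))
  have h6 : χ p r * χ p (conjE r) * χ r (-(p * conjE p * p)) = 1 := by
    apply (v1.mul v2).eq_of_dvd (Or.inr (Or.inl rfl)) hr1 hr.not_isUnit
    obtain ⟨a, ha⟩ := h4
    obtain ⟨b, hb⟩ := h5
    exact ⟨a - χ p r * χ p (conjE r) * b, by
      linear_combination ha - (χ p r * χ p (conjE r)) * hb⟩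
  rw [hχ.map_neg hr1, hχ.map_mul' hr1, hχ.map_mul' hr1] at h6
  linear_combination h6

lemma recip_prime_aux {χ : Eis → Eis → Eis} (hχ : IsCubicSymbol χ) {p r : Eis} (hp : Prime p)
    (hp1 : P1 p) (hr : Prime r) (hr1 : P1 r) (hpr' : conjE p ≠ r) : χ p r = χ r p := by
  by_cases hpr : p = r
  · rw [hpr]
  have hrp' : conjE r ≠ p := by
    intro h; apply hpr'; rw [← h, conjE_conjE]
  have hA := gauss_relation hχ hp hp1 hr hr1 hpr hpr'
  have hB := gauss_relation hχ hr hr1 hp hp1 (Ne.symm hpr) hrp'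
  have hne : χ p r * χ r p * χ p (conjE r) * χ r (conjE p) ≠ 0 := by
    intro h
    have : (1 : Eis) = 0 := by linear_combination (-1 : Eis) * hA + χ r p * h
    exact one_ne_zero this
  have := mul_left_cancel₀ hne (b := χ p r) (c := χ r p)
    (by linear_combination hB - hA)
  exact this

lemma recip_aux {χ : Eis → Eis → Eis} (hχ : IsCubicSymbol χ) {p : Eis} (hp : Prime p)
    (hp1 : P1 p) : ∀ a, P1 a → ¬ conjE p ∣ a → χ p a = χ a p := by
  apply P1.induction
  · intro _; rw [hχ.one_bot, hχ.map_one' hp1]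
  · intro r a hr hr1 ha ih hnd
    have h1 : conjE p ≠ r := by rintro rfl; exact hnd (dvd_mul_right _ _)
    have h2 : ¬ conjE p ∣ a := fun h => hnd (h.mul_left _)
    rw [hχ.map_mul' hp1, hχ.mul_bot _ _ _ hr1 ha, ih h2, recip_prime_aux hχ hp hp1 hr hr1 h1]

lemma recip_prime {χ : Eis → Eis → Eis} (hχ : IsCubicSymbol χ) {p r : Eis} (hp : Prime p)
    (hp1 : P1 p) (hr : Prime r) (hr1 : P1 r) : χ p r = χ r p := by
  by_cases h : conjE p = r
  swap
  · exact recip_prime_aux hχ hp hp1 hr hr1 h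
  subst h
  by_cases hpp : conjE p = p
  · rw [hpp]
  have hnd : ¬ p ∣ conjE p := fun h => hpp (P1_prime_dvd_eq hp hr hp1 hr1 h).symm
  have hnd' : ¬ conjE p ∣ p := fun h => hpp (P1_prime_dvd_eq hr hp hr1 hp1 h)
  set T := -(p + conjE p) with hT
  have hTP : P1 T := by
    obtain ⟨a, ha⟩ := hp1
    obtain ⟨b, hb⟩ := hr1
    exact ⟨-a - b - 1, by rw [hT]; linear_combination -ha - hb⟩
  have h1 : ¬ p ∣ T := by
    rw [hT, dvd_neg, dvd_add_right (dvd_refl p)]; exact hnd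
  have h2 : ¬ conjE p ∣ T := by
    rw [hT, dvd_neg, dvd_add_left (dvd_refl _)]; exact hnd'
  have e1 : χ p (conjE p) = χ p T := by
    rw [← hχ.map_neg hp1 T]
    apply hχ.periodic hp1
    exact ⟨-1, by rw [hT]; ring⟩
  have e2 : χ (conjE p) p = χ (conjE p) T := by
    rw [← hχ.map_neg hr1 T]
    apply hχ.periodic hr1
    exact ⟨-1, by rw [hT]; ring⟩
  rw [e1, e2, recip_aux hχ hp hp1 T hTP h2,
    recip_aux hχ hr hr1 T hTP (by rw [conjE_conjE]; exact h1), ← hχ.map_neg hTP p]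
  apply hχ.periodic hTP
  exact ⟨1, by rw [hT]; ring⟩

lemma recip_one {χ : Eis → Eis → Eis} (hχ : IsCubicSymbol χ) {p : Eis} (hp : Prime p)
    (hp1 : P1 p) : ∀ b, P1 b → χ p b = χ b p := by
  apply P1.induction
  · rw [hχ.one_bot, hχ.map_one' hp1]
  · intro r b hr hr1 hb ih
    rw [hχ.map_mul' hp1, hχ.mul_bot _ _ _ hr1 hb, recip_prime hχ hp hp1 hr hr1, ih]

/-- Cubic reciprocity. -/
theorem recip {χ : Eis → Eis → Eis} (hχ : IsCubicSymbol χ) {a b : Eis} (ha : P1 a)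
    (hb : P1 b) : χ a b = χ b a := by
  revert a
  apply P1.induction
  · rw [hχ.one_bot, hχ.map_one' hb]
  · intro p a hp hp1 ha ih
    rw [hχ.mul_bot _ _ _ hp1 ha, hχ.map_mul' hb, ih, recip_one hχ hp hp1 b hb]

/-! ### Additive characters and Gauss sums -/

/-- `eL z = ě(z/λ)`. -/
def eL (z : ℂ) : ℂ := cexp (2 * Real.pi * I * ((2 * z.im / Real.sqrt 3 : ℝ) : ℂ))

lemma eL_add (z w : ℂ) : eL (z + w) = eL z * eL w := by
  rw [eL, eL, eL, ← Complex.exp_add]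
  congr 1
  simp only [Complex.add_im]
  push_cast; ring

lemma eL_zero : eL 0 = 1 := by simp [eL]

lemma eL_norm (z : ℂ) : ‖eL z‖ = 1 := by
  rw [eL, Complex.norm_exp]
  simp

lemma eL_conj (z : ℂ) : (starRingEnd ℂ) (eL z) = eL (-z) := by
  rw [eL, eL, ← Complex.exp_conj]
  congr 1
  simp [Complex.conj_ofReal, map_ofNat]
  ring

lemma im_mk (a b : ℝ) : 2 * ((a : ℂ) + b * ωc).im / Real.sqrt 3 = b := by
  have h3 : Real.sqrt 3 ≠ 0 := by positivity
  rw [ωc_eq]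
  simp
  field_simp

lemma eL_lin (a b : ℝ) : eL ((a : ℂ) + b * ωc) = cexp (2 * Real.pi * I * b) := by
  rw [eL, im_mk]

lemma eL_coe (x : Eis) : eL (x : ℂ) = 1 := by
  obtain ⟨a, b, rfl⟩ := exists_mk x
  rw [coe_mk]
  have := eL_lin a b
  push_cast at this
  rw [this, Complex.exp_eq_one_iff]
  exact ⟨b, by ring⟩

lemma exists_lin (z : ℂ) : ∃ a b : ℝ, z = (a : ℂ) + b * ωc := by
  have h3 : Real.sqrt 3 ≠ 0 := by positivity
  refine ⟨z.re + z.im / Real.sqrt 3, 2 * z.im / Real.sqrt 3, ?_⟩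
  rw [ωc_eq]
  apply Complex.ext
  · simp; ring
  · simp; field_simp

lemma eL_eq_one {z : ℂ} (h : eL z = 1) (h' : eL (ωc * z) = 1) : ∃ x : Eis, z = x := by
  obtain ⟨a, b, rfl⟩ := exists_lin z
  have e : ωc * ((a : ℂ) + b * ωc) = ((-b : ℝ) : ℂ) + ((a - b : ℝ) : ℂ) * ωc := by
    push_cast
    linear_combination (b : ℂ) * ωc_sq
  rw [e] at h'
  rw [eL_lin, Complex.exp_eq_one_iff] at h h'
  obtain ⟨n, hn⟩ := h
  obtain ⟨m, hm⟩ := h'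
  have hpi : (2 * Real.pi * I : ℂ) ≠ 0 := by
    simp [Real.pi_ne_zero]
  have hb : (b : ℂ) = n := by
    apply mul_left_cancel₀ hpi; rw [hn]; ring
  have ha : ((a - b : ℝ) : ℂ) = m := by
    apply mul_left_cancel₀ hpi; rw [hm]; ring
  refine ⟨mk (m + n) n, ?_⟩
  rw [coe_mk]
  push_cast at ha ⊢
  rw [← ha, hb]; ring

/-- `f` is periodic modulo `r`. -/
def Per (r : Eis) (f : Eis → ℂ) : Prop := ∀ x y, r ∣ x - y → f x = f y

/-- sum over residues -/
def qsum (r : Eis) (f : Eis → ℂ) : ℂ := ∑' x : Eis ⧸ Ideal.span {r}, f x.out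

lemma Per.out {r : Eis} {f : Eis → ℂ} (hf : Per r f) (x : Eis) :
    f (Ideal.Quotient.mk (Ideal.span {r}) x).out = f x := hf _ _ (dvd_out_sub r x)

/-- finite Fourier transform -/
def fhat (r : Eis) (f : Eis → ℂ) (k : Eis) : ℂ :=
  qsum r (fun x => f x * eL ((k : ℂ) * x / r))

lemma Per.mul_eL {r : Eis} (hr : r ≠ 0) {f : Eis → ℂ} (hf : Per r f) (k : Eis) :
    Per r (fun x => f x * eL ((k : ℂ) * x / r)) := by
  intro x y h
  have hr' : (r : ℂ) ≠ 0 := by simpa using hr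
  simp only
  rw [hf x y h]
  congr 1
  obtain ⟨z, hz⟩ := h
  have hx : (x : ℂ) = y + r * z := by
    have : x = y + r * z := by linear_combination hz
    rw [this]; push_cast; ring
  have : (k : ℂ) * x / r = (k : ℂ) * y / r + ((k * z : Eis) : ℂ) := by
    rw [hx]; push_cast; field_simp
  rw [this, eL_add, eL_coe, mul_one]

/-- CRT equivalence -/
lemma crt_bij {a b : Eis} (hab : IsCoprime a b) :
    Function.Bijective (fun p : (Eis ⧸ Ideal.span {a}) × (Eis ⧸ Ideal.span {b}) =>
      Ideal.Quotient.mk (Ideal.span {a * b}) (b * p.1.out + a * p.2.out)) := by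
  constructor
  · rintro ⟨x, y⟩ ⟨x', y'⟩ h
    simp only [mk_eq_iff] at h
    obtain ⟨z, hz⟩ := h
    have h1 : a ∣ x.out - x'.out := by
      refine hab.dvd_of_dvd_mul_left (?_ : a ∣ b * _)
      exact ⟨b * z - (y.out - y'.out), by linear_combination hz⟩
    have h2 : b ∣ y.out - y'.out := by
      refine hab.symm.dvd_of_dvd_mul_left (?_ : b ∣ a * _)
      exact ⟨a * z - (x.out - x'.out), by linear_combination hz⟩
    rw [← mk_eq_iff] at h1 h2
    have e1 : Ideal.Quotient.mk (Ideal.span {a}) x.out = x := Quotient.out_eq x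
    have e2 : Ideal.Quotient.mk (Ideal.span {a}) x'.out = x' := Quotient.out_eq x'
    have e3 : Ideal.Quotient.mk (Ideal.span {b}) y.out = y := Quotient.out_eq y
    have e4 : Ideal.Quotient.mk (Ideal.span {b}) y'.out = y' := Quotient.out_eq y'
    rw [e1, e2] at h1
    rw [e3, e4] at h2
    rw [h1, h2]
  · intro z
    obtain ⟨z, rfl⟩ := Ideal.Quotient.mk_surjective z
    obtain ⟨u, v, huv⟩ := hab
    refine ⟨(Ideal.Quotient.mk _ (v * z), Ideal.Quotient.mk _ (u * z)), ?_⟩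
    simp only [mk_eq_iff]
    obtain ⟨s, hs⟩ := dvd_out_sub a (v * z)
    obtain ⟨t, ht⟩ := dvd_out_sub b (u * z)
    exact ⟨s + t, by linear_combination b * hs + a * ht + z * huv⟩

lemma fhat_mul {a b : Eis} (ha : a ≠ 0) (hb : b ≠ 0) (hab : IsCoprime a b) {f g : Eis → ℂ}
    (hf : Per a f) (hg : Per b g) (k : Eis) :
    fhat (a * b) (fun x => f x * g x) k =
      fhat a (fun x => f (b * x)) k * fhat b (fun x => g (a * x)) k := by
  have hab0 : a * b ≠ 0 := mul_ne_zero ha hb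
  have ha' : (a : ℂ) ≠ 0 := by simpa using ha
  have hb' : (b : ℂ) ≠ 0 := by simpa using hb
  have := finite_quot ha
  have := finite_quot hb
  have := finite_quot hab0
  let _ := Fintype.ofFinite (Eis ⧸ Ideal.span {a})
  let _ := Fintype.ofFinite (Eis ⧸ Ideal.span {b})
  have hper : Per (a * b) (fun x => f x * g x) := by
    intro x y h
    simp only
    rw [hf x y ((dvd_mul_right _ _).trans h), hg x y ((dvd_mul_left _ _).trans h)]
  have hP := hper.mul_eL hab0 k
  unfold fhat qsum
  rw [← (Equiv.ofBijective _ (crt_bij hab)).tsum_eq]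
  rw [tsum_fintype, tsum_fintype, tsum_fintype, Fintype.sum_prod_type, Finset.sum_mul]
  apply Finset.sum_congr rfl
  intro x _
  rw [Finset.mul_sum]
  apply Finset.sum_congr rfl
  intro y _
  simp only [Equiv.ofBijective_apply]
  rw [hP.out]
  rw [hf (b * x.out + a * y.out) (b * x.out) ⟨y.out, by ring⟩,
    hg (b * x.out + a * y.out) (a * y.out) ⟨x.out, by ring⟩]
  have : (k : ℂ) * ((b * x.out + a * y.out : Eis) : ℂ) / ((a * b : Eis) : ℂ)
      = (k : ℂ) * x.out / a + (k : ℂ) * y.out / b := by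
    push_cast; field_simp
  rw [this, eL_add]
  ring

/-- complex valued symbol -/
abbrev cx (χ : Eis → Eis → Eis) (b x : Eis) : ℂ := ((χ b x : Eis) : ℂ)

section Gauss
variable {χ : Eis → Eis → Eis}

lemma cx_per (hχ : IsCubicSymbol χ) {b : Eis} (hb : P1 b) : Per b (cx χ b) := by
  intro x y h; rw [cx, hχ.periodic hb h]

lemma cx_mul (hχ : IsCubicSymbol χ) {b : Eis} (hb : P1 b) (x y : Eis) : cx χ b (x * y) = cx χ b x * cx χ b y := by
  rw [cx, hχ.map_mul' hb]; push_cast; rfl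

lemma cx_bot (hχ : IsCubicSymbol χ) {a b : Eis} (ha : P1 a) (hb : P1 b) (x : Eis) :
    cx χ (a * b) x = cx χ a x * cx χ b x := by
  rw [cx, hχ.mul_bot _ _ _ ha hb]; push_cast; rfl

lemma cx_norm_le (hχ : IsCubicSymbol χ) {b : Eis} (hb : P1 b) (x : Eis) : ‖cx χ b x‖ ≤ 1 := (hχ.val hb x).norm_le

lemma cx_mul_conj (hχ : IsCubicSymbol χ) {b : Eis} (hb : P1 b) {x : Eis} (h : IsCoprime b x) :
    cx χ b x * (starRingEnd ℂ) (cx χ b x) = 1 := by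
  have := conj_val_inv (hχ.val hb x) ((hχ.ne_zero_iff hb x).2 h)
  rw [cx, ← coe_conjE]
  exact_mod_cast congrArg Subtype.val this

lemma cx_recip (hχ : IsCubicSymbol χ) {a b : Eis} (ha : P1 a) (hb : P1 b) : cx χ a b = cx χ b a := by
  rw [cx, cx, recip hχ ha hb]

lemma gauss_prime (hχ : IsCubicSymbol χ) {p : Eis} (hp : Prime p) (hp1 : P1 p) :
    (∀ k, fhat p (cx χ p) k = (starRingEnd ℂ) (cx χ p k) * fhat p (cx χ p) 1) ∧
      ‖fhat p (cx χ p) 1‖ ^ 2 = Nm p := by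
  classical
  let _ := resField hp
  have := finite_quot hp.ne_zero
  let _ := Fintype.ofFinite (Eis ⧸ Ideal.span {p})
  have hcardp : Fintype.card (Eis ⧸ Ideal.span {p}) = NmN p := by
    rw [← Nat.card_eq_fintype_card, card_quot]
  have hp' : (p : ℂ) ≠ 0 := by simpa using hp.ne_zero
  have hP : Per p (fun x => (1 : ℂ) * eL (((1 : Eis) : ℂ) * x / p)) :=
    Per.mul_eL hp.ne_zero (f := fun _ => 1) (fun _ _ _ => rfl) 1
  have hP' : Per p (fun x => eL ((x : ℂ) / p)) := by
    intro x y h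
    simpa using hP x y h
  let ψ : AddChar (Eis ⧸ Ideal.span {p}) ℂ :=
    { toFun := fun x => eL ((x.out : ℂ) / p)
      map_zero_eq_one' := by
        have := hP'.out 0
        simp only [map_zero] at this
        rw [this]; simp [eL_zero]
      map_add_eq_mul' := by
        intro x y
        obtain ⟨x, rfl⟩ := Ideal.Quotient.mk_surjective x
        obtain ⟨y, rfl⟩ := Ideal.Quotient.mk_surjective y
        have h1 := hP'.out x
        have h2 := hP'.out y
        have h3 := hP'.out (x + y)
        rw [← map_add]
        beta_reduce at h1 h2 h3
        rw [h1, h2, h3, ← eL_add]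
        congr 1; push_cast; ring }
  have hψ : ∀ x : Eis, ψ (Ideal.Quotient.mk _ x) = eL ((x : ℂ) / p) := fun x => hP'.out x
  let c := (mchar hχ hp1).ringHomComp Eis.subtype
  have hc : ∀ x : Eis, c (Ideal.Quotient.mk _ x) = cx χ p x := by
    intro x
    simp only [c, MulChar.ringHomComp_apply, mchar_mk]; rfl
  have hc1 : c ≠ 1 := by
    intro h
    obtain ⟨x, hx, hx1⟩ := exists_nontriv hχ hp hp1
    apply hx1
    have h2 : c (Ideal.Quotient.mk _ x) = 1 := by
      rw [h, MulChar.one_apply]; exact isUnit_mk_iff.2 hx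
    rw [hc] at h2
    exact Subtype.ext h2
  have hfh : ∀ k : Eis, fhat p (cx χ p) k = gaussSum c (ψ.mulShift (Ideal.Quotient.mk _ k)) := by
    intro k
    unfold fhat qsum
    rw [tsum_fintype, gaussSum]
    apply Finset.sum_congr rfl
    intro x _
    obtain ⟨x, rfl⟩ := Ideal.Quotient.mk_surjective x
    rw [AddChar.mulShift_apply, ← map_mul, hψ, hc]
    have := ((cx_per hχ hp1).mul_eL hp.ne_zero k).out x
    beta_reduce at this ⊢
    rw [this]
    push_cast; rfl
  have hψ1 : ψ ≠ 1 := by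
    intro h
    have hall : ∀ x : Eis, eL ((x : ℂ) / p) = 1 := by
      intro x; rw [← hψ, h]; simp
    obtain ⟨y, hy⟩ := eL_eq_one (z := 1 / (p : ℂ)) (by simpa using hall 1)
      (by
        have := hall ωE
        rw [mul_one_div]; exact this)
    apply hp.not_isUnit
    refine IsUnit.of_mul_eq_one y ?_
    apply Subtype.ext
    push_cast
    rw [← hy]; field_simp
  have hψp : ψ.IsPrimitive := AddChar.IsPrimitive.of_ne_one hψ1
  constructor
  · intro k
    rw [hfh k, hfh 1, map_one, AddChar.mulShift_one]
    by_cases hk : p ∣ k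
    · have h0 : Ideal.Quotient.mk (Ideal.span {p}) k = 0 := mk_eq_zero_iff.2 hk
      have h1 : χ p k = 0 := (hχ.prime_eq_zero p k hp hp1).2 hk
      rw [h0, AddChar.mulShift_zero, cx, h1, gaussSum]
      simp only [AddChar.one_apply, mul_one]
      rw [MulChar.sum_eq_zero_of_ne_one hc1]
      simp
    · have hcop : IsCoprime p k := (hp.irreducible.coprime_iff_not_dvd).2 hk
      have hu := isUnit_mk_iff.2 hcop
      have h := gaussSum_mulShift c ψ hu.unit
      rw [hu.unit_spec, hc] at h
      rw [← h, ← mul_assoc, mul_comm ((starRingEnd ℂ) _), cx_mul_conj hχ hp1 hcop, one_mul]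
  · rw [hfh 1, map_one, AddChar.mulShift_one]
    have h := gaussSum_mul_gaussSum_eq_card hc1 hψp
    rw [← star_gaussSum_eq, hcardp] at h
    have h2 : (gaussSum c ψ) * (starRingEnd ℂ) (gaussSum c ψ) = ((NmN p : ℕ) : ℂ) := h
    rw [Complex.mul_conj, Complex.normSq_eq_norm_sq] at h2
    rw [← Nm_nat]
    exact_mod_cast h2

lemma fhat_smul (hχ : IsCubicSymbol χ) {r : Eis} (c : ℂ) (f : Eis → ℂ) (k : Eis) :
    fhat r (fun x => c * f x) k = c * fhat r f k := by
  unfold fhat qsum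
  rw [← tsum_mul_left]
  congr 1; ext x; ring

/-- Gauss sums for squarefree moduli. -/
lemma gauss_sqfree (hχ : IsCubicSymbol χ) : ∀ a, P1 a → Squarefree a →
    (∀ k, fhat a (cx χ a) k = (starRingEnd ℂ) (cx χ a k) * fhat a (cx χ a) 1) ∧
      ‖fhat a (cx χ a) 1‖ ^ 2 = Nm a := by
  apply P1.induction
  · intro _
    have h1 : ∀ k, fhat 1 (cx χ 1) k = 1 := by
      intro k
      have := finite_quot (one_ne_zero (α := Eis))
      let _ := Fintype.ofFinite (Eis ⧸ Ideal.span {(1 : Eis)})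
      have : Subsingleton (Eis ⧸ Ideal.span {(1 : Eis)}) := by
        rw [Ideal.Quotient.subsingleton_iff, Ideal.span_singleton_one]
      unfold fhat qsum
      rw [tsum_fintype, Fintype.sum_subsingleton _ (Ideal.Quotient.mk _ (0 : Eis))]
      have hper : Per 1 (cx χ 1) := cx_per hχ P1_one
      have := (hper.mul_eL one_ne_zero k).out 0
      beta_reduce at this ⊢
      rw [this]
      simp [cx, hχ.one_bot, eL_zero]
    constructor
    · intro k; rw [h1, h1, cx, hχ.one_bot]; simp
    · rw [h1]; simp
  · intro p a hp hp1 ha ih hsq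
    have hcop : IsCoprime p a := by
      rw [hp.irreducible.coprime_iff_not_dvd]
      rintro ⟨z, rfl⟩
      apply hp.not_isUnit
      exact hsq p ⟨z, by ring⟩
    obtain ⟨i1, i2⟩ := ih (hsq.squarefree_of_dvd (dvd_mul_left _ _))
    obtain ⟨j1, j2⟩ := gauss_prime hχ hp hp1
    have hm : ∀ k, fhat (p * a) (cx χ (p * a)) k =
        cx χ p a * cx χ a p * (fhat p (cx χ p) k * fhat a (cx χ a) k) := by
      intro k
      have e : cx χ (p * a) = fun x => cx χ p x * cx χ a x := by
        ext x; rw [cx_bot hχ hp1 ha]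
      rw [e, fhat_mul hp.ne_zero ha.ne_zero hcop (cx_per hχ hp1) (cx_per hχ ha)]
      have e1 : (fun x => cx χ p (a * x)) = fun x => cx χ p a * cx χ p x := by
        ext x; rw [cx_mul hχ hp1]
      have e2 : (fun x => cx χ a (p * x)) = fun x => cx χ a p * cx χ a x := by
        ext x; rw [cx_mul hχ ha]
      rw [e1, e2, fhat_smul hχ, fhat_smul hχ]
      ring
    constructor
    · intro k
      rw [hm k, hm 1, i1 k, j1 k, cx_bot hχ hp1 ha, map_mul]
      ring
    · rw [hm 1, norm_mul, norm_mul, norm_mul]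
      have n1 : ‖cx χ p a‖ = 1 := (hχ.val hp1 a).norm_eq ((hχ.ne_zero_iff hp1 a).2 hcop)
      have n2 : ‖cx χ a p‖ = 1 := (hχ.val ha p).norm_eq ((hχ.ne_zero_iff ha p).2 hcop.symm)
      rw [n1, n2, one_mul, one_mul, mul_pow, i2, j2, Nm_mul]

/-- The normalising Gauss sum -/
def gam (χ : Eis → Eis → Eis) (a : Eis) : ℂ := fhat a (cx χ a) 1

lemma fhat_conj {r : Eis} (hr : r ≠ 0) {f : Eis → ℂ} (hf : Per r f) (hneg : ∀ x, f (-x) = f x)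
    (k : Eis) : fhat r (fun x => (starRingEnd ℂ) (f x)) k = (starRingEnd ℂ) (fhat r f k) := by
  have := finite_quot hr
  let _ := Fintype.ofFinite (Eis ⧸ Ideal.span {r})
  have hP := hf.mul_eL hr k
  have h1 : fhat r f k = ∑ x : Eis ⧸ Ideal.span {r}, f x.out * eL (-((k : ℂ) * x.out / r)) := by
    unfold fhat qsum
    rw [tsum_fintype, ← Equiv.sum_comp (Equiv.neg (Eis ⧸ Ideal.span {r}))]
    apply Finset.sum_congr rfl
    intro x _
    obtain ⟨x, rfl⟩ := Ideal.Quotient.mk_surjective x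
    rw [Equiv.neg_apply, ← map_neg]
    have h2 := (hf.mul_eL hr (-k)).out x
    have h4 := hP.out (-x)
    beta_reduce at h2 h4 ⊢
    rw [h4]
    have e : ∀ y : Eis, eL (-((k : ℂ) * y / r)) = eL (((-k : Eis) : ℂ) * y / r) := by
      intro y; congr 1; push_cast; ring
    rw [e, h2, hneg]
    congr 2; push_cast; ring
  rw [h1, map_sum]
  unfold fhat qsum
  rw [tsum_fintype]
  apply Finset.sum_congr rfl
  intro x _
  rw [map_mul, eL_conj, neg_neg]

lemma gauss_two (hχ : IsCubicSymbol χ) {a b : Eis} (ha : P1 a) (hb : P1 b) (sa : Squarefree a) (sb : Squarefree b)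
    (hab : IsCoprime a b) (k : Eis) :
    fhat (a * b) (fun x => cx χ a x * (starRingEnd ℂ) (cx χ b x)) k =
      gam χ a * (starRingEnd ℂ) (gam χ b) * ((starRingEnd ℂ) (cx χ a k) * cx χ b k) := by
  have hb' : Per b (fun x => (starRingEnd ℂ) (cx χ b x)) := by
    intro x y h; simp only; rw [cx_per hχ hb x y h]
  rw [fhat_mul ha.ne_zero hb.ne_zero hab (cx_per hχ ha) hb']
  have e1 : (fun x => cx χ a (b * x)) = fun x => cx χ a b * cx χ a x := by
    ext x; rw [cx_mul hχ ha]
  have e2 : (fun x => (starRingEnd ℂ) (cx χ b (a * x))) =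
      fun x => (starRingEnd ℂ) (cx χ b a) * (starRingEnd ℂ) (cx χ b x) := by
    ext x; rw [cx_mul hχ hb, map_mul]
  rw [e1, e2, fhat_smul hχ, fhat_smul hχ, fhat_conj hb.ne_zero (cx_per hχ hb)
    (fun x => by rw [cx, hχ.map_neg hb]), (gauss_sqfree hχ a ha sa).1 k,
    (gauss_sqfree hχ b hb sb).1 k, cx_recip hχ hb ha]
  have h := cx_mul_conj hχ ha hab
  simp only [map_mul, Complex.conj_conj, gam]
  linear_combination ((starRingEnd ℂ) (cx χ a k) * cx χ b k * fhat a (cx χ a) 1 *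
    (starRingEnd ℂ) (fhat b (cx χ b) 1)) * h

lemma gam_norm (hχ : IsCubicSymbol χ) {a : Eis} (ha : P1 a) (sa : Squarefree a) : ‖gam χ a‖ ^ 2 = Nm a :=
  (gauss_sqfree hχ a ha sa).2

end Gauss

/-! ### Poisson summation -/

lemma summ_gauss1 {t : ℝ} (ht : 0 < t) : Summable (fun n : ℤ => Real.exp (-(t * (n : ℝ) ^ 2))) := by
  have h := summable_pow_mul_jacobiTheta₂_term_bound 0 (T := t / Real.pi) (by positivity) 0
  refine h.congr (fun n => ?_)
  rw [pow_zero, one_mul]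
  congr 1
  field_simp
  ring

lemma summ_gauss_shift {t : ℝ} (ht : 0 < t) (v : ℝ) :
    Summable (fun n : ℤ => Real.exp (-(t * ((n : ℝ) + v) ^ 2))) := by
  refine Summable.of_nonneg_of_le (fun _ => (Real.exp_pos _).le) (fun n => ?_)
    ((summ_gauss1 (half_pos ht)).mul_left (Real.exp (t * v ^ 2)))
  rw [← Real.exp_add]
  apply Real.exp_le_exp.2
  nlinarith [mul_nonneg ht.le (sq_nonneg ((n : ℝ) + 2 * v))]

lemma poisson1 {s : ℝ} (hs : 0 < s) (w : ℂ) :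
    ∑' n : ℤ, cexp (-Real.pi * s * (n + w) ^ 2) =
      ((Real.sqrt s)⁻¹ : ℝ) * ∑' n : ℤ, cexp (-Real.pi * n ^ 2 / s - 2 * Real.pi * I * w * n) := by
  have h := Complex.tsum_exp_neg_quadratic (a := ((1 / s : ℝ) : ℂ)) (by simpa using hs) (-I * w)
  have hs' : (s : ℂ) ≠ 0 := by exact_mod_cast hs.ne'
  have hsq : (1 : ℂ) / ((1 / s : ℝ) : ℂ) ^ (1 / 2 : ℂ) = (Real.sqrt s : ℝ) := by
    have e : (1 / 2 : ℂ) = ((1 / 2 : ℝ) : ℂ) := by push_cast; rfl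
    rw [e, ← Complex.ofReal_cpow (by positivity), ← Real.sqrt_eq_rpow]
    rw [one_div s, Real.sqrt_inv]
    push_cast
    simp
  rw [hsq] at h
  have hq : ((Real.sqrt s : ℝ) : ℂ) ≠ 0 := by
    have := Real.sqrt_pos.2 hs
    exact_mod_cast this.ne'
  have e1 : (∑' n : ℤ, cexp (-Real.pi * n ^ 2 / s - 2 * Real.pi * I * w * n)) =
      ∑' n : ℤ, cexp (-Real.pi * ((1 / s : ℝ) : ℂ) * n ^ 2 + 2 * Real.pi * (-I * w) * n) := by
    congr 1; ext n; congr 1; push_cast; field_simp; ring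
  have e2 : (∑' n : ℤ, cexp (-Real.pi / ((1 / s : ℝ) : ℂ) * (n + I * (-I * w)) ^ 2)) =
      ∑' n : ℤ, cexp (-Real.pi * s * (n + w) ^ 2) := by
    congr 1; ext n; congr 1
    have : I * (-I * w) = w := by
      linear_combination (-w) * I_mul_I
    rw [this]
    push_cast; field_simp
  rw [e1, h, e2]
  push_cast
  field_simp

lemma summ_gauss2 {t : ℝ} (ht : 0 < t) :
    Summable (fun m : Eis => Real.exp (-(t * Nm m))) := by
  rw [← eisEquiv.summable_iff]
  have h := (summ_gauss1 (half_pos ht)).mul_of_nonneg (summ_gauss1 (half_pos ht))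
    (fun _ => (Real.exp_pos _).le) (fun _ => (Real.exp_pos _).le)
  refine Summable.of_nonneg_of_le (fun _ => (Real.exp_pos _).le) (fun n => ?_) h
  rw [Function.comp, eisEquiv_apply, Nm_mk, ← Real.exp_add]
  apply Real.exp_le_exp.2
  push_cast
  nlinarith [mul_nonneg ht.le (sq_nonneg ((n.1 : ℝ) - n.2))]

lemma normSq_lin (a b : ℝ) : ‖(a : ℂ) + b * ωc‖ ^ 2 = (a - b / 2) ^ 2 + 3 / 4 * b ^ 2 := by
  have h3 : Real.sqrt 3 ^ 2 = 3 := Real.sq_sqrt (by norm_num)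
  rw [← Complex.normSq_eq_norm_sq, ωc_eq, Complex.normSq_apply]
  simp
  ring_nf
  rw [h3]; ring

lemma Nm_norm (x : Eis) : Nm x = ‖(x : ℂ)‖ ^ 2 := by rw [Nm, Complex.normSq_eq_norm_sq]

lemma summ_gauss_z {t : ℝ} (ht : 0 < t) (z : ℂ) :
    Summable (fun m : Eis => Real.exp (-(t * ‖(m : ℂ) + z‖ ^ 2))) := by
  refine Summable.of_nonneg_of_le (fun _ => (Real.exp_pos _).le) (fun n => ?_)
    ((summ_gauss2 (half_pos ht)).mul_left (Real.exp (t * ‖z‖ ^ 2)))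
  rw [← Real.exp_add]
  apply Real.exp_le_exp.2
  rw [Nm_norm]
  have h1 : ‖(n : ℂ)‖ ≤ ‖(n : ℂ) + z‖ + ‖z‖ := by
    have := norm_sub_le ((n : ℂ) + z) z
    simpa using this
  have h2 : ‖(n : ℂ)‖ ^ 2 ≤ 2 * ‖(n : ℂ) + z‖ ^ 2 + 2 * ‖z‖ ^ 2 := by
    nlinarith [norm_nonneg (n : ℂ), sq_nonneg (‖(n : ℂ) + z‖ - ‖z‖)]
  nlinarith

lemma norm_cexp_neg (x y : ℝ) : ‖cexp (-(x : ℂ) + (y : ℂ) * I)‖ = Real.exp (-x) := by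
  rw [Complex.norm_exp]; simp

/-- two dimensional Poisson summation -/
lemma poisson2 {s : ℝ} (hs : 0 < s) (z : ℂ) :
    ∑' m : Eis, (Real.exp (-(Real.pi * s * ‖(m : ℂ) + z‖ ^ 2)) : ℂ) =
      ((2 / (Real.sqrt 3 * s) : ℝ) : ℂ) *
        ∑' k : Eis, (Real.exp (-(4 * Real.pi * Nm k / (3 * s))) : ℂ) * eL ((k : ℂ) * z) := by
  obtain ⟨u, v, rfl⟩ := exists_lin z
  have hpi := Real.pi_pos
  set s' : ℝ := 3 * s / 4 with hs'
  have hs0' : 0 < s' := by positivity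
  have hsC : (s : ℂ) ≠ 0 := by exact_mod_cast hs.ne'
  -- left side
  have hL : Summable (fun m : Eis =>
      (Real.exp (-(Real.pi * s * ‖(m : ℂ) + ((u : ℂ) + v * ωc)‖ ^ 2)) : ℂ)) := by
    exact Complex.summable_ofReal.2 (summ_gauss_z (by positivity : 0 < Real.pi * s) _)
  have hval : ∀ a b : ℤ, (Real.exp (-(Real.pi * s * ‖((mk a b : Eis) : ℂ) + ((u : ℂ) + v * ωc)‖ ^ 2)) : ℂ)
      = cexp (-Real.pi * s' * (b + v) ^ 2) *
        cexp (-Real.pi * s * (a + ((u - (b + v) / 2 : ℝ) : ℂ)) ^ 2) := by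
    intro a b
    have e : ((mk a b : Eis) : ℂ) + ((u : ℂ) + v * ωc) =
        ((a + u : ℝ) : ℂ) + ((b + v : ℝ) : ℂ) * ωc := by
      rw [coe_mk]; push_cast; ring
    rw [e, normSq_lin, ← Complex.exp_add, Complex.ofReal_exp]
    congr 1
    rw [hs']; push_cast; ring
  rw [← ((Equiv.prodComm ℤ ℤ).trans eisEquiv).tsum_eq]
  have hL2 := (((Equiv.prodComm ℤ ℤ).trans eisEquiv).summable_iff).2 hL
  refine (Summable.tsum_prod hL2).trans ?_
  simp only [Function.comp_apply]
  have step1 : ∀ b : ℤ, (∑' a : ℤ, (Real.exp (-(Real.pi * s *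
      ‖((((Equiv.prodComm ℤ ℤ).trans eisEquiv) (b, a) : Eis) : ℂ) + ((u : ℂ) + v * ωc)‖ ^ 2)) : ℂ)) =
      ((Real.sqrt s)⁻¹ : ℝ) * ∑' j : ℤ, cexp (-Real.pi * s' * (b + v) ^ 2) *
        cexp (-Real.pi * j ^ 2 / s - 2 * Real.pi * I * ((u - (b + v) / 2 : ℝ) : ℂ) * j) := by
    intro b
    refine (tsum_congr (fun a => hval a b)).trans ?_
    rw [tsum_mul_left, poisson1 hs, tsum_mul_left]
    ring
  rw [tsum_congr step1, tsum_mul_left]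
  -- interchange
  have hsum : Summable (Function.uncurry fun (b j : ℤ) => cexp (-Real.pi * s' * (b + v) ^ 2) *
        cexp (-Real.pi * j ^ 2 / s - 2 * Real.pi * I * ((u - (b + v) / 2 : ℝ) : ℂ) * j)) := by
    have h := (summ_gauss_shift (t := Real.pi * s') (by positivity) v).mul_of_nonneg
      (summ_gauss1 (t := Real.pi / s) (by positivity))
      (fun _ => (Real.exp_pos _).le) (fun _ => (Real.exp_pos _).le)
    refine Summable.of_norm_bounded h ?_
    rintro ⟨b, j⟩
    simp only [Function.uncurry]
    rw [norm_mul]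
    apply le_of_eq
    congr 1
    · rw [← norm_cexp_neg _ 0]; congr 2; push_cast; ring
    · rw [← norm_cexp_neg _ (-(2 * Real.pi * (u - (b + v) / 2) * j))]
      congr 2; push_cast; ring
  rw [← Summable.tsum_comm hsum]
  have step2 : ∀ j : ℤ, (∑' b : ℤ, cexp (-Real.pi * s' * (b + v) ^ 2) *
        cexp (-Real.pi * j ^ 2 / s - 2 * Real.pi * I * ((u - (b + v) / 2 : ℝ) : ℂ) * j)) =
      ((Real.sqrt s')⁻¹ : ℝ) * ∑' l : ℤ,
        (Real.exp (-(4 * Real.pi * Nm (mk (-l - j) (-j)) / (3 * s))) : ℂ) *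
          eL (((mk (-l - j) (-j) : Eis) : ℂ) * ((u : ℂ) + v * ωc)) := by
    intro j
    have e1 : ∀ b : ℤ, cexp (-Real.pi * s' * (b + v) ^ 2) *
        cexp (-Real.pi * j ^ 2 / s - 2 * Real.pi * I * ((u - (b + v) / 2 : ℝ) : ℂ) * j) =
        cexp (-Real.pi * j ^ 2 / s - 2 * Real.pi * I * u * j - Real.pi * j ^ 2 / (4 * s')) *
        cexp (-Real.pi * s' * (b + (v - I * j / (2 * s'))) ^ 2) := by
      intro b
      rw [← Complex.exp_add, ← Complex.exp_add]
      congr 1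
      rw [hs']; push_cast
      field_simp
      ring_nf
      simp only [I_sq]
      ring
    rw [tsum_congr e1, tsum_mul_left, poisson1 hs0', mul_left_comm, ← tsum_mul_left]
    congr 1
    apply tsum_congr
    intro l
    have e2 : ((mk (-l - j) (-j) : Eis) : ℂ) * ((u : ℂ) + v * ωc) =
        (((-l - j) * u + j * v : ℝ) : ℂ) + ((-(u * j + l * v) : ℝ) : ℂ) * ωc := by
      rw [coe_mk]; push_cast
      linear_combination (-(j : ℂ) * v) * ωc_sq
    rw [e2, eL_lin, Nm_mk, Complex.ofReal_exp, ← Complex.exp_add, ← Complex.exp_add]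
    congr 1
    rw [hs']; push_cast
    field_simp
    ring_nf
    simp only [I_sq]
    ring
  rw [tsum_congr step2, tsum_mul_left]
  -- right side
  let e : ℤ × ℤ ≃ Eis := (Equiv.mk (fun p : ℤ × ℤ => (-p.2 - p.1, -p.1))
    (fun p => (-p.2, p.2 - p.1)) (fun p => by ext <;> simp; ring) (fun p => by ext <;> simp)).trans eisEquiv
  have he : ∀ p, e p = mk (-p.2 - p.1) (-p.1) := fun p => rfl
  have hR : Summable (fun k : Eis =>
      (Real.exp (-(4 * Real.pi * Nm k / (3 * s))) : ℂ) * eL ((k : ℂ) * ((u : ℂ) + v * ωc))) := by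
    refine Summable.of_norm_bounded (summ_gauss2 (t := 4 * Real.pi / (3 * s)) (by positivity)) ?_
    intro k
    rw [norm_mul, eL_norm, mul_one, Complex.norm_real, Real.norm_of_nonneg (Real.exp_pos _).le]
    apply le_of_eq; congr 1; ring
  rw [← e.tsum_eq (fun k : Eis =>
      (Real.exp (-(4 * Real.pi * Nm k / (3 * s))) : ℂ) * eL ((k : ℂ) * ((u : ℂ) + v * ωc)))]
  have hR2 := Summable.tsum_prod (e.summable_iff.2 hR)
  simp only [Function.comp_apply] at hR2
  rw [hR2]
  simp only [he]
  rw [← mul_assoc]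
  congr 1
  rw [← Complex.ofReal_mul]
  congr 1
  have h34 : s' = s * (3 / 4) := by rw [hs']; ring
  rw [h34, Real.sqrt_mul hs.le, Real.sqrt_div (by norm_num)]
  have h4 : Real.sqrt 4 = 2 := by
    rw [show (4 : ℝ) = 2 ^ 2 by norm_num, Real.sqrt_sq (by norm_num)]
  rw [h4]
  have hss : Real.sqrt s * Real.sqrt s = s := Real.mul_self_sqrt hs.le
  have : 0 < Real.sqrt s := Real.sqrt_pos.2 hs
  field_simp
  nlinarith

/-- residue decomposition -/
def resEquiv {r : Eis} (hr : r ≠ 0) : (Eis ⧸ Ideal.span {r}) × Eis ≃ Eis :=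
  Equiv.ofBijective (fun p => p.1.out + r * p.2) (by
    constructor
    · rintro ⟨x, n⟩ ⟨y, m⟩ h
      simp only at h
      have e1 : Ideal.Quotient.mk (Ideal.span {r}) x.out = x := Quotient.out_eq x
      have e2 : Ideal.Quotient.mk (Ideal.span {r}) y.out = y := Quotient.out_eq y
      have hxy : x = y := by
        rw [← e1, ← e2, mk_eq_iff]
        exact ⟨m - n, by linear_combination h⟩
      subst hxy
      have : n = m := by
        apply mul_left_cancel₀ hr
        exact add_left_cancel h
      rw [this]
    · intro z
      obtain ⟨w, hw⟩ := dvd_out_sub r z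
      exact ⟨(Ideal.Quotient.mk _ z, -w), by simp only; linear_combination hw⟩)

lemma Per.bdd {r : Eis} (hr : r ≠ 0) {f : Eis → ℂ} (hf : Per r f) : ∃ C : ℝ, ∀ x, ‖f x‖ ≤ C := by
  have := finite_quot hr
  obtain ⟨C, hC⟩ := (Set.finite_range (fun x : Eis ⧸ Ideal.span {r} => ‖f x.out‖)).bddAbove
  refine ⟨C, fun x => ?_⟩
  rw [← hf.out x]
  exact hC ⟨_, rfl⟩

lemma poisson_tw {r : Eis} (hr : r ≠ 0) {f : Eis → ℂ} (hf : Per r f) {s : ℝ} (hs : 0 < s) :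
    ∑' m : Eis, f m * (Real.exp (-(Real.pi * s * Nm m)) : ℂ) =
      ((2 / (Real.sqrt 3 * s * Nm r) : ℝ) : ℂ) *
        ∑' k : Eis, (Real.exp (-(4 * Real.pi * Nm k / (3 * s * Nm r))) : ℂ) * fhat r f k := by
  have := finite_quot hr
  let _ := Fintype.ofFinite (Eis ⧸ Ideal.span {r})
  have hN := Nm_pos hr
  have hpi := Real.pi_pos
  have hr' : (r : ℂ) ≠ 0 := by simpa using hr
  obtain ⟨C, hC⟩ := hf.bdd hr
  have hS : Summable (fun m : Eis => f m * (Real.exp (-(Real.pi * s * Nm m)) : ℂ)) := by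
    refine Summable.of_norm_bounded
      ((summ_gauss2 (t := Real.pi * s) (by positivity)).mul_left C) (fun m => ?_)
    rw [norm_mul, Complex.norm_real, Real.norm_of_nonneg (Real.exp_pos _).le]
    exact mul_le_mul_of_nonneg_right (hC m) (Real.exp_pos _).le
  rw [← (resEquiv hr).tsum_eq]
  refine (Summable.tsum_prod ((resEquiv hr).summable_iff.2 hS)).trans ?_
  rw [tsum_fintype]
  simp only [Function.comp_apply]
  have hR : ∀ x : Eis ⧸ Ideal.span {r}, Summable (fun k : Eis =>
      (Real.exp (-(4 * Real.pi * Nm k / (3 * s * Nm r))) : ℂ) *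
        (f x.out * eL ((k : ℂ) * x.out / r))) := by
    intro x
    refine Summable.of_norm_bounded
      ((summ_gauss2 (t := 4 * Real.pi / (3 * s * Nm r)) (by positivity)).mul_right C) (fun m => ?_)
    rw [norm_mul, Complex.norm_real, Real.norm_of_nonneg (Real.exp_pos _).le, norm_mul, eL_norm,
      mul_one]
    have e : 4 * Real.pi * Nm m / (3 * s * Nm r) = 4 * Real.pi / (3 * s * Nm r) * Nm m := by ring
    rw [e]
    exact mul_le_mul_of_nonneg_left (hC _) (Real.exp_pos _).le
  have h1 : ∀ x : Eis ⧸ Ideal.span {r}, (∑' n : Eis, f (resEquiv hr (x, n)) *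
      (Real.exp (-(Real.pi * s * Nm (resEquiv hr (x, n)))) : ℂ)) =
      ((2 / (Real.sqrt 3 * s * Nm r) : ℝ) : ℂ) * ∑' k : Eis,
      (Real.exp (-(4 * Real.pi * Nm k / (3 * s * Nm r))) : ℂ) *
        (f x.out * eL ((k : ℂ) * x.out / r)) := by
    intro x
    have e1 : ∀ n : Eis, f (resEquiv hr (x, n)) *
      (Real.exp (-(Real.pi * s * Nm (resEquiv hr (x, n)))) : ℂ) =
      f x.out * (Real.exp (-(Real.pi * (s * Nm r) * ‖(n : ℂ) + x.out / r‖ ^ 2)) : ℂ) := by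
      intro n
      have e0 : resEquiv hr (x, n) = x.out + r * n := rfl
      rw [e0, hf (x.out + r * n) x.out ⟨n, by ring⟩]
      congr 4
      rw [Nm_norm, Nm_norm]
      have e3 : ((x.out + r * n : Eis) : ℂ) = r * ((n : ℂ) + x.out / r) := by
        push_cast; field_simp; ring
      rw [e3, norm_mul]; ring
    rw [tsum_congr e1, tsum_mul_left, poisson2 (by positivity)]
    have e4 : ∀ k : Eis, (Real.exp (-(4 * Real.pi * Nm k / (3 * s * Nm r))) : ℂ) *
        (f x.out * eL ((k : ℂ) * x.out / r)) = f x.out *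
        ((Real.exp (-(4 * Real.pi * Nm k / (3 * (s * Nm r)))) : ℂ) *
        eL ((k : ℂ) * (x.out / r))) := by
      intro k
      rw [← mul_div_assoc, ← mul_assoc 3 s]; ring
    rw [tsum_congr e4, tsum_mul_left, ← mul_assoc (Real.sqrt 3)]
    ring
  rw [Finset.sum_congr rfl (fun x _ => h1 x), ← Finset.mul_sum,
    ← Summable.tsum_finsetSum (fun x _ => hR x)]
  congr 1
  apply tsum_congr
  intro k
  rw [← Finset.mul_sum, fhat, qsum, tsum_fintype]

/-! ### Counting, divisors, Möbius -/

lemma summ_rpow {ε : ℝ} (hε : 0 < ε) : Summable (fun x : Eis => Nm x ^ (-(1 + ε))) := by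
  rw [← eisEquiv.summable_iff]
  have h := EisensteinSeries.summable_one_div_norm_rpow (k := 2 + 2 * ε) (by linarith)
  have h2 := ((finTwoArrowEquiv ℤ).symm.summable_iff).2 h
  refine Summable.of_nonneg_of_le (fun p => ?_) (fun p => ?_)
    (h2.mul_left ((3 / 4 : ℝ) ^ (-(1 + ε))))
  · exact Real.rpow_nonneg (Nm_nonneg _) _
  · obtain ⟨a, b⟩ := p
    simp only [Function.comp_apply, eisEquiv_apply, finTwoArrowEquiv_symm_apply]
    set n : ℝ := ‖![a, b]‖ with hn
    have hn0 : 0 ≤ n := norm_nonneg _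
    have hle : 3 / 4 * n ^ 2 ≤ Nm (mk a b) := by
      have hcase : n = |(a : ℝ)| ∨ n = |(b : ℝ)| := by
        rw [hn, Pi.norm_def, Fin.univ_succ]
        simp
        rcases le_total |a| |b| with h | h
        · right
          simp [Int.norm_eq_abs]
          exact_mod_cast h
        · left
          simp [Int.norm_eq_abs]
          exact_mod_cast h
      rw [Nm_mk]; push_cast
      rcases hcase with h | h <;> rw [h, sq_abs]
      · nlinarith [sq_nonneg ((a : ℝ) - 2 * b)]
      · nlinarith [sq_nonneg ((b : ℝ) - 2 * a)]
    rcases hn0.eq_or_lt with h0 | h0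
    · have hz : mk a b = 0 := by
        have : ![a, b] = 0 := norm_eq_zero.1 h0.symm
        have h1 : a = 0 := by simpa using congrFun this 0
        have h2 : b = 0 := by simpa using congrFun this 1
        rw [h1, h2, ← zero_eq_mk]
      rw [hz, Nm_zero, Real.zero_rpow (by linarith)]
      positivity
    · have e : n ^ (-(2 + 2 * ε)) = (n ^ 2) ^ (-(1 + ε)) := by
        rw [← Real.rpow_natCast, ← Real.rpow_mul hn0]; congr 1; push_cast; ring
      rw [e, ← Real.mul_rpow (by norm_num) (by positivity)]
      exact Real.rpow_le_rpow_of_nonpos (by positivity) hle (by linarith)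

/-- a zeta value over all elements -/
def ZE (ε : ℝ) : ℝ := ∑' x : Eis, Nm x ^ (-(1 + ε))

lemma ZE_nonneg (ε : ℝ) : 0 ≤ ZE ε := tsum_nonneg (fun _ => Real.rpow_nonneg (Nm_nonneg _) _)

lemma sum_le_ZE {ε : ℝ} (hε : 0 < ε) (s : Finset Eis) : ∑ x ∈ s, Nm x ^ (-(1 + ε)) ≤ ZE ε :=
  (summ_rpow hε).sum_le_tsum _ (fun _ _ => Real.rpow_nonneg (Nm_nonneg _) _)

lemma finite_bl (T : ℝ) : {x : Eis | Nm x ≤ T}.Finite := by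
  have h := summ_rpow one_pos
  have h2 := h.tendsto_cofinite_zero
  by_cases hT : T ≤ 0
  · apply Set.Finite.subset (Set.finite_singleton (0 : Eis))
    intro x hx
    have : Nm x = 0 := le_antisymm (le_trans hx hT) (Nm_nonneg x)
    exact Nm_eq_zero.1 this
  · push Not at hT
    have h3 := h2.eventually_lt_const (show (0 : ℝ) < T ^ (-(1 + 1) : ℝ) by positivity)
    rw [Filter.eventually_cofinite] at h3
    apply (h3.union (Set.finite_singleton (0 : Eis))).subset
    intro x hx
    by_cases hx0 : x = 0
    · right; exact hx0
    · left
      simp only [Set.mem_ofPred_eq, not_lt]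
      exact Real.rpow_le_rpow_of_nonpos (Nm_pos hx0) hx (by norm_num)

/-- elements of norm at most `T` -/
def bl (T : ℝ) : Finset Eis := (finite_bl T).toFinset

lemma mem_bl {T : ℝ} {x : Eis} : x ∈ bl T ↔ Nm x ≤ T := by simp [bl]

lemma bl_mono {T T' : ℝ} (h : T ≤ T') : bl T ⊆ bl T' := by
  intro x hx; rw [mem_bl] at *; linarith

/-- squarefree and `≡ 1 (mod 3)` -/
def PS (a : Eis) : Prop := P1 a ∧ Squarefree a

open Classical in
/-- `PS` elements of norm at most `T` -/
def ps (T : ℝ) : Finset Eis := (bl T).filter PS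

lemma mem_ps {T : ℝ} {x : Eis} : x ∈ ps T ↔ PS x ∧ Nm x ≤ T := by
  classical
  simp [ps, mem_bl, and_comm]

lemma ps_mono {T T' : ℝ} (h : T ≤ T') : ps T ⊆ ps T' := by
  intro x hx; rw [mem_ps] at *; exact ⟨hx.1, by linarith [hx.2]⟩

lemma PS.P1 {a : Eis} (h : PS a) : P1 a := h.1
lemma PS.sq {a : Eis} (h : PS a) : Squarefree a := h.2
lemma PS.ne_zero {a : Eis} (h : PS a) : a ≠ 0 := h.1.ne_zero
lemma PS.one_le {a : Eis} (h : PS a) : 1 ≤ Nm a := one_le_Nm h.ne_zero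
lemma PS_one : PS 1 := ⟨P1_one, squarefree_one⟩
lemma PS.of_mul_left {a b : Eis} (h : PS (a * b)) (ha : CubicPaper.P1 a) : PS a :=
  ⟨ha, h.2.squarefree_of_dvd (dvd_mul_right _ _)⟩
lemma PS.of_dvd {a b : Eis} (h : PS b) (ha : CubicPaper.P1 a) (hab : a ∣ b) : PS a :=
  ⟨ha, h.2.squarefree_of_dvd hab⟩

open Classical in
/-- `P1` divisors -/
def divs (n : Eis) : Finset Eis := (bl (Nm n)).filter (fun d => P1 d ∧ d ∣ n)

lemma mem_divs {n d : Eis} (hn : n ≠ 0) : d ∈ divs n ↔ P1 d ∧ d ∣ n := by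
  classical
  simp only [divs, Finset.mem_filter, mem_bl, and_iff_right_iff_imp]
  rintro ⟨_, h⟩
  exact Nm_le_of_dvd h hn

lemma card_divs_mul {x y : Eis} (hx : x ≠ 0) (hy : y ≠ 0) :
    (divs (x * y)).card ≤ (divs x).card * (divs y).card := by
  classical
  rw [← Finset.card_product]
  apply Finset.card_le_card_of_surjOn (fun p : Eis × Eis => p.1 * p.2)
  intro d hd
  rw [Finset.mem_coe, mem_divs (mul_ne_zero hx hy)] at hd
  obtain ⟨d1, d2, h1, h2, rfl⟩ := exists_dvd_and_dvd_of_dvd_mul hd.2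
  have hl : ¬ lam ∣ d1 := fun h => hd.1.not_lam_dvd (h.mul_right _)
  obtain ⟨u, hu, hu1⟩ := exists_unit_P1 hl
  obtain ⟨v, hv⟩ := hu.exists_left_inv
  have hvu : IsUnit v := IsUnit.of_mul_eq_one u hv
  have e : (u * d1) * (v * d2) = d1 * d2 := by linear_combination (d1 * d2) * hv
  refine ⟨(u * d1, v * d2), ?_, e⟩
  rw [Finset.mem_coe, Finset.mem_product, mem_divs hx, mem_divs hy]
  refine ⟨⟨hu1, (hu.mul_left_dvd).2 h1⟩, ?_, (hvu.mul_left_dvd).2 h2⟩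
  apply P1_of_mul hu1
  rw [e]; exact hd.1

lemma card_divs_prime_pow {p : Eis} (hp : Prime p) (i : ℕ) : (divs (p ^ i)).card ≤ i + 1 := by
  classical
  rw [← Finset.card_range (i + 1)]
  have hp0 : p ^ i ≠ 0 := pow_ne_zero _ hp.ne_zero
  have hex : ∀ d ∈ divs (p ^ i), ∃ j ∈ Finset.range (i + 1), Associated d (p ^ j) := by
    intro d hd
    rw [mem_divs hp0] at hd
    obtain ⟨j, hj, h⟩ := (dvd_prime_pow hp i).1 hd.2
    exact ⟨j, by simpa [Nat.lt_succ_iff] using hj, h⟩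
  choose! f hf1 hf2 using hex
  apply Finset.card_le_card_of_injOn f hf1
  intro d hd e he hde
  rw [Finset.mem_coe] at hd he
  have h1 := hf2 d hd
  have h2 := hf2 e he
  rw [hde] at h1
  rw [mem_divs hp0] at hd he
  exact P1_assoc hd.1 he.1 (h1.trans h2.symm)

lemma two_le_Nm {p : Eis} (hp : Prime p) : 2 ≤ Nm p := by
  have h1 := one_le_Nm hp.ne_zero
  have h2 : Nm p ≠ 1 := fun h => hp.not_isUnit (isUnit_iff_Nm.2 h)
  obtain ⟨n, hn⟩ := Nm_int p
  rw [hn] at h1 h2 ⊢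
  have h3 : (1 : ℤ) ≤ n := by exact_mod_cast h1
  have h4 : n ≠ 1 := by exact_mod_cast h2
  have : (2 : ℤ) ≤ n := by omega
  exact_mod_cast this

/-- The divisor bound. -/
lemma divisor_bound {ε : ℝ} (hε : 0 < ε) :
    ∃ C : ℝ, 1 ≤ C ∧ ∀ n : Eis, n ≠ 0 → ((divs n).card : ℝ) ≤ C * Nm n ^ ε := by
  classical
  set x : ℝ := ε * Real.log 2 with hx
  have hx0 : 0 < x := mul_pos hε (Real.log_pos (by norm_num))
  set K : ℝ := 1 + 1 / x with hK
  have hK1 : 1 ≤ K := by rw [hK]; have : 0 < 1 / x := by positivity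
                         linarith
  set T : ℝ := (2 : ℝ) ^ (1 / ε) with hT
  let Sm : Finset Eis := bl T
  refine ⟨K ^ Sm.card, one_le_pow₀ hK1, ?_⟩
  have key : ∀ n : Eis, n ≠ 0 → ((divs n).card : ℝ) ≤
      K ^ (Sm.filter (fun p => Prime p ∧ p ∣ n)).card * Nm n ^ ε := by
    intro n
    induction n using UniqueFactorizationMonoid.induction_on_coprime with
    | h0 => intro h; exact absurd rfl h
    | h1 hu =>
      rename_i u
      intro h
      have h1 : (divs u).card ≤ 1 := by
        rw [Finset.card_le_one]
        intro a ha b hb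
        rw [mem_divs h] at ha hb
        rw [P1_unit (isUnit_of_dvd_unit ha.2 hu) ha.1, P1_unit (isUnit_of_dvd_unit hb.2 hu) hb.1]
      have h2 : Nm u = 1 := isUnit_iff_Nm.1 hu
      rw [h2, Real.one_rpow, mul_one]
      calc ((divs u).card : ℝ) ≤ 1 := by exact_mod_cast h1
        _ ≤ _ := one_le_pow₀ hK1
    | hpr i hp =>
      rename_i p
      intro _
      have h1 : ((divs (p ^ i)).card : ℝ) ≤ i + 1 := by exact_mod_cast card_divs_prime_pow hp i
      refine h1.trans ?_
      have h2 := two_le_Nm hp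
      have hNi : Nm (p ^ i) ^ ε = (Nm p ^ ε) ^ i := by
        rw [Nm_pow, ← Real.rpow_natCast, ← Real.rpow_natCast, ← Real.rpow_mul (by linarith),
          ← Real.rpow_mul (by linarith), mul_comm]
      rcases Nat.eq_zero_or_pos i with rfl | hi
      · simp only [pow_zero, Nm_one, Real.one_rpow, mul_one]
        push_cast
        have := one_le_pow₀ hK1 (n := (Sm.filter (fun q => Prime q ∧ q ∣ (1 : Eis))).card)
        linarith
      by_cases hpT : Nm p ≤ T
      · have hc : 1 ≤ (Sm.filter (fun q => Prime q ∧ q ∣ p ^ i)).card := by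
          apply Finset.card_pos.2
          exact ⟨p, by
            rw [Finset.mem_filter]
            exact ⟨mem_bl.2 hpT, hp, dvd_pow_self _ hi.ne'⟩⟩
        have h3 : K ≤ K ^ (Sm.filter (fun q => Prime q ∧ q ∣ p ^ i)).card :=
          le_self_pow₀ hK1 (by omega)
        have h4 : 1 + i * x ≤ (Nm p ^ ε) ^ i := by
          have : 1 + x ≤ Nm p ^ ε := by
            calc 1 + x ≤ Real.exp x := by linarith [Real.add_one_le_exp x]
              _ = (2 : ℝ) ^ ε := by rw [hx, mul_comm, Real.rpow_def_of_pos (by norm_num)]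
              _ ≤ Nm p ^ ε := Real.rpow_le_rpow (by norm_num) h2 hε.le
          calc 1 + i * x ≤ (1 + x) ^ i := one_add_mul_le_pow (by linarith) i
            _ ≤ _ := pow_le_pow_left₀ (by linarith) this i
        calc (i : ℝ) + 1 ≤ K * (1 + i * x) := by
              have e : K * (1 + i * x) = 1 + i * x + 1 / x + i := by
                rw [hK]; field_simp; ring
              rw [e]
              have : 0 < 1 / x := by positivity
              have : (0 : ℝ) ≤ i * x := by positivity
              linarith
          _ ≤ _ := by
              rw [hNi]
              apply mul_le_mul h3 h4 (by positivity) (by positivity)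
      · push Not at hpT
        have h3 : (2 : ℝ) ≤ Nm p ^ ε := by
          calc (2 : ℝ) = T ^ ε := by
                rw [hT, ← Real.rpow_mul (by norm_num), one_div_mul_cancel hε.ne', Real.rpow_one]
            _ ≤ _ := Real.rpow_le_rpow (by positivity) hpT.le hε.le
        calc (i : ℝ) + 1 ≤ 2 ^ i := by
              exact_mod_cast Nat.lt_two_pow_self
          _ ≤ (Nm p ^ ε) ^ i := pow_le_pow_left₀ (by norm_num) h3 i
          _ = 1 * Nm (p ^ i) ^ ε := by rw [hNi, one_mul]
          _ ≤ _ := mul_le_mul_of_nonneg_right (one_le_pow₀ hK1) (Real.rpow_nonneg (Nm_nonneg _) _)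
    | hcp hrel ihx ihy =>
      rename_i a b
      intro h
      have ha : a ≠ 0 := left_ne_zero_of_mul h
      have hb : b ≠ 0 := right_ne_zero_of_mul h
      have h1 : ((divs (a * b)).card : ℝ) ≤ (divs a).card * (divs b).card := by
        exact_mod_cast card_divs_mul ha hb
      have hdisj : Disjoint (Sm.filter (fun p => Prime p ∧ p ∣ a))
          (Sm.filter (fun p => Prime p ∧ p ∣ b)) := by
        rw [Finset.disjoint_left]
        intro p h1 h2
        rw [Finset.mem_filter] at h1 h2
        exact h1.2.1.not_isUnit (hrel h1.2.2 h2.2.2)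
      have h2 : (Sm.filter (fun p => Prime p ∧ p ∣ a)).card +
          (Sm.filter (fun p => Prime p ∧ p ∣ b)).card ≤
          (Sm.filter (fun p => Prime p ∧ p ∣ a * b)).card := by
        rw [← Finset.card_union_of_disjoint hdisj]
        apply Finset.card_le_card
        intro p hp
        rw [Finset.mem_union, Finset.mem_filter, Finset.mem_filter] at hp
        rw [Finset.mem_filter]
        rcases hp with hp | hp
        · exact ⟨hp.1, hp.2.1, hp.2.2.mul_right _⟩
        · exact ⟨hp.1, hp.2.1, hp.2.2.mul_left _⟩
      calc ((divs (a * b)).card : ℝ) ≤ (divs a).card * (divs b).card := h1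
        _ ≤ (K ^ (Sm.filter (fun p => Prime p ∧ p ∣ a)).card * Nm a ^ ε) *
            (K ^ (Sm.filter (fun p => Prime p ∧ p ∣ b)).card * Nm b ^ ε) :=
          mul_le_mul (ihx ha) (ihy hb) (by positivity)
            (mul_nonneg (by positivity) (Real.rpow_nonneg (Nm_nonneg _) _))
        _ = K ^ ((Sm.filter (fun p => Prime p ∧ p ∣ a)).card +
            (Sm.filter (fun p => Prime p ∧ p ∣ b)).card) * Nm (a * b) ^ ε := by
          rw [Nm_mul, Real.mul_rpow (Nm_nonneg _) (Nm_nonneg _), pow_add]; ring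
        _ ≤ _ := mul_le_mul_of_nonneg_right (pow_le_pow_right₀ hK1 h2)
            (Real.rpow_nonneg (Nm_nonneg _) _)
  intro n hn
  refine (key n hn).trans ?_
  apply mul_le_mul_of_nonneg_right _ (Real.rpow_nonneg (Nm_nonneg _) _)
  exact pow_le_pow_right₀ hK1 (Finset.card_filter_le _ _)

/-- Möbius function (only used at squarefree arguments) -/
def mob (n : Eis) : ℝ := (-1) ^ (UniqueFactorizationMonoid.factors n).card

lemma abs_mob (n : Eis) : |mob n| = 1 := by
  rw [mob, abs_pow]; simp

lemma mob_one : mob 1 = 1 := by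
  rw [mob]
  have : UniqueFactorizationMonoid.factors (1 : Eis) = 0 := by
    exact UniqueFactorizationMonoid.factors_one
  rw [this]; simp

lemma mob_prime_mul {p n : Eis} (hp : Prime p) (hn : n ≠ 0) : mob (p * n) = - mob n := by
  have h := UniqueFactorizationMonoid.factors_mul hp.ne_zero hn
  have h1 := Multiset.card_eq_card_of_rel h
  have h2 := UniqueFactorizationMonoid.card_factors_of_irreducible hp.irreducible
  rw [Multiset.card_add, h2] at h1
  rw [mob, mob, h1, pow_add]; simp

lemma sum_mob : ∀ n, P1 n → Squarefree n →
    ∑ e ∈ divs n, mob e = if n = 1 then 1 else 0 := by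
  classical
  apply P1.induction
  · intro _
    have : divs 1 = {1} := by
      ext d
      rw [mem_divs one_ne_zero, Finset.mem_singleton]
      constructor
      · rintro ⟨h1, h2⟩; exact P1_unit (isUnit_of_dvd_one h2) h1
      · rintro rfl; exact ⟨P1_one, dvd_rfl⟩
    rw [this]; simp [mob_one]
  · intro p n hp hp1 hn _ hsq
    have hpn : ¬ p ∣ n := by
      rintro ⟨z, rfl⟩
      exact hp.not_isUnit (hsq p ⟨z, by ring⟩)
    have hpn0 : p * n ≠ 0 := mul_ne_zero hp.ne_zero hn.ne_zero
    have hset : divs (p * n) = divs n ∪ (divs n).image (fun d => p * d) := by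
      ext d
      rw [Finset.mem_union, Finset.mem_image, mem_divs hpn0]
      constructor
      · rintro ⟨h1, h2⟩
        by_cases hpd : p ∣ d
        · obtain ⟨e, rfl⟩ := hpd
          right
          refine ⟨e, (mem_divs hn.ne_zero).2 ⟨P1_of_mul hp1 h1, ?_⟩, rfl⟩
          exact (mul_dvd_mul_iff_left hp.ne_zero).1 h2
        · left
          rw [mem_divs hn.ne_zero]
          refine ⟨h1, ?_⟩
          have : IsCoprime d p := ((hp.irreducible.coprime_iff_not_dvd).2 hpd).symm
          exact this.dvd_of_dvd_mul_left h2
      · rintro (h | ⟨e, he, rfl⟩)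
        · rw [mem_divs hn.ne_zero] at h; exact ⟨h.1, h.2.mul_left _⟩
        · rw [mem_divs hn.ne_zero] at he
          exact ⟨hp1.mul he.1, mul_dvd_mul_left _ he.2⟩
    have hdisj : Disjoint (divs n) ((divs n).image (fun d => p * d)) := by
      rw [Finset.disjoint_left]
      intro d hd hd2
      rw [Finset.mem_image] at hd2
      obtain ⟨e, _, rfl⟩ := hd2
      rw [mem_divs hn.ne_zero] at hd
      exact hpn ((dvd_mul_right _ _).trans hd.2)
    rw [hset, Finset.sum_union hdisj, Finset.sum_image
      (fun a _ b _ h => mul_left_cancel₀ hp.ne_zero h)]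
    have : ∀ e ∈ divs n, mob (p * e) = - mob e := by
      intro e he
      rw [mem_divs hn.ne_zero] at he
      exact mob_prime_mul hp he.1.ne_zero
    rw [Finset.sum_congr rfl this, Finset.sum_neg_distrib, add_neg_cancel, if_neg]
    intro h
    exact hp.not_isUnit (IsUnit.of_mul_eq_one _ h)

/-- a `P1` gcd -/
lemma exists_P1_gcd {d : Eis} (hd : P1 d) (m : Eis) :
    ∃ g : Eis, P1 g ∧ g ∣ d ∧ g ∣ m ∧ ∀ e, e ∣ d → e ∣ m → e ∣ g := by
  classical
  obtain ⟨g, hg⟩ := IsPrincipalIdealRing.principal (Ideal.span {d, m})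
  have h1 : g ∣ d := by
    rw [← Ideal.mem_span_singleton, ← Ideal.submodule_span_eq, ← hg]; exact Ideal.subset_span (by simp)
  have h2 : g ∣ m := by
    rw [← Ideal.mem_span_singleton, ← Ideal.submodule_span_eq, ← hg]; exact Ideal.subset_span (by simp)
  have h3 : ∀ e, e ∣ d → e ∣ m → e ∣ g := by
    intro e he1 he2
    have : g ∈ Ideal.span {d, m} := by rw [hg]; exact Submodule.mem_span_singleton_self g
    obtain ⟨a, b, hab⟩ := Ideal.mem_span_pair.1 this
    rw [← hab]; exact dvd_add (he1.mul_left _) (he2.mul_left _)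
  have hl : ¬ lam ∣ g := fun h => hd.not_lam_dvd (h.trans h1)
  obtain ⟨u, hu, hu1⟩ := exists_unit_P1 hl
  exact ⟨u * g, hu1, hu.mul_left_dvd.2 h1, hu.mul_left_dvd.2 h2,
    fun e he1 he2 => (h3 e he1 he2).mul_left _⟩

open Classical in
lemma sum_mob_coprime {d : Eis} (hd : PS d) (m : Eis) :
    ∑ e ∈ (divs d).filter (fun e => e ∣ m), mob e = if IsCoprime d m then 1 else 0 := by
  obtain ⟨g, hg1, hg2, hg3, hg4⟩ := exists_P1_gcd hd.1 m
  have h1 : (divs d).filter (fun e => e ∣ m) = divs g := by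
    ext e
    rw [Finset.mem_filter, mem_divs hd.ne_zero, mem_divs hg1.ne_zero]
    constructor
    · rintro ⟨⟨h1, h2⟩, h3⟩; exact ⟨h1, hg4 e h2 h3⟩
    · rintro ⟨h1, h2⟩; exact ⟨⟨h1, h2.trans hg2⟩, h2.trans hg3⟩
  rw [h1, sum_mob g hg1 (hd.2.squarefree_of_dvd hg2)]
  congr 1
  apply propext
  constructor
  · rintro rfl
    rw [← isRelPrime_iff_isCoprime]
    intro e h1 h2
    exact isUnit_of_dvd_one (hg4 e h1 h2)
  · intro h
    exact P1_unit (h.isUnit_of_dvd' hg2 hg3) hg1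

/-! ### Abstract large sieve inequalities -/

section abstractLS
open ComplexConjugate

/-- A large sieve inequality for a matrix. -/
def LSI (S T : Finset Eis) (f : Eis → Eis → ℂ) (D : ℝ) : Prop :=
  ∀ c : Eis → ℂ, ∑ m ∈ S, ‖∑ n ∈ T, c n * f m n‖ ^ 2 ≤ D * ∑ n ∈ T, ‖c n‖ ^ 2

variable {S S' T T' : Finset Eis} {f g : Eis → Eis → ℂ} {D D' : ℝ}

lemma LSI.mono (h : LSI S T f D) (hD : D ≤ D') : LSI S T f D' := fun c =>
  (h c).trans (mul_le_mul_of_nonneg_right hD (Finset.sum_nonneg fun _ _ => by positivity))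

lemma LSI.left (h : LSI S T f D) (hS : S' ⊆ S) : LSI S' T f D := fun c =>
  (Finset.sum_le_sum_of_subset_of_nonneg hS (fun _ _ _ => by positivity)).trans (h c)

lemma LSI.right (h : LSI S T f D) (hT : T' ⊆ T) : LSI S T' f D := by
  classical
  intro c
  have h1 := h (fun n => if n ∈ T' then c n else 0)
  have e1 : ∀ m, ∑ n ∈ T, (if n ∈ T' then c n else 0) * f m n = ∑ n ∈ T', c n * f m n := by
    intro m
    rw [← Finset.sum_subset hT (f := fun n => (if n ∈ T' then c n else 0) * f m n)]
    · exact Finset.sum_congr rfl fun n hn => by rw [if_pos hn]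
    · intro n _ hn; simp [hn]
  have e2 : ∑ n ∈ T, ‖(if n ∈ T' then c n else 0)‖ ^ 2 = ∑ n ∈ T', ‖c n‖ ^ 2 := by
    rw [← Finset.sum_subset hT (f := fun n => ‖(if n ∈ T' then c n else 0)‖ ^ 2)]
    · exact Finset.sum_congr rfl fun n hn => by rw [if_pos hn]
    · intro n _ hn; simp [hn]
  simpa only [e1, e2] using h1

lemma LSI.congr (h : LSI S T f D) (hfg : ∀ m ∈ S, ∀ n ∈ T, f m n = g m n) : LSI S T g D := by
  intro c
  refine le_of_eq_of_le (Finset.sum_congr rfl fun m hm => ?_) (h c)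
  rw [Finset.sum_congr rfl fun n hn => by rw [← hfg m hm n hn]]

lemma LSI.twist_right (h : LSI S T f D) (hD : 0 ≤ D) {u : Eis → ℂ} (hu : ∀ n ∈ T, ‖u n‖ ≤ 1) :
    LSI S T (fun m n => f m n * u n) D := by
  intro c
  have h1 := h (fun n => c n * u n)
  refine le_trans (le_of_eq ?_) (h1.trans ?_)
  · refine Finset.sum_congr rfl fun m _ => ?_
    congr 2
    exact Finset.sum_congr rfl fun n _ => by ring
  · refine mul_le_mul_of_nonneg_left (Finset.sum_le_sum fun n hn => ?_) hD
    rw [norm_mul]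
    exact pow_le_pow_left₀ (by positivity) (mul_le_of_le_one_right (norm_nonneg _) (hu n hn)) 2

lemma LSI.twist_left (h : LSI S T f D) {u : Eis → ℂ} (hu : ∀ m ∈ S, ‖u m‖ ≤ 1) :
    LSI S T (fun m n => f m n * u m) D := by
  intro c
  refine (Finset.sum_le_sum fun m hm => ?_).trans (h c)
  have : ∑ n ∈ T, c n * (f m n * u m) = (∑ n ∈ T, c n * f m n) * u m := by
    rw [Finset.sum_mul]; exact Finset.sum_congr rfl fun n _ => by ring
  rw [this, norm_mul]
  exact pow_le_pow_left₀ (by positivity) (mul_le_of_le_one_right (norm_nonneg _) (hu m hm)) 2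

lemma LSI.conj (h : LSI S T f D) : LSI S T (fun m n => conj (f m n)) D := by
  intro c
  have h1 := h (fun n => conj (c n))
  simp only [RCLike.norm_conj] at h1
  refine le_trans (le_of_eq ?_) h1
  refine Finset.sum_congr rfl fun m _ => ?_
  rw [← RCLike.norm_conj, map_sum]
  simp

lemma LSI.dual (h : LSI S T f D) (hD : 0 ≤ D) : LSI T S (fun n m => f m n) D := by
  intro c
  set G : ℝ := ∑ n ∈ T, ‖∑ m ∈ S, c m * f m n‖ ^ 2 with hG
  have hG0 : 0 ≤ G := Finset.sum_nonneg fun _ _ => by positivity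
  set y : Eis → ℂ := fun n => conj (∑ m ∈ S, c m * f m n) with hy
  have e1 : (G : ℂ) = ∑ m ∈ S, c m * ∑ n ∈ T, y n * f m n := by
    rw [hG]; push_cast
    have : ∀ n, ((‖∑ m ∈ S, c m * f m n‖ : ℂ)) ^ 2 = ∑ m ∈ S, c m * (y n * f m n) := by
      intro n
      rw [← Complex.conj_mul']
      change y n * _ = _
      rw [Finset.mul_sum]
      exact Finset.sum_congr rfl fun m _ => by ring
    simp_rw [this, Finset.mul_sum]
    exact Finset.sum_comm
  have e2 : G ≤ ∑ m ∈ S, ‖c m‖ * ‖∑ n ∈ T, y n * f m n‖ := by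
    have : G = ‖(G : ℂ)‖ := by simp [abs_of_nonneg hG0]
    rw [this, e1]
    refine (norm_sum_le _ _).trans (Finset.sum_le_sum fun m _ => by rw [norm_mul])
  have e3 : ∑ n ∈ T, ‖y n‖ ^ 2 = G := by
    rw [hG]; exact Finset.sum_congr rfl fun n _ => by rw [hy]; simp only [RCLike.norm_conj]
  have e4 := h y
  rw [e3] at e4
  have e5 : G ^ 2 ≤ (∑ m ∈ S, ‖c m‖ ^ 2) * (D * G) := by
    refine (pow_le_pow_left₀ hG0 e2 2).trans ((Finset.sum_mul_sq_le_sq_mul_sq _ _ _).trans ?_)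
    exact mul_le_mul_of_nonneg_left e4 (Finset.sum_nonneg fun _ _ => by positivity)
  rcases hG0.eq_or_lt with h0 | h0
  · rw [← h0]; exact mul_nonneg hD (Finset.sum_nonneg fun _ _ => by positivity)
  · nlinarith

/-- bilinear large sieve with a kernel -/
def Good (S T : Finset Eis) (a : Eis → Eis → ℂ) (f : Eis → Eis → Eis → ℂ) (C : ℝ) : Prop :=
  ∀ z w : Eis → ℂ, ∑ k ∈ S, ‖∑ i ∈ T, ∑ j ∈ T, z i * w j * (a k i * conj (a k j)) * f k i j‖ ≤
    C * (Real.sqrt (∑ i ∈ T, ‖z i‖ ^ 2) * Real.sqrt (∑ i ∈ T, ‖w i‖ ^ 2))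

lemma LSI.good (h : LSI S T f D) (hD : 0 ≤ D) : Good S T f (fun _ _ _ => 1) D := by
  intro z w
  have e : ∀ k, ‖∑ i ∈ T, ∑ j ∈ T, z i * w j * (f k i * conj (f k j)) * 1‖ =
      ‖∑ i ∈ T, z i * f k i‖ * ‖∑ j ∈ T, w j * conj (f k j)‖ := by
    intro k
    rw [← norm_mul, Finset.sum_mul_sum]
    congr 1
    exact Finset.sum_congr rfl fun i _ => Finset.sum_congr rfl fun j _ => by ring
  simp_rw [e]
  have h1 := h z
  have h2 := h.conj w
  set Z := ∑ i ∈ T, ‖z i‖ ^ 2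
  set W := ∑ i ∈ T, ‖w i‖ ^ 2
  have hZ : 0 ≤ Z := Finset.sum_nonneg fun _ _ => by positivity
  have hW : 0 ≤ W := Finset.sum_nonneg fun _ _ => by positivity
  have h3 := Finset.sum_mul_sq_le_sq_mul_sq S (fun k => ‖∑ i ∈ T, z i * f k i‖)
    (fun k => ‖∑ j ∈ T, w j * conj (f k j)‖)
  refine le_of_sq_le_sq ?_ (by positivity)
  refine h3.trans ?_
  have : (D * (√Z * √W)) ^ 2 = (D * Z) * (D * W) := by
    rw [mul_pow, mul_pow, Real.sq_sqrt hZ, Real.sq_sqrt hW]; ring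
  rw [this]
  exact mul_le_mul h1 h2 (Finset.sum_nonneg fun _ _ => by positivity) (by positivity)

variable {a : Eis → Eis → ℂ} {F G : Eis → Eis → Eis → ℂ} {C C' : ℝ}

lemma Good.add (h : Good S T a F C) (h' : Good S T a G C') :
    Good S T a (fun k i j => F k i j + G k i j) (C + C') := by
  intro z w
  refine le_trans ?_ ((add_le_add (h z w) (h' z w)).trans_eq (by ring))
  rw [← Finset.sum_add_distrib]
  refine Finset.sum_le_sum fun k _ => ?_
  refine le_trans (le_of_eq ?_) (norm_add_le _ _)
  congr 1
  rw [← Finset.sum_add_distrib]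
  refine Finset.sum_congr rfl fun i _ => ?_
  rw [← Finset.sum_add_distrib]
  exact Finset.sum_congr rfl fun j _ => by ring

lemma Good.smul (h : Good S T a F C) (hC : 0 ≤ C) {g s t : Eis → ℝ} {γ σ τ : ℝ}
    (hg : ∀ k ∈ S, |g k| ≤ γ) (hs : ∀ i ∈ T, |s i| ≤ σ) (ht : ∀ i ∈ T, |t i| ≤ τ)
    (hγ : 0 ≤ γ) (hσ : 0 ≤ σ) (hτ : 0 ≤ τ) :
    Good S T a (fun k i j => F k i j * (g k * s i * t j : ℝ)) (C * (γ * σ * τ)) := by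
  intro z w
  have key : ∀ (x : Eis → ℂ) (s : Eis → ℝ) (σ : ℝ), 0 ≤ σ → (∀ i ∈ T, |s i| ≤ σ) →
      √(∑ i ∈ T, ‖x i * s i‖ ^ 2) ≤ σ * √(∑ i ∈ T, ‖x i‖ ^ 2) := by
    intro x s σ hσ hs
    refine Real.sqrt_le_iff.2 ⟨by positivity, ?_⟩
    rw [mul_pow, Real.sq_sqrt (Finset.sum_nonneg fun _ _ => by positivity), Finset.mul_sum]
    refine Finset.sum_le_sum fun i hi => ?_
    rw [norm_mul, mul_pow, mul_comm, Complex.norm_real, Real.norm_eq_abs]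
    exact mul_le_mul_of_nonneg_right (pow_le_pow_left₀ (abs_nonneg _) (hs i hi) 2) (by positivity)
  have h1 := h (fun i => z i * s i) (fun j => w j * t j)
  have h2 : ∑ k ∈ S, ‖∑ i ∈ T, ∑ j ∈ T, z i * w j * (a k i * conj (a k j)) *
      (F k i j * (g k * s i * t j : ℝ))‖ ≤ γ * ∑ k ∈ S, ‖∑ i ∈ T, ∑ j ∈ T,
        z i * s i * (w j * t j) * (a k i * conj (a k j)) * F k i j‖ := by
    rw [Finset.mul_sum]
    refine Finset.sum_le_sum fun k hk => ?_
    have : ∑ i ∈ T, ∑ j ∈ T, z i * w j * (a k i * conj (a k j)) * (F k i j * (g k * s i * t j : ℝ))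
        = g k * ∑ i ∈ T, ∑ j ∈ T, z i * s i * (w j * t j) * (a k i * conj (a k j)) * F k i j := by
      rw [Finset.mul_sum]
      refine Finset.sum_congr rfl fun i _ => ?_
      rw [Finset.mul_sum]
      refine Finset.sum_congr rfl fun j _ => ?_
      push_cast; ring
    rw [this, norm_mul, Complex.norm_real, Real.norm_eq_abs]
    exact mul_le_mul_of_nonneg_right (hg k hk) (norm_nonneg _)
  refine h2.trans ?_
  refine (mul_le_mul_of_nonneg_left h1 hγ).trans ?_
  have k1 := key z s σ hσ hs
  have k2 := key w t τ hτ ht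
  calc _ ≤ γ * (C * ((σ * √(∑ i ∈ T, ‖z i‖ ^ 2)) * (τ * √(∑ i ∈ T, ‖w i‖ ^ 2)))) := by
        gcongr
    _ = _ := by ring

lemma Good.exp (h : Good S T a F C) (hC : 0 ≤ C) {g s t : Eis → ℝ} {γ σ τ : ℝ}
    (hg : ∀ k ∈ S, |g k| ≤ γ) (hs : ∀ i ∈ T, |s i| ≤ σ) (ht : ∀ i ∈ T, |t i| ≤ τ)
    (hγ : 0 ≤ γ) (hσ : 0 ≤ σ) (hτ : 0 ≤ τ) :
    Good S T a (fun k i j => F k i j * (Real.exp (g k * s i * t j) : ℝ))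
      (C * Real.exp (γ * σ * τ)) := by
  have h1 : ∀ N : ℕ, Good S T a (fun k i j => F k i j *
      ((∑ n ∈ Finset.range N, (g k * s i * t j) ^ n / n.factorial : ℝ) : ℂ))
      (C * ∑ n ∈ Finset.range N, (γ * σ * τ) ^ n / n.factorial) := by
    intro N
    induction N with
    | zero => intro z w; simp
    | succ N ih =>
      have h2 := h.smul hC (g := fun k => g k ^ N / N.factorial) (s := fun i => s i ^ N)
        (t := fun i => t i ^ N) (γ := γ ^ N / N.factorial) (σ := σ ^ N) (τ := τ ^ N)
        (fun k hk => by
          rw [abs_div, abs_pow, Nat.abs_cast]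
          have := hg k hk
          gcongr)
        (fun k hk => by
          rw [abs_pow]
          have := hs k hk
          gcongr)
        (fun k hk => by
          rw [abs_pow]
          have := ht k hk
          gcongr) (by positivity) (by positivity) (by positivity)
      have h3 := ih.add h2
      intro z w
      refine le_trans (le_of_eq ?_) ((h3 z w).trans (le_of_eq ?_))
      · refine Finset.sum_congr rfl fun k _ => ?_
        congr 1
        refine Finset.sum_congr rfl fun i _ => Finset.sum_congr rfl fun j _ => ?_
        beta_reduce
        rw [Finset.sum_range_succ]
        push_cast; ring
      · rw [Finset.sum_range_succ]; ring
  intro z w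
  have hexp : ∀ x : ℝ, Filter.Tendsto (fun N : ℕ => ∑ n ∈ Finset.range N, x ^ n / n.factorial)
      Filter.atTop (nhds (Real.exp x)) := by
    intro x
    have := (Real.summable_pow_div_factorial x).hasSum.tendsto_sum_nat
    rwa [show ∑' n : ℕ, x ^ n / n.factorial = Real.exp x from by
      rw [Real.exp_eq_exp_ℝ, NormedSpace.exp_eq_tsum_div]] at this
  beta_reduce
  refine le_of_tendsto_of_tendsto' (b := Filter.atTop) ?_ ?_ (fun N => h1 N z w)
  · refine tendsto_finsetSum _ fun k _ => ?_
    refine Filter.Tendsto.norm ?_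
    refine tendsto_finsetSum _ fun i _ => tendsto_finsetSum _ fun j _ => ?_
    refine Filter.Tendsto.const_mul _ (Filter.Tendsto.const_mul _ ?_)
    exact (Complex.continuous_ofReal.tendsto _).comp (hexp _)
  · exact ((hexp _).const_mul _).mul_const _

/-- the separated kernel: `u i = 1 + s i`, `|s i| ≤ 1/9` -/
lemma LSI.sep (h : LSI S T f D) (hD : 0 ≤ D) {B s : Eis → ℝ} {b₀ b₁ : ℝ} (hb₀ : 0 ≤ b₀)
    (hB0 : ∀ k ∈ S, b₀ ≤ B k) (hB1 : ∀ k ∈ S, B k ≤ b₁) (hb : 0 ≤ b₁)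
    (hs : ∀ i ∈ T, |s i| ≤ 1 / 9) (z w : Eis → ℂ) :
    ∑ k ∈ S, ‖∑ i ∈ T, ∑ j ∈ T, z i * w j * (f k i * conj (f k j)) *
      (Real.exp (-(B k * ((1 + s i) * (1 + s j)))) : ℝ)‖ ≤
    D * Real.exp (19 / 81 * b₁ - b₀) *
      (Real.sqrt (∑ i ∈ T, ‖z i‖ ^ 2) * Real.sqrt (∑ i ∈ T, ‖w i‖ ^ 2)) := by
  have hBa : ∀ k ∈ S, |(- B k)| ≤ b₁ := fun k hk => by
    rw [abs_neg, abs_of_nonneg (hb₀.trans (hB0 k hk))]; exact hB1 k hk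
  have g0 := (h.good hD)
  have g1 := g0.smul hD (g := fun k => Real.exp (-(B k))) (s := fun _ => 1) (t := fun _ => 1)
    (γ := Real.exp (-b₀)) (σ := 1) (τ := 1) (fun k hk => by
      rw [abs_of_pos (Real.exp_pos _)]; exact Real.exp_le_exp.2 (by linarith [hB0 k hk]))
    (by simp) (by simp) (by positivity) (by simp) (by simp)
  have g2 := g1.exp (by positivity) (g := fun k => -(B k)) (s := s) (t := fun _ => 1) hBa hs
    (fun _ _ => by simp : ∀ i ∈ T, |(1 : ℝ)| ≤ 1) hb (by norm_num) (by norm_num)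
  have g3 := g2.exp (by positivity) (g := fun k => -(B k)) (s := fun _ => 1) (t := s) hBa
    (fun _ _ => by simp : ∀ i ∈ T, |(1 : ℝ)| ≤ 1) hs hb (by norm_num) (by norm_num)
  have g4 := g3.exp (by positivity) (g := fun k => -(B k)) (s := s) (t := s) hBa
    hs hs hb (by norm_num) (by norm_num)
  refine le_trans (le_of_eq ?_) ((g4 z w).trans (le_of_eq ?_))
  · refine Finset.sum_congr rfl fun k _ => ?_
    congr 1
    refine Finset.sum_congr rfl fun i _ => Finset.sum_congr rfl fun j _ => ?_
    congr 1
    beta_reduce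
    rw [one_mul, ← Complex.ofReal_mul, ← Complex.ofReal_mul, ← Complex.ofReal_mul, mul_one, mul_one,
      ← Real.exp_add, ← Real.exp_add, ← Real.exp_add]
    congr 2; ring
  · congr 1
    rw [mul_one, mul_one, mul_assoc, mul_assoc, mul_assoc, ← Real.exp_add, ← Real.exp_add,
      ← Real.exp_add]
    congr 2; ring

end abstractLS

/-! ### Cube-full decomposition and the bound for all `k` -/

section allk
open ComplexConjugate

lemma cubic_decomp : ∀ c, P1 c → ∃ k₁ k₂ k₃ : Eis, PS k₁ ∧ PS k₂ ∧ P1 k₃ ∧ IsCoprime k₁ k₂ ∧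
    c = k₁ * k₂ ^ 2 * k₃ ^ 3 := by
  apply P1.induction
  · exact ⟨1, 1, 1, PS_one, PS_one, P1_one, isCoprime_one_left, by ring⟩
  · rintro p a hp hp1 ha ⟨k₁, k₂, k₃, h1, h2, h3, hc, rfl⟩
    have sqf : ∀ k : Eis, PS k → ¬ p ∣ k → PS (p * k) := fun k hk hpk =>
      ⟨hp1.mul hk.1, (squarefree_mul_iff).2 ⟨hp.irreducible.isRelPrime_iff_not_dvd.2 hpk,
        hp.irreducible.squarefree, hk.2⟩⟩
    by_cases hp2 : p ∣ k₂
    · obtain ⟨t, rfl⟩ := hp2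
      have ht : P1 t := P1_of_mul hp1 h2.1
      refine ⟨k₁, t, p * k₃, h1, h2.of_dvd ht (dvd_mul_left _ _), hp1.mul h3, ?_, by ring⟩
      exact hc.of_isCoprime_of_dvd_right (dvd_mul_left _ _)
    · by_cases hp3 : p ∣ k₁
      · obtain ⟨t, rfl⟩ := hp3
        have ht : P1 t := P1_of_mul hp1 h1.1
        have hpt : IsCoprime p t := by
          refine (hp.coprime_iff_not_dvd).2 fun h => ?_
          obtain ⟨s, rfl⟩ := h
          exact hp.not_isUnit (h1.2 p ⟨s, by ring⟩)
        refine ⟨t, p * k₂, k₃, h1.of_dvd ht (dvd_mul_left _ _), sqf _ h2 hp2, h3, ?_, by ring⟩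
        exact IsCoprime.mul_right hpt.symm (hc.of_isCoprime_of_dvd_left (dvd_mul_left _ _))
      · refine ⟨p * k₁, k₂, k₃, sqf _ h1 hp3, h2, h3, ?_, by ring⟩
        exact IsCoprime.mul_left ((hp.coprime_iff_not_dvd).2 hp2) hc

lemma sum_cover {ι : Type*} (I : Finset ι) (R : ι → Finset Eis) (φ : ι → Eis → Eis)
    (S : Finset Eis) (F : Eis → ℝ) (hF : ∀ k, 0 ≤ F k)
    (h : ∀ k ∈ S, ∃ i ∈ I, ∃ r ∈ R i, φ i r = k) :
    ∑ k ∈ S, F k ≤ ∑ i ∈ I, ∑ r ∈ R i, F (φ i r) := by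
  classical
  rw [Finset.sum_sigma']
  refine le_trans (Finset.sum_le_sum_of_subset_of_nonneg (t := (I.sigma R).image
    (fun p => φ p.1 p.2)) ?_ (fun _ _ _ => hF _)) (Finset.sum_image_le_of_nonneg fun _ _ => hF _)
  intro k hk
  obtain ⟨i, hi, r, hr, rfl⟩ := h k hk
  exact Finset.mem_image.2 ⟨⟨i, r⟩, Finset.mem_sigma.2 ⟨hi, hr⟩, rfl⟩

lemma LSI.cover {ι : Type*} (I : Finset ι) (R : ι → Finset Eis) (φ : ι → Eis → Eis)
    {S T : Finset Eis} {f : Eis → Eis → ℂ} {D : ι → ℝ} {D' : ℝ}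
    (h : ∀ k ∈ S, ∃ i ∈ I, ∃ r ∈ R i, φ i r = k)
    (hL : ∀ i ∈ I, LSI (R i) T (fun r n => f (φ i r) n) (D i)) (hD : ∑ i ∈ I, D i ≤ D') :
    LSI S T f D' := by
  intro c
  refine (sum_cover I R φ S _ (fun _ => by positivity) h).trans ?_
  refine (Finset.sum_le_sum fun i hi => hL i hi c).trans ?_
  rw [← Finset.sum_mul]
  exact mul_le_mul_of_nonneg_right hD (Finset.sum_nonneg fun _ _ => by positivity)

/-- the basic large sieve statement -/
def LS (χ : Eis → Eis → Eis) (M N D : ℝ) : Prop := LSI (ps M) (ps N) (fun m n => cx χ n m) D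

lemma LS.symm {χ : Eis → Eis → Eis} (hχ : IsCubicSymbol χ) {M N D : ℝ} (h : LS χ M N D)
    (hD : 0 ≤ D) : LS χ N M D :=
  (LSI.dual h hD).congr fun n hn m hm => cx_recip hχ (mem_ps.1 hn).1.1 (mem_ps.1 hm).1.1

/-- the hypothesis at exponent `ξ` -/
def HX (ξ : ℝ) : Prop := ∀ ε : ℝ, 0 < ε → ∃ C : ℝ, 0 ≤ C ∧ ∀ χ, IsCubicSymbol χ → ∀ M N : ℝ,
  1 ≤ M → 1 ≤ N → LS χ M N (C * (M * N) ^ ε * (M + N ^ ξ + (M * N) ^ (2 / 3 : ℝ)))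

/-- large sieve over all nonzero `k` -/
def BH (α β : Fin 3 → ℝ) : Prop := ∀ ε : ℝ, 0 < ε → ∃ C : ℝ, 0 ≤ C ∧ ∀ χ, IsCubicSymbol χ →
  ∀ K N : ℝ, 0 < K → 1 ≤ N → LSI ((bl K).erase 0) (ps N) (fun k n => cx χ n k)
    (C * ((1 + K) * N) ^ ε * ∑ i, K ^ α i * N ^ β i)

lemma bl_erase_empty {K : ℝ} (hK : K < 1) : (bl K).erase 0 = ∅ := by
  ext x
  simp only [Finset.mem_erase, mem_bl, Finset.notMem_empty, iff_false, not_and, not_le]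
  intro hx; exact hK.trans_le (one_le_Nm hx)

lemma LSI.of_empty {T : Finset Eis} {f : Eis → Eis → ℂ} {D : ℝ} (hD : 0 ≤ D) :
    LSI ∅ T f D := fun c => by
  rw [Finset.sum_empty]; exact mul_nonneg hD (Finset.sum_nonneg fun _ _ => by positivity)

lemma card_bl_le {ε : ℝ} (hε : 0 < ε) {K : ℝ} (hK : 1 ≤ K) :
    (((bl K).erase 0).card : ℝ) ≤ ZE ε * K ^ (1 + ε) := by
  have h := sum_le_ZE hε ((bl K).erase 0)
  have h2 : ((bl K).erase 0).card • K ^ (-(1 + ε)) ≤ ∑ x ∈ (bl K).erase 0, Nm x ^ (-(1 + ε)) := by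
    refine Finset.card_nsmul_le_sum _ _ _ fun x hx => ?_
    rw [Finset.mem_erase, mem_bl] at hx
    exact Real.rpow_le_rpow_of_nonpos (Nm_pos hx.1) hx.2 (by linarith)
  rw [nsmul_eq_mul] at h2
  have h3 : K ^ (-(1 + ε)) * K ^ (1 + ε) = 1 := by
    rw [← Real.rpow_add (by linarith)]; simp
  calc (((bl K).erase 0).card : ℝ) = (((bl K).erase 0).card * K ^ (-(1 + ε))) * K ^ (1 + ε) := by
        rw [mul_assoc, h3, mul_one]
    _ ≤ _ := mul_le_mul_of_nonneg_right (h2.trans h) (by positivity)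

lemma ps_subset (N : ℝ) : ps N ⊆ (bl N).erase 0 := by
  intro x hx
  rw [mem_ps] at hx
  rw [Finset.mem_erase, mem_bl]; exact ⟨hx.1.ne_zero, hx.2⟩

lemma LSI.trivial {S T : Finset Eis} {f : Eis → Eis → ℂ} (hf : ∀ m ∈ S, ∀ n ∈ T, ‖f m n‖ ≤ 1) :
    LSI S T f (S.card * T.card) := by
  intro c
  have h : ∀ m ∈ S, ‖∑ n ∈ T, c n * f m n‖ ^ 2 ≤ T.card * ∑ n ∈ T, ‖c n‖ ^ 2 := by
    intro m hm
    have h1 : ‖∑ n ∈ T, c n * f m n‖ ≤ ∑ n ∈ T, ‖c n‖ :=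
      (norm_sum_le _ _).trans (Finset.sum_le_sum fun n hn => by
        rw [norm_mul]; exact mul_le_of_le_one_right (norm_nonneg _) (hf m hm n hn))
    exact (pow_le_pow_left₀ (norm_nonneg _) h1 2).trans sq_sum_le_card_mul_sum_sq
  refine (Finset.sum_le_card_nsmul _ _ _ h).trans_eq ?_
  rw [nsmul_eq_mul]; ring

/-- the trivial bound -/
lemma BH_trivial : BH (fun _ => 1) (fun _ => 1) := by
  intro ε hε
  refine ⟨ZE ε * ZE ε, mul_nonneg (ZE_nonneg _) (ZE_nonneg _), fun χ hχ K N hK hN => ?_⟩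
  have hZ := ZE_nonneg ε
  rcases lt_or_ge K 1 with h1 | h1
  · rw [bl_erase_empty h1]; exact LSI.of_empty (by positivity)
  refine (LSI.trivial fun k _ n hn => cx_norm_le hχ (mem_ps.1 hn).1.1 k).mono ?_
  have c1 := card_bl_le hε h1
  have c2 := card_bl_le hε hN
  have c3 : ((ps N).card : ℝ) ≤ ((bl N).erase 0).card := by
    exact_mod_cast Finset.card_le_card (ps_subset N)
  calc (((bl K).erase 0).card : ℝ) * (ps N).card
      ≤ (ZE ε * K ^ (1 + ε)) * (ZE ε * N ^ (1 + ε)) := by gcongr; exact c3.trans c2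
    _ = ZE ε * ZE ε * (K * N) ^ ε * (K * N) := by
        rw [Real.rpow_add hK, Real.rpow_add (by linarith), Real.mul_rpow hK.le (by linarith),
          Real.rpow_one, Real.rpow_one]
        ring
    _ ≤ ZE ε * ZE ε * ((1 + K) * N) ^ ε * ∑ i : Fin 3, K ^ (1 : ℝ) * N ^ (1 : ℝ) := by
        have : K * N ≤ ∑ i : Fin 3, K ^ (1 : ℝ) * N ^ (1 : ℝ) := by
          simp only [Real.rpow_one, Finset.sum_const, Finset.card_univ, Fintype.card_fin]
          rw [nsmul_eq_mul]; push_cast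
          nlinarith [mul_pos hK (by linarith : (0 : ℝ) < N)]
        gcongr
        linarith

lemma numeric_B2 {x p K N ξ : ℝ} (hx : 1 ≤ x) (hp : 1 ≤ p) (hN : 1 ≤ N) (hξ : 1 ≤ ξ)
    (h1 : p ^ 3 ≤ K) (h2 : x * p ≤ K) (h3 : x ^ 2 * p ^ 3 ≤ K ^ 2) :
    N + x ^ ξ + (x * N) ^ (2 / 3 : ℝ) ≤
      (K ^ (1 / 3 : ℝ) * N + K ^ ξ + (K * N) ^ (2 / 3 : ℝ)) * p⁻¹ := by
  have hp0 : 0 < p := by linarith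
  have hx0 : 0 < x := by linarith
  have hN0 : 0 < N := by linarith
  have hK : 0 < K := lt_of_lt_of_le (by positivity) h1
  rw [le_mul_inv_iff₀ hp0, add_mul, add_mul]
  have e1 : p ≤ K ^ (1 / 3 : ℝ) := by
    calc p = (p ^ (3 : ℝ)) ^ (1 / 3 : ℝ) := by
          rw [← Real.rpow_mul hp0.le]; norm_num
      _ ≤ _ := by
          refine Real.rpow_le_rpow (by positivity) ?_ (by norm_num)
          exact_mod_cast h1
  have e2 : x ^ ξ * p ≤ K ^ ξ := by
    calc x ^ ξ * p ≤ x ^ ξ * p ^ ξ := by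
          gcongr
          calc p = p ^ (1 : ℝ) := (Real.rpow_one p).symm
            _ ≤ _ := Real.rpow_le_rpow_of_exponent_le hp hξ
      _ = (x * p) ^ ξ := (Real.mul_rpow hx0.le hp0.le).symm
      _ ≤ _ := Real.rpow_le_rpow (by positivity) h2 (by linarith)
  have e3 : x ^ (2 / 3 : ℝ) * p ≤ K ^ (2 / 3 : ℝ) := by
    have a1 : x ^ (2 / 3 : ℝ) * p = (x ^ 2 * p ^ 3) ^ (1 / 3 : ℝ) := by
      rw [Real.mul_rpow (by positivity) (by positivity), ← Real.rpow_natCast, ← Real.rpow_natCast,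
        ← Real.rpow_mul hx0.le, ← Real.rpow_mul hp0.le]
      norm_num
    have a2 : K ^ (2 / 3 : ℝ) = (K ^ 2) ^ (1 / 3 : ℝ) := by
      rw [← Real.rpow_natCast, ← Real.rpow_mul hK.le]; norm_num
    rw [a1, a2]
    exact Real.rpow_le_rpow (by positivity) h3 (by norm_num)
  refine add_le_add (add_le_add ?_ e2) ?_
  · rw [mul_comm]; gcongr
  · rw [Real.mul_rpow hx0.le hN0.le, Real.mul_rpow hK.le hN0.le]
    calc x ^ (2 / 3 : ℝ) * N ^ (2 / 3 : ℝ) * p = x ^ (2 / 3 : ℝ) * p * N ^ (2 / 3 : ℝ) := by ring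
      _ ≤ _ := by gcongr

end allk

section allk2
open ComplexConjugate

lemma cx_sq {χ : Eis → Eis → Eis} (hχ : IsCubicSymbol χ) {n : Eis} (hn : P1 n) (r : Eis) :
    cx χ n (r ^ 2) = conj (cx χ n r) := by
  rw [pow_two, cx_mul hχ hn, cx, ← coe_conjE, (hχ.val hn r).conj]
  push_cast; ring

lemma Nm_unit {u : Eis} (hu : IsUnit u) : Nm u = 1 := isUnit_iff_Nm.1 hu

open Classical in
/-- `P1` elements up to `K` -/
def pone (K : ℝ) : Finset Eis := (bl K).filter P1

lemma mem_pone {K : ℝ} {x : Eis} : x ∈ pone K ↔ P1 x ∧ Nm x ≤ K := by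
  classical
  simp [pone, mem_bl, and_comm]

lemma sum_inv_le {ε : ℝ} (hε : 0 < ε) {K : ℝ} (hK : 0 ≤ K) (s : Finset Eis)
    (hs : ∀ x ∈ s, x ≠ 0 ∧ Nm x ≤ K) : ∑ x ∈ s, (Nm x)⁻¹ ≤ ZE ε * K ^ ε := by
  calc ∑ x ∈ s, (Nm x)⁻¹ ≤ ∑ x ∈ s, Nm x ^ (-(1 + ε)) * K ^ ε := by
        refine Finset.sum_le_sum fun x hx => ?_
        have h0 := Nm_pos (hs x hx).1
        have : (Nm x)⁻¹ = Nm x ^ (-(1 + ε)) * Nm x ^ ε := by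
          rw [← Real.rpow_add h0, ← Real.rpow_neg_one]; congr 1; ring
        rw [this]
        have h1 : Nm x ^ ε ≤ K ^ ε := Real.rpow_le_rpow h0.le (hs x hx).2 hε.le
        gcongr
    _ ≤ _ := by
        rw [← Finset.sum_mul]
        exact mul_le_mul_of_nonneg_right (sum_le_ZE hε s) (by positivity)

/-- number of relevant powers of `lam` -/
lemma pow_bound {ε K : ℝ} (hε : 0 < ε) (hK : 1 ≤ K) {j : ℕ} (hj : (3 : ℝ) ^ j ≤ K) :
    j < ⌊K ^ ε / ε⌋₊ + 1 := by
  have hl : (1 : ℝ) ≤ Real.log 3 := by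
    rw [Real.le_log_iff_exp_le (by norm_num)]
    exact Real.exp_one_lt_d9.le.trans (by norm_num)
  have h1 : (j : ℝ) ≤ Real.log K := by
    have := Real.log_le_log (by positivity) hj
    rw [Real.log_pow] at this
    nlinarith [(Nat.cast_nonneg j : (0 : ℝ) ≤ j)]
  have h2 := Real.log_le_rpow_div (by linarith : (0 : ℝ) ≤ K) hε
  exact Nat.lt_succ_of_le (Nat.le_floor (h1.trans h2))

/-- the exponents coming from `HX ξ` -/
def aX (ξ : ℝ) : Fin 3 → ℝ := ![1 / 3, ξ, 2 / 3]
def bX : Fin 3 → ℝ := ![1, 0, 2 / 3]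

set_option maxHeartbeats 2000000 in
lemma BH_of_HX {ξ : ℝ} (hξ : 1 ≤ ξ) (h : HX ξ) : BH (aX ξ) bX := by
  classical
  intro ε hε
  set δ : ℝ := ε / 4 with hδ
  have hδ0 : 0 < δ := by positivity
  obtain ⟨C, hC, hL⟩ := h δ hδ0
  have hZ := ZE_nonneg δ
  refine ⟨2 * (bl 1).card * (1 / δ + 1) * C * ZE δ * ZE δ, by positivity, fun χ hχ K N hK0 hN => ?_⟩
  set G : ℝ := ∑ i, K ^ aX ξ i * N ^ bX i with hG
  have hG0 : 0 ≤ G := Finset.sum_nonneg fun _ _ => by positivity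
  have hGe : G = K ^ (1 / 3 : ℝ) * N + K ^ ξ + (K * N) ^ (2 / 3 : ℝ) := by
    rw [hG, Fin.sum_univ_three, Real.mul_rpow hK0.le (by linarith)]
    simp [aX, bX]
  clear_value G
  rcases lt_or_ge K 1 with hK | hK
  · rw [bl_erase_empty hK]; exact LSI.of_empty (by positivity)
  set J := ⌊K ^ δ / δ⌋₊ + 1 with hJ
  set I : Finset (Bool × Eis × ℕ × Eis × Eis) :=
    Finset.univ ×ˢ bl 1 ×ˢ Finset.range J ×ˢ pone K ×ˢ pone K with hI
  let R : Bool × Eis × ℕ × Eis × Eis → Finset Eis := fun i =>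
    (ps (if i.1 then K / (Nm i.2.2.2.1 ^ 2 * Nm i.2.2.2.2 ^ 3)
      else √(K / (Nm i.2.2.2.1 * Nm i.2.2.2.2 ^ 3)))).filter (fun r => Nm i.2.2.2.1 ≤ Nm r)
  let φ : Bool × Eis × ℕ × Eis × Eis → Eis → Eis := fun i r =>
    i.2.1 * lam ^ i.2.2.1 * (if i.1 then r * i.2.2.2.1 ^ 2 else i.2.2.2.1 * r ^ 2) * i.2.2.2.2 ^ 3
  refine LSI.cover I R φ (D := fun i => C * (K * N) ^ δ * G * ((Nm i.2.2.2.1)⁻¹ * (Nm i.2.2.2.2)⁻¹))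
    ?_ ?_ ?_
  · intro k hk
    rw [Finset.mem_erase, mem_bl] at hk
    obtain ⟨u, j, c, hu, hc, rfl⟩ := exists_decomp hk.1
    obtain ⟨k₁, k₂, k₃, h1, h2, h3, -, rfl⟩ := cubic_decomp c hc
    have hN1 := h1.one_le
    have hN2 := h2.one_le
    have hN3 := one_le_Nm h3.ne_zero
    have hk2 : 3 ^ j * (Nm k₁ * Nm k₂ ^ 2 * Nm k₃ ^ 3) ≤ K := by
      have := hk.2
      simp only [Nm_mul, Nm_pow, Nm_unit hu, Nm_lam, one_mul] at this
      exact this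
    have h3j : (1 : ℝ) ≤ 3 ^ j := one_le_pow₀ (by norm_num)
    have hkk : Nm k₁ * Nm k₂ ^ 2 * Nm k₃ ^ 3 ≤ K :=
      (le_mul_of_one_le_left (by positivity) h3j).trans hk2
    have p2 : 1 ≤ Nm k₂ ^ 2 := one_le_pow₀ hN2
    have p3 : 1 ≤ Nm k₃ ^ 3 := one_le_pow₀ hN3
    have p3' : Nm k₃ ≤ Nm k₃ ^ 3 := le_self_pow₀ hN3 (by norm_num)
    have p2' : Nm k₂ ≤ Nm k₂ ^ 2 := le_self_pow₀ hN2 (by norm_num)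
    have b1 : Nm k₁ ≤ K := le_trans (by
      rw [mul_assoc]; exact le_mul_of_one_le_right (by positivity) (one_le_mul_of_one_le_of_one_le p2 p3)) hkk
    have b2 : Nm k₂ ≤ K := le_trans (by
      calc Nm k₂ ≤ Nm k₂ ^ 2 := p2'
        _ ≤ Nm k₁ * Nm k₂ ^ 2 := le_mul_of_one_le_left (by positivity) hN1
        _ ≤ _ := le_mul_of_one_le_right (by positivity) p3) hkk
    have b3 : Nm k₃ ≤ K := le_trans (by
      calc Nm k₃ ≤ Nm k₃ ^ 3 := p3'
        _ ≤ _ := le_mul_of_one_le_left (by positivity) (one_le_mul_of_one_le_of_one_le hN1 p2)) hkk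
    have hjJ : j < J := pow_bound hδ0 hK (le_trans (le_mul_of_one_le_right (by positivity)
      (one_le_mul_of_one_le_of_one_le (one_le_mul_of_one_le_of_one_le hN1 p2) p3)) hk2)
    rcases le_total (Nm k₂) (Nm k₁) with h12 | h12
    · refine ⟨(true, u, j, k₂, k₃), ?_, k₁, ?_, ?_⟩
      · simp only [hI, Finset.mem_product, Finset.mem_univ, true_and, mem_bl, Finset.mem_range,
          mem_pone]
        exact ⟨(Nm_unit hu).le, hjJ, ⟨h2.1, b2⟩, h3, b3⟩
      · simp only [R, Finset.mem_filter, mem_ps, if_true]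
        refine ⟨⟨h1, ?_⟩, h12⟩
        rw [le_div_iff₀ (by positivity)]
        linarith
      · simp only [φ, if_true]; ring
    · refine ⟨(false, u, j, k₁, k₃), ?_, k₂, ?_, ?_⟩
      · simp only [hI, Finset.mem_product, Finset.mem_univ, true_and, mem_bl, Finset.mem_range,
          mem_pone]
        exact ⟨(Nm_unit hu).le, hjJ, ⟨h1.1, b1⟩, h3, b3⟩
      · simp only [R, Finset.mem_filter, mem_ps, Bool.false_eq_true, if_false]
        refine ⟨⟨h2, ?_⟩, h12⟩
        refine Real.le_sqrt_of_sq_le ?_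
        rw [le_div_iff₀ (by positivity)]
        linarith
      · simp only [φ, Bool.false_eq_true, if_false]; ring
  · rintro ⟨t, u, j, a, b⟩ hi
    simp only [hI, Finset.mem_product, Finset.mem_univ, true_and, mem_bl, Finset.mem_range,
          mem_pone] at hi
    obtain ⟨-, -, ⟨ha, haK⟩, hb, hbK⟩ := hi
    have ha1 := one_le_Nm ha.ne_zero
    have hb1 := one_le_Nm hb.ne_zero
    have ha0 : 0 < Nm a := by linarith
    have hb0 : 0 < Nm b := by linarith
    have hDD : 0 ≤ C * (K * N) ^ δ * G * ((Nm a)⁻¹ * (Nm b)⁻¹) := by positivity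
    rcases (R (t, u, j, a, b)).eq_empty_or_nonempty with he | ⟨r, hr⟩
    · rw [he]; exact LSI.of_empty hDD
    set x : ℝ := (if t then K / (Nm a ^ 2 * Nm b ^ 3) else √(K / (Nm a * Nm b ^ 3))) with hx
    have hr' : r ∈ (ps x).filter (fun r => Nm a ≤ Nm r) := hr
    rw [Finset.mem_filter, mem_ps] at hr'
    obtain ⟨⟨hr1, hr2⟩, hr3⟩ := hr'
    have hx1 : 1 ≤ x := hr1.one_le.trans hr2
    have hax : Nm a ≤ x := hr3.trans hr2
    have hcond : (Nm a * Nm b) ^ 3 ≤ K ∧ x * (Nm a * Nm b) ≤ K ∧ x ^ 2 * (Nm a * Nm b) ^ 3 ≤ K ^ 2 := by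
      have pb : Nm b ≤ Nm b ^ 3 := le_self_pow₀ hb1 (by norm_num)
      have pa : Nm a ≤ Nm a ^ 2 := le_self_pow₀ ha1 (by norm_num)
      cases t with
      | true =>
        simp only [if_true] at hx
        have hxe : x * (Nm a ^ 2 * Nm b ^ 3) = K := by
          rw [hx]; field_simp
        refine ⟨?_, ?_, ?_⟩
        · rw [← hxe]
          calc (Nm a * Nm b) ^ 3 = Nm a * (Nm a ^ 2 * Nm b ^ 3) := by ring
            _ ≤ _ := by gcongr
        · rw [← hxe]; gcongr
        · rw [← hxe]
          calc x ^ 2 * (Nm a * Nm b) ^ 3 = (x ^ 2 * Nm a ^ 3 * Nm b ^ 3) * (1 * 1) := by ring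
            _ ≤ (x ^ 2 * Nm a ^ 3 * Nm b ^ 3) * (Nm a * Nm b ^ 3) := by
                gcongr; exact one_le_pow₀ hb1
            _ = _ := by ring
      | false =>
        simp only [Bool.false_eq_true, if_false] at hx
        have hxe : x ^ 2 * (Nm a * Nm b ^ 3) = K := by
          rw [hx, Real.sq_sqrt (by positivity)]; field_simp
        have hxx : x ≤ x ^ 2 := le_self_pow₀ hx1 (by norm_num)
        refine ⟨?_, ?_, ?_⟩
        · rw [← hxe]
          calc (Nm a * Nm b) ^ 3 = Nm a ^ 2 * (Nm a * Nm b ^ 3) := by ring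
            _ ≤ _ := by gcongr
        · rw [← hxe]; gcongr
        · have : Nm a ^ 2 ≤ K := by
            rw [← hxe]
            calc Nm a ^ 2 = Nm a ^ 2 * (1 * 1) := by ring
              _ ≤ x ^ 2 * (Nm a * Nm b ^ 3) := by
                gcongr; exact one_le_pow₀ hb1
          calc x ^ 2 * (Nm a * Nm b) ^ 3 = (x ^ 2 * (Nm a * Nm b ^ 3)) * Nm a ^ 2 := by ring
            _ ≤ K ^ 2 := by
                rw [hxe, pow_two K]; exact mul_le_mul_of_nonneg_left this hK0.le
    obtain ⟨c1, c2, c3⟩ := hcond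
    have hp : 1 ≤ Nm a * Nm b := one_le_mul_of_one_le_of_one_le ha1 hb1
    have hnum := numeric_B2 hx1 hp hN hξ c1 c2 c3
    have hxK : x ≤ K := le_trans (le_mul_of_one_le_right (by linarith) hp) c2
    have hls : LS χ x N (C * (K * N) ^ δ * G * ((Nm a)⁻¹ * (Nm b)⁻¹)) := by
      refine LSI.mono ((hL χ hχ N x hN hx1).symm hχ (by positivity)) ?_
      rw [mul_assoc _ G, hGe, ← mul_inv]
      refine mul_le_mul (mul_le_mul_of_nonneg_left (Real.rpow_le_rpow (by positivity) ?_ hδ0.le) hC)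
        ?_ (by positivity) (by positivity)
      · rw [mul_comm]; gcongr
      · rw [mul_comm N x]; exact hnum
    have hsub : R (t, u, j, a, b) ⊆ ps x := Finset.filter_subset _ _
    have hls2 := LSI.left hls hsub
    cases t with
    | true =>
      refine (hls2.twist_right hDD (u := fun n => cx χ n (u * lam ^ j * a ^ 2 * b ^ 3))
        (fun n hn => cx_norm_le hχ (mem_ps.1 hn).1.1 _)).congr fun r _ n hn => ?_
      simp only [φ, if_true]
      rw [← cx_mul hχ (mem_ps.1 hn).1.1]
      congr 1; ring
    | false =>
      refine (hls2.conj.twist_right hDD (u := fun n => cx χ n (u * lam ^ j * a * b ^ 3))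
        (fun n hn => cx_norm_le hχ (mem_ps.1 hn).1.1 _)).congr fun r _ n hn => ?_
      simp only [φ, Bool.false_eq_true, if_false]
      rw [← cx_sq hχ (mem_ps.1 hn).1.1, ← cx_mul hχ (mem_ps.1 hn).1.1]
      congr 1; ring
  · have hsum : ∑ i ∈ I, C * (K * N) ^ δ * G * ((Nm i.2.2.2.1)⁻¹ * (Nm i.2.2.2.2)⁻¹) =
        2 * (bl 1).card * J * (C * (K * N) ^ δ * G) *
          ((∑ a ∈ pone K, (Nm a)⁻¹) * (∑ a ∈ pone K, (Nm a)⁻¹)) := by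
      rw [hI]
      simp only [Finset.sum_product, Finset.sum_const, Finset.card_range, Finset.card_univ,
        Fintype.card_bool, nsmul_eq_mul]
      simp only [← Finset.mul_sum, ← Finset.sum_mul]
      push_cast; ring
    rw [hsum]
    have hs := sum_inv_le hδ0 hK0.le (pone K) (fun x hx => ⟨(mem_pone.1 hx).1.ne_zero, (mem_pone.1 hx).2⟩)
    have hJle : (J : ℝ) ≤ (1 / δ + 1) * K ^ δ := by
      rw [hJ]; push_cast
      have := Nat.floor_le (show 0 ≤ K ^ δ / δ by positivity)
      have h1 : 1 ≤ K ^ δ := Real.one_le_rpow hK hδ0.le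
      have : (1 / δ + 1) * K ^ δ = K ^ δ / δ + K ^ δ := by ring
      linarith
    have hsn : 0 ≤ ∑ a ∈ pone K, (Nm a)⁻¹ := Finset.sum_nonneg fun x _ => inv_nonneg.2 (Nm_nonneg x)
    have hKN : K * N ≤ (1 + K) * N := by gcongr; linarith
    have hKK : K ≤ (1 + K) * N := by nlinarith
    calc 2 * (bl 1).card * J * (C * (K * N) ^ δ * G) *
          ((∑ a ∈ pone K, (Nm a)⁻¹) * (∑ a ∈ pone K, (Nm a)⁻¹))
        ≤ 2 * (bl 1).card * ((1 / δ + 1) * ((1 + K) * N) ^ δ) * (C * ((1 + K) * N) ^ δ * G) *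
          ((ZE δ * ((1 + K) * N) ^ δ) * (ZE δ * ((1 + K) * N) ^ δ)) := by
          have hKd : K ^ δ ≤ ((1 + K) * N) ^ δ := Real.rpow_le_rpow hK0.le hKK hδ0.le
          have hs' := hs.trans (mul_le_mul_of_nonneg_left hKd hZ)
          have hJ' := hJle.trans (mul_le_mul_of_nonneg_left hKd (by positivity))
          gcongr
      _ = 2 * (bl 1).card * (1 / δ + 1) * C * ZE δ * ZE δ * (((1 + K) * N) ^ δ) ^ 4 * G := by ring
      _ = _ := by
          rw [← Real.rpow_natCast, ← Real.rpow_mul (by positivity)]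
          congr 3; rw [hδ]; push_cast; ring

end allk2

section ksum
open ComplexConjugate

/-- the kernel in the dual sum -/
def ker (χ : Eis → Eis → Eis) (b : ℝ) (i j k : Eis) : ℂ :=
  conj (cx χ i k) * cx χ j k * (Real.exp (-(b * Nm k / (Nm i * Nm j))) : ℝ)

lemma ksum_fin {α β : Fin 3 → ℝ} (hα0 : ∀ i, 0 ≤ α i) (hα : ∀ i, α i ≤ 2) (hB : BH α β)
    {ε : ℝ} (hε : 0 < ε) (hε1 : ε ≤ 1) : ∃ C : ℝ, 0 ≤ C ∧ ∀ χ, IsCubicSymbol χ → ∀ ℓ b : ℝ,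
      0 < ℓ → 1 ≤ 5 / 4 * ℓ → 0 < b → ∀ T : Finset Eis,
      (∀ a ∈ T, PS a ∧ ℓ ≤ Nm a ∧ Nm a ≤ 5 / 4 * ℓ) → ∀ z : Eis → ℂ, ∀ S : Finset Eis,
      (∀ k ∈ S, k ≠ 0) →
      ∑ k ∈ S, ‖∑ i ∈ T, ∑ j ∈ T, z i * conj (z j) * ker χ b i j k‖ ≤
        C * ((1 + ℓ ^ 2 / b) * (5 / 4 * ℓ)) ^ ε * (∑ i, (ℓ ^ 2 / b) ^ α i * (5 / 4 * ℓ) ^ β i) *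
          ∑ i ∈ T, ‖z i‖ ^ 2 := by
  classical
  obtain ⟨C, hC, hL⟩ := hB ε hε
  refine ⟨C * 50000, by positivity, fun χ hχ ℓ b hℓ hL1 hb T hT z S hS => ?_⟩
  set K : ℝ := ℓ ^ 2 / b with hK
  have hK0 : 0 < K := by positivity
  set L : ℝ := 5 / 4 * ℓ with hLdef
  set G : ℝ := ∑ i, K ^ α i * L ^ β i with hG
  have hG0 : 0 ≤ G := Finset.sum_nonneg fun _ _ => by positivity
  have hTL : T ⊆ ps L := fun a ha => mem_ps.2 ⟨(hT a ha).1, (hT a ha).2.2⟩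
  set Z : ℝ := ∑ i ∈ T, ‖z i‖ ^ 2 with hZ
  have hZ0 : 0 ≤ Z := Finset.sum_nonneg fun _ _ => by positivity
  -- covering
  let R : ℕ → Finset Eis := fun i => ((bl (2 ^ i * K)).erase 0).filter
    (fun k => (2 ^ i - 1) / 2 * K ≤ Nm k)
  have hidx : ∀ k : Eis, ∃ i : ℕ, k ≠ 0 → k ∈ R i := by
    intro k
    by_cases hk : k = 0
    · exact ⟨0, fun h => absurd hk h⟩
    have hex : ∃ i : ℕ, Nm k ≤ 2 ^ i * K := by
      obtain ⟨i, hi⟩ := pow_unbounded_of_one_lt (Nm k / K) (by norm_num : (1 : ℝ) < 2)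
      exact ⟨i, by rw [div_lt_iff₀ hK0] at hi; exact hi.le⟩
    refine ⟨Nat.find hex, fun _ => ?_⟩
    have h1 := Nat.find_spec hex
    simp only [R, Finset.mem_filter, Finset.mem_erase, mem_bl]
    refine ⟨⟨hk, h1⟩, ?_⟩
    rcases Nat.eq_zero_or_pos (Nat.find hex) with h0 | h0
    · rw [h0]; simp [Nm_nonneg]
    · have h2 := Nat.find_min hex (Nat.sub_lt h0 one_pos)
      rw [not_le] at h2
      obtain ⟨n, hn⟩ : ∃ n, Nat.find hex = n + 1 := ⟨Nat.find hex - 1, by omega⟩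
      rw [hn] at h2 ⊢
      simp only [Nat.add_sub_cancel] at h2
      rw [pow_succ]
      nlinarith
  choose ix hix using hidx
  have hcov := sum_cover (Finset.range (S.sup ix + 1)) R (fun _ k => k) S
    (fun k => ‖∑ i ∈ T, ∑ j ∈ T, z i * conj (z j) * ker χ b i j k‖) (fun _ => norm_nonneg _)
    (fun k hk => ⟨ix k, Finset.mem_range.2 (Nat.lt_succ_of_le (Finset.le_sup hk)), k,
      hix k (hS k hk), rfl⟩)
  refine hcov.trans ?_
  have hshell : ∀ i : ℕ, ∑ k ∈ R i, ‖∑ i ∈ T, ∑ j ∈ T, z i * conj (z j) * ker χ b i j k‖ ≤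
      C * ((1 + K) * L) ^ ε * G * Z * 25000 * (1 / 2) ^ i := by
    intro n
    set x : ℝ := 2 ^ n with hx
    have hx1 : 1 ≤ x := one_le_pow₀ (by norm_num)
    have hls := (((hL χ hχ (x * K) L (by positivity) hL1).left
      (Finset.filter_subset (fun k => (2 ^ n - 1) / 2 * K ≤ Nm k) _)).right hTL).conj
    have hD0 : 0 ≤ C * ((1 + x * K) * L) ^ ε * ∑ i, (x * K) ^ α i * L ^ β i :=
      mul_nonneg (by positivity) (Finset.sum_nonneg fun _ _ => by positivity)
    have hsep := hls.sep hD0 (B := fun k => 81 / 100 * (Nm k / K))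
      (s := fun a => 10 * ℓ / (9 * Nm a) - 1) (b₀ := 81 / 200 * (x - 1)) (b₁ := 81 / 100 * x)
      (by linarith)
      (fun k hk => by
        simp only [Finset.mem_filter] at hk
        have : (x - 1) / 2 ≤ Nm k / K := by rw [le_div_iff₀ hK0]; exact hk.2
        linarith)
      (fun k hk => by
        simp only [Finset.mem_filter, Finset.mem_erase, mem_bl] at hk
        have : Nm k / K ≤ x := by rw [div_le_iff₀ hK0]; exact hk.1.2
        linarith)
      (by linarith)
      (fun a ha => by
        obtain ⟨h1, h2, h3⟩ := hT a ha
        have h0 : 0 < Nm a := by linarith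
        rw [abs_le]
        constructor
        · have : 8 / 9 ≤ 10 * ℓ / (9 * Nm a) := by rw [le_div_iff₀ (by positivity)]; linarith
          linarith
        · have : 10 * ℓ / (9 * Nm a) ≤ 10 / 9 := by rw [div_le_iff₀ (by positivity)]; linarith
          linarith)
      z (fun i => conj (z i))
    simp only [RCLike.norm_conj] at hsep
    rw [← hZ, Real.mul_self_sqrt hZ0] at hsep
    refine le_trans (le_of_eq ?_) (hsep.trans ?_)
    · refine Finset.sum_congr rfl fun k _ => ?_
      congr 1
      refine Finset.sum_congr rfl fun i hi => Finset.sum_congr rfl fun j hj => ?_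
      have hi0 : 0 < Nm i := by linarith [(hT i hi).2.1]
      have hj0 : 0 < Nm j := by linarith [(hT j hj).2.1]
      rw [ker, mul_assoc (z i * conj (z j))]
      simp only [RingHomCompTriple.comp_apply, RingHom.id_apply]
      congr 5
      rw [hK]
      field_simp
      ring
    · have e1 : C * ((1 + x * K) * L) ^ ε * ∑ i, (x * K) ^ α i * L ^ β i ≤
          C * ((1 + K) * L) ^ ε * G * x ^ 3 := by
        have a1 : ((1 + x * K) * L) ^ ε ≤ x * ((1 + K) * L) ^ ε := by
          calc ((1 + x * K) * L) ^ ε ≤ (x * ((1 + K) * L)) ^ ε := by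
                refine Real.rpow_le_rpow (by positivity) ?_ hε.le
                have hh : 1 + x * K ≤ x * (1 + K) := by nlinarith
                have h3 : 0 ≤ L := by linarith
                have h4 := mul_le_mul_of_nonneg_right hh h3
                calc _ ≤ _ := h4
                  _ = _ := mul_assoc _ _ _
            _ = x ^ ε * ((1 + K) * L) ^ ε := Real.mul_rpow (by positivity) (by positivity)
            _ ≤ _ := by
                gcongr
                calc x ^ ε ≤ x ^ (1 : ℝ) := Real.rpow_le_rpow_of_exponent_le hx1 hε1
                  _ = x := Real.rpow_one x
        have a2 : ∑ i, (x * K) ^ α i * L ^ β i ≤ x ^ 2 * G := by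
          rw [hG, Finset.mul_sum]
          refine Finset.sum_le_sum fun i _ => ?_
          rw [Real.mul_rpow (by positivity) hK0.le, mul_assoc]
          refine mul_le_mul_of_nonneg_right ?_ (by positivity)
          calc x ^ α i ≤ x ^ (2 : ℝ) := Real.rpow_le_rpow_of_exponent_le hx1 (hα i)
            _ = x ^ 2 := by norm_num
        calc _ ≤ C * (x * ((1 + K) * L) ^ ε) * (x ^ 2 * G) :=
              mul_le_mul (mul_le_mul_of_nonneg_left a1 hC) a2
                (Finset.sum_nonneg fun _ _ => by positivity) (by positivity)
          _ = _ := by ring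
      have e2 : Real.exp (19 / 81 * (81 / 100 * x) - 81 / 200 * (x - 1)) * x ^ 3 ≤
          25000 * (1 / 2) ^ n := by
        have b1 : 19 / 81 * (81 / 100 * x) - 81 / 200 * (x - 1) = 81 / 200 + -(43 / 200 * x) := by
          ring
        have b2 := Real.pow_div_factorial_le_exp (43 / 200 * x) (by positivity) 4
        have b3 : Real.exp (81 / 200) ≤ 2 := by
          have := Real.exp_one_lt_d9
          have h2 : Real.exp (81 / 200) ^ 2 ≤ Real.exp 1 := by
            rw [← Real.exp_nat_mul]; exact Real.exp_le_exp.2 (by norm_num)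
          nlinarith [Real.exp_pos (81 / 200)]
        have b4 : Real.exp (-(43 / 200 * x)) ≤ 12000 / x ^ 4 := by
          rw [Real.exp_neg, inv_le_comm₀ (Real.exp_pos _) (by positivity), inv_div]
          refine le_trans ?_ b2
          rw [mul_pow, show Nat.factorial 4 = 24 from rfl]
          have : 0 < x ^ 4 := by positivity
          push_cast
          nlinarith
        rw [b1, Real.exp_add]
        have b5 : ((1 : ℝ) / 2) ^ n = 1 / x := by rw [hx, one_div_pow]
        rw [b5]
        calc Real.exp (81 / 200) * Real.exp (-(43 / 200 * x)) * x ^ 3 ≤ 2 * (12000 / x ^ 4) * x ^ 3 := by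
              gcongr
          _ = 24000 * (1 / x) := by field_simp; norm_num
          _ ≤ _ := by gcongr; norm_num
      calc _ ≤ (C * ((1 + K) * L) ^ ε * G * x ^ 3) *
            Real.exp (19 / 81 * (81 / 100 * x) - 81 / 200 * (x - 1)) * Z := by gcongr
        _ = (C * ((1 + K) * L) ^ ε * G * Z) *
            (Real.exp (19 / 81 * (81 / 100 * x) - 81 / 200 * (x - 1)) * x ^ 3) := by ring
        _ ≤ (C * ((1 + K) * L) ^ ε * G * Z) * (25000 * (1 / 2) ^ n) := by gcongr
        _ = _ := by ring
  refine (Finset.sum_le_sum fun i _ => hshell i).trans ?_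
  rw [← Finset.mul_sum]
  have hgeo : ∑ i ∈ Finset.range (S.sup ix + 1), ((1 : ℝ) / 2) ^ i ≤ 2 :=
    (summable_geometric_two.sum_le_tsum _ (fun _ _ => by positivity)).trans_eq tsum_geometric_two
  calc _ ≤ C * ((1 + K) * L) ^ ε * G * Z * 25000 * 2 := by gcongr
    _ = _ := by ring

end ksum

section rec1
open ComplexConjugate

/-- dual side of the theta sum attached to a divisor `e` -/
def Wt (χ : Eis → Eis → Eis) (M : ℝ) (e a b : Eis) : ℂ :=
  ((2 * M / (Real.sqrt 3 * Nm e) : ℝ) : ℂ) * (cx χ a e * gam χ a / (Nm a : ℂ)) *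
    conj (cx χ b e * gam χ b / (Nm b : ℂ)) * ∑' k : Eis, ker χ (4 * Real.pi * M / (3 * Nm e)) a b k

lemma norm_exp_real (x : ℝ) : ‖((Real.exp x : ℝ) : ℂ)‖ = Real.exp x := by
  rw [Complex.norm_real, Real.norm_of_nonneg (Real.exp_pos _).le]

lemma cx2_norm {χ : Eis → Eis → Eis} (hχ : IsCubicSymbol χ) {a b : Eis} (ha : P1 a) (hb : P1 b)
    (x y : Eis) : ‖cx χ a x * conj (cx χ b y)‖ ≤ 1 := by
  rw [norm_mul, RCLike.norm_conj]
  exact mul_le_one₀ (cx_norm_le hχ ha x) (norm_nonneg _) (cx_norm_le hχ hb y)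

lemma theta_formula {χ : Eis → Eis → Eis} (hχ : IsCubicSymbol χ) {M : ℝ} (hM : 0 < M)
    {a b d : Eis} (ha : PS a) (hb : PS b) (hab : IsCoprime a b) (hd : PS d) :
    ∑' m : Eis, cx χ (d * a) m * conj (cx χ (d * b) m) *
        ((Real.exp (-(Real.pi * Nm m / M)) : ℝ) : ℂ) =
      ∑ e ∈ divs d, (mob e : ℂ) * Wt χ M e a b := by
  classical
  have hpi := Real.pi_pos
  set g : Eis → ℂ := fun m => cx χ a m * conj (cx χ b m) *
        ((Real.exp (-(Real.pi * Nm m / M)) : ℝ) : ℂ) with hg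
  have hgs : Summable g := by
    refine Summable.of_norm_bounded (summ_gauss2 (t := Real.pi / M) (by positivity)) fun m => ?_
    rw [hg]; beta_reduce
    rw [norm_mul, norm_exp_real, mul_div_right_comm]
    exact mul_le_of_le_one_left (Real.exp_pos _).le (cx2_norm hχ ha.1 hb.1 m m)
  have h1 : ∀ m, cx χ (d * a) m * conj (cx χ (d * b) m) *
        ((Real.exp (-(Real.pi * Nm m / M)) : ℝ) : ℂ) =
        ∑ e ∈ divs d, (mob e : ℂ) * (if e ∣ m then g m else 0) := by
    intro m
    have e1 : ∑ e ∈ divs d, (mob e : ℂ) * (if e ∣ m then g m else 0) =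
        ((∑ e ∈ (divs d).filter (fun e => e ∣ m), mob e : ℝ) : ℂ) * g m := by
      push_cast
      rw [Finset.sum_mul, Finset.sum_filter]
      refine Finset.sum_congr rfl fun e _ => ?_
      split_ifs <;> simp
    rw [e1, sum_mob_coprime hd, cx_bot hχ hd.1 ha.1, cx_bot hχ hd.1 hb.1]
    split_ifs with hc
    · rw [hg]; beta_reduce
      rw [map_mul]
      have := cx_mul_conj hχ hd.1 hc
      push_cast
      linear_combination (cx χ a m * conj (cx χ b m) *
        Complex.exp (-(Real.pi * Nm m / M))) * this
    · have : cx χ d m = 0 := by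
        by_contra h0
        exact hc ((hχ.ne_zero_iff hd.1 m).1 (fun h => h0 (by rw [cx, h]; rfl)))
      rw [this]; simp
  have h2 : ∀ e ∈ divs d, Summable (fun m => (mob e : ℂ) * (if e ∣ m then g m else 0)) := by
    intro e _
    refine Summable.mul_left _ ?_
    refine Summable.of_norm_bounded hgs.norm fun m => ?_
    split_ifs
    · exact le_rfl
    · simp
  refine (tsum_congr h1).trans ?_
  rw [Summable.tsum_finsetSum h2]
  refine Finset.sum_congr rfl fun e he => ?_
  rw [tsum_mul_left]
  congr 1
  have he0 : e ≠ 0 := ((mem_divs hd.ne_zero).1 he).1.ne_zero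
  have hNe := Nm_pos he0
  have hNa := Nm_pos ha.ne_zero
  have hNb := Nm_pos hb.ne_zero
  have h3 : ∑' m : Eis, (if e ∣ m then g m else 0) = ∑' m : Eis, g (e * m) := by
    have := (mul_right_injective₀ he0).tsum_eq (f := fun m : Eis => if e ∣ m then g m else 0)
      (by
        intro m hm
        rw [Function.mem_support] at hm
        have : e ∣ m := by by_contra hh; exact hm (if_neg hh)
        obtain ⟨k, rfl⟩ := this
        exact ⟨k, rfl⟩)
    rw [← this]
    exact tsum_congr fun m => by rw [if_pos (dvd_mul_right e m)]
  rw [h3]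
  have hper : Per (a * b) (fun x => cx χ a x * conj (cx χ b x)) := by
    intro x y h
    simp only
    rw [cx_per hχ ha.1 x y ((dvd_mul_right a b).trans h),
      cx_per hχ hb.1 x y ((dvd_mul_left b a).trans h)]
  have hP := poisson_tw (mul_ne_zero ha.ne_zero hb.ne_zero) hper (s := Nm e / M) (by positivity)
  have h4 : ∀ m, g (e * m) = (cx χ a e * conj (cx χ b e)) * ((fun x => cx χ a x * conj (cx χ b x)) m *
      ((Real.exp (-(Real.pi * (Nm e / M) * Nm m)) : ℝ) : ℂ)) := by
    intro m
    rw [hg]; beta_reduce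
    rw [cx_mul hχ ha.1, cx_mul hχ hb.1, Nm_mul, map_mul,
      show Real.pi * (Nm e * Nm m) / M = Real.pi * (Nm e / M) * Nm m by ring]
    ring
  refine (tsum_congr h4).trans ?_
  rw [tsum_mul_left, hP, Wt]
  have h5 : ∀ k, (Real.exp (-(4 * Real.pi * Nm k / (3 * (Nm e / M) * Nm (a * b)))) : ℂ) *
      fhat (a * b) (fun x => cx χ a x * conj (cx χ b x)) k =
      (gam χ a * conj (gam χ b)) * ker χ (4 * Real.pi * M / (3 * Nm e)) a b k := by
    intro k
    rw [gauss_two hχ ha.1 hb.1 ha.2 hb.2 hab, ker, Nm_mul,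
      show 4 * Real.pi * Nm k / (3 * (Nm e / M) * (Nm a * Nm b)) =
        4 * Real.pi * M / (3 * Nm e) * Nm k / (Nm a * Nm b) by field_simp]
    push_cast; ring
  have h6 : ∑' k : Eis, (Real.exp (-(4 * Real.pi * Nm k / (3 * (Nm e / M) * Nm (a * b)))) : ℂ) *
      fhat (a * b) (fun x => cx χ a x * conj (cx χ b x)) k = 
      (gam χ a * conj (gam χ b)) * ∑' k, ker χ (4 * Real.pi * M / (3 * Nm e)) a b k :=
    (tsum_congr h5).trans tsum_mul_left
  rw [h6]
  have h7 : (2 / (Real.sqrt 3 * (Nm e / M) * Nm (a * b))) =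
     (2 * M / (Real.sqrt 3 * Nm e)) * (Nm a)⁻¹ * (Nm b)⁻¹ := by
    rw [Nm_mul]; field_simp
  rw [h7]
  simp only [map_mul, map_div₀, Complex.conj_ofReal, Complex.ofReal_mul, Complex.ofReal_inv]
  ring

lemma ker_summ {χ : Eis → Eis → Eis} (hχ : IsCubicSymbol χ) {b : ℝ} (hb : 0 < b) {i j : Eis}
    (hi : P1 i) (hj : P1 j) : Summable (ker χ b i j) := by
  have h1 := Nm_pos hi.ne_zero
  have h2 := Nm_pos hj.ne_zero
  refine Summable.of_norm_bounded (summ_gauss2 (t := b / (Nm i * Nm j)) (by positivity)) fun m => ?_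
  rw [ker, norm_mul, norm_exp_real, mul_div_right_comm]
  refine mul_le_of_le_one_left (Real.exp_pos _).le ?_
  rw [mul_comm]
  exact cx2_norm hχ hj hi m m

lemma cx_zero {χ : Eis → Eis → Eis} (hχ : IsCubicSymbol χ) {i : Eis} (hi : P1 i) (h : i ≠ 1) :
    cx χ i 0 = 0 := by
  by_contra h0
  have h1 := (hχ.ne_zero_iff hi 0).1 (fun h => h0 (by rw [cx, h]; rfl))
  exact h (P1_unit (isCoprime_zero_right.1 h1) hi)

lemma ksum_tsum {α β : Fin 3 → ℝ} (hα0 : ∀ i, 0 ≤ α i) (hα : ∀ i, α i ≤ 2) (hB : BH α β)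
    {ε : ℝ} (hε : 0 < ε) (hε1 : ε ≤ 1) : ∃ C : ℝ, 0 ≤ C ∧ ∀ χ, IsCubicSymbol χ → ∀ ℓ b : ℝ,
      0 < ℓ → 1 ≤ 5 / 4 * ℓ → 0 < b → ∀ T : Finset Eis,
      (∀ a ∈ T, PS a ∧ ℓ ≤ Nm a ∧ Nm a ≤ 5 / 4 * ℓ) → ∀ z : Eis → ℂ,
      ‖∑ i ∈ T, ∑ j ∈ T, z i * conj (z j) * ∑' k, ker χ b i j k‖ ≤
        (1 + C * ((1 + ℓ ^ 2 / b) * (5 / 4 * ℓ)) ^ ε *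
          (∑ i, (ℓ ^ 2 / b) ^ α i * (5 / 4 * ℓ) ^ β i)) * ∑ i ∈ T, ‖z i‖ ^ 2 := by
  classical
  obtain ⟨C, hC, h⟩ := ksum_fin hα0 hα hB hε hε1
  refine ⟨C, hC, fun χ hχ ℓ b hℓ hL1 hb T hT z => ?_⟩
  have h1 := h χ hχ ℓ b hℓ hL1 hb T hT z
  set D : ℝ := C * ((1 + ℓ ^ 2 / b) * (5 / 4 * ℓ)) ^ ε *
          (∑ i, (ℓ ^ 2 / b) ^ α i * (5 / 4 * ℓ) ^ β i) with hD
  set Z : ℝ := ∑ i ∈ T, ‖z i‖ ^ 2 with hZ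
  set f : Eis → ℂ := fun k => ∑ i ∈ T, ∑ j ∈ T, z i * conj (z j) * ker χ b i j k with hf
  have hks : ∀ i ∈ T, ∀ j ∈ T, Summable (fun k => z i * conj (z j) * ker χ b i j k) :=
    fun i hi j hj => (ker_summ hχ hb (hT i hi).1.1 (hT j hj).1.1).mul_left _
  have hfs : Summable f := summable_sum fun i hi => summable_sum fun j hj => hks i hi j hj
  have e1 : ∑ i ∈ T, ∑ j ∈ T, z i * conj (z j) * ∑' k, ker χ b i j k = ∑' k, f k := by
    rw [hf, Summable.tsum_finsetSum fun i hi => summable_sum fun j hj => hks i hi j hj]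
    refine Finset.sum_congr rfl fun i hi => ?_
    rw [Summable.tsum_finsetSum fun j hj => hks i hi j hj]
    refine Finset.sum_congr rfl fun j hj => ?_
    rw [tsum_mul_left]
  rw [e1]
  refine (norm_tsum_le_tsum_norm hfs.norm).trans ?_
  refine Real.tsum_le_of_sum_le (fun _ => norm_nonneg _) fun S => ?_
  have h0 : ‖f 0‖ ≤ Z := by
    have hz : ∀ i ∈ T, i ≠ 1 → cx χ i 0 = 0 := fun i hi h => cx_zero hχ (hT i hi).1.1 h
    by_cases hm : (1 : Eis) ∈ T
    · rw [hf]; beta_reduce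
      have hs : ∀ i ∈ T, i ≠ 1 → ∑ j ∈ T, z i * conj (z j) * ker χ b i j 0 = 0 := fun i hi h =>
        Finset.sum_eq_zero fun j _ => by rw [ker, hz i hi h]; simp
      rw [Finset.sum_eq_single_of_mem 1 hm hs, Finset.sum_eq_single_of_mem 1 hm fun j hj h => by
        rw [ker, hz j hj h]; simp]
      refine le_trans ?_ (Finset.single_le_sum (f := fun i => ‖z i‖ ^ 2)
        (fun _ _ => by positivity) hm)
      rw [ker, norm_mul, norm_mul, RCLike.norm_conj, norm_mul, norm_mul, RCLike.norm_conj,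
        norm_exp_real]
      have := cx_norm_le hχ P1_one 0
      have h3 : Real.exp (-(b * Nm 0 / (Nm 1 * Nm 1))) = 1 := by rw [Nm_zero]; simp
      rw [h3, mul_one, ← pow_two]
      exact mul_le_of_le_one_right (by positivity) (mul_le_one₀ this (norm_nonneg _) this)
    · have : f 0 = 0 := Finset.sum_eq_zero fun i hi => Finset.sum_eq_zero fun j _ => by
        rw [ker, hz i hi (fun h => hm (h ▸ hi))]; simp
      rw [this, norm_zero]
      exact Finset.sum_nonneg fun _ _ => by positivity
  have h2 := h1 (S.erase 0) (fun k hk => Finset.ne_of_mem_erase hk)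
  calc ∑ k ∈ S, ‖f k‖ ≤ ∑ k ∈ insert 0 (S.erase 0), ‖f k‖ :=
        Finset.sum_le_sum_of_subset_of_nonneg (fun k hk => by
          by_cases hk0 : k = 0 <;> simp [hk0, hk]) fun _ _ _ => norm_nonneg _
    _ = ‖f 0‖ + ∑ k ∈ S.erase 0, ‖f k‖ := Finset.sum_insert (Finset.notMem_erase _ _)
    _ ≤ Z + D * Z := add_le_add h0 h2
    _ = _ := by ring

end rec1

section rec2
open ComplexConjugate

lemma num_rec {α β M ℓ D e : ℝ} (hM : 0 < M) (hℓ : 0 < ℓ) (he : 1 ≤ e) (heD : e ≤ D)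
    (hα : 0 ≤ α) (hβ : β ≤ 2) (h1 : 1 ≤ 2 * α + β) (h2 : 0 ≤ α + β) :
    M / (e * ℓ) * ((ℓ ^ 2 / (4 * Real.pi * M / (3 * e))) ^ α * (5 / 4 * ℓ) ^ β) ≤
      2 * (M ^ (1 - α) * (D * ℓ) ^ (2 * α + β - 1)) := by
  have hpi := Real.pi_gt_three
  have he0 : 0 < e := by linarith
  have hD0 : 0 < D := by linarith
  have a1 : (ℓ ^ 2 / (4 * Real.pi * M / (3 * e))) ^ α ≤ (e * ℓ ^ 2 / M) ^ α := by
    refine Real.rpow_le_rpow (by positivity) ?_ hα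
    rw [div_div_eq_mul_div, div_le_div_iff₀ (by positivity) hM]
    nlinarith [show 0 < ℓ ^ 2 * e * M by positivity]
  have a2 : (5 / 4 * ℓ) ^ β ≤ 2 * ℓ ^ β := by
    rw [Real.mul_rpow (by norm_num) hℓ.le]
    refine mul_le_mul_of_nonneg_right ?_ (by positivity)
    calc (5 / 4 : ℝ) ^ β ≤ (5 / 4 : ℝ) ^ (2 : ℝ) :=
          Real.rpow_le_rpow_of_exponent_le (by norm_num) hβ
      _ ≤ 2 := by norm_num
  have a3 : M / (e * ℓ) * ((e * ℓ ^ 2 / M) ^ α * ℓ ^ β) ≤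
      M ^ (1 - α) * (D * ℓ) ^ (2 * α + β - 1) := by
    obtain ⟨m, rfl⟩ : ∃ m, M = Real.exp m := ⟨Real.log M, (Real.exp_log hM).symm⟩
    obtain ⟨u, rfl⟩ : ∃ m, e = Real.exp m := ⟨Real.log e, (Real.exp_log he0).symm⟩
    obtain ⟨v, rfl⟩ : ∃ m, ℓ = Real.exp m := ⟨Real.log ℓ, (Real.exp_log hℓ).symm⟩
    obtain ⟨w, rfl⟩ : ∃ m, D = Real.exp m := ⟨Real.log D, (Real.exp_log hD0).symm⟩
    have hu : 0 ≤ u := by rwa [Real.one_le_exp_iff] at he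
    have huw : u ≤ w := Real.exp_le_exp.1 heD
    have e2 : Real.exp v ^ 2 = Real.exp (2 * v) := by rw [two_mul, Real.exp_add]; ring
    rw [e2]
    simp only [← Real.exp_add, ← Real.exp_sub, ← Real.exp_mul]
    apply Real.exp_le_exp.2
    rcases le_total 1 α with h | h <;> nlinarith
  calc _ ≤ M / (e * ℓ) * ((e * ℓ ^ 2 / M) ^ α * (2 * ℓ ^ β)) := by
        refine mul_le_mul_of_nonneg_left ?_ (by positivity)
        exact mul_le_mul a1 a2 (by positivity) (by positivity)
    _ = 2 * (M / (e * ℓ) * ((e * ℓ ^ 2 / M) ^ α * ℓ ^ β)) := by ring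
    _ ≤ _ := by linarith

/-- admissible exponent pairs -/
structure Adm (α β : Fin 3 → ℝ) : Prop where
  a0 : ∀ i, 0 ≤ α i
  a2 : ∀ i, α i ≤ 2
  b2 : ∀ i, β i ≤ 2
  h1 : ∀ i, 1 ≤ 2 * α i + β i
  h2 : ∀ i, 0 ≤ α i + β i

/-- the resulting large sieve quantity -/
def RQ (α β : Fin 3 → ℝ) (M N : ℝ) : ℝ := M + ∑ i, M ^ (1 - α i) * N ^ (2 * α i + β i - 1)

set_option maxHeartbeats 1000000 in
lemma wsum {α β : Fin 3 → ℝ} (hA : Adm α β) (hB : BH α β) {ε : ℝ} (hε : 0 < ε) (hε1 : ε ≤ 1) :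
    ∃ C : ℝ, 0 ≤ C ∧ ∀ χ, IsCubicSymbol χ → ∀ M N : ℝ, 1 ≤ M → 1 ≤ N → ∀ d e : Eis, PS d →
      e ∈ divs d → ∀ T : Finset Eis, (∀ a ∈ T, PS a ∧ N ≤ Nm (d * a) ∧ Nm (d * a) ≤ 5 / 4 * N) →
      ∀ c : Eis → ℂ, ‖∑ a ∈ T, ∑ b ∈ T, c a * conj (c b) * Wt χ M e a b‖ ≤
        C * N ^ (3 * ε) * RQ α β M N * ∑ a ∈ T, ‖c a‖ ^ 2 := by
  obtain ⟨C, hC, h⟩ := ksum_tsum hA.a0 hA.a2 hB hε hε1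
  refine ⟨2 + 12 * C, by positivity, fun χ hχ M N hM hN d e hd he T hT c => ?_⟩
  have hM0 : 0 < M := by linarith
  have hN0 : 0 < N := by linarith
  have hRQ : 0 ≤ ∑ i, M ^ (1 - α i) * N ^ (2 * α i + β i - 1) :=
    Finset.sum_nonneg fun _ _ => by positivity
  rcases T.eq_empty_or_nonempty with rfl | ⟨a₀, ha₀⟩
  · simp
  obtain ⟨he1, hed⟩ := (mem_divs hd.ne_zero).1 he
  have hNe : 1 ≤ Nm e := one_le_Nm he1.ne_zero
  have hNed : Nm e ≤ Nm d := Nm_le_of_dvd hed hd.ne_zero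
  have hNd : 1 ≤ Nm d := by linarith
  set ℓ : ℝ := N / Nm d with hℓ
  have hDl : Nm d * ℓ = N := by rw [hℓ]; field_simp
  have hT' : ∀ a ∈ T, PS a ∧ ℓ ≤ Nm a ∧ Nm a ≤ 5 / 4 * ℓ := by
    intro a ha
    obtain ⟨h1, h2, h3⟩ := hT a ha
    rw [Nm_mul] at h2 h3
    refine ⟨h1, ?_, ?_⟩
    · rw [hℓ, div_le_iff₀ (by linarith)]; linarith
    · rw [hℓ, ← mul_div_assoc, le_div_iff₀ (by linarith)]; linarith
  have hℓ0 : 0 < ℓ := by positivity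
  have hL1 : 1 ≤ 5 / 4 * ℓ := (hT' a₀ ha₀).1.one_le.trans (hT' a₀ ha₀).2.2
  clear_value ℓ
  have hpi := Real.pi_gt_three
  set b : ℝ := 4 * Real.pi * M / (3 * Nm e) with hb
  have hb0 : 0 < b := by positivity
  set z : Eis → ℂ := fun a => c a * (cx χ a e * gam χ a / (Nm a : ℂ)) with hz
  have h1 := h χ hχ ℓ b hℓ0 hL1 hb0 T hT' z
  have hzn : ∀ a ∈ T, ‖z a‖ ^ 2 ≤ ‖c a‖ ^ 2 * ℓ⁻¹ ∧ ‖z a‖ ^ 2 ≤ ‖c a‖ ^ 2 := by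
    intro a ha
    obtain ⟨g1, g2, g3⟩ := hT' a ha
    have g0 := g1.one_le
    have e1 : ‖z a‖ ^ 2 ≤ ‖c a‖ ^ 2 * (Nm a)⁻¹ := by
      rw [hz]; beta_reduce
      rw [norm_mul, norm_div, norm_mul, Complex.norm_real, Real.norm_of_nonneg (by linarith),
        mul_pow, div_pow, mul_pow, gam_norm hχ g1.1 g1.2]
      refine mul_le_mul_of_nonneg_left ?_ (by positivity)
      have : ‖cx χ a e‖ ^ 2 ≤ 1 := pow_le_one₀ (norm_nonneg _) (cx_norm_le hχ g1.1 e)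
      rw [div_le_iff₀ (by positivity)]
      have : (Nm a)⁻¹ * Nm a ^ 2 = Nm a := by field_simp
      rw [this]
      nlinarith
    refine ⟨e1.trans (mul_le_mul_of_nonneg_left (inv_anti₀ hℓ0 g2) (by positivity)),
      e1.trans (mul_le_of_le_one_right (by positivity) (inv_le_one_of_one_le₀ g0))⟩
  set Z : ℝ := ∑ a ∈ T, ‖c a‖ ^ 2 with hZ
  have hZ0 : 0 ≤ Z := Finset.sum_nonneg fun _ _ => by positivity
  have hz1 : ∑ i ∈ T, ‖z i‖ ^ 2 ≤ Z * ℓ⁻¹ := by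
    rw [hZ, Finset.sum_mul]; exact Finset.sum_le_sum fun a ha => (hzn a ha).1
  have hz2 : ∑ i ∈ T, ‖z i‖ ^ 2 ≤ Z := Finset.sum_le_sum fun a ha => (hzn a ha).2
  set p : ℝ := 2 * M / (Real.sqrt 3 * Nm e) with hp
  have hs3 : 1 ≤ Real.sqrt 3 := by rw [Real.one_le_sqrt]; norm_num
  have hp0 : 0 ≤ p := by positivity
  have hp1 : p ≤ 2 * (M / Nm e) := by
    rw [hp, ← mul_div_assoc]
    refine div_le_div_of_nonneg_left (by positivity) (by positivity) ?_
    nlinarith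
  have hp2 : p ≤ 2 * M := by
    refine hp1.trans ?_
    have := div_le_self hM0.le hNe
    linarith
  have e0 : ∑ a ∈ T, ∑ b ∈ T, c a * conj (c b) * Wt χ M e a b =
      (p : ℂ) * ∑ i ∈ T, ∑ j ∈ T, z i * conj (z j) * ∑' k, ker χ b i j k := by
    simp only [Finset.mul_sum (s := T)]
    refine Finset.sum_congr rfl fun i _ => Finset.sum_congr rfl fun j _ => ?_
    rw [Wt, hz]
    simp only [map_mul]
    ring
  rw [e0, norm_mul, Complex.norm_real, Real.norm_of_nonneg hp0]
  set Q : ℝ := ∑ i, (ℓ ^ 2 / b) ^ α i * (5 / 4 * ℓ) ^ β i with hQ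
  have hQ0 : 0 ≤ Q := Finset.sum_nonneg fun _ _ => by positivity
  have hpow : ((1 + ℓ ^ 2 / b) * (5 / 4 * ℓ)) ^ ε ≤ 3 * N ^ (3 * ε) := by
    have hlN : ℓ ≤ N := by nlinarith
    have k1 : ℓ ^ 2 / b ≤ N ^ 2 := by
      rw [hb, div_div_eq_mul_div, div_le_iff₀ (by positivity)]
      have q1 : ℓ ^ 2 * Nm e ≤ N * ℓ := by
        calc ℓ ^ 2 * Nm e ≤ ℓ ^ 2 * Nm d := by gcongr
          _ = (Nm d * ℓ) * ℓ := by ring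
          _ = N * ℓ := by rw [hDl]
      have q2 : N * ℓ ≤ N ^ 2 := by nlinarith
      have q3 : 3 ≤ 4 * Real.pi * M := by nlinarith
      nlinarith [sq_nonneg N]
    have k2 : (1 + ℓ ^ 2 / b) * (5 / 4 * ℓ) ≤ 3 * N ^ 3 := by
      have : 1 + ℓ ^ 2 / b ≤ 2 * N ^ 2 := by nlinarith
      calc (1 + ℓ ^ 2 / b) * (5 / 4 * ℓ) ≤ 2 * N ^ 2 * (5 / 4 * N) := by gcongr
        _ ≤ _ := by nlinarith [show 0 < N ^ 3 by positivity]
    calc _ ≤ (3 * N ^ 3) ^ ε := Real.rpow_le_rpow (by positivity) k2 hε.le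
      _ = 3 ^ ε * N ^ (3 * ε) := by
          rw [Real.mul_rpow (by norm_num) (by positivity), Real.rpow_mul hN0.le]; norm_num
      _ ≤ 3 ^ (1 : ℝ) * N ^ (3 * ε) := by
          gcongr
          norm_num
      _ = _ := by rw [Real.rpow_one]
  set G : ℝ := ∑ i, M ^ (1 - α i) * N ^ (2 * α i + β i - 1) with hG
  have hmain : M / (Nm e * ℓ) * Q ≤ 2 * G := by
    rw [hQ, hG, Finset.mul_sum, Finset.mul_sum]
    refine Finset.sum_le_sum fun i _ => ?_
    have := num_rec (α := α i) (β := β i) hM0 hℓ0 hNe hNed (hA.a0 i) (hA.b2 i) (hA.h1 i) (hA.h2 i)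
    rw [hDl] at this
    exact this
  set P : ℝ := N ^ (3 * ε) with hP
  have hP1 : 1 ≤ P := Real.one_le_rpow hN (by positivity)
  clear_value P
  calc _ ≤ p * ((1 + C * ((1 + ℓ ^ 2 / b) * (5 / 4 * ℓ)) ^ ε * Q) * ∑ i ∈ T, ‖z i‖ ^ 2) :=
        mul_le_mul_of_nonneg_left h1 hp0
    _ ≤ p * ((1 + C * (3 * P) * Q) * ∑ i ∈ T, ‖z i‖ ^ 2) := by
        refine mul_le_mul_of_nonneg_left (mul_le_mul_of_nonneg_right ?_ ?_) hp0
        · gcongr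
        · exact Finset.sum_nonneg fun _ _ => by positivity
    _ = p * (∑ i ∈ T, ‖z i‖ ^ 2) + p * (C * (3 * P) * Q) * (∑ i ∈ T, ‖z i‖ ^ 2) := by ring
    _ ≤ (2 * M) * Z + (2 * (M / Nm e)) * (C * (3 * P) * Q) * (Z * ℓ⁻¹) := by gcongr
    _ = 2 * M * Z + 6 * C * P * Z * (M / (Nm e * ℓ) * Q) := by
        rw [div_mul_eq_div_div, div_eq_mul_inv _ ℓ]; ring
    _ ≤ 2 * M * Z + 6 * C * P * Z * (2 * G) := by gcongr
    _ ≤ (2 + 12 * C) * P * (M + G) * Z := by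
        have t1 : 0 ≤ M * Z * (P - 1) := mul_nonneg (by positivity) (by linarith)
        have t2 : 0 ≤ P * G * Z := by positivity
        have t3 : 0 ≤ C * P * M * Z := by positivity
        nlinarith
    _ = _ := by rw [RQ]

end rec2

section rec3
open ComplexConjugate
open Classical in
/-- cofactors -/
def Sd (S : Finset Eis) (X : ℝ) (d : Eis) : Finset Eis := (ps X).filter (fun a => d * a ∈ S)

lemma mem_Sd {S : Finset Eis} {X : ℝ} {d a : Eis} : a ∈ Sd S X d ↔ a ∈ ps X ∧ d * a ∈ S := by
  classical
  rw [Sd, Finset.mem_filter]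

open Classical in
/-- cofactors divisible by `f` -/
def Sf (S : Finset Eis) (X : ℝ) (d f : Eis) : Finset Eis := (Sd S X d).filter (fun a => f ∣ a)

open Classical in
lemma gcd_sum {X : ℝ} {S : Finset Eis} (hS : ∀ n ∈ S, PS n ∧ Nm n ≤ X) (G : Eis → Eis → ℂ) :
    ∑ n₁ ∈ S, ∑ n₂ ∈ S, G n₁ n₂ = ∑ d ∈ ps X, ∑ a ∈ Sd S X d, ∑ b ∈ Sd S X d,
      if IsCoprime a b then G (d * a) (d * b) else 0 := by
  have e1 : ∀ d ∈ ps X, ∑ a ∈ Sd S X d, ∑ b ∈ Sd S X d,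
      (if IsCoprime a b then G (d * a) (d * b) else 0) =
      ∑ p ∈ (Sd S X d ×ˢ Sd S X d).filter (fun p => IsCoprime p.1 p.2), G (d * p.1) (d * p.2) := by
    intro d _
    rw [Finset.sum_filter, Finset.sum_product]
  rw [Finset.sum_congr rfl e1, ← Finset.sum_product', Finset.sum_sigma']
  symm
  refine Finset.sum_nbij (fun x => (x.1 * x.2.1, x.1 * x.2.2)) ?_ ?_ ?_ ?_
  · rintro ⟨d, a, b⟩ h
    simp only [Finset.mem_sigma, Finset.mem_filter, Finset.mem_product, mem_Sd] at h
    exact Finset.mem_product.2 ⟨h.2.1.1.2, h.2.1.2.2⟩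
  · rintro ⟨d, a, b⟩ h ⟨d', a', b'⟩ h' heq
    simp only [Finset.coe_sigma, Set.mem_sigma_iff, Finset.mem_coe, Finset.mem_filter,
      Finset.mem_product, mem_Sd, mem_ps] at h h'
    simp only [Prod.mk.injEq] at heq
    have key : ∀ {d a b d' a' b' : Eis}, IsCoprime a' b' → d * a = d' * a' → d * b = d' * b' →
        d ∣ d' := by
      rintro d a b d' a' b' ⟨u, v, huv⟩ e1 e2
      refine ⟨u * a + v * b, ?_⟩
      linear_combination (-d') * huv - u * e1 - v * e2
    have h1 := key h'.2.2 heq.1 heq.2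
    have h2 := key h.2.2 heq.1.symm heq.2.symm
    have hd : d = d' := P1_assoc h.1.1.1 h'.1.1.1 (associated_of_dvd_dvd h1 h2)
    subst hd
    have hd0 := h.1.1.ne_zero
    rw [mul_right_injective₀ hd0 heq.1, mul_right_injective₀ hd0 heq.2]
  · rintro ⟨n₁, n₂⟩ hn
    simp only [Finset.coe_product, Set.mem_prod, Finset.mem_coe] at hn
    obtain ⟨p1, q1⟩ := hS _ hn.1
    obtain ⟨p2, q2⟩ := hS _ hn.2
    obtain ⟨g, hg, ⟨a, rfl⟩, ⟨b, rfl⟩, hg4⟩ := exists_P1_gcd p1.1 n₂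
    have hga : PS a := p1.of_dvd (P1_of_mul hg p1.1) (dvd_mul_left _ _)
    have hgb : PS b := p2.of_dvd (P1_of_mul hg p2.1) (dvd_mul_left _ _)
    have hgg : PS g := p1.of_mul_left hg
    refine ⟨⟨g, a, b⟩, ?_, rfl⟩
    simp only [Finset.coe_sigma, Set.mem_sigma_iff, Finset.mem_coe, Finset.mem_filter,
      Finset.mem_product, mem_Sd, mem_ps]
    refine ⟨⟨hgg, (Nm_le_of_dvd (dvd_mul_right _ _) p1.ne_zero).trans q1⟩,
      ⟨⟨⟨hga, (Nm_le_of_dvd (dvd_mul_left _ _) p1.ne_zero).trans q1⟩, hn.1⟩,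
      ⟨⟨hgb, (Nm_le_of_dvd (dvd_mul_left _ _) p2.ne_zero).trans q2⟩, hn.2⟩⟩, ?_⟩
    obtain ⟨t, ht, ht1, ht2, ht3⟩ := exists_P1_gcd hga.1 b
    have h1 : g * t ∣ g := hg4 _ (mul_dvd_mul_left g ht1) (mul_dvd_mul_left g ht2)
    have h2 : IsUnit t := by
      obtain ⟨s, hs⟩ := h1
      refine IsUnit.of_mul_eq_one s ?_
      exact mul_right_injective₀ hgg.ne_zero (by simpa [mul_assoc] using hs.symm)
    rw [← isRelPrime_iff_isCoprime]
    exact fun e he1 he2 => isUnit_of_dvd_unit (ht3 e he1 he2) h2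
  · rintro ⟨d, a, b⟩ _
    rfl

open Classical in
lemma mob_cop {X : ℝ} {a : Eis} (ha : PS a) (haX : Nm a ≤ X) (b : Eis) :
    ∑ f ∈ pone X, (if f ∣ a ∧ f ∣ b then mob f else 0) = if IsCoprime a b then 1 else 0 := by
  rw [← sum_mob_coprime ha b, ← Finset.sum_filter]
  refine Finset.sum_congr ?_ fun _ _ => rfl
  ext f
  simp only [Finset.mem_filter, mem_pone, mem_divs ha.ne_zero]
  constructor
  · rintro ⟨⟨h1, h2⟩, h3, h4⟩; exact ⟨⟨h1, h3⟩, h4⟩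
  · rintro ⟨⟨h1, h3⟩, h4⟩; exact ⟨⟨h1, (Nm_le_of_dvd h3 ha.ne_zero).trans haX⟩, h3, h4⟩

open Classical in
lemma mob_sum {X : ℝ} {S : Finset Eis} {d : Eis} (w : Eis → Eis → Eis → ℂ) :
    ∑ a ∈ Sd S X d, ∑ b ∈ Sd S X d,
      (if IsCoprime a b then ∑ e ∈ divs d, (mob e : ℂ) * w e a b else 0) =
    ∑ e ∈ divs d, ∑ f ∈ pone X, (mob e : ℂ) * (mob f : ℂ) *
      ∑ a ∈ Sf S X d f, ∑ b ∈ Sf S X d f, w e a b := by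
  have e1 : ∀ e ∈ divs d, ∀ f ∈ pone X, (mob e : ℂ) * (mob f : ℂ) *
      ∑ a ∈ Sf S X d f, ∑ b ∈ Sf S X d f, w e a b = ∑ a ∈ Sd S X d, ∑ b ∈ Sd S X d,
        ((if f ∣ a ∧ f ∣ b then mob f else 0 : ℝ) : ℂ) * ((mob e : ℂ) * w e a b) := by
    intro e _ f _
    rw [Sf, Finset.sum_filter, Finset.mul_sum]
    refine Finset.sum_congr rfl fun a _ => ?_
    rw [Finset.sum_filter]
    split_ifs with ha
    · rw [Finset.mul_sum]
      refine Finset.sum_congr rfl fun b _ => ?_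
      by_cases hb : f ∣ b
      · simp [ha, hb]; ring
      · simp [hb]
    · simp [ha]
  rw [Finset.sum_congr rfl fun e he => Finset.sum_congr rfl fun f hf => e1 e he f hf]
  have e2 : ∀ e ∈ divs d, ∑ f ∈ pone X, ∑ a ∈ Sd S X d, ∑ b ∈ Sd S X d,
        ((if f ∣ a ∧ f ∣ b then mob f else 0 : ℝ) : ℂ) * ((mob e : ℂ) * w e a b) =
      ∑ a ∈ Sd S X d, ∑ b ∈ Sd S X d, if IsCoprime a b then (mob e : ℂ) * w e a b else 0 := by
    intro e _
    rw [Finset.sum_comm]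
    refine Finset.sum_congr rfl fun a ha => ?_
    rw [Finset.sum_comm]
    refine Finset.sum_congr rfl fun b hb => ?_
    obtain ⟨ha1, ha2⟩ := mem_ps.1 (mem_Sd.1 ha).1
    rw [← Finset.sum_mul, ← Complex.ofReal_sum, mob_cop ha1 ha2]
    split_ifs <;> simp
  rw [Finset.sum_congr rfl e2]
  symm
  rw [Finset.sum_comm]
  refine Finset.sum_congr rfl fun a _ => ?_
  rw [Finset.sum_comm]
  refine Finset.sum_congr rfl fun b _ => ?_
  split_ifs
  · rfl
  · simp

lemma Sf_sum_le {ε C : ℝ} (hC1 : 1 ≤ C) (hε : 0 < ε)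
    (hC : ∀ n : Eis, n ≠ 0 → ((divs n).card : ℝ) ≤ C * Nm n ^ ε)
    {X : ℝ} (hX : 1 ≤ X) {S : Finset Eis} (hS : ∀ n ∈ S, PS n ∧ Nm n ≤ X)
    (v : Eis → ℝ) (hv : ∀ n, 0 ≤ v n) :
    ∑ d ∈ ps X, ∑ e ∈ divs d, ∑ f ∈ pone X, ∑ a ∈ Sf S X d f, v (d * a) ≤
      (C * X ^ ε) ^ 3 * ∑ n ∈ S, v n := by
  classical
  set D : ℝ := C * X ^ ε with hD
  have hX0 : 0 ≤ X := by linarith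
  have hD0 : 0 ≤ D := by positivity
  have hdv : ∀ n : Eis, n ≠ 0 → Nm n ≤ X → ((divs n).card : ℝ) ≤ D := fun n hn h =>
    (hC n hn).trans (mul_le_mul_of_nonneg_left (Real.rpow_le_rpow (Nm_nonneg _) h hε.le)
      (by linarith))
  have h1 : ∀ d ∈ ps X, ∑ f ∈ pone X, ∑ a ∈ Sf S X d f, v (d * a) ≤
      D * ∑ a ∈ Sd S X d, v (d * a) := by
    intro d hd
    simp only [Sf, Finset.sum_filter]
    rw [Finset.sum_comm, Finset.mul_sum]
    refine Finset.sum_le_sum fun a ha => ?_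
    obtain ⟨ha1, ha2⟩ := mem_ps.1 (mem_Sd.1 ha).1
    rw [← Finset.sum_filter, Finset.sum_const, nsmul_eq_mul]
    refine mul_le_mul_of_nonneg_right (le_trans ?_ (hdv a ha1.ne_zero ha2)) (hv _)
    refine Nat.cast_le.2 (Finset.card_le_card fun f hf => ?_)
    rw [Finset.mem_filter, mem_pone] at hf
    exact (mem_divs ha1.ne_zero).2 ⟨hf.1.1, hf.2⟩
  have h2 : ∑ d ∈ ps X, ∑ e ∈ divs d, ∑ f ∈ pone X, ∑ a ∈ Sf S X d f, v (d * a) ≤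
      ∑ d ∈ ps X, D * (D * ∑ a ∈ Sd S X d, v (d * a)) := by
    refine Finset.sum_le_sum fun d hd => ?_
    obtain ⟨hd1, hd2⟩ := mem_ps.1 hd
    rw [Finset.sum_const, nsmul_eq_mul]
    refine mul_le_mul (hdv d hd1.ne_zero hd2) (h1 d hd) ?_ hD0
    exact Finset.sum_nonneg fun _ _ => Finset.sum_nonneg fun _ _ => hv _
  refine h2.trans ?_
  simp only [← mul_assoc]
  rw [← Finset.mul_sum]
  have h3 : ∑ d ∈ ps X, ∑ a ∈ Sd S X d, v (d * a) ≤ D * ∑ n ∈ S, v n := by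
    have e1 : ∀ d, ∑ a ∈ Sd S X d, v (d * a) ≤ ∑ n ∈ S, if d ∣ n then v n else 0 := by
      intro d
      by_cases hd0 : d = 0
      · have : Sd S X d = ∅ := by
          ext a
          simp only [mem_Sd, hd0, zero_mul, Finset.notMem_empty, iff_false, not_and]
          exact fun _ h => (hS 0 h).1.ne_zero rfl
        rw [this, Finset.sum_empty]
        exact Finset.sum_nonneg fun _ _ => by split_ifs <;> simp [hv]
      rw [← Finset.sum_filter, ← Finset.sum_image (f := v) (g := fun a => d * a)
        (fun a _ b _ h => mul_right_injective₀ hd0 h)]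
      refine Finset.sum_le_sum_of_subset_of_nonneg ?_ fun _ _ _ => hv _
      intro n hn
      obtain ⟨a, ha, rfl⟩ := Finset.mem_image.1 hn
      exact Finset.mem_filter.2 ⟨(mem_Sd.1 ha).2, dvd_mul_right _ _⟩
    refine (Finset.sum_le_sum fun d _ => e1 d).trans ?_
    rw [Finset.sum_comm, Finset.mul_sum]
    refine Finset.sum_le_sum fun n hn => ?_
    obtain ⟨hn1, hn2⟩ := hS n hn
    rw [← Finset.sum_filter, Finset.sum_const, nsmul_eq_mul]
    refine mul_le_mul_of_nonneg_right (le_trans ?_ (hdv n hn1.ne_zero hn2)) (hv _)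
    refine Nat.cast_le.2 (Finset.card_le_card fun f hf => ?_)
    rw [Finset.mem_filter, mem_ps] at hf
    exact (mem_divs hn1.ne_zero).2 ⟨hf.1.1.1, hf.2⟩
  calc D * D * ∑ d ∈ ps X, ∑ a ∈ Sd S X d, v (d * a) ≤ D * D * (D * ∑ n ∈ S, v n) := by gcongr
    _ = _ := by ring

set_option maxHeartbeats 1000000 in
lemma rec_shell {α β : Fin 3 → ℝ} (hA : Adm α β) (hB : BH α β) {ε : ℝ} (hε : 0 < ε)
    (hε1 : ε ≤ 1) :
    ∃ C : ℝ, 0 ≤ C ∧ ∀ χ, IsCubicSymbol χ → ∀ M N : ℝ, 1 ≤ M → 1 ≤ N → ∀ S : Finset Eis,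
      (∀ n ∈ S, PS n ∧ N ≤ Nm n ∧ Nm n ≤ 5 / 4 * N) →
      LSI (ps M) S (fun m n => cx χ n m) (C * N ^ (6 * ε) * RQ α β M N) := by
  classical
  obtain ⟨C, hC, hW⟩ := wsum hA hB hε hε1
  obtain ⟨C₁, hC₁, hdiv⟩ := divisor_bound hε
  refine ⟨Real.exp Real.pi * (C * (2 * C₁) ^ 3), by positivity, fun χ hχ M N hM hN S hS c => ?_⟩
  have hM0 : 0 < M := by linarith
  have hN0 : 0 < N := by linarith
  have hpi := Real.pi_pos
  have hRQ : 0 ≤ RQ α β M N := by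
    have : 0 ≤ ∑ i, M ^ (1 - α i) * N ^ (2 * α i + β i - 1) :=
      Finset.sum_nonneg fun _ _ => by positivity
    rw [RQ]; linarith
  set X : ℝ := 5 / 4 * N with hX
  have hX1 : 1 ≤ X := by linarith
  have hSX : ∀ n ∈ S, PS n ∧ Nm n ≤ X := fun n hn => ⟨(hS n hn).1, (hS n hn).2.2⟩
  set E : Eis → ℝ := fun m => Real.exp (-(Real.pi * Nm m / M)) with hE
  set g : Eis → ℂ := fun m => ∑ n ∈ S, c n * cx χ n m with hg
  set Θ : Eis → Eis → ℂ := fun n₁ n₂ => ∑' m : Eis, cx χ n₁ m * conj (cx χ n₂ m) * (E m : ℂ)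
    with hΘ
  have hsum : ∀ n₁ ∈ S, ∀ n₂ ∈ S, Summable (fun m : Eis => cx χ n₁ m * conj (cx χ n₂ m) * (E m : ℂ)) := by
    intro n₁ h1 n₂ h2
    refine Summable.of_norm_bounded (summ_gauss2 (t := Real.pi / M) (by positivity)) fun m => ?_
    rw [norm_mul, hE, norm_exp_real, mul_div_right_comm]
    exact mul_le_of_le_one_left (Real.exp_pos _).le (cx2_norm hχ (hS _ h1).1.1 (hS _ h2).1.1 m m)
  have hgE : ∀ m, ((‖g m‖ ^ 2 * E m : ℝ) : ℂ) =
      ∑ n₁ ∈ S, ∑ n₂ ∈ S, c n₁ * conj (c n₂) * (cx χ n₁ m * conj (cx χ n₂ m) * (E m : ℂ)) := by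
    intro m
    have : ((‖g m‖ ^ 2 : ℝ) : ℂ) = g m * conj (g m) := by
      rw [Complex.mul_conj, Complex.normSq_eq_norm_sq]
    rw [Complex.ofReal_mul, this, hg]
    beta_reduce
    rw [map_sum, Finset.sum_mul_sum, Finset.sum_mul]
    refine Finset.sum_congr rfl fun i _ => ?_
    rw [Finset.sum_mul]
    refine Finset.sum_congr rfl fun j _ => ?_
    rw [map_mul]; ring
  have hs2 : Summable (fun m => ((‖g m‖ ^ 2 * E m : ℝ) : ℂ)) := by
    simp_rw [hgE]
    exact summable_sum fun i hi => summable_sum fun j hj => (hsum i hi j hj).mul_left _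
  have hs3 : Summable (fun m => ‖g m‖ ^ 2 * E m) := Complex.summable_ofReal.1 hs2
  have htot : ((∑' m, ‖g m‖ ^ 2 * E m : ℝ) : ℂ) =
      ∑ n₁ ∈ S, ∑ n₂ ∈ S, c n₁ * conj (c n₂) * Θ n₁ n₂ := by
    rw [Complex.ofReal_tsum]
    refine (tsum_congr hgE).trans ?_
    rw [Summable.tsum_finsetSum fun i hi => summable_sum fun j hj => (hsum i hi j hj).mul_left _]
    refine Finset.sum_congr rfl fun i hi => ?_
    rw [Summable.tsum_finsetSum fun j hj => (hsum i hi j hj).mul_left _]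
    refine Finset.sum_congr rfl fun j hj => ?_
    rw [tsum_mul_left]
  have h1 : ∑ m ∈ ps M, ‖g m‖ ^ 2 ≤ Real.exp Real.pi * ∑' m, ‖g m‖ ^ 2 * E m := by
    have k1 : ∑ m ∈ ps M, ‖g m‖ ^ 2 * E m ≤ ∑' m, ‖g m‖ ^ 2 * E m :=
      hs3.sum_le_tsum _ fun _ _ => mul_nonneg (by positivity) (Real.exp_pos _).le
    refine le_trans ?_ (mul_le_mul_of_nonneg_left k1 (Real.exp_pos _).le)
    rw [Finset.mul_sum]
    refine Finset.sum_le_sum fun m hm => ?_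
    have hmM := (mem_ps.1 hm).2
    have : 1 ≤ Real.exp Real.pi * E m := by
      rw [hE]; beta_reduce
      rw [← Real.exp_add, Real.one_le_exp_iff]
      have : Real.pi * Nm m / M ≤ Real.pi := by
        rw [div_le_iff₀ hM0]; exact mul_le_mul_of_nonneg_left hmM hpi.le
      linarith
    nlinarith [sq_nonneg ‖g m‖]
  have h2 : ∑' m, ‖g m‖ ^ 2 * E m = ‖∑ n₁ ∈ S, ∑ n₂ ∈ S, c n₁ * conj (c n₂) * Θ n₁ n₂‖ := by
    rw [← htot, Complex.norm_real, Real.norm_of_nonneg]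
    exact tsum_nonneg fun _ => mul_nonneg (by positivity) (Real.exp_pos _).le
  have h3 : ∑ n₁ ∈ S, ∑ n₂ ∈ S, c n₁ * conj (c n₂) * Θ n₁ n₂ =
      ∑ d ∈ ps X, ∑ e ∈ divs d, ∑ f ∈ pone X, (mob e : ℂ) * (mob f : ℂ) *
      ∑ a ∈ Sf S X d f, ∑ b ∈ Sf S X d f, c (d * a) * conj (c (d * b)) * Wt χ M e a b := by
    rw [gcd_sum hSX]
    refine Finset.sum_congr rfl fun d hd => ?_
    rw [← mob_sum (fun e a b => c (d * a) * conj (c (d * b)) * Wt χ M e a b)]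
    refine Finset.sum_congr rfl fun a ha => Finset.sum_congr rfl fun b hb => ?_
    split_ifs with hab
    · rw [hΘ]; beta_reduce
      rw [theta_formula hχ hM0 (mem_ps.1 (mem_Sd.1 ha).1).1 (mem_ps.1 (mem_Sd.1 hb).1).1 hab
        (mem_ps.1 hd).1, Finset.mul_sum]
      exact Finset.sum_congr rfl fun e _ => by ring
    · rfl
  set Q : ℝ := C * N ^ (3 * ε) * RQ α β M N with hQ
  have hQ0 : 0 ≤ Q := by positivity
  have hmob : ∀ e, ‖(mob e : ℂ)‖ = 1 := fun e => by
    rw [Complex.norm_real, Real.norm_eq_abs, abs_mob]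
  have h4 : ‖∑ n₁ ∈ S, ∑ n₂ ∈ S, c n₁ * conj (c n₂) * Θ n₁ n₂‖ ≤
      ∑ d ∈ ps X, ∑ e ∈ divs d, ∑ f ∈ pone X, ∑ a ∈ Sf S X d f, Q * ‖c (d * a)‖ ^ 2 := by
    rw [h3]
    refine (norm_sum_le _ _).trans (Finset.sum_le_sum fun d hd => ?_)
    refine (norm_sum_le _ _).trans (Finset.sum_le_sum fun e he => ?_)
    refine (norm_sum_le _ _).trans (Finset.sum_le_sum fun f _ => ?_)
    rw [norm_mul, norm_mul, hmob, hmob, one_mul, one_mul, ← Finset.mul_sum]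
    refine hW χ hχ M N hM hN d e (mem_ps.1 hd).1 he _ ?_ (fun a => c (d * a))
    intro a ha
    have ha' := mem_Sd.1 (Finset.mem_filter.1 ha).1
    exact ⟨(mem_ps.1 ha'.1).1, (hS _ ha'.2).2⟩
  have h5 := Sf_sum_le hC₁ hε hdiv hX1 hSX (fun n => Q * ‖c n‖ ^ 2) (fun n => by positivity)
  rw [← Finset.mul_sum] at h5
  have h6 : (C₁ * X ^ ε) ^ 3 ≤ (2 * C₁) ^ 3 * N ^ (3 * ε) := by
    have : X ^ ε ≤ 2 * N ^ ε := by
      rw [hX, Real.mul_rpow (by norm_num) hN0.le]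
      refine mul_le_mul_of_nonneg_right ?_ (by positivity)
      calc (5 / 4 : ℝ) ^ ε ≤ (5 / 4 : ℝ) ^ (1 : ℝ) :=
            Real.rpow_le_rpow_of_exponent_le (by norm_num) hε1
        _ ≤ 2 := by norm_num
    have e3 : N ^ (3 * ε) = (N ^ ε) ^ 3 := by
      rw [mul_comm, Real.rpow_mul hN0.le]; norm_num
    rw [e3, ← mul_pow]
    refine pow_le_pow_left₀ (by positivity) ?_ 3
    nlinarith
  have e6 : N ^ (6 * ε) = N ^ (3 * ε) * N ^ (3 * ε) := by
    rw [← Real.rpow_add hN0]; congr 1; ring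
  set V : ℝ := ∑ n ∈ S, ‖c n‖ ^ 2 with hV
  have hV0 : 0 ≤ V := Finset.sum_nonneg fun _ _ => by positivity
  calc _ ≤ Real.exp Real.pi * ((C₁ * X ^ ε) ^ 3 * (Q * V)) := by
        refine h1.trans (mul_le_mul_of_nonneg_left ?_ (Real.exp_pos _).le)
        rw [h2]
        exact h4.trans h5
    _ ≤ Real.exp Real.pi * ((2 * C₁) ^ 3 * N ^ (3 * ε) * (Q * V)) := by gcongr
    _ = _ := by rw [hQ, e6]; ring

end rec3

section iter

lemma RQ_mono {α β : Fin 3 → ℝ} (hA : Adm α β) {M N N' : ℝ} (hM : 0 < M) (hN : 0 < N)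
    (h : N ≤ N') : RQ α β M N ≤ RQ α β M N' := by
  rw [RQ, RQ]
  gcongr with i
  linarith [hA.h1 i]

lemma RQ_nonneg {α β : Fin 3 → ℝ} {M N : ℝ} (hM : 0 < M) (hN : 0 < N) : 0 ≤ RQ α β M N := by
  rw [RQ]
  have : 0 ≤ ∑ i, M ^ (1 - α i) * N ^ (2 * α i + β i - 1) :=
    Finset.sum_nonneg fun _ _ => by positivity
  linarith

lemma rec_full {α β : Fin 3 → ℝ} (hA : Adm α β) (hB : BH α β) {ε : ℝ} (hε : 0 < ε) :
    ∃ C : ℝ, 0 ≤ C ∧ ∀ χ, IsCubicSymbol χ → ∀ M N : ℝ, 1 ≤ M → 1 ≤ N →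
      LS χ M N (C * N ^ ε * RQ α β M N) := by
  classical
  set δ : ℝ := min (ε / 11) 1 with hδ
  have hδ0 : 0 < δ := by positivity
  have hδ1 : δ ≤ 1 := min_le_right _ _
  have hδε : 11 * δ ≤ ε := by have := min_le_left (ε / 11) 1; linarith
  obtain ⟨C, hC, h⟩ := rec_shell hA hB hδ0 hδ1
  refine ⟨(1 / δ + 1) * C, by positivity, fun χ hχ M N hM hN => ?_⟩
  have hM0 : 0 < M := by linarith
  have hN0 : 0 < N := by linarith
  have hRQ := RQ_nonneg (α := α) (β := β) hM0 hN0
  set D : ℝ := C * N ^ (6 * δ) * RQ α β M N with hD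
  have hD0 : 0 ≤ D := by positivity
  let R : ℕ → Finset Eis := fun i => (ps N).filter
    (fun n => (5 / 4 : ℝ) ^ i ≤ Nm n ∧ Nm n ≤ 5 / 4 * (5 / 4) ^ i)
  set J : ℕ := ⌊(N ^ 5) ^ δ / δ⌋₊ + 1 with hJ
  have hN5 : 1 ≤ N ^ 5 := one_le_pow₀ hN
  have hR : ∀ i ∈ Finset.range J, LSI (R i) (ps M) (fun n m => cx χ n m) D := by
    intro i _
    rcases (R i).eq_empty_or_nonempty with h0 | ⟨n, hn⟩
    · rw [h0]; exact LSI.of_empty hD0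
    have h1i : (1 : ℝ) ≤ (5 / 4) ^ i := one_le_pow₀ (by norm_num)
    have hiN : (5 / 4 : ℝ) ^ i ≤ N := by
      have := Finset.mem_filter.1 hn
      exact this.2.1.trans (mem_ps.1 this.1).2
    have h1 := h χ hχ M ((5 / 4) ^ i) hM h1i (R i) (fun n hn => by
      have := Finset.mem_filter.1 hn
      exact ⟨(mem_ps.1 this.1).1, this.2⟩)
    refine LSI.mono ?_ ?_ (D := C * ((5 / 4) ^ i) ^ (6 * δ) * RQ α β M ((5 / 4) ^ i))
    · exact h1.dual (mul_nonneg (by positivity) (RQ_nonneg hM0 (by positivity)))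
    · have := RQ_mono hA hM0 (by positivity) hiN
      have h0 := RQ_nonneg (α := α) (β := β) hM0 (N := (5 / 4) ^ i) (by positivity)
      rw [hD]
      gcongr
  have hcov : ∀ n ∈ ps N, ∃ i ∈ Finset.range J, ∃ r ∈ R i, (fun _ x => x : ℕ → Eis → Eis) i r = n := by
    intro n hn
    obtain ⟨hn1, hn2⟩ := mem_ps.1 hn
    obtain ⟨i, hi1, hi2⟩ := exists_nat_pow_near hn1.one_le (by norm_num : (1 : ℝ) < 5 / 4)
    refine ⟨i, Finset.mem_range.2 ?_, n, Finset.mem_filter.2 ⟨hn, hi1, ?_⟩, rfl⟩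
    · apply pow_bound hδ0 hN5
      calc (3 : ℝ) ^ i ≤ ((5 / 4) ^ 5) ^ i := by gcongr; norm_num
        _ = ((5 / 4) ^ i) ^ 5 := by rw [← pow_mul, ← pow_mul, mul_comm]
        _ ≤ N ^ 5 := by gcongr; linarith
    · rw [pow_succ] at hi2; linarith
  have hfin := LSI.cover (Finset.range J) R (fun _ x => x) hcov hR (le_refl _)
  have hfin2 := LSI.dual hfin (by rw [Finset.sum_const]; positivity)
  refine LSI.mono hfin2 ?_
  rw [Finset.sum_const, Finset.card_range, nsmul_eq_mul]
  have e5 : (N ^ 5) ^ δ = N ^ (5 * δ) := by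
    rw [Real.rpow_mul hN0.le]; norm_num
  have hJ1 : (J : ℝ) ≤ (1 / δ + 1) * N ^ (5 * δ) := by
    rw [hJ, Nat.cast_add, Nat.cast_one]
    have h1 := Nat.floor_le (show 0 ≤ (N ^ 5) ^ δ / δ by positivity)
    have h2 : 1 ≤ N ^ (5 * δ) := Real.one_le_rpow hN (by positivity)
    rw [e5] at h1 ⊢
    have : (1 / δ + 1) * N ^ (5 * δ) = N ^ (5 * δ) / δ + N ^ (5 * δ) := by ring
    linarith
  have e6 : N ^ (5 * δ) * N ^ (6 * δ) ≤ N ^ ε := by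
    rw [← Real.rpow_add hN0]
    exact Real.rpow_le_rpow_of_exponent_le hN (by linarith)
  calc (J : ℝ) * D ≤ ((1 / δ + 1) * N ^ (5 * δ)) * D := by gcongr
    _ = (1 / δ + 1) * C * (N ^ (5 * δ) * N ^ (6 * δ)) * RQ α β M N := by rw [hD]; ring
    _ ≤ _ := by gcongr

lemma rpow_le_mul_rpow {M N ε : ℝ} (hM : 1 ≤ M) (hN : 1 ≤ N) (hε : 0 < ε) :
    N ^ ε ≤ (M * N) ^ ε := by
  refine Real.rpow_le_rpow (by linarith) ?_ hε.le
  nlinarith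

lemma HX_two : HX 2 := by
  intro ε hε
  have hA : Adm (fun _ => 1) (fun _ => 1) :=
    ⟨fun _ => by norm_num, fun _ => by norm_num, fun _ => by norm_num, fun _ => by norm_num,
      fun _ => by norm_num⟩
  obtain ⟨C, hC, h⟩ := rec_full hA BH_trivial hε
  refine ⟨3 * C, by positivity, fun χ hχ M N hM hN => LSI.mono (h χ hχ M N hM hN) ?_⟩
  have hM0 : 0 < M := by linarith
  have hN0 : 0 < N := by linarith
  have h1 : RQ (fun _ => 1) (fun _ => 1) M N ≤ 3 * (M + N ^ (2 : ℝ) + (M * N) ^ (2 / 3 : ℝ)) := by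
    have : RQ (fun _ => 1) (fun _ => 1) M N = M + 3 * N ^ (2 : ℝ) := by
      rw [RQ]; norm_num
    rw [this]
    have : 0 < (M * N) ^ (2 / 3 : ℝ) := by positivity
    linarith
  calc C * N ^ ε * RQ (fun _ => 1) (fun _ => 1) M N
      ≤ C * (M * N) ^ ε * (3 * (M + N ^ (2 : ℝ) + (M * N) ^ (2 / 3 : ℝ))) := by
        refine mul_le_mul (mul_le_mul_of_nonneg_left (rpow_le_mul_rpow hM hN hε) hC) h1
          (RQ_nonneg hM0 hN0) (by positivity)
    _ = _ := by ring

lemma HX_step {ξ : ℝ} (h1 : 4 / 3 ≤ ξ) (h2 : ξ ≤ 2) (h : HX ξ) :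
    HX ((6 * ξ - 4) / (3 * ξ - 1)) := by
  intro ε hε
  have hA : Adm (aX ξ) bX := by
    constructor <;> intro i <;> fin_cases i <;> simp [aX, bX] <;> linarith
  obtain ⟨C, hC, hL⟩ := rec_full hA (BH_of_HX (by linarith) h) hε
  refine ⟨4 * C, by positivity, fun χ hχ M N hM hN => ?_⟩
  have hM0 : 0 < M := by linarith
  have hN0 : 0 < N := by linarith
  set β : ℝ := (6 * ξ - 5) / (3 * ξ - 1) with hβ
  set ξ' : ℝ := (6 * ξ - 4) / (3 * ξ - 1) with hξ'
  have hd : 0 < 3 * ξ - 1 := by linarith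
  have hd' : 3 * ξ - 1 ≠ 0 := hd.ne'
  have hβ1 : 1 ≤ β := by rw [hβ, le_div_iff₀ hd]; linarith
  have hβ2 : β ≤ 2 := by rw [hβ, div_le_iff₀ hd]; linarith
  have hx1 : ξ' = (1 + β) * (2 / 3) := by
    have k1 : β * (3 * ξ - 1) = 6 * ξ - 5 := div_mul_cancel₀ _ hd'
    have k2 : ξ' * (3 * ξ - 1) = 6 * ξ - 4 := div_mul_cancel₀ _ hd'
    refine mul_right_cancel₀ hd' ?_
    linear_combination k2 - (2 / 3) * k1
  have hx2 : β * (1 - ξ) + (2 * ξ - 1) = ξ' := by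
    have k1 : β * (3 * ξ - 1) = 6 * ξ - 5 := div_mul_cancel₀ _ hd'
    have k2 : ξ' * (3 * ξ - 1) = 6 * ξ - 4 := div_mul_cancel₀ _ hd'
    refine mul_right_cancel₀ hd' ?_
    linear_combination (1 - ξ) * k1 - k2
  clear_value β ξ'
  set M' : ℝ := max M (N ^ β) with hM'
  have hMM : M ≤ M' := le_max_left _ _
  have hNM : N ^ β ≤ M' := le_max_right _ _
  have hM'0 : 0 < M' := by linarith
  have hLS := hL χ hχ M' N (by linarith) hN
  refine LSI.mono (LSI.left hLS (ps_mono hMM)) ?_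
  have hNN : N ≤ M' := by
    refine le_trans ?_ hNM
    calc N = N ^ (1 : ℝ) := (Real.rpow_one N).symm
      _ ≤ N ^ β := Real.rpow_le_rpow_of_exponent_le hN hβ1
  have hββ : N ^ β ≤ N ^ ξ' := Real.rpow_le_rpow_of_exponent_le hN (by linarith)
  have eRQ : RQ (aX ξ) bX M' N = M' + (M' ^ (2 / 3 : ℝ) * N ^ (2 / 3 : ℝ) +
      M' ^ (1 - ξ) * N ^ (2 * ξ - 1) + M' ^ (1 / 3 : ℝ) * N) := by
    rw [RQ, Fin.sum_univ_three]
    have A0 : aX ξ 0 = 1 / 3 := rfl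
    have A1 : aX ξ 1 = ξ := rfl
    have A2 : aX ξ 2 = 2 / 3 := rfl
    have B0 : bX 0 = 1 := rfl
    have B1 : bX 1 = 0 := rfl
    have B2 : bX 2 = 2 / 3 := rfl
    rw [A0, A1, A2, B0, B1, B2]
    norm_num
  have a1 : M' ≤ M + N ^ ξ' := by
    have : M' ≤ M + N ^ β := by
      refine max_le ?_ ?_
      · have : 0 < N ^ β := by positivity
        linarith
      · linarith
    linarith
  have a2 : M' ^ (2 / 3 : ℝ) * N ^ (2 / 3 : ℝ) ≤ N ^ ξ' + (M * N) ^ (2 / 3 : ℝ) := by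
    rw [← Real.mul_rpow hM'0.le hN0.le]
    have : 0 < N ^ ξ' := by positivity
    have : 0 < (M * N) ^ (2 / 3 : ℝ) := by positivity
    rcases max_cases M (N ^ β) with ⟨h, _⟩ | ⟨h, _⟩
    · rw [hM', h]; linarith
    · rw [hM', h]
      have : (N ^ β * N) ^ (2 / 3 : ℝ) = N ^ ξ' := by
        rw [hx1, Real.rpow_mul hN0.le, add_comm, Real.rpow_add hN0, Real.rpow_one]
      linarith
  have a3 : M' ^ (1 - ξ) * N ^ (2 * ξ - 1) ≤ N ^ ξ' := by
    have : M' ^ (1 - ξ) ≤ (N ^ β) ^ (1 - ξ) :=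
      Real.rpow_le_rpow_of_nonpos (by positivity) hNM (by linarith)
    calc _ ≤ (N ^ β) ^ (1 - ξ) * N ^ (2 * ξ - 1) := by gcongr
      _ = N ^ ξ' := by rw [← Real.rpow_mul hN0.le, ← Real.rpow_add hN0, hx2]
  have a4 : M' ^ (1 / 3 : ℝ) * N ≤ M' ^ (2 / 3 : ℝ) * N ^ (2 / 3 : ℝ) := by
    have e1 : M' ^ (2 / 3 : ℝ) = M' ^ (1 / 3 : ℝ) * M' ^ (1 / 3 : ℝ) := by
      rw [← Real.rpow_add hM'0]; norm_num
    have e2 : N = N ^ (1 / 3 : ℝ) * N ^ (2 / 3 : ℝ) := by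
      rw [← Real.rpow_add hN0]; norm_num
    have e3 : N ^ (1 / 3 : ℝ) ≤ M' ^ (1 / 3 : ℝ) := Real.rpow_le_rpow hN0.le hNN (by norm_num)
    calc M' ^ (1 / 3 : ℝ) * N = M' ^ (1 / 3 : ℝ) * (N ^ (1 / 3 : ℝ) * N ^ (2 / 3 : ℝ)) := by rw [← e2]
      _ ≤ M' ^ (1 / 3 : ℝ) * (M' ^ (1 / 3 : ℝ) * N ^ (2 / 3 : ℝ)) := by gcongr
      _ = _ := by rw [e1]; ring
  have hR : RQ (aX ξ) bX M' N ≤ 4 * (M + N ^ ξ' + (M * N) ^ (2 / 3 : ℝ)) := by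
    rw [eRQ]
    have : 0 < (M * N) ^ (2 / 3 : ℝ) := by positivity
    linarith
  calc C * N ^ ε * RQ (aX ξ) bX M' N
      ≤ C * (M * N) ^ ε * (4 * (M + N ^ ξ' + (M * N) ^ (2 / 3 : ℝ))) := by
        refine mul_le_mul (mul_le_mul_of_nonneg_left (rpow_le_mul_rpow hM hN hε) hC) hR
          (RQ_nonneg hM'0 hN0) (by positivity)
    _ = _ := by ring

lemma HX_seq (n : ℕ) : ∃ ξ : ℝ, 4 / 3 ≤ ξ ∧ ξ ≤ 2 ∧ ξ ≤ 4 / 3 + (2 / 3) ^ n ∧ HX ξ := by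
  induction n with
  | zero => exact ⟨2, by norm_num, le_rfl, by norm_num, HX_two⟩
  | succ n ih =>
    obtain ⟨ξ, h1, h2, h3, h4⟩ := ih
    have hd : 0 < 3 * ξ - 1 := by linarith
    have hd' : 3 * ξ - 1 ≠ 0 := hd.ne'
    have e : (6 * ξ - 4) / (3 * ξ - 1) = 4 / 3 + 2 * (ξ - 4 / 3) / (3 * ξ - 1) := by
      rw [div_eq_iff hd', add_mul, div_mul_cancel₀ _ hd']; ring
    have h5 : 2 * (ξ - 4 / 3) / (3 * ξ - 1) ≤ 2 / 3 * (ξ - 4 / 3) := by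
      rw [div_le_iff₀ hd]; nlinarith
    have h6 : 0 ≤ 2 * (ξ - 4 / 3) / (3 * ξ - 1) := div_nonneg (by linarith) hd.le
    refine ⟨_, ?_, ?_, ?_, HX_step h1 h2 h4⟩
    · rw [e]; linarith
    · rw [e]; linarith
    · rw [e, pow_succ]; linarith

lemma HX_final : HX (4 / 3) := by
  intro ε hε
  obtain ⟨n, hn⟩ := exists_pow_lt_of_lt_one (half_pos hε) (by norm_num : (2 / 3 : ℝ) < 1)
  obtain ⟨ξ, h1, h2, h3, h4⟩ := HX_seq n
  obtain ⟨C, hC, hL⟩ := h4 (ε / 2) (half_pos hε)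
  refine ⟨C, hC, fun χ hχ M N hM hN => LSI.mono (hL χ hχ M N hM hN) ?_⟩
  have hM0 : 0 < M := by linarith
  have hN0 : 0 < N := by linarith
  have k1 : 1 ≤ N ^ (ε / 2) := Real.one_le_rpow hN (by linarith)
  have k2 : N ^ ξ ≤ N ^ (ε / 2) * N ^ (4 / 3 : ℝ) := by
    rw [← Real.rpow_add hN0]
    exact Real.rpow_le_rpow_of_exponent_le hN (by linarith)
  have k3 : M + N ^ ξ + (M * N) ^ (2 / 3 : ℝ) ≤
      (M * N) ^ (ε / 2) * (M + N ^ (4 / 3 : ℝ) + (M * N) ^ (2 / 3 : ℝ)) := by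
    have k4 := rpow_le_mul_rpow hM hN (half_pos hε)
    have : 0 < N ^ (4 / 3 : ℝ) := by positivity
    have : 0 < (M * N) ^ (2 / 3 : ℝ) := by positivity
    nlinarith
  calc _ ≤ C * (M * N) ^ (ε / 2) *
        ((M * N) ^ (ε / 2) * (M + N ^ (4 / 3 : ℝ) + (M * N) ^ (2 / 3 : ℝ))) := by gcongr
    _ = C * ((M * N) ^ (ε / 2) * (M * N) ^ (ε / 2)) *
        (M + N ^ (4 / 3 : ℝ) + (M * N) ^ (2 / 3 : ℝ)) := by ring
    _ = _ := by rw [← Real.rpow_add (by positivity)]; norm_num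

/-- the large sieve quantity -/
def GQ (Q L : ℝ) : ℝ := Q + L + (Q * L) ^ (2 / 3 : ℝ)

/-- Heath-Brown's cubic large sieve. -/
theorem cubic_large_sieve {ε : ℝ} (hε : 0 < ε) : ∃ C : ℝ, 0 ≤ C ∧ ∀ χ, IsCubicSymbol χ →
    ∀ Q L : ℝ, 1 ≤ Q → 1 ≤ L → LS χ Q L (C * (Q * L) ^ ε * GQ Q L) := by
  obtain ⟨C, hC, h⟩ := HX_final ε hε
  have key : ∀ χ, IsCubicSymbol χ → ∀ Q L : ℝ, 1 ≤ L → L ≤ Q →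
      LS χ Q L (2 * C * (Q * L) ^ ε * GQ Q L) := by
    intro χ hχ Q L h1 h2
    have hQ0 : 0 < Q := by linarith
    have hL0 : 0 < L := by linarith
    refine LSI.mono (h χ hχ Q L (by linarith) h1) ?_
    have k1 : L ^ (4 / 3 : ℝ) ≤ (Q * L) ^ (2 / 3 : ℝ) := by
      calc L ^ (4 / 3 : ℝ) = (L * L) ^ (2 / 3 : ℝ) := by
            rw [Real.mul_rpow hL0.le hL0.le, ← Real.rpow_add hL0]; norm_num
        _ ≤ _ := by gcongr
    have : 0 < (Q * L) ^ (2 / 3 : ℝ) := by positivity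
    calc _ ≤ C * (Q * L) ^ ε * (2 * GQ Q L) := by
          refine mul_le_mul_of_nonneg_left ?_ (by positivity)
          rw [GQ]; linarith
      _ = _ := by ring
  refine ⟨2 * C, by positivity, fun χ hχ Q L hQ hL => ?_⟩
  rcases le_total L Q with h1 | h1
  · exact key χ hχ Q L hL h1
  · have h2 := key χ hχ L Q hQ h1
    have : 0 ≤ 2 * C * (L * Q) ^ ε * GQ L Q := by
      rw [GQ]; positivity
    refine LSI.mono (LS.symm hχ h2 this) (le_of_eq ?_)
    rw [GQ, GQ, mul_comm L Q, add_comm L Q]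

end iter

section weighted

lemma wcs {ι : Type*} (I : Finset ι) (w : ι → ℝ) (hw : ∀ i ∈ I, 0 < w i) (f : ι → ℂ) :
    ‖∑ i ∈ I, f i‖ ^ 2 ≤ (∑ i ∈ I, w i) * ∑ i ∈ I, (w i)⁻¹ * ‖f i‖ ^ 2 := by
  rcases I.eq_empty_or_nonempty with rfl | hI
  · simp
  have h1 := Finset.sq_sum_div_le_sum_sq_div I (fun i => ‖f i‖) hw
  have h2 : 0 < ∑ i ∈ I, w i := Finset.sum_pos hw hI
  rw [div_le_iff₀ h2] at h1
  have h3 : ‖∑ i ∈ I, f i‖ ^ 2 ≤ (∑ i ∈ I, ‖f i‖) ^ 2 := by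
    gcongr; exact norm_sum_le _ _
  refine h3.trans (h1.trans (le_of_eq ?_))
  rw [mul_comm]
  congr 1
  exact Finset.sum_congr rfl fun i _ => by rw [div_eq_inv_mul]

lemma GQ_mono {Q L L' : ℝ} (hQ : 0 ≤ Q) (hL : 0 ≤ L) (h : L ≤ L') : GQ Q L ≤ GQ Q L' := by
  rw [GQ, GQ]; gcongr

lemma GQ_nonneg {Q L : ℝ} (hQ : 0 ≤ Q) (hL : 0 ≤ L) : 0 ≤ GQ Q L := by
  rw [GQ]; positivity

lemma GQ_scale {Q L t : ℝ} (hQ : 0 ≤ Q) (hL : 0 ≤ L) (ht : 1 ≤ t) :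
    GQ Q (t * L) ≤ t * GQ Q L := by
  have h1 : (Q * (t * L)) ^ (2 / 3 : ℝ) ≤ t * (Q * L) ^ (2 / 3 : ℝ) := by
    rw [show Q * (t * L) = t * (Q * L) by ring, Real.mul_rpow (by linarith) (by positivity)]
    gcongr
    exact Real.rpow_le_self_of_one_le ht (by norm_num)
  rw [GQ, GQ]
  nlinarith

lemma GQ_le {Q L x : ℝ} (hQ : 0 ≤ Q) (hL : 0 < L) (hx : 0 ≤ x) :
    GQ Q x ≤ (1 + x / L) * GQ Q L := by
  have h : x ≤ (1 + x / L) * L := by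
    rw [add_mul, div_mul_cancel₀ _ hL.ne']; linarith
  refine (GQ_mono hQ hx h).trans (GQ_scale hQ hL.le ?_)
  have : 0 ≤ x / L := by positivity
  linarith

set_option maxHeartbeats 1000000 in
/-- large sieve with weights, dyadic version -/
lemma WLS1 {ε : ℝ} (hε : 0 < ε) : ∃ C : ℝ, 0 ≤ C ∧ ∀ χ, IsCubicSymbol χ → ∀ Q : ℝ, 1 ≤ Q →
    ∀ T : Finset Eis, (∀ m ∈ T, PS m) → ∀ y : Eis → ℂ,
    ∑ q ∈ ps Q, ‖∑ m ∈ T, y m * cx χ q m‖ ^ 2 ≤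
      C * Q ^ ε * ∑ m ∈ T, ‖y m‖ ^ 2 * (Nm m ^ ε * GQ Q (Nm m)) := by
  classical
  obtain ⟨C, hC, hLS⟩ := cubic_large_sieve (half_pos hε)
  set r : ℝ := 2 ^ (-(ε / 2)) with hr
  have hr0 : 0 < r := by positivity
  have hr1 : r < 1 := Real.rpow_lt_one_of_one_lt_of_neg (by norm_num) (by linarith)
  have hsum := summable_geometric_of_lt_one hr0.le hr1
  set W : ℝ := ∑' n : ℕ, r ^ n with hW
  have hW0 : 0 ≤ W := tsum_nonneg fun n => by positivity
  clear_value W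
  refine ⟨W * (C * 2 ^ (ε / 2) * 2), by positivity, fun χ hχ Q hQ T hT y => ?_⟩
  have hQ0 : 0 < Q := by linarith
  set j : Eis → ℕ := fun m => Nat.log 2 ⌊Nm m⌋₊ with hj
  have hj1 : ∀ m ∈ T, (2 : ℝ) ^ j m ≤ Nm m ∧ Nm m ≤ 2 ^ (j m + 1) := by
    intro m hm
    have h1 : 1 ≤ Nm m := (hT m hm).one_le
    have h2 : ⌊Nm m⌋₊ ≠ 0 := (Nat.floor_pos.2 h1).ne'
    constructor
    · have := Nat.pow_log_le_self 2 h2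
      calc (2 : ℝ) ^ j m = ((2 ^ j m : ℕ) : ℝ) := by push_cast; rfl
        _ ≤ (⌊Nm m⌋₊ : ℝ) := by exact_mod_cast this
        _ ≤ _ := Nat.floor_le (by linarith)
    · have := Nat.lt_pow_succ_log_self (b := 2) (by norm_num) ⌊Nm m⌋₊
      have h3 : ((⌊Nm m⌋₊ + 1 : ℕ) : ℝ) ≤ ((2 ^ (j m + 1) : ℕ) : ℝ) := by exact_mod_cast this
      push_cast at h3
      exact (Nat.lt_floor_add_one _).le.trans h3
  clear_value j
  set I := T.image j with hI
  have hmap : ∀ m ∈ T, j m ∈ I := fun m hm => Finset.mem_image_of_mem _ hm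
  set f : Eis → ℕ → ℂ := fun q i => ∑ m ∈ T with j m = i, y m * cx χ q m with hf
  have e1 : ∀ q, ∑ m ∈ T, y m * cx χ q m = ∑ i ∈ I, f q i := fun q =>
    (Finset.sum_fiberwise_of_maps_to hmap _).symm
  have b1 : ∀ q, ‖∑ m ∈ T, y m * cx χ q m‖ ^ 2 ≤ W * ∑ i ∈ I, (r ^ i)⁻¹ * ‖f q i‖ ^ 2 := by
    intro q
    rw [e1]
    refine (wcs I (fun i => r ^ i) (fun i _ => by positivity) _).trans ?_
    refine mul_le_mul_of_nonneg_right ?_ (Finset.sum_nonneg fun _ _ => by positivity)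
    rw [hW]
    exact hsum.sum_le_tsum _ fun n _ => by positivity
  have b2 : ∀ i ∈ I, ∑ q ∈ ps Q, ‖f q i‖ ^ 2 ≤
      C * (Q * 2 ^ (i + 1)) ^ (ε / 2) * GQ Q (2 ^ (i + 1)) * ∑ m ∈ T with j m = i, ‖y m‖ ^ 2 := by
    intro i _
    have h1 := hLS χ hχ Q (2 ^ (i + 1)) hQ (one_le_pow₀ (by norm_num))
    have h2 : LSI (ps Q) (ps (2 ^ (i + 1))) (fun q m => cx χ q m) _ :=
      h1.congr fun q hq m hm => cx_recip hχ (mem_ps.1 hm).1.1 (mem_ps.1 hq).1.1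
    have h3 := h2.right (T' := {m ∈ T | j m = i}) (by
      intro m hm
      rw [Finset.mem_filter] at hm
      rw [mem_ps]
      refine ⟨hT m hm.1, ?_⟩
      have := (hj1 m hm.1).2
      rwa [hm.2] at this)
    exact h3 y
  calc ∑ q ∈ ps Q, ‖∑ m ∈ T, y m * cx χ q m‖ ^ 2
      ≤ ∑ q ∈ ps Q, W * ∑ i ∈ I, (r ^ i)⁻¹ * ‖f q i‖ ^ 2 := Finset.sum_le_sum fun q _ => b1 q
    _ = W * ∑ i ∈ I, (r ^ i)⁻¹ * ∑ q ∈ ps Q, ‖f q i‖ ^ 2 := by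
        rw [← Finset.mul_sum, Finset.sum_comm]
        simp_rw [Finset.mul_sum]
    _ ≤ W * ∑ i ∈ I, (r ^ i)⁻¹ * (C * (Q * 2 ^ (i + 1)) ^ (ε / 2) * GQ Q (2 ^ (i + 1)) *
          ∑ m ∈ T with j m = i, ‖y m‖ ^ 2) := by
        refine mul_le_mul_of_nonneg_left (Finset.sum_le_sum fun i hi => ?_) hW0
        exact mul_le_mul_of_nonneg_left (b2 i hi) (by positivity)
    _ = W * ∑ m ∈ T, (r ^ j m)⁻¹ * (C * (Q * 2 ^ (j m + 1)) ^ (ε / 2) * GQ Q (2 ^ (j m + 1)) *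
          ‖y m‖ ^ 2) := by
        rw [← Finset.sum_fiberwise_of_maps_to hmap]
        congr 1
        refine Finset.sum_congr rfl fun i _ => ?_
        rw [Finset.mul_sum, Finset.mul_sum]
        refine Finset.sum_congr rfl fun m hm => ?_
        rw [(Finset.mem_filter.1 hm).2]
    _ ≤ W * ∑ m ∈ T, C * 2 ^ (ε / 2) * 2 * Q ^ ε * (‖y m‖ ^ 2 * (Nm m ^ ε * GQ Q (Nm m))) := by
        refine mul_le_mul_of_nonneg_left (Finset.sum_le_sum fun m hm => ?_) hW0
        have hN1 : 1 ≤ Nm m := (hT m hm).one_le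
        have hN0 : 0 < Nm m := by linarith
        obtain ⟨h1, h2⟩ := hj1 m hm
        have k1 : (r ^ j m)⁻¹ ≤ Nm m ^ (ε / 2) := by
          rw [hr, ← Real.rpow_natCast, ← Real.rpow_mul (by norm_num), ← Real.rpow_neg (by norm_num)]
          calc (2 : ℝ) ^ (-(-(ε / 2) * (j m : ℝ))) = ((2 : ℝ) ^ j m) ^ (ε / 2) := by
                rw [← Real.rpow_natCast, ← Real.rpow_mul (by norm_num)]; congr 1; ring
            _ ≤ _ := by gcongr
        have h3 : (2 : ℝ) ^ (j m + 1) ≤ 2 * Nm m := by rw [pow_succ]; linarith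
        have k2 : (Q * 2 ^ (j m + 1)) ^ (ε / 2) ≤ 2 ^ (ε / 2) * (Q ^ ε * Nm m ^ (ε / 2)) := by
          calc (Q * 2 ^ (j m + 1)) ^ (ε / 2) ≤ (Q * (2 * Nm m)) ^ (ε / 2) := by gcongr
            _ = 2 ^ (ε / 2) * (Q ^ (ε / 2) * Nm m ^ (ε / 2)) := by
                rw [Real.mul_rpow hQ0.le (by positivity), Real.mul_rpow (by norm_num) hN0.le]; ring
            _ ≤ _ := by gcongr <;> linarith
        have k3 : GQ Q (2 ^ (j m + 1)) ≤ 2 * GQ Q (Nm m) :=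
          (GQ_mono hQ0.le (by positivity) h3).trans (GQ_scale hQ0.le hN0.le (by norm_num))
        have g0 := GQ_nonneg hQ0.le hN0.le
        have g1 : 0 ≤ GQ Q (2 ^ (j m + 1)) := GQ_nonneg hQ0.le (by positivity)
        calc (r ^ j m)⁻¹ * (C * (Q * 2 ^ (j m + 1)) ^ (ε / 2) * GQ Q (2 ^ (j m + 1)) * ‖y m‖ ^ 2)
            ≤ Nm m ^ (ε / 2) * (C * (2 ^ (ε / 2) * (Q ^ ε * Nm m ^ (ε / 2))) *
              (2 * GQ Q (Nm m)) * ‖y m‖ ^ 2) := by gcongr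
          _ = C * 2 ^ (ε / 2) * 2 * Q ^ ε * (‖y m‖ ^ 2 *
              ((Nm m ^ (ε / 2) * Nm m ^ (ε / 2)) * GQ Q (Nm m))) := by ring
          _ = _ := by rw [← Real.rpow_add hN0, add_halves]
    _ = _ := by rw [← Finset.mul_sum]; ring

lemma decomp_v {m : Eis} (hm : m ≠ 0) : ∃ v s k m₁ : Eis, v ≠ 0 ∧ Nm v ≤ 3 ∧ s ≠ 0 ∧ k ≠ 0 ∧
    PS m₁ ∧ m = (v * s ^ 2 * k ^ 3) * m₁ := by
  obtain ⟨u, j, c, hu, hc, rfl⟩ := exists_decomp hm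
  obtain ⟨k₁, k₂, k₃, h1, h2, h3, -, rfl⟩ := cubic_decomp c hc
  have hl : lam ≠ 0 := lam_prime.ne_zero
  refine ⟨u * lam ^ (j % 2), lam ^ (j / 2) * k₂, k₃, k₁, mul_ne_zero hu.ne_zero (pow_ne_zero _ hl),
    ?_, mul_ne_zero (pow_ne_zero _ hl) h2.ne_zero, h3.ne_zero, h1, ?_⟩
  · rw [Nm_mul, Nm_unit hu, Nm_pow, Nm_lam]
    rcases Nat.mod_two_eq_zero_or_one j with h | h <;> rw [h] <;> norm_num
  · conv_lhs => rw [← Nat.mod_add_div j 2]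
    ring

lemma sum_powerful {ε : ℝ} (hε : 0 < ε) (T : Finset Eis)
    (hT : ∀ t ∈ T, ∃ v s k : Eis, v ≠ 0 ∧ Nm v ≤ 3 ∧ s ≠ 0 ∧ k ≠ 0 ∧ t = v * s ^ 2 * k ^ 3) :
    ∑ t ∈ T, Nm t ^ (-(1 / 2 + ε)) ≤
      ((bl 3).erase 0).card * (ZE (2 * ε) * ZE (1 / 2 + 3 * ε)) := by
  classical
  have hT' : ∀ t : Eis, ∃ p : Eis × Eis × Eis, t ∈ T → p.1 ≠ 0 ∧ Nm p.1 ≤ 3 ∧ p.2.1 ≠ 0 ∧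
      p.2.2 ≠ 0 ∧ t = p.1 * p.2.1 ^ 2 * p.2.2 ^ 3 := by
    intro t
    by_cases h : t ∈ T
    · obtain ⟨v, s, k, h⟩ := hT t h
      exact ⟨(v, s, k), fun _ => h⟩
    · exact ⟨(0, 0, 0), fun h' => absurd h' h⟩
  choose p hp using hT'
  set I := ((bl 3).erase 0) ×ˢ (T.image fun t => (p t).2.1) with hI
  set R := T.image fun t => (p t).2.2 with hR
  have h1 := sum_cover I (fun _ => R) (fun i r => i.1 * i.2 ^ 2 * r ^ 3) T
    (fun t => Nm t ^ (-(1 / 2 + ε))) (fun t => Real.rpow_nonneg (Nm_nonneg _) _) (by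
      intro t ht
      obtain ⟨a1, a2, a3, a4, a5⟩ := hp t ht
      refine ⟨((p t).1, (p t).2.1), ?_, (p t).2.2, Finset.mem_image_of_mem _ ht, a5.symm⟩
      rw [hI, Finset.mem_product, Finset.mem_erase, mem_bl]
      exact ⟨⟨a1, a2⟩, Finset.mem_image_of_mem _ ht⟩)
  refine h1.trans ?_
  rw [hI, Finset.sum_product]
  have h2 : ∀ v ∈ (bl 3).erase 0, ∑ s ∈ T.image (fun t => (p t).2.1), ∑ k ∈ R,
      Nm (v * s ^ 2 * k ^ 3) ^ (-(1 / 2 + ε)) ≤ ZE (2 * ε) * ZE (1 / 2 + 3 * ε) := by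
    intro v hv
    rw [Finset.mem_erase] at hv
    have h3 : ∀ s k : Eis, Nm (v * s ^ 2 * k ^ 3) ^ (-(1 / 2 + ε)) ≤
        Nm s ^ (-(1 + 2 * ε)) * Nm k ^ (-(1 + (1 / 2 + 3 * ε))) := by
      intro s k
      have e1 : Nm (v * s ^ 2 * k ^ 3) = Nm v * (Nm s ^ 2 * Nm k ^ 3) := by
        rw [Nm_mul, Nm_mul, Nm_pow, Nm_pow]; ring
      have hv1 := one_le_Nm hv.1
      have hs := Nm_nonneg s
      have hk := Nm_nonneg k
      rw [e1, Real.mul_rpow (by linarith) (by positivity),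
        Real.mul_rpow (by positivity) (by positivity), ← Real.rpow_natCast, ← Real.rpow_natCast,
        ← Real.rpow_mul hs, ← Real.rpow_mul hk]
      have e2 : ((2 : ℕ) : ℝ) * -(1 / 2 + ε) = -(1 + 2 * ε) := by push_cast; ring
      have e3 : ((3 : ℕ) : ℝ) * -(1 / 2 + ε) = -(1 + (1 / 2 + 3 * ε)) := by push_cast; ring
      rw [e2, e3]
      refine mul_le_of_le_one_left (by positivity) ?_
      exact Real.rpow_le_one_of_one_le_of_nonpos hv1 (by linarith)
    calc _ ≤ ∑ s ∈ T.image (fun t => (p t).2.1), ∑ k ∈ R,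
          Nm s ^ (-(1 + 2 * ε)) * Nm k ^ (-(1 + (1 / 2 + 3 * ε))) :=
          Finset.sum_le_sum fun s _ => Finset.sum_le_sum fun k _ => h3 s k
      _ = (∑ s ∈ T.image (fun t => (p t).2.1), Nm s ^ (-(1 + 2 * ε))) *
          ∑ k ∈ R, Nm k ^ (-(1 + (1 / 2 + 3 * ε))) := (Finset.sum_mul_sum _ _ _ _).symm
      _ ≤ _ := by
          refine mul_le_mul (sum_le_ZE (by positivity) _) (sum_le_ZE (by positivity) _)
            (Finset.sum_nonneg fun _ _ => Real.rpow_nonneg (Nm_nonneg _) _) (ZE_nonneg _)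
  refine (Finset.sum_le_sum h2).trans ?_
  rw [Finset.sum_const, nsmul_eq_mul]

set_option maxHeartbeats 1000000 in
/-- weighted large sieve over all nonzero elements -/
lemma WLS {ε : ℝ} (hε : 0 < ε) : ∃ C : ℝ, 0 ≤ C ∧ ∀ χ, IsCubicSymbol χ → ∀ Q L A : ℝ,
    1 ≤ Q → 1 ≤ L → 0 ≤ A → ∀ S : Finset Eis, (∀ m ∈ S, m ≠ 0) → ∀ a : Eis → ℂ,
    (∀ m ∈ S, ‖a m‖ ≤ A * (Nm m ^ (-(1 / 2 + ε)) * (1 + Nm m / L)⁻¹)) →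
    ∑ q ∈ ps Q, ‖∑ m ∈ S, a m * cx χ q m‖ ^ 2 ≤ C * A ^ 2 * Q ^ ε * GQ Q L := by
  classical
  obtain ⟨C, hC, hW⟩ := WLS1 hε
  set V : ℝ := ((bl 3).erase 0).card * (ZE (2 * ε) * ZE (1 / 2 + 3 * ε)) with hV
  have hV0 : 0 ≤ V := mul_nonneg (by positivity) (mul_nonneg (ZE_nonneg _) (ZE_nonneg _))
  have hZ := ZE_nonneg ε
  refine ⟨V * (V * (C * ZE ε)), by positivity, fun χ hχ Q L A hQ hL hA S hS a ha => ?_⟩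
  have hQ0 : 0 < Q := by linarith
  have hL0 : 0 < L := by linarith
  have hdec : ∀ m : Eis, ∃ p : Eis × Eis, m ∈ S → (∃ v s k : Eis, v ≠ 0 ∧ Nm v ≤ 3 ∧ s ≠ 0 ∧ k ≠ 0 ∧
      p.1 = v * s ^ 2 * k ^ 3) ∧ PS p.2 ∧ m = p.1 * p.2 := by
    intro m
    by_cases h : m ∈ S
    · obtain ⟨v, s, k, m₁, h1, h2, h3, h4, h5, h6⟩ := decomp_v (hS m h)
      exact ⟨(v * s ^ 2 * k ^ 3, m₁), fun _ => ⟨⟨v, s, k, h1, h2, h3, h4, rfl⟩, h5, h6⟩⟩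
    · exact ⟨(0, 0), fun h' => absurd h' h⟩
  choose p hp using hdec
  set T := S.image (fun m => (p m).1) with hT
  have hmap : ∀ m ∈ S, (p m).1 ∈ T := fun m hm => Finset.mem_image_of_mem _ hm
  have hTne : ∀ t ∈ T, 1 ≤ Nm t := by
    intro t ht
    obtain ⟨m, hm, rfl⟩ := Finset.mem_image.1 ht
    refine one_le_Nm fun h => hS m hm ?_
    rw [(hp m hm).2.2, h, zero_mul]
  have hTV : ∑ t ∈ T, Nm t ^ (-(1 / 2 + ε)) ≤ V := by
    refine sum_powerful hε T fun t ht => ?_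
    obtain ⟨m, hm, rfl⟩ := Finset.mem_image.1 ht
    exact (hp m hm).1
  clear_value V
  set Tf : Eis → Finset Eis := fun t => {m ∈ S | (p m).1 = t}.image (fun m => (p m).2) with hTf
  have hfib : ∀ q ∈ ps Q, ∀ t, ∑ m ∈ S with (p m).1 = t, a m * cx χ q m =
      cx χ q t * ∑ n ∈ Tf t, a (t * n) * cx χ q n := by
    intro q hq t
    rw [hTf, Finset.sum_image, Finset.mul_sum]
    · refine Finset.sum_congr rfl fun m hm => ?_
      rw [Finset.mem_filter] at hm
      have h := (hp m hm.1).2.2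
      rw [hm.2] at h
      rw [← h]
      conv_lhs => rw [h, cx_mul hχ (mem_ps.1 hq).1.1, ← h]
      ring
    · intro m hm m' hm' h
      simp only [Finset.coe_filter, Set.mem_ofPred_eq] at hm hm'
      rw [(hp m hm.1).2.2, (hp m' hm'.1).2.2, hm.2, hm'.2]
      congr 1
  have hTfS : ∀ t, ∀ n ∈ Tf t, PS n ∧ t * n ∈ S := by
    intro t n hn
    obtain ⟨m, hm, rfl⟩ := Finset.mem_image.1 hn
    rw [Finset.mem_filter] at hm
    have h := (hp m hm.1).2
    rw [hm.2] at h
    exact ⟨h.1, h.2 ▸ hm.1⟩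
  clear_value Tf
  have b1 : ∀ q ∈ ps Q, ‖∑ m ∈ S, a m * cx χ q m‖ ^ 2 ≤ V * ∑ t ∈ T, (Nm t ^ (-(1 / 2 + ε)))⁻¹ *
      ‖∑ n ∈ Tf t, a (t * n) * cx χ q n‖ ^ 2 := by
    intro q hq
    rw [← Finset.sum_fiberwise_of_maps_to hmap]
    refine (wcs T (fun t => Nm t ^ (-(1 / 2 + ε)))
      (fun t ht => Real.rpow_pos_of_pos (by linarith [hTne t ht]) _) _).trans ?_
    refine mul_le_mul hTV (Finset.sum_le_sum fun t ht => ?_) (Finset.sum_nonneg fun t _ =>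
      mul_nonneg (inv_nonneg.2 (Real.rpow_nonneg (Nm_nonneg _) _)) (by positivity)) hV0
    rw [hfib q hq, norm_mul]
    have hc := cx_norm_le hχ (mem_ps.1 hq).1.1 t
    refine mul_le_mul_of_nonneg_left ?_ (inv_nonneg.2 (Real.rpow_nonneg (Nm_nonneg _) _))
    have := mul_le_of_le_one_left (norm_nonneg (∑ n ∈ Tf t, a (t * n) * cx χ q n)) hc
    gcongr
  have g0 := GQ_nonneg hQ0.le hL0.le
  have b2 : ∀ t ∈ T, ∑ q ∈ ps Q, ‖∑ n ∈ Tf t, a (t * n) * cx χ q n‖ ^ 2 ≤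
      C * Q ^ ε * ((A * Nm t ^ (-(1 / 2 + ε))) ^ 2 * (GQ Q L * ZE ε)) := by
    intro t ht
    have ht1 := hTne t ht
    refine (hW χ hχ Q hQ (Tf t) (fun n hn => (hTfS t n hn).1) (fun n => a (t * n))).trans ?_
    refine mul_le_mul_of_nonneg_left ?_ (by positivity)
    calc _ ≤ ∑ n ∈ Tf t, (A * Nm t ^ (-(1 / 2 + ε))) ^ 2 * (GQ Q L * Nm n ^ (-(1 + ε))) := by
          refine Finset.sum_le_sum fun n hn => ?_
          obtain ⟨h1, h2⟩ := hTfS t n hn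
          have hn1 := h1.one_le
          have hn0 : 0 < Nm n := by linarith
          have c1 := ha _ h2
          have c2 : 1 + Nm n / L ≤ 1 + Nm (t * n) / L := by
            rw [Nm_mul]; gcongr; nlinarith
          have c4 : 0 < 1 + Nm n / L := by positivity
          have c3 : ‖a (t * n)‖ ≤ (A * Nm t ^ (-(1 / 2 + ε))) *
              (Nm n ^ (-(1 / 2 + ε)) * (1 + Nm n / L)⁻¹) := by
            refine c1.trans ?_
            rw [Nm_mul t n, Real.mul_rpow (by linarith) hn0.le, ← Nm_mul t n]
            calc _ ≤ A * (Nm t ^ (-(1 / 2 + ε)) * Nm n ^ (-(1 / 2 + ε)) * (1 + Nm n / L)⁻¹) := by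
                  gcongr
              _ = _ := by ring
          have c5 := GQ_le hQ0.le hL0 hn0.le
          have c6 : 0 ≤ GQ Q (Nm n) := GQ_nonneg hQ0.le hn0.le
          calc _ ≤ ((A * Nm t ^ (-(1 / 2 + ε))) *
              (Nm n ^ (-(1 / 2 + ε)) * (1 + Nm n / L)⁻¹)) ^ 2 *
              (Nm n ^ ε * ((1 + Nm n / L) * GQ Q L)) := by gcongr
            _ = (A * Nm t ^ (-(1 / 2 + ε))) ^ 2 * (GQ Q L * (Nm n ^ (-(1 / 2 + ε)) *
              Nm n ^ (-(1 / 2 + ε)) * Nm n ^ ε)) * (1 + Nm n / L)⁻¹ := by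
                field_simp
            _ = (A * Nm t ^ (-(1 / 2 + ε))) ^ 2 * (GQ Q L * Nm n ^ (-(1 + ε))) *
                (1 + Nm n / L)⁻¹ := by
                rw [← Real.rpow_add hn0, ← Real.rpow_add hn0]
                congr 5; ring
            _ ≤ _ := by
                refine mul_le_of_le_one_right (by positivity) (inv_le_one_of_one_le₀ ?_)
                have : 0 ≤ Nm n / L := by positivity
                linarith
      _ = (A * Nm t ^ (-(1 / 2 + ε))) ^ 2 * (GQ Q L * ∑ n ∈ Tf t, Nm n ^ (-(1 + ε))) := by
          rw [Finset.mul_sum, Finset.mul_sum]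
      _ ≤ _ := by
          have := sum_le_ZE hε (Tf t)
          gcongr
  calc ∑ q ∈ ps Q, ‖∑ m ∈ S, a m * cx χ q m‖ ^ 2
      ≤ ∑ q ∈ ps Q, V * ∑ t ∈ T, (Nm t ^ (-(1 / 2 + ε)))⁻¹ *
      ‖∑ n ∈ Tf t, a (t * n) * cx χ q n‖ ^ 2 := Finset.sum_le_sum b1
    _ = V * ∑ t ∈ T, (Nm t ^ (-(1 / 2 + ε)))⁻¹ *
      ∑ q ∈ ps Q, ‖∑ n ∈ Tf t, a (t * n) * cx χ q n‖ ^ 2 := by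
        rw [← Finset.mul_sum, Finset.sum_comm]
        simp_rw [Finset.mul_sum]
    _ ≤ V * ∑ t ∈ T, (C * Q ^ ε * (A ^ 2 * (GQ Q L * ZE ε))) * Nm t ^ (-(1 / 2 + ε)) := by
        refine mul_le_mul_of_nonneg_left (Finset.sum_le_sum fun t ht => ?_) hV0
        have ht1 := hTne t ht
        have ht2 : 0 < Nm t ^ (-(1 / 2 + ε)) := Real.rpow_pos_of_pos (by linarith) _
        refine (mul_le_mul_of_nonneg_left (b2 t ht) (by positivity)).trans (le_of_eq ?_)
        field_simp
    _ = V * ((C * Q ^ ε * (A ^ 2 * (GQ Q L * ZE ε))) * ∑ t ∈ T, Nm t ^ (-(1 / 2 + ε))) := by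
        congr 1; rw [Finset.mul_sum]
    _ ≤ V * ((C * Q ^ ε * (A ^ 2 * (GQ Q L * ZE ε))) * V) := by gcongr
    _ = _ := by ring
end weighted

section phi
open MeasureTheory Set

lemma norm_Gamma_le {s : ℂ} (hs : 0 < s.re) : ‖Complex.Gamma s‖ ≤ Real.Gamma s.re := by
  rw [Complex.Gamma_eq_integral hs, Complex.GammaIntegral, Real.Gamma_eq_integral hs]
  refine (norm_integral_le_integral_norm _).trans (le_of_eq ?_)
  refine setIntegral_congr_fun measurableSet_Ioi fun x hx => ?_
  have hx' : (0 : ℝ) < x := hx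
  rw [norm_mul, Complex.norm_cpow_eq_rpow_re_of_pos hx', Complex.norm_real, Real.norm_eq_abs,
    abs_of_pos (Real.exp_pos _)]
  simp

lemma Gamma_vert (t : ℝ) : ‖Complex.Gamma (5 / 2 + t * I)‖ ≤ Real.Gamma (9 / 2) * (1 + t ^ 2)⁻¹ := by
  have e1 : Complex.Gamma (9 / 2 + t * I) =
      (7 / 2 + t * I) * ((5 / 2 + t * I) * Complex.Gamma (5 / 2 + t * I)) := by
    have h1 : (5 / 2 + t * I : ℂ) ≠ 0 := fun h => by
      have := congrArg Complex.re h; simp at this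
    have h2 : (7 / 2 + t * I : ℂ) ≠ 0 := fun h => by
      have := congrArg Complex.re h; simp at this
    rw [← Complex.Gamma_add_one _ h1, show (5 / 2 + t * I + 1 : ℂ) = 7 / 2 + t * I by ring,
      ← Complex.Gamma_add_one _ h2]
    congr 1; ring
  have e2 : ‖Complex.Gamma (9 / 2 + t * I)‖ ≤ Real.Gamma (9 / 2) := by
    refine (norm_Gamma_le (by simp)).trans (le_of_eq ?_)
    congr 1; simp
  have key : ∀ a : ℝ, 1 ≤ a → Real.sqrt (1 + t ^ 2) ≤ ‖(a + t * I : ℂ)‖ := by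
    intro a ha
    rw [Complex.norm_add_mul_I]
    apply Real.sqrt_le_sqrt
    nlinarith
  have k1 := key (7 / 2) (by norm_num)
  have k2 := key (5 / 2) (by norm_num)
  push_cast at k1 k2
  have h0 : 0 < 1 + t ^ 2 := by positivity
  rw [← div_eq_mul_inv, le_div_iff₀ h0]
  refine le_trans ?_ e2
  rw [e1, norm_mul, norm_mul]
  calc ‖Complex.Gamma (5 / 2 + t * I)‖ * (1 + t ^ 2) =
      Real.sqrt (1 + t ^ 2) * (Real.sqrt (1 + t ^ 2) * ‖Complex.Gamma (5 / 2 + t * I)‖) := by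
        rw [← mul_assoc, Real.mul_self_sqrt h0.le]; ring
    _ ≤ _ := by gcongr

lemma Gamma_line_cont : Continuous fun t : ℝ => Complex.Gamma (5 / 2 + t * I) := by
  rw [continuous_iff_continuousAt]
  intro t
  refine ContinuousAt.comp (f := fun t : ℝ => (5 / 2 + t * I : ℂ)) (g := Complex.Gamma) ?_ (by fun_prop)
  refine (Complex.differentiableAt_Gamma _ fun m h => ?_).continuousAt
  have := congrArg Complex.re h
  simp at this
  have : (0 : ℝ) ≤ m := by positivity
  linarith

lemma Gamma_line_int : Integrable fun t : ℝ => Complex.Gamma (5 / 2 + t * I) := by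
  refine Integrable.mono' (integrable_inv_one_add_sq.const_mul (Real.Gamma (9 / 2)))
    Gamma_line_cont.aestronglyMeasurable (Filter.Eventually.of_forall Gamma_vert)

lemma inv_gamma {x : ℝ} (hx : 0 < x) :
    (1 / (2 * Real.pi) : ℂ) * ∫ t : ℝ, (x : ℂ) ^ (-(5 / 2 + t * I)) * Complex.Gamma (5 / 2 + t * I) =
      (Real.exp (-x) : ℝ) := by
  have hm : ∀ t : ℝ, mellin (fun x => ((Real.exp (-x) : ℝ) : ℂ)) (5 / 2 + t * I) =
      Complex.Gamma (5 / 2 + t * I) := by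
    intro t
    rw [Complex.Gamma_eq_integral (by simp), Complex.GammaIntegral_eq_mellin]
  have h := mellinInv_mellin_eq (5 / 2) (fun x => ((Real.exp (-x) : ℝ) : ℂ)) hx
    (by
      have := Complex.GammaIntegral_convergent (s := 5 / 2) (by simp)
      rw [MellinConvergent]
      refine this.congr_fun (fun x _ => ?_) measurableSet_Ioi
      simp [mul_comm])
    (by
      rw [VerticalIntegrable]
      refine Gamma_line_int.congr (Filter.Eventually.of_forall fun t => ?_)
      beta_reduce
      rw [← hm t]; push_cast; rfl) (by fun_prop)
  rw [← h, mellinInv]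
  have e52 : ((5 / 2 : ℝ) : ℂ) = 5 / 2 := by push_cast; rfl
  simp_rw [e52, hm]
  simp only [smul_eq_mul, Complex.real_smul]
  push_cast
  rfl

end phi

section phi2
open MeasureTheory Set

/-- the quadrant measure -/
def mu2 : Measure (ℝ × ℝ) := (volume.restrict (Ioi 0)).prod (volume.restrict (Ioi 0))

instance : SFinite mu2 := by unfold mu2; infer_instance

lemma mu2_ae {p : ℝ × ℝ → Prop} (h : ∀ s v : ℝ, 0 < s → 0 < v → p (s, v)) : ∀ᵐ z ∂mu2, p z := by
  rw [mu2, Measure.prod_restrict]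
  refine (ae_restrict_iff' (measurableSet_Ioi.prod measurableSet_Ioi)).2 ?_
  exact Filter.Eventually.of_forall fun z hz => h z.1 z.2 hz.1 hz.2

/-- the integrand after separation -/
def FF (N₁ N₂ τ : ℝ) (z : (ℝ × ℝ) × ℝ) : ℂ :=
  ((((Real.exp (-(N₁ * z.1.1)) : ℝ) : ℂ) * (z.1.1 : ℂ) ^ ((5 / 2 + z.2 * I) - 1)) *
    Complex.exp (-(z.1.2 * ((5 / 2 + z.2 * I) - 1 / 2)))) *
    (τ * (((N₂ * τ ^ 2 : ℝ) : ℂ) ^ (-(5 / 2 + z.2 * I)) * Complex.Gamma (5 / 2 + z.2 * I)))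

lemma FF_meas (N₁ N₂ τ : ℝ) : Measurable (FF N₁ N₂ τ) := by
  have hG : Measurable fun z : (ℝ × ℝ) × ℝ => Complex.Gamma (5 / 2 + z.2 * I) :=
    Gamma_line_cont.measurable.comp measurable_snd
  unfold FF
  fun_prop

lemma int_base {N₁ : ℝ} (h1 : 0 < N₁) :
    Integrable (fun z : ℝ × ℝ => (Real.exp (-(N₁ * z.1)) * z.1 ^ (3 / 2 : ℝ)) *
      Real.exp (-2 * z.2)) mu2 := by
  have i1 : IntegrableOn (fun s : ℝ => Real.exp (-(N₁ * s)) * s ^ (3 / 2 : ℝ)) (Ioi 0) := by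
    have := integrableOn_rpow_mul_exp_neg_mul_rpow (p := 1) (s := 3 / 2) (b := N₁) (by norm_num)
      (by norm_num) h1
    refine this.congr_fun (fun s hs => ?_) measurableSet_Ioi
    simp [mul_comm]
  have i2 : IntegrableOn (fun v : ℝ => Real.exp (-2 * v)) (Ioi 0) :=
    exp_neg_integrableOn_Ioi 0 (by norm_num)
  exact Integrable.mul_prod i1 i2

lemma FF_int {N₁ N₂ τ : ℝ} (h1 : 0 < N₁) (h2 : 0 < N₂) (ht : 0 < τ) :
    Integrable (FF N₁ N₂ τ) (mu2.prod volume) := by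
  have i3 : Integrable (fun t : ℝ => τ * ((N₂ * τ ^ 2) ^ (-(5 / 2) : ℝ) *
      ‖Complex.Gamma (5 / 2 + t * I)‖)) := (Gamma_line_int.norm.const_mul _).const_mul _
  have i4 := Integrable.mul_prod (int_base h1) i3
  refine Integrable.mono' i4 (FF_meas _ _ _).aestronglyMeasurable ?_
  have : mu2.prod (volume : Measure ℝ) = (volume : Measure ((ℝ × ℝ) × ℝ)).restrict
      ((Ioi 0 ×ˢ Ioi 0) ×ˢ univ) := by
    have h0 : mu2 = (volume : Measure (ℝ × ℝ)).restrict (Ioi 0 ×ˢ Ioi 0) := by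
      rw [mu2, Measure.prod_restrict]; rfl
    rw [h0]
    have h9 := Measure.prod_restrict (μ := (volume : Measure (ℝ × ℝ))) (ν := (volume : Measure ℝ))
      (Ioi 0 ×ˢ Ioi 0) univ
    rw [Measure.restrict_univ] at h9
    exact h9
  rw [this]
  refine (ae_restrict_iff' ((measurableSet_Ioi.prod measurableSet_Ioi).prod .univ)).2 ?_
  refine Filter.Eventually.of_forall fun z hz => le_of_eq ?_
  have hs : 0 < z.1.1 := hz.1.1
  have hY : 0 < N₂ * τ ^ 2 := by positivity
  simp only [FF, norm_mul]
  rw [Complex.norm_cpow_eq_rpow_re_of_pos hs, Complex.norm_cpow_eq_rpow_re_of_pos hY,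
    Complex.norm_real, Real.norm_eq_abs, abs_of_pos (Real.exp_pos _), Complex.norm_exp,
    Complex.norm_real, Real.norm_eq_abs, abs_of_pos ht]
  have e1 : ((5 / 2 + z.2 * I : ℂ) - 1).re = 3 / 2 := by simp; norm_num
  have e2 : (-(5 / 2 + z.2 * I : ℂ)).re = -(5 / 2) := by simp
  have e3 : (-(z.1.2 * ((5 / 2 + z.2 * I) - 1 / 2)) : ℂ).re = -2 * z.1.2 := by
    simp; ring
  rw [e1, e2, e3]

lemma FF_int_z {N₁ N₂ τ : ℝ} (h1 : 0 < N₁) (t : ℝ) :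
    ∫ z, FF N₁ N₂ τ (z, t) ∂mu2 = ((N₁ : ℂ) ^ (-(5 / 2 + t * I)) * Complex.Gamma (5 / 2 + t * I)) *
      (1 / (2 + t * I)) *
      (τ * (((N₂ * τ ^ 2 : ℝ) : ℂ) ^ (-(5 / 2 + t * I)) * Complex.Gamma (5 / 2 + t * I))) := by
  simp only [FF]
  rw [integral_mul_const]
  congr 1
  rw [mu2, integral_prod_mul (fun s : ℝ => ((Real.exp (-(N₁ * s)) : ℝ) : ℂ) *
    (s : ℂ) ^ ((5 / 2 + t * I) - 1)) (fun v : ℝ => Complex.exp (-(v * ((5 / 2 + t * I) - 1 / 2))))]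
  congr 1
  · have h9 := Complex.integral_cpow_mul_exp_neg_mul_Ioi (a := 5 / 2 + t * I) (r := N₁) (by simp) h1
    have e1 : (1 / (N₁ : ℂ)) ^ (5 / 2 + t * I : ℂ) = (N₁ : ℂ) ^ (-(5 / 2 + t * I)) := by
      rw [one_div, Complex.inv_cpow, Complex.cpow_neg]
      rw [Complex.arg_ofReal_of_nonneg h1.le]; exact Real.pi_pos.ne
    rw [← e1, ← h9]
    refine setIntegral_congr_fun measurableSet_Ioi fun s _ => ?_
    push_cast
    ring
  · have h9 := integral_exp_mul_complex_Ioi (a := -(2 + t * I)) (by simp) 0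
    refine (setIntegral_congr_fun measurableSet_Ioi fun s _ => ?_).trans (h9.trans ?_)
    · congr 1; ring
    · simp [one_div]; rw [neg_div, ← div_neg]; simp [one_div, add_comm]

lemma FF_int_t {N₁ N₂ τ : ℝ} (h2 : 0 < N₂) (ht : 0 < τ) {s v : ℝ} (hs : 0 < s) :
    ∫ t, FF N₁ N₂ τ ((s, v), t) = (2 * Real.pi : ℂ) *
      ((Real.exp (-(N₁ * s)) * Real.exp (-(N₂ * (τ ^ 2 * Real.exp v / s))) *
        (τ * Real.exp (v / 2) / s) : ℝ) : ℂ) := by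
  have hx : 0 < N₂ * (τ ^ 2 * Real.exp v / s) := by positivity
  have h9 := inv_gamma hx
  have e1 : ∀ t : ℝ, FF N₁ N₂ τ ((s, v), t) =
      ((Real.exp (-(N₁ * s)) * (τ * Real.exp (v / 2) / s) : ℝ) : ℂ) *
      (((N₂ * (τ ^ 2 * Real.exp v / s) : ℝ) : ℂ) ^ (-(5 / 2 + t * I)) *
        Complex.Gamma (5 / 2 + t * I)) := by
    intro t
    have hs' : (s : ℂ) ≠ 0 := by exact_mod_cast hs.ne'
    have hsp : (s : ℂ) ^ (5 / 2 + t * I : ℂ) ≠ 0 := by rw [Complex.cpow_ne_zero_iff]; left; exact hs'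
    have e2 : (N₂ * (τ ^ 2 * Real.exp v / s) : ℝ) = (N₂ * τ ^ 2) * (Real.exp v * s⁻¹) := by
      field_simp
    have e3 : ((s⁻¹ : ℝ) : ℂ) ^ (-(5 / 2 + t * I)) = (s : ℂ) ^ (5 / 2 + t * I) := by
      rw [Complex.ofReal_inv, Complex.inv_cpow, Complex.cpow_neg, inv_inv]
      rw [Complex.arg_ofReal_of_nonneg hs.le]; exact Real.pi_pos.ne
    have e4 : ((Real.exp v : ℝ) : ℂ) ^ (-(5 / 2 + t * I)) = Complex.exp (v * (-(5 / 2 + t * I))) := by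
      rw [Complex.cpow_def_of_ne_zero (by exact_mod_cast (Real.exp_pos v).ne'), ← Complex.ofReal_log
        (Real.exp_pos v).le, Real.log_exp]
    rw [e2, Complex.ofReal_mul (N₂ * τ ^ 2), Complex.mul_cpow_ofReal_nonneg (by positivity) (by positivity),
      Complex.ofReal_mul (Real.exp v), Complex.mul_cpow_ofReal_nonneg (by positivity) (by positivity), e3, e4]
    simp only [FF]
    rw [Complex.cpow_sub _ _ hs', Complex.cpow_one]
    have e5 : Complex.exp (-(v * ((5 / 2 + t * I) - 1 / 2))) =
        ((Real.exp (v / 2) : ℝ) : ℂ) * Complex.exp (v * (-(5 / 2 + t * I))) := by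
      push_cast
      rw [← Complex.exp_add]; congr 1; ring
    rw [e5]
    push_cast
    ring
  simp_rw [e1]
  rw [integral_const_mul]
  have hpi : (Real.pi : ℂ) ≠ 0 := by exact_mod_cast Real.pi_ne_zero
  have h10 : ∫ t : ℝ, ((N₂ * (τ ^ 2 * Real.exp v / s) : ℝ) : ℂ) ^ (-(5 / 2 + t * I)) *
        Complex.Gamma (5 / 2 + t * I) = (2 * Real.pi) * (Real.exp (-(N₂ * (τ ^ 2 * Real.exp v / s))) : ℝ) := by
    rw [← h9, ← mul_assoc, mul_one_div, div_self (mul_ne_zero two_ne_zero hpi), one_mul]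
  rw [h10]
  push_cast
  ring

/-- the kernel on the quadrant -/
def KK (N₁ N₂ τ : ℝ) (z : ℝ × ℝ) : ℝ :=
  Real.exp (-(N₁ * z.1)) * Real.exp (-(N₂ * (τ ^ 2 * Real.exp z.2 / z.1))) *
        (τ * Real.exp (z.2 / 2) / z.1)

lemma KK_int {N₁ N₂ τ : ℝ} (h1 : 0 < N₁) (h2 : 0 < N₂) (ht : 0 < τ) :
    Integrable (KK N₁ N₂ τ) mu2 := by
  have h := (FF_int h1 h2 ht).integral_prod_left
  have h' : Integrable (fun z => (2 * Real.pi : ℂ) * ((KK N₁ N₂ τ z : ℝ) : ℂ)) mu2 := by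
    refine h.congr (mu2_ae fun s v hs hv => ?_)
    exact FF_int_t h2 ht hs
  have h2 := (h'.const_mul ((2 * Real.pi : ℂ)⁻¹)).re
  refine h2.congr (Filter.Eventually.of_forall fun z => ?_)
  have hpi : (2 * Real.pi : ℂ) ≠ 0 := by exact_mod_cast Real.two_pi_pos.ne'
  simp only [RCLike.re_to_complex]
  rw [← mul_assoc, inv_mul_cancel₀ hpi, one_mul, Complex.ofReal_re]

lemma Phi_formula {N₁ N₂ τ y : ℝ} (h1 : 0 < N₁) (h2 : 0 < N₂) (ht : 0 < τ)
    (hy : 4 * Real.pi ^ 2 * y = N₁ * N₂ * τ ^ 2) :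
    ((N₁ * N₂ : ℝ) : ℂ) ^ (-(1 / 2 : ℂ)) * Φ 2 y = ((1 / Real.pi * ∫ z, KK N₁ N₂ τ z ∂mu2 : ℝ) : ℂ) := by
  have hpi : (Real.pi : ℂ) ≠ 0 := by exact_mod_cast Real.pi_ne_zero
  have hy0 : 0 < y := by
    have : 0 < N₁ * N₂ * τ ^ 2 := by positivity
    have h3 : (0:ℝ) < 4 * Real.pi ^ 2 := by positivity
    rw [← hy] at this
    exact (pos_iff_pos_of_mul_pos this).1 h3
  have hsw := integral_integral_swap (f := fun (z : ℝ × ℝ) (t : ℝ) => FF N₁ N₂ τ (z, t))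
    (FF_int h1 h2 ht)
  have e1 : ∫ z, (∫ t, FF N₁ N₂ τ (z, t)) ∂mu2 = (2 * Real.pi : ℂ) * ((∫ z, KK N₁ N₂ τ z ∂mu2 : ℝ) : ℂ) := by
    rw [← integral_complex_ofReal, ← integral_const_mul]
    exact integral_congr_ae (mu2_ae fun s v hs hv => FF_int_t h2 ht hs)
  rw [e1] at hsw
  simp_rw [FF_int_z h1] at hsw
  unfold Φ
  rw [← mul_assoc, mul_comm (_ ^ _), mul_assoc, ← integral_const_mul]
  have e2 : ∀ t : ℝ, ((N₁ * N₂ : ℝ) : ℂ) ^ (-(1 / 2 : ℂ)) * (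
      (2 * Real.pi : ℂ) ^ (-((2 : ℕ) * (2 + t * Complex.I))) *
    (y : ℂ) ^ (-(2 + t * Complex.I)) *
    (Complex.Gamma (1 / 2 + (2 + t * Complex.I)) / Complex.Gamma (1 / 2)) ^ 2 /
    (2 + t * Complex.I)) = (1 / Real.pi) * (((N₁ : ℂ) ^ (-(5 / 2 + t * I)) * Complex.Gamma (5 / 2 + t * I)) *
      (1 / (2 + t * I)) *
      (τ * (((N₂ * τ ^ 2 : ℝ) : ℂ) ^ (-(5 / 2 + t * I)) * Complex.Gamma (5 / 2 + t * I)))) := by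
    intro t
    have a1 : (2 * Real.pi : ℂ) ^ (-(((2 : ℕ) : ℂ) * (2 + t * Complex.I))) =
        ((4 * Real.pi ^ 2 : ℝ) : ℂ) ^ (-(2 + t * Complex.I)) := by
      have : ((4 * Real.pi ^ 2 : ℝ) : ℂ) = ((2 * Real.pi : ℝ) : ℂ) * ((2 * Real.pi : ℝ) : ℂ) := by
        push_cast; ring
      rw [this, Complex.mul_cpow_ofReal_nonneg (by positivity) (by positivity), ← Complex.cpow_add]
      · push_cast; congr 1; ring
      · exact_mod_cast Real.two_pi_pos.ne'
    have a2 : ((4 * Real.pi ^ 2 : ℝ) : ℂ) ^ (-(2 + t * Complex.I)) * (y : ℂ) ^ (-(2 + t * Complex.I)) =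
        ((N₁ * N₂ * τ ^ 2 : ℝ) : ℂ) ^ (-(2 + t * Complex.I)) := by
      rw [← Complex.mul_cpow_ofReal_nonneg (by positivity) hy0.le, ← Complex.ofReal_mul, hy]
    have a3 : (1 / 2 + (2 + t * I) : ℂ) = 5 / 2 + t * I := by ring
    have a4 : Complex.Gamma (1 / 2) ^ 2 = Real.pi := by
      rw [Complex.Gamma_one_half_eq, ← Complex.cpow_nat_mul]
      norm_num
    have a5 : ((N₁ : ℂ) ^ (-(5 / 2 + t * I))) * ((N₂ * τ ^ 2 : ℝ) : ℂ) ^ (-(5 / 2 + t * I)) =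
        ((N₁ * N₂ * τ ^ 2 : ℝ) : ℂ) ^ (-(2 + t * Complex.I)) *
        (((N₁ * N₂ : ℝ) : ℂ) ^ (-(1 / 2 : ℂ)) * ((τ : ℂ)⁻¹)) := by
      rw [← Complex.mul_cpow_ofReal_nonneg h1.le (by positivity), ← Complex.ofReal_mul, ← mul_assoc N₁ N₂ (τ ^ 2)]
      have : (-(5 / 2 + t * I) : ℂ) = -(2 + t * I) + (-(1 / 2)) := by ring
      rw [this, Complex.cpow_add _ _ (by
        have : (N₁ * N₂ * τ ^ 2) ≠ 0 := by positivity
        exact_mod_cast this)]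
      congr 1
      rw [Complex.ofReal_mul (N₁ * N₂) (τ ^ 2), Complex.mul_cpow_ofReal_nonneg (by positivity) (by positivity)]
      congr 1
      have : ((τ ^ 2 : ℝ) : ℂ) = (τ : ℂ) * (τ : ℂ) := by push_cast; ring
      rw [this, Complex.mul_cpow_ofReal_nonneg ht.le ht.le, ← Complex.cpow_add _ _ (by exact_mod_cast ht.ne')]
      norm_num
      rw [Complex.cpow_neg_one]
    rw [a1, a2, a3, div_pow, a4]
    have ht' : (τ : ℂ) ≠ 0 := by exact_mod_cast ht.ne'
    calc _ = (((N₁ * N₂ * τ ^ 2 : ℝ) : ℂ) ^ (-(2 + t * Complex.I)) *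
        (((N₁ * N₂ : ℝ) : ℂ) ^ (-(1 / 2 : ℂ)) * ((τ : ℂ)⁻¹))) * (τ * Complex.Gamma (5 / 2 + t * I) ^ 2 *
          (1 / Real.pi) * (1 / (2 + t * I))) := by
            field_simp
      _ = _ := by rw [← a5]; ring
  simp_rw [e2]
  rw [integral_const_mul, ← hsw]
  push_cast
  field_simp

end phi2

section lemA
open MeasureTheory Set

lemma exp_neg_le_rpow {a : ℝ} (ha : 0 < a) {u : ℝ} (hu : 0 < u) :
    Real.exp (-u) ≤ a ^ a * u ^ (-a) := by
  have h1 : u / a ≤ Real.exp (u / a) := by linarith [Real.add_one_le_exp (u / a)]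
  have h2 : (u / a) ^ a ≤ Real.exp u := by
    refine (Real.rpow_le_rpow (by positivity) h1 ha.le).trans (le_of_eq ?_)
    rw [← Real.exp_mul, div_mul_cancel₀ _ ha.ne']
  rw [Real.div_rpow hu.le ha.le] at h2
  rw [Real.exp_neg, Real.rpow_neg hu.le, ← div_eq_mul_inv, inv_le_comm₀ (Real.exp_pos _) (by positivity), inv_div]
  exact h2

lemma KK_nonneg {N₁ N₂ τ : ℝ} (ht : 0 < τ) {s v : ℝ} (hs : 0 < s) : 0 ≤ KK N₁ N₂ τ (s, v) := by
  unfold KK; positivity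

lemma KK_le {δ : ℝ} (hδ : 0 < δ) : ∃ C : ℝ, 0 ≤ C ∧ ∀ N₁ N₂ τ : ℝ, 0 < N₁ → 0 < N₂ → 0 < τ →
    ∫ z, KK N₁ N₂ τ z ∂mu2 ≤ C * (N₁ ^ (-(1 + δ)) * N₂ ^ (-(1 + δ)) * τ ^ (-(1 + 2 * δ))) := by
  set A := (1 + δ) ^ (1 + δ) with hA
  have hA0 : 0 < A := by positivity
  have hG : 0 < Real.Gamma (1 + δ) := Real.Gamma_pos_of_pos (by positivity)
  refine ⟨A * (Real.Gamma (1 + δ) * (1 / 2 + δ)⁻¹), by positivity, fun N₁ N₂ τ h1 h2 ht => ?_⟩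
  have i1 : IntegrableOn (fun s : ℝ => s ^ ((1 + δ) - 1) * Real.exp (-(N₁ * s))) (Ioi 0) := by
    have := integrableOn_rpow_mul_exp_neg_mul_rpow (p := 1) (s := (1 + δ) - 1) (b := N₁) (by linarith)
      (by norm_num) h1
    refine this.congr_fun (fun s hs => ?_) measurableSet_Ioi
    simp
  have i2 : IntegrableOn (fun v : ℝ => Real.exp (-(1 / 2 + δ) * v)) (Ioi 0) :=
    exp_neg_integrableOn_Ioi 0 (by positivity)
  have i3 := (Integrable.mul_prod i1 i2).const_mul (A * (N₂ ^ (-(1 + δ)) * τ ^ (-(1 + 2 * δ))))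
  have hle : ∫ z, KK N₁ N₂ τ z ∂mu2 ≤ ∫ z : ℝ × ℝ, (A * (N₂ ^ (-(1 + δ)) * τ ^ (-(1 + 2 * δ)))) *
      ((z.1 ^ ((1 + δ) - 1) * Real.exp (-(N₁ * z.1))) * Real.exp (-(1 / 2 + δ) * z.2)) ∂mu2 := by
    refine integral_mono_ae (KK_int h1 h2 ht) i3 (mu2_ae fun s v hs hv => ?_)
    have hu : 0 < N₂ * (τ ^ 2 * Real.exp v / s) := by positivity
    have h3 := exp_neg_le_rpow (a := 1 + δ) (by positivity) hu
    simp only [KK]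
    have h4 : KK N₁ N₂ τ (s, v) ≤ Real.exp (-(N₁ * s)) * (A * (N₂ * (τ ^ 2 * Real.exp v / s)) ^ (-(1 + δ))) *
        (τ * Real.exp (v / 2) / s) := by
      unfold KK
      gcongr
    refine h4.trans (le_of_eq ?_)
    have e1 : (N₂ * (τ ^ 2 * Real.exp v / s)) ^ (-(1 + δ)) =
        N₂ ^ (-(1 + δ)) * (τ ^ (-(2 + 2 * δ)) * Real.exp (-(1 + δ) * v) * (s ^ δ * s)) := by
      rw [Real.mul_rpow h2.le (by positivity), Real.div_rpow (by positivity) hs.le,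
        Real.mul_rpow (by positivity) (by positivity), ← Real.exp_mul, ← Real.rpow_natCast,
        ← Real.rpow_mul ht.le, div_eq_mul_inv, ← Real.rpow_neg hs.le, neg_neg, add_comm 1 δ,
        Real.rpow_add_one hs.ne']
      congr 3
      · congr 1; push_cast; ring
      · ring_nf
    have e2 : τ ^ (-(1 + 2 * δ)) = τ ^ (-(2 + 2 * δ)) * τ := by
      rw [← Real.rpow_add_one ht.ne']; congr 1; ring
    have e3 : Real.exp (-(1 / 2 + δ) * v) = Real.exp (-(1 + δ) * v) * Real.exp (v / 2) := by
      rw [← Real.exp_add]; congr 1; ring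
    rw [e1, e2, e3, add_sub_cancel_left]
    field_simp
  refine hle.trans (le_of_eq ?_)
  rw [integral_const_mul, mu2, integral_prod_mul (fun s : ℝ => s ^ ((1 + δ) - 1) * Real.exp (-(N₁ * s)))
    (fun v : ℝ => Real.exp (-(1 / 2 + δ) * v)), Real.integral_rpow_mul_exp_neg_mul_Ioi (by positivity) h1,
    integral_exp_mul_Ioi (by linarith) 0, one_div, Real.inv_rpow h1.le, Real.rpow_neg h1.le]
  simp only [neg_add_rev, mul_zero, Real.exp_zero]
  have hd : (1 / 2 + δ) ≠ 0 := by positivity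
  have e9 : (-1 / (-δ + -(1 / 2)) : ℝ) = (1 / 2 + δ)⁻¹ := by
    rw [show (-δ + -(1 / 2) : ℝ) = -(1 / 2 + δ) by ring, neg_div_neg_eq, one_div]
  rw [e9]
  ring

/-- canonical generators -/
abbrev RT := {x : Eis // Rep x}

lemma Rep_ne {x : Eis} (h : Rep x) : x ≠ 0 := by
  obtain ⟨k, c, hc, rfl⟩ := h
  exact mul_ne_zero (pow_ne_zero _ lam_prime.ne_zero) (P1.ne_zero hc)

instance : Countable Eis := eisEquiv.symm.injective.countable

lemma RT_pos (n : RT) : 0 < Nm n.1 := Nm_pos (Rep_ne n.2)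

lemma RT_summ {δ : ℝ} (hδ : 0 < δ) : Summable fun n : RT => Nm n.1 ^ (-(1 + δ)) :=
  (summ_rpow hδ).comp_injective Subtype.val_injective

/-- Gaussian weight, cut at 0 -/
def gw (x y : ℝ) : ℝ := if 0 < x then Real.exp (-(y * x)) else 0

/-- theta over ideals -/
def TH (χ : Eis → Eis → Eis) (q : Eis) (x : ℝ) : ℂ := ∑' n : RT, cx χ q n.1 * (gw x (Nm n.1) : ℂ)

lemma TH_summ {χ : Eis → Eis → Eis} (hχ : IsCubicSymbol χ) {q : Eis} (hq : P1 q) (x : ℝ) :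
    Summable fun n : RT => ‖cx χ q n.1 * (gw x (Nm n.1) : ℂ)‖ := by
  by_cases hx : 0 < x
  · refine Summable.of_nonneg_of_le (fun _ => norm_nonneg _) (fun n => ?_)
      ((summ_gauss2 hx).comp_injective (Subtype.val_injective (p := Rep)))
    rw [norm_mul, gw, if_pos hx, Complex.norm_real, Real.norm_eq_abs, abs_of_pos (Real.exp_pos _)]
    refine (mul_le_of_le_one_left (Real.exp_pos _).le (cx_norm_le hχ hq _)).trans (le_of_eq ?_)
    simp [mul_comm]
  · simp [gw, hx, summable_zero]

lemma TH_meas {χ : Eis → Eis → Eis} (hχ : IsCubicSymbol χ) {q : Eis} (hq : P1 q) :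
    Measurable (TH χ q) := by
  refine measurable_of_tendsto_metrizable' (Filter.atTop : Filter (Finset RT))
    (f := fun s x => ∑ n ∈ s, cx χ q n.1 * (gw x (Nm n.1) : ℂ)) (fun s => ?_) ?_
  · refine Finset.measurable_fun_sum _ fun n _ => ?_
    refine Measurable.const_mul ?_ _
    refine Complex.measurable_ofReal.comp ?_
    unfold gw
    refine Measurable.ite measurableSet_Ioi (by fun_prop) (by fun_prop)
  · rw [tendsto_pi_nhds]
    intro x
    exact (TH_summ hχ hq x).of_norm.hasSum

lemma lint_inv {c : ℝ} (hc : 0 < c) (g : ℝ → ENNReal) :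
    ∫⁻ x in Ioi (0:ℝ), g (c / x) * ENNReal.ofReal x⁻¹ = ∫⁻ x in Ioi (0:ℝ), g x * ENNReal.ofReal x⁻¹ := by
  have him : (fun x : ℝ => c / x) '' Ioi 0 = Ioi 0 := by
    ext y; constructor
    · rintro ⟨x, hx, rfl⟩; exact div_pos hc hx
    · intro hy; exact ⟨c / y, div_pos hc hy, by
        have : y ≠ 0 := ne_of_gt hy
        field_simp⟩
  have h := lintegral_image_eq_lintegral_abs_deriv_mul (s := Ioi (0:ℝ)) (f := fun x => c / x)
    (f' := fun x => -c / x ^ 2) measurableSet_Ioi (fun x hx => by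
      have hx0 : x ≠ 0 := ne_of_gt hx
      have := ((hasDerivAt_const x c).div (hasDerivAt_id x) hx0).hasDerivWithinAt (s := Ioi 0)
      refine HasDerivWithinAt.congr_deriv (f := fun x => c / x) this ?_
      simp) (fun x hx y hy hxy => by
        have hx0 : x ≠ 0 := ne_of_gt hx
        have hy0 : y ≠ 0 := ne_of_gt hy
        have : c / x = c / y := hxy
        rw [div_eq_div_iff hx0 hy0] at this
        exact (mul_left_cancel₀ hc.ne' this).symm) (fun x => g x * ENNReal.ofReal x⁻¹)
  rw [him] at h
  rw [h]
  refine setLIntegral_congr_fun measurableSet_Ioi fun x hx => ?_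
  have hx0 : 0 < x := hx
  rw [mul_left_comm, ← ENNReal.ofReal_mul (abs_nonneg _), neg_div, abs_neg, abs_of_pos (by positivity)]
  congr 2
  field_simp

end lemA

section lemA2
open MeasureTheory Set

/-- the scale -/
def tq (q : Eis) : ℝ := 2 * Real.pi / Real.sqrt (3 * Nm q)

lemma tq_pos {q : Eis} (hq : q ≠ 0) : 0 < tq q := by
  have := Nm_pos hq
  have := Real.pi_pos
  unfold tq; positivity

/-- coefficients -/
def cp (χ : Eis → Eis → Eis) (q : Eis) (p : RT × RT) : ℂ :=
  cx χ q p.1.1 * (starRingEnd ℂ) (cx χ q p.2.1)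

lemma cp_norm {χ : Eis → Eis → Eis} (hχ : IsCubicSymbol χ) {q : Eis} (hq : P1 q) (p : RT × RT) :
    ‖cp χ q p‖ ≤ 1 := by
  rw [cp, norm_mul, RCLike.norm_conj]
  exact mul_le_one₀ (cx_norm_le hχ hq _) (norm_nonneg _) (cx_norm_le hχ hq _)

lemma A2_term {χ : Eis → Eis → Eis} {q : Eis} (hq : q ≠ 0) :
    A₂ χ q = ∑' p : RT × RT, ∫ z, cp χ q p * ((1 / Real.pi * KK (Nm p.1.1) (Nm p.2.1) (tq q) z : ℝ) : ℂ) ∂mu2 := by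
  unfold A₂
  refine tsum_congr fun p => ?_
  have hN := Nm_pos hq
  have h := Phi_formula (RT_pos p.1) (RT_pos p.2) (tq_pos hq)
    (y := Nm p.1.1 * Nm p.2.1 / (3 * Nm q)) (by
      unfold tq
      rw [div_pow, Real.sq_sqrt (by positivity)]
      ring)
  rw [mul_assoc, h, integral_const_mul, integral_complex_ofReal, integral_const_mul]
  rfl

lemma KK_norm {N₁ N₂ τ : ℝ} (ht : 0 < τ) :
    ∫ z, ‖KK N₁ N₂ τ z‖ ∂mu2 = ∫ z, KK N₁ N₂ τ z ∂mu2 := by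
  refine integral_congr_ae (mu2_ae fun s v hs hv => ?_)
  beta_reduce
  rw [Real.norm_eq_abs, abs_of_nonneg (KK_nonneg ht hs)]

lemma pair_summ {δ : ℝ} (hδ : 0 < δ) :
    Summable fun p : RT × RT => Nm p.1.1 ^ (-(1 + δ)) * Nm p.2.1 ^ (-(1 + δ)) :=
  (RT_summ hδ).mul_of_nonneg (RT_summ hδ) (fun n => Real.rpow_nonneg (RT_pos n).le _)
    (fun n => Real.rpow_nonneg (RT_pos n).le _)

lemma term_le {δ C : ℝ} (hC : ∀ N₁ N₂ τ : ℝ, 0 < N₁ → 0 < N₂ → 0 < τ →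
    ∫ z, KK N₁ N₂ τ z ∂mu2 ≤ C * (N₁ ^ (-(1 + δ)) * N₂ ^ (-(1 + δ)) * τ ^ (-(1 + 2 * δ))))
    {χ : Eis → Eis → Eis} (hχ : IsCubicSymbol χ) {q : Eis} (hq : P1 q) (p : RT × RT) :
    ∫ z, ‖cp χ q p * ((1 / Real.pi * KK (Nm p.1.1) (Nm p.2.1) (tq q) z : ℝ) : ℂ)‖ ∂mu2 ≤
      (C * tq q ^ (-(1 + 2 * δ))) * (Nm p.1.1 ^ (-(1 + δ)) * Nm p.2.1 ^ (-(1 + δ))) := by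
  have ht := tq_pos hq.ne_zero
  have hpi : (1:ℝ) / Real.pi ≤ 1 := by
    rw [div_le_one Real.pi_pos]; linarith [Real.two_le_pi]
  have h0 : (0:ℝ) < 1 / Real.pi := by have := Real.pi_pos; positivity
  simp only [norm_mul, Complex.norm_real, Complex.ofReal_mul]
  rw [integral_const_mul, integral_const_mul, KK_norm ht]
  have h1 := hC _ _ _ (RT_pos p.1) (RT_pos p.2) ht
  have h2 : 0 ≤ ∫ z, KK (Nm p.1.1) (Nm p.2.1) (tq q) z ∂mu2 := by
    rw [← KK_norm ht]; exact integral_nonneg fun _ => norm_nonneg _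
  calc _ ≤ 1 * (1 * ∫ z, KK (Nm p.1.1) (Nm p.2.1) (tq q) z ∂mu2) := by
        rw [Real.norm_eq_abs, abs_of_pos h0]
        gcongr
        exact cp_norm hχ hq p
    _ ≤ _ := by rw [one_mul, one_mul]; refine h1.trans (le_of_eq (by ring))

lemma A2_trivial {δ : ℝ} (hδ : 0 < δ) : ∃ C : ℝ, 0 ≤ C ∧ ∀ χ, IsCubicSymbol χ → ∀ q : Eis, P1 q →
    ‖A₂ χ q‖ ≤ C * Nm q ^ (1 / 2 + δ) := by
  obtain ⟨C, hC0, hC⟩ := KK_le hδ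
  set Z := ∑' p : RT × RT, Nm p.1.1 ^ (-(1 + δ)) * Nm p.2.1 ^ (-(1 + δ)) with hZ
  have hZ0 : 0 ≤ Z := tsum_nonneg fun p => mul_nonneg (Real.rpow_nonneg (RT_pos _).le _)
    (Real.rpow_nonneg (RT_pos _).le _)
  refine ⟨C * Z * 3 ^ (1 / 2 + δ), by positivity, fun χ hχ q hq => ?_⟩
  have hN := Nm_pos hq.ne_zero
  have hs := (pair_summ hδ).mul_left (C * tq q ^ (-(1 + 2 * δ)))
  have hle : ∀ p : RT × RT, ‖∫ z, cp χ q p * ((1 / Real.pi * KK (Nm p.1.1) (Nm p.2.1) (tq q) z : ℝ) : ℂ) ∂mu2‖ ≤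
      (C * tq q ^ (-(1 + 2 * δ))) * (Nm p.1.1 ^ (-(1 + δ)) * Nm p.2.1 ^ (-(1 + δ))) := fun p =>
    (norm_integral_le_integral_norm _).trans (term_le hC hχ hq p)
  rw [A2_term hq.ne_zero]
  refine (tsum_of_norm_bounded hs.hasSum hle).trans ?_
  rw [tsum_mul_left, ← hZ]
  have e1 : tq q ^ (-(1 + 2 * δ)) ≤ (3 * Nm q) ^ (1 / 2 + δ) := by
    have hpi : 1 ≤ 2 * Real.pi := by linarith [Real.two_le_pi]
    have h3 : (3 * Nm q) ^ (1 / 2 + δ) = ((Real.sqrt (3 * Nm q))⁻¹) ^ (-(1 + 2 * δ)) := by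
      rw [Real.inv_rpow (by positivity), Real.rpow_neg (by positivity), inv_inv, Real.sqrt_eq_rpow,
        ← Real.rpow_mul (by positivity)]
      congr 1; ring
    rw [h3]
    refine Real.rpow_le_rpow_of_nonpos (by positivity) ?_ (by linarith)
    unfold tq
    rw [inv_eq_one_div]
    gcongr
  calc _ ≤ C * (3 * Nm q) ^ (1 / 2 + δ) * Z := by gcongr
    _ = _ := by rw [Real.mul_rpow (by norm_num) hN.le]; ring

lemma A2_int {χ : Eis → Eis → Eis} (hχ : IsCubicSymbol χ) {q : Eis} (hq : P1 q) :
    A₂ χ q = ∫ z, (∑' p : RT × RT, cp χ q p * ((1 / Real.pi * KK (Nm p.1.1) (Nm p.2.1) (tq q) z : ℝ) : ℂ)) ∂mu2 := by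
  obtain ⟨C, hC0, hC⟩ := KK_le one_pos
  rw [A2_term hq.ne_zero]
  refine integral_tsum_of_summable_integral_norm (fun p => ?_) ?_
  · exact (((KK_int (RT_pos p.1) (RT_pos p.2) (tq_pos hq.ne_zero)).const_mul _).ofReal).const_mul _
  · exact Summable.of_nonneg_of_le (fun p => integral_nonneg fun _ => norm_nonneg _)
      (term_le hC hχ hq) ((pair_summ one_pos).mul_left _)

lemma A2_inner {χ : Eis → Eis → Eis} (hχ : IsCubicSymbol χ) {q : Eis} (hq : P1 q) {s v : ℝ} (hs : 0 < s) :
    (∑' p : RT × RT, cp χ q p * ((1 / Real.pi * KK (Nm p.1.1) (Nm p.2.1) (tq q) (s, v) : ℝ) : ℂ)) =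
      (TH χ q s * (starRingEnd ℂ) (TH χ q (tq q ^ 2 * Real.exp v / s))) *
        ((1 / Real.pi * (tq q * Real.exp (v / 2) / s) : ℝ) : ℂ) := by
  have ht := tq_pos hq.ne_zero
  set s' := tq q ^ 2 * Real.exp v / s with hs'
  have hs0 : 0 < s' := by positivity
  have h1 := TH_summ hχ hq s
  have h2 := TH_summ hχ hq s'
  have h3 : (starRingEnd ℂ) (TH χ q s') = ∑' n : RT, (starRingEnd ℂ) (cx χ q n.1 * (gw s' (Nm n.1) : ℂ)) := by
    rw [TH, Complex.conj_tsum]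
  have h4 : Summable fun n : RT => ‖(starRingEnd ℂ) (cx χ q n.1 * (gw s' (Nm n.1) : ℂ))‖ := by
    simpa only [RCLike.norm_conj] using h2
  rw [h3, TH, tsum_mul_tsum_of_summable_norm h1 h4, ← tsum_mul_right]
  refine tsum_congr fun p => ?_
  simp only [cp, KK, gw, if_pos hs, if_pos hs0, map_mul, Complex.conj_ofReal, ← hs']
  push_cast
  ring

lemma amgm {a b w k p : ℝ} (hw : 0 < w) (hp : 0 ≤ p) (hp1 : p ≤ 1) (ha : 0 ≤ a) (hb : 0 ≤ b) (hk : 0 ≤ k) :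
    a * b * (p * k) ≤ a ^ 2 * w + b ^ 2 * (w⁻¹ * k ^ 2) := by
  have h1 : a * b * (p * k) ≤ a * b * k := by
    have : 0 ≤ a * b * k := by positivity
    nlinarith
  refine h1.trans ?_
  have h2 : 0 ≤ (a * w - b * k) ^ 2 := sq_nonneg _
  have h3 : 0 ≤ a * b * k := by positivity
  have h4 : a ^ 2 * w + b ^ 2 * (w⁻¹ * k ^ 2) - a * b * k = ((a * w - b * k) ^ 2 + a * b * k * w) * w⁻¹ := by
    field_simp; ring
  have h5 : 0 ≤ ((a * w - b * k) ^ 2 + a * b * k * w) * w⁻¹ := by positivity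
  linarith

/-- half of the AM-GM majorant -/
def HH (χ : Eis → Eis → Eis) (q : Eis) (s s' : ℝ) : ENNReal :=
  ‖TH χ q s‖ₑ ^ 2 * ENNReal.ofReal (Real.exp (s / 4 - s' / 4)) * ENNReal.ofReal s

lemma inner_le {χ : Eis → Eis → Eis} (hχ : IsCubicSymbol χ) {q : Eis} (hq : P1 q) {s v : ℝ} (hs : 0 < s) :
    ‖(∑' p : RT × RT, cp χ q p * ((1 / Real.pi * KK (Nm p.1.1) (Nm p.2.1) (tq q) (s, v) : ℝ) : ℂ))‖ₑ ≤
      HH χ q s (tq q ^ 2 * Real.exp v / s) * ENNReal.ofReal s⁻¹ +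
      HH χ q (tq q ^ 2 * Real.exp v / s) s * ENNReal.ofReal s⁻¹ := by
  have ht := tq_pos hq.ne_zero
  rw [A2_inner hχ hq hs]
  set s' := tq q ^ 2 * Real.exp v / s with hs'
  have hs0 : 0 < s' := by positivity
  have hpi : (1:ℝ) / Real.pi ≤ 1 := by
    rw [div_le_one Real.pi_pos]; linarith [Real.two_le_pi]
  have h0 : (0:ℝ) ≤ 1 / Real.pi := by have := Real.pi_pos; positivity
  set k := tq q * Real.exp (v / 2) / s with hk
  have hk0 : 0 < k := by positivity
  have hk2 : k ^ 2 = s' * s⁻¹ := by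
    rw [hk, hs', div_pow, mul_pow, ← Real.exp_nat_mul]
    have : ((2 : ℕ) : ℝ) * (v / 2) = v := by push_cast; ring
    rw [this]; field_simp
  have h := amgm (Real.exp_pos (s / 4 - s' / 4)) h0 hpi (norm_nonneg (TH χ q s)) (norm_nonneg (TH χ q s')) hk0.le
  have e0 : ‖TH χ q s * (starRingEnd ℂ) (TH χ q s') * ((1 / Real.pi * k : ℝ) : ℂ)‖ =
      ‖TH χ q s‖ * ‖TH χ q s'‖ * (1 / Real.pi * k) := by
    rw [norm_mul, norm_mul, RCLike.norm_conj, Complex.norm_real, Real.norm_eq_abs, abs_of_nonneg (by positivity)]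
  rw [← ofReal_norm, e0]
  refine (ENNReal.ofReal_le_ofReal h).trans ?_
  rw [ENNReal.ofReal_add (by positivity) (by positivity)]
  refine le_of_eq ?_
  congr 1
  · rw [HH, mul_assoc (_ * _), ← ENNReal.ofReal_mul hs.le, mul_inv_cancel₀ hs.ne', ENNReal.ofReal_one, mul_one,
      ENNReal.ofReal_mul (by positivity), ENNReal.ofReal_pow (norm_nonneg _), ofReal_norm]
  · rw [HH, mul_assoc (_ * _), ← ENNReal.ofReal_mul hs0.le, ENNReal.ofReal_mul (by positivity),
      ENNReal.ofReal_pow (norm_nonneg _), ofReal_norm, hk2, ← Real.exp_neg, ENNReal.ofReal_mul (Real.exp_pos _).le, mul_assoc]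
    congr 4
    ring

end lemA2

section lemA3
open MeasureTheory Set

lemma HH_meas {χ : Eis → Eis → Eis} (hχ : IsCubicSymbol χ) {q : Eis} (hq : P1 q) :
    Measurable fun z : ℝ × ℝ => HH χ q z.1 z.2 := by
  have := TH_meas hχ hq
  unfold HH
  fun_prop

lemma A2_le_HH {χ : Eis → Eis → Eis} (hχ : IsCubicSymbol χ) {q : Eis} (hq : P1 q) :
    ‖A₂ χ q‖ₑ ≤ 2 * ∫⁻ z, HH χ q z.1 (tq q ^ 2 * Real.exp z.2 / z.1) * ENNReal.ofReal z.1⁻¹ ∂mu2 := by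
  have ht := tq_pos hq.ne_zero
  have hm := HH_meas hχ hq
  have m1 : Measurable fun z : ℝ × ℝ => HH χ q z.1 (tq q ^ 2 * Real.exp z.2 / z.1) * ENNReal.ofReal z.1⁻¹ := by
    refine Measurable.mul ?_ (ENNReal.measurable_ofReal.comp measurable_fst.inv)
    exact hm.comp (f := fun z : ℝ × ℝ => (z.1, tq q ^ 2 * Real.exp z.2 / z.1)) (by fun_prop)
  have m2 : Measurable fun z : ℝ × ℝ => HH χ q (tq q ^ 2 * Real.exp z.2 / z.1) z.1 * ENNReal.ofReal z.1⁻¹ := by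
    refine Measurable.mul ?_ (ENNReal.measurable_ofReal.comp measurable_fst.inv)
    exact hm.comp (f := fun z : ℝ × ℝ => (tq q ^ 2 * Real.exp z.2 / z.1, z.1)) (by fun_prop)
  rw [A2_int hχ hq]
  refine (enorm_integral_le_lintegral_enorm _).trans ?_
  refine (lintegral_mono_ae (g := fun z : ℝ × ℝ => HH χ q z.1 (tq q ^ 2 * Real.exp z.2 / z.1) *
      ENNReal.ofReal z.1⁻¹ + HH χ q (tq q ^ 2 * Real.exp z.2 / z.1) z.1 * ENNReal.ofReal z.1⁻¹)
    (mu2_ae fun s v hs hv => inner_le hχ hq hs)).trans ?_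
  have e : ∫⁻ z, HH χ q (tq q ^ 2 * Real.exp z.2 / z.1) z.1 * ENNReal.ofReal z.1⁻¹ ∂mu2 =
      ∫⁻ z, HH χ q z.1 (tq q ^ 2 * Real.exp z.2 / z.1) * ENNReal.ofReal z.1⁻¹ ∂mu2 := by
    rw [mu2, lintegral_prod_symm _ m2.aemeasurable, lintegral_prod_symm _ m1.aemeasurable]
    refine lintegral_congr fun v => ?_
    have hc : 0 < tq q ^ 2 * Real.exp v := by positivity
    rw [← lint_inv hc (fun x => HH χ q x (tq q ^ 2 * Real.exp v / x))]
    refine setLIntegral_congr_fun measurableSet_Ioi fun s hs => ?_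
    have hs0 : 0 < s := hs
    simp only
    rw [div_div_cancel₀ hc.ne']
  rw [lintegral_add_left m1, e, two_mul]

lemma lemA {δ : ℝ} (hδ : 0 < δ) : ∃ C : ℝ, 0 ≤ C ∧ ∀ χ, IsCubicSymbol χ → ∀ q : Eis, P1 q →
    ‖A₂ χ q‖ₑ ≤ ENNReal.ofReal (C * Nm q ^ δ) *
      ∫⁻ x in Ioi (0:ℝ), ‖TH χ q x‖ₑ ^ 2 * ENNReal.ofReal (Real.exp (x / 2)) := by
  set B := δ ^ δ with hB
  have hB0 : 0 < B := by positivity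
  refine ⟨2 * (B * 4 ^ δ * (B * 4 ^ δ) * δ⁻¹) * 3 ^ δ, by positivity, fun χ hχ q hq => ?_⟩
  have ht := tq_pos hq.ne_zero
  have hN := Nm_pos hq.ne_zero
  refine (A2_le_HH hχ hq).trans ?_
  set K := B * 4 ^ δ * (B * 4 ^ δ) * tq q ^ (-(2 * δ)) with hK
  have hK0 : 0 < K := by positivity
  have h1 : ∫⁻ z, HH χ q z.1 (tq q ^ 2 * Real.exp z.2 / z.1) * ENNReal.ofReal z.1⁻¹ ∂mu2 ≤
      ∫⁻ z : ℝ × ℝ, (‖TH χ q z.1‖ₑ ^ 2 * ENNReal.ofReal (Real.exp (z.1 / 2))) *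
        ENNReal.ofReal (K * Real.exp (-δ * z.2)) ∂mu2 := by
    refine lintegral_mono_ae (mu2_ae fun s v hs hv => ?_)
    simp only [HH]
    rw [mul_assoc (_ * _), ← ENNReal.ofReal_mul hs.le, mul_inv_cancel₀ hs.ne', ENNReal.ofReal_one, mul_one,
      mul_assoc, ← ENNReal.ofReal_mul (Real.exp_pos _).le]
    gcongr
    have a1 := exp_neg_le_rpow hδ (u := tq q ^ 2 * Real.exp v / s / 4) (by positivity)
    have a2 := exp_neg_le_rpow hδ (u := s / 4) (by positivity)
    have e1 : (tq q ^ 2 * Real.exp v / s / 4) ^ (-δ) = 4 ^ δ * tq q ^ (-(2 * δ)) * Real.exp (-δ * v) * s ^ δ := by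
      rw [div_div, Real.div_rpow (by positivity) (by positivity), Real.mul_rpow (by positivity) (by positivity),
        Real.mul_rpow hs.le (by norm_num), ← Real.exp_mul, ← Real.rpow_natCast, ← Real.rpow_mul ht.le,
        Real.rpow_neg hs.le, Real.rpow_neg (by norm_num : (0:ℝ) ≤ 4)]
      have : v * -δ = -δ * v := by ring
      rw [this]
      have : ((2 : ℕ) : ℝ) * -δ = -(2 * δ) := by push_cast; ring
      rw [this]
      have : 0 < s ^ δ := by positivity
      field_simp
    have e2 : s ^ δ ≤ B * 4 ^ δ * Real.exp (s / 4) := by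
      rw [Real.div_rpow hs.le (by norm_num), Real.rpow_neg hs.le, Real.rpow_neg (by norm_num), Real.exp_neg,
        inv_div_inv] at a2
      have h3 : 0 < s ^ δ := by positivity
      rw [← mul_div_assoc, le_div_iff₀ h3] at a2
      have := mul_le_mul_of_nonneg_right a2 (Real.exp_pos (s / 4)).le
      calc s ^ δ = (Real.exp (s / 4))⁻¹ * s ^ δ * Real.exp (s / 4) := by field_simp
        _ ≤ _ := this
    rw [e1] at a1
    calc Real.exp (s / 4 - tq q ^ 2 * Real.exp v / s / 4)
        = Real.exp (s / 4) * Real.exp (-(tq q ^ 2 * Real.exp v / s / 4)) := by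
          rw [← Real.exp_add]; congr 1
      _ ≤ Real.exp (s / 4) * (B * (4 ^ δ * tq q ^ (-(2 * δ)) * Real.exp (-δ * v) * (B * 4 ^ δ * Real.exp (s / 4)))) := by
          refine mul_le_mul_of_nonneg_left (a1.trans ?_) (Real.exp_pos _).le
          gcongr
      _ = Real.exp (s / 2) * (K * Real.exp (-δ * v)) := by
          have : Real.exp (s / 2) = Real.exp (s / 4) * Real.exp (s / 4) := by
            rw [← Real.exp_add]; congr 1; ring
          rw [this, hK]; ring
  have mT := TH_meas hχ hq
  rw [mu2, lintegral_prod_mul (f := fun s => ‖TH χ q s‖ₑ ^ 2 * ENNReal.ofReal (Real.exp (s / 2)))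
    (g := fun v => ENNReal.ofReal (K * Real.exp (-δ * v))) (by fun_prop) (by fun_prop)] at h1
  have h2 : ∫⁻ v in Ioi (0:ℝ), ENNReal.ofReal (K * Real.exp (-δ * v)) = ENNReal.ofReal (K * δ⁻¹) := by
    rw [← ofReal_integral_eq_lintegral_ofReal]
    · rw [integral_const_mul, integral_exp_mul_Ioi (by linarith) 0]
      congr 2; simp
    · exact (exp_neg_integrableOn_Ioi 0 hδ).const_mul _
    · exact Filter.Eventually.of_forall fun v => by positivity
  rw [h2] at h1
  have hfin : 2 * (K * δ⁻¹) ≤ 2 * (B * 4 ^ δ * (B * 4 ^ δ) * δ⁻¹) * 3 ^ δ * Nm q ^ δ := by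
    have e1 : tq q ^ (-(2 * δ)) ≤ (3 * Nm q) ^ δ := by
      have hpi : 1 ≤ 2 * Real.pi := by linarith [Real.two_le_pi]
      have h3 : (3 * Nm q) ^ δ = ((Real.sqrt (3 * Nm q))⁻¹) ^ (-(2 * δ)) := by
        rw [Real.inv_rpow (by positivity), Real.rpow_neg (by positivity), inv_inv, Real.sqrt_eq_rpow,
          ← Real.rpow_mul (by positivity)]
        congr 1; ring
      rw [h3]
      refine Real.rpow_le_rpow_of_nonpos (by positivity) ?_ (by linarith)
      unfold tq
      rw [inv_eq_one_div]
      gcongr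
    rw [Real.mul_rpow (by norm_num) hN.le] at e1
    calc 2 * (K * δ⁻¹) = 2 * (B * 4 ^ δ * (B * 4 ^ δ) * δ⁻¹) * tq q ^ (-(2 * δ)) := by rw [hK]; ring
      _ ≤ 2 * (B * 4 ^ δ * (B * 4 ^ δ) * δ⁻¹) * (3 ^ δ * Nm q ^ δ) := by gcongr
      _ = _ := by ring
  calc _ ≤ 2 * ((∫⁻ x in Ioi (0:ℝ), ‖TH χ q x‖ₑ ^ 2 * ENNReal.ofReal (Real.exp (x / 2))) *
        ENNReal.ofReal (K * δ⁻¹)) := by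
        exact mul_le_mul_right h1 2
    _ = ENNReal.ofReal (2 * (K * δ⁻¹)) * (∫⁻ x in Ioi (0:ℝ), ‖TH χ q x‖ₑ ^ 2 * ENNReal.ofReal (Real.exp (x / 2))) := by
        rw [ENNReal.ofReal_mul (p := 2) (by norm_num), ENNReal.ofReal_ofNat]; ring
    _ ≤ _ := by gcongr

end lemA3

section unitsum
open ComplexConjugate

lemma ω_val (k : ℕ) : Val (ωE ^ k) := by
  have h : ωE ^ k = ωE ^ (k % 3) := by
    conv_lhs => rw [← Nat.div_add_mod k 3, pow_add, pow_mul, ωE_cube, one_pow, one_mul]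
  rw [h]
  have : k % 3 < 3 := Nat.mod_lt _ (by norm_num)
  interval_cases (k % 3) <;> simp [Val]

lemma chi_omega {χ : Eis → Eis → Eis} (hχ : IsCubicSymbol χ) :
    ∀ b, P1 b → χ b ωE = ωE ^ ((NmN b - 1) / 3) := by
  apply P1.induction
  · have h1 : NmN 1 = 1 := by
      have := Nm_nat 1
      rw [Nm_one] at this
      exact_mod_cast this
    rw [hχ.one_bot, h1]; simp
  · intro p a hp hp1 ha ih
    rw [hχ.mul_bot _ _ _ hp1 ha, ih, NmN_mul]
    have e1 : χ p ωE = ωE ^ ((NmN p - 1) / 3) := by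
      have h1 := hχ.prime_congr p ωE hp hp1
      exact (Val.eq_of_dvd (ω_val _) (hχ.val hp1 ωE) hp1 hp.not_isUnit h1).symm
    rw [e1, ← pow_add]
    have h1 := hp1.NmN_mod
    have h2 := ha.NmN_mod
    obtain ⟨k, hk⟩ : ∃ k, NmN p = 3 * k + 1 := ⟨NmN p / 3, by omega⟩
    obtain ⟨l, hl⟩ : ∃ l, NmN a = 3 * l + 1 := ⟨NmN a / 3, by omega⟩
    have e2 : (NmN p - 1) / 3 = k := by omega
    have e3 : (NmN a - 1) / 3 = l := by omega
    have e4 : (NmN p * NmN a - 1) / 3 = 3 * (k * l) + (k + l) := by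
      rw [hk, hl]
      have : (3 * k + 1) * (3 * l + 1) - 1 = 3 * (3 * (k * l) + (k + l)) := by
        have : (3 * k + 1) * (3 * l + 1) = 3 * (3 * (k * l) + (k + l)) + 1 := by ring
        omega
      rw [this]; simp
    rw [e2, e3, e4, pow_add _ (3 * _), pow_mul, ωE_cube, one_pow, one_mul]

lemma nine_P1 {q : Eis} (hq : (9 : Eis) ∣ q - 1) : P1 q :=
  (Dvd.intro (3 : Eis) (by norm_num)).trans hq

lemma chi_omega9 {χ : Eis → Eis → Eis} (hχ : IsCubicSymbol χ) {q : Eis} (hq : (9 : Eis) ∣ q - 1) :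
    χ q ωE = 1 := by
  rw [chi_omega hχ q (nine_P1 hq)]
  obtain ⟨y, hy⟩ := hq
  obtain ⟨a, b, rfl⟩ := exists_mk y
  have hqe : q = mk (1 + 9 * a) (9 * b) := by
    have : (9 : Eis) = mk 9 0 := by rw [mk]; simp
    have h2 : q = mk 1 0 + mk 9 0 * mk a b := by
      rw [← one_eq_mk, ← this]; linear_combination hy
    rw [h2, mk_mul, mk_add]; congr 1 <;> ring
  have h := Nm_nat q
  rw [hqe, Nm_mk] at h
  have h2 : ((NmN (mk (1 + 9 * a) (9 * b)) : ℤ)) = (1 + 9 * a) ^ 2 - (1 + 9 * a) * (9 * b) + (9 * b) ^ 2 := by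
    exact_mod_cast h
  rw [hqe]
  have h3 : ∃ k : ℕ, NmN (mk (1 + 9 * a) (9 * b)) = 9 * k + 1 := by
    refine ⟨NmN (mk (1 + 9 * a) (9 * b)) / 9, ?_⟩
    have : ((NmN (mk (1 + 9 * a) (9 * b)) : ℤ)) = 9 * (2 * a + 9 * a ^ 2 - (1 + 9 * a) * b + 9 * b ^ 2) + 1 := by
      rw [h2]; ring
    omega
  obtain ⟨k, hk⟩ := h3
  have e : (NmN (mk (1 + 9 * a) (9 * b)) - 1) / 3 = 3 * k := by omega
  rw [e, pow_mul, ωE_cube, one_pow]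

lemma cx_unit {χ : Eis → Eis → Eis} (hχ : IsCubicSymbol χ) {q : Eis} (hq : (9 : Eis) ∣ q - 1)
    {u : Eis} (hu : IsUnit u) (x : Eis) : cx χ q (u * x) = cx χ q x := by
  have h1 := nine_P1 hq
  have h2 : χ q u = 1 := by
    have hω := chi_omega9 hχ hq
    have hω2 : χ q (ωE ^ 2) = 1 := by rw [hχ.map_pow h1, hω, one_pow]
    rcases unit_cases hu with h | h | h | h | h | h <;> rw [h]
    · exact hχ.map_one' h1
    · exact hχ.map_neg_one h1
    · exact hω
    · rw [hχ.map_neg h1, hω]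
    · exact hω2
    · rw [hχ.map_neg h1, hω2]
  rw [cx_mul hχ h1]
  rw [cx, h2]; simp

instance : Finite Eisˣ := by
  have h : Set.Finite ({1, -1, ωE, -ωE, ωE ^ 2, -ωE ^ 2} : Set Eis) := by simp
  have := h.to_subtype
  refine Finite.of_injective (fun u : Eisˣ => (⟨u.1, by
    have := unit_cases u.isUnit
    simpa using this⟩ : ({1, -1, ωE, -ωE, ωE ^ 2, -ωE ^ 2} : Set Eis))) ?_
  intro u v h
  simp only [Subtype.mk.injEq] at h
  exact Units.ext h

lemma rep_bij : Function.Bijective (fun p : Eisˣ × RT => (⟨p.1.1 * p.2.1, mul_ne_zero p.1.ne_zero (Rep_ne p.2.2)⟩ :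
    {x : Eis // x ≠ 0})) := by
  constructor
  · rintro ⟨u, n, hn⟩ ⟨v, m, hm⟩ h
    simp only [Subtype.mk.injEq] at h
    obtain ⟨k, c, hc, rfl⟩ := hn
    obtain ⟨l, d, hd, rfl⟩ := hm
    have hlc : ¬ lam ∣ c := P1.not_lam_dvd hc
    have hld : ¬ lam ∣ d := P1.not_lam_dvd hd
    have hl0 := lam_prime.ne_zero
    have hkl : ∀ (k l : ℕ) (c d u v : Eis), IsUnit u → ¬ lam ∣ c → u * (lam ^ k * c) = v * (lam ^ l * d) → ¬ k < l := by
      intro k l c d u v hu hc h hlt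
      obtain ⟨j, rfl⟩ := Nat.exists_eq_add_of_lt hlt
      have : lam ^ k * (u * c) = lam ^ k * (lam * (v * lam ^ j * d)) := by
        rw [pow_add, pow_add] at h; linear_combination h
      have h2 := mul_left_cancel₀ (pow_ne_zero _ hl0) this
      have h3 : lam ∣ u * c := ⟨_, h2⟩
      exact hc ((hu.dvd_mul_left).1 h3)
    have e1 := hkl k l c d u v u.isUnit hlc h
    have e2 := hkl l k d c v u v.isUnit hld h.symm
    have e3 : k = l := by omega
    subst e3
    have h4 : (u : Eis) * c = v * d := by
      have : lam ^ k * ((u : Eis) * c) = lam ^ k * (v * d) := by linear_combination h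
      exact mul_left_cancel₀ (pow_ne_zero _ hl0) this
    have h5 : c = d := by
      refine P1_assoc hc hd ⟨u * v⁻¹, ?_⟩
      rw [Units.val_mul, ← mul_assoc, mul_comm c, h4, mul_comm (v : Eis), mul_assoc, Units.mul_inv, mul_one]
    subst h5
    have h6 : (u : Eis) = v := mul_right_cancel₀ (P1.ne_zero hc) h4
    rw [Units.ext h6]
  · rintro ⟨x, hx⟩
    obtain ⟨u, j, c, hu, hc, rfl⟩ := exists_decomp hx
    obtain ⟨u, rfl⟩ := hu
    exact ⟨⟨u, ⟨lam ^ j * c, j, c, hc, rfl⟩⟩, by simp [mul_assoc]⟩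

lemma FT_summ {c : Eis → ℂ} (hc : ∀ n, ‖c n‖ ≤ 1) (x : ℝ) :
    Summable fun n : Eis => ‖c n * (gw x (Nm n) : ℂ)‖ := by
  by_cases hx : 0 < x
  · refine Summable.of_nonneg_of_le (fun _ => norm_nonneg _) (fun n => ?_) (summ_gauss2 hx)
    rw [norm_mul, gw, if_pos hx, Complex.norm_real, Real.norm_eq_abs, abs_of_pos (Real.exp_pos _)]
    refine (mul_le_of_le_one_left (Real.exp_pos _).le (hc n)).trans (le_of_eq ?_)
    rw [mul_comm]
  · simp [gw, hx, summable_zero]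

lemma TH_le {χ : Eis → Eis → Eis} (hχ : IsCubicSymbol χ) {q : Eis} (hq : (9 : Eis) ∣ q - 1) (hq1 : q ≠ 1)
    (x : ℝ) : ‖TH χ q x‖ ≤ ‖∑' n : Eis, cx χ q n * (gw x (Nm n) : ℂ)‖ := by
  have hP := nine_P1 hq
  have hs := FT_summ (cx_norm_le hχ hP) x
  set f : Eis → ℂ := fun n => cx χ q n * (gw x (Nm n) : ℂ) with hf
  have hf0 : f 0 = 0 := by rw [hf]; beta_reduce; rw [cx_zero hχ hP hq1, zero_mul]
  have e1 : ∑' n : Eis, f n = ∑' n : {x : Eis // x ≠ 0}, f n.1 := by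
    refine (Subtype.val_injective.tsum_eq ?_).symm
    intro n hn
    refine ⟨⟨n, fun h => hn (by rw [h, hf0])⟩, rfl⟩
  have e2 : ∑' n : {x : Eis // x ≠ 0}, f n.1 = ∑' p : Eisˣ × RT, f p.2.1 := by
    rw [← (Equiv.ofBijective _ rep_bij).tsum_eq]
    refine tsum_congr fun p => ?_
    simp only [Equiv.ofBijective_apply, hf]
    rw [cx_unit hχ hq p.1.isUnit, Nm_mul, Nm_unit p.1.isUnit, one_mul]
  have hs2 : Summable fun p : Eisˣ × RT => f p.2.1 := by
    have := hs.of_norm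
    have h3 := ((Equiv.ofBijective _ rep_bij).summable_iff).2 (this.comp_injective (Subtype.val_injective (p := fun x : Eis => x ≠ 0)))
    refine h3.congr fun p => ?_
    simp only [Equiv.ofBijective_apply, hf, Function.comp]
    rw [cx_unit hχ hq p.1.isUnit, Nm_mul, Nm_unit p.1.isUnit, one_mul]
  have e3 : ∑' p : Eisˣ × RT, f p.2.1 = (Nat.card Eisˣ : ℂ) * TH χ q x := by
    refine hs2.tsum_prod.trans ?_
    change ∑' _ : Eisˣ, TH χ q x = _
    rw [tsum_const, nsmul_eq_mul]
  rw [e1, e2, e3, norm_mul, Complex.norm_natCast]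
  have h1 : (1 : ℝ) ≤ Nat.card Eisˣ := by
    exact_mod_cast Nat.card_pos
  exact le_mul_of_one_le_left (norm_nonneg _) h1

end unitsum

section fesec
open ComplexConjugate

/-- the character `χ_a conj χ_b` -/
def psi (χ : Eis → Eis → Eis) (a b n : Eis) : ℂ := cx χ a n * conj (cx χ b n)

lemma psi_norm {χ : Eis → Eis → Eis} (hχ : IsCubicSymbol χ) {a b : Eis} (ha : P1 a) (hb : P1 b)
    (x : Eis) : ‖psi χ a b x‖ ≤ 1 := cx2_norm hχ ha hb x x

lemma psi_mul {χ : Eis → Eis → Eis} (hχ : IsCubicSymbol χ) {a b : Eis} (ha : P1 a) (hb : P1 b)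
    (x y : Eis) : psi χ a b (x * y) = psi χ a b x * psi χ a b y := by
  rw [psi, psi, psi, cx_mul hχ ha, cx_mul hχ hb, map_mul]; ring

lemma cx_eq_zero {χ : Eis → Eis → Eis} (hχ : IsCubicSymbol χ) {c n : Eis} (hc : P1 c)
    (h : ¬ IsCoprime c n) : cx χ c n = 0 := by
  by_contra h0
  exact h ((hχ.ne_zero_iff hc n).1 (fun h => h0 (by rw [cx, h]; rfl)))

open Classical in
lemma cx_split {χ : Eis → Eis → Eis} (hχ : IsCubicSymbol χ) {a b c : Eis} (ha : P1 a) (hb : P1 b)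
    (hc : P1 c) (n : Eis) : cx χ (a * b ^ 2 * c ^ 3) n =
      psi χ a b n * (if IsCoprime c n then 1 else 0) := by
  rw [cx_bot hχ (ha.mul (hb.pow 2)) (hc.pow 3), cx_bot hχ ha (hb.pow 2), pow_two, cx_bot hχ hb hb,
    show c ^ 3 = c * (c * c) by ring, cx_bot hχ hc (hc.mul hc), cx_bot hχ hc hc]
  have h1 : ∀ d, P1 d → cx χ d n * cx χ d n = conj (cx χ d n) := by
    intro d hd
    rw [← cx_mul hχ hd, ← pow_two, cx_sq hχ hd]
  rw [h1 b hb, h1 c hc, psi]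
  split_ifs with h
  · rw [cx_mul_conj hχ hc h]
  · rw [cx_eq_zero hχ hc h, zero_mul]

lemma exists_rad : ∀ c, P1 c → ∃ r, PS r ∧ r ∣ c ∧ ∀ m, IsCoprime r m ↔ IsCoprime c m := by
  apply P1.induction
  · exact ⟨1, PS_one, dvd_rfl, fun m => Iff.rfl⟩
  · rintro p a hp hp1 ha ⟨r, hr, hra, hrm⟩
    by_cases hpr : p ∣ r
    · refine ⟨r, hr, hra.mul_left p, fun m => ?_⟩
      rw [IsCoprime.mul_left_iff, ← hrm]
      refine ⟨fun h => ⟨h.of_isCoprime_of_dvd_left hpr, h⟩, fun h => h.2⟩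
    · have hcop : IsCoprime p r := (hp.irreducible.coprime_iff_not_dvd).2 hpr
      refine ⟨p * r, ⟨hp1.mul hr.1, ?_⟩, mul_dvd_mul_left p hra, fun m => ?_⟩
      · rw [squarefree_mul_iff]
        exact ⟨hcop.isRelPrime, hp.irreducible.squarefree, hr.2⟩
      · rw [IsCoprime.mul_left_iff, IsCoprime.mul_left_iff, ← hrm]

/-- theta function of `psi` -/
def vt (χ : Eis → Eis → Eis) (a b : Eis) (y : ℝ) : ℂ := ∑' n : Eis, psi χ a b n * (gw y (Nm n) : ℂ)

lemma vt_summ {χ : Eis → Eis → Eis} (hχ : IsCubicSymbol χ) {a b : Eis} (ha : P1 a) (hb : P1 b)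
    (x : ℝ) : Summable fun n : Eis => ‖psi χ a b n * (gw x (Nm n) : ℂ)‖ :=
  FT_summ (psi_norm hχ ha hb) x

lemma vt_meas {χ : Eis → Eis → Eis} (hχ : IsCubicSymbol χ) {a b : Eis} (ha : P1 a) (hb : P1 b) :
    Measurable (vt χ a b) := by
  refine measurable_of_tendsto_metrizable' (Filter.atTop : Filter (Finset Eis))
    (f := fun s x => ∑ n ∈ s, psi χ a b n * (gw x (Nm n) : ℂ)) (fun s => ?_) ?_
  · refine Finset.measurable_fun_sum _ fun n _ => ?_
    refine Measurable.const_mul ?_ _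
    refine Complex.measurable_ofReal.comp ?_
    unfold gw
    refine Measurable.ite measurableSet_Ioi (by fun_prop) (by fun_prop)
  · rw [tendsto_pi_nhds]
    intro x
    exact (vt_summ hχ ha hb x).of_norm.hasSum

lemma theta_split {χ : Eis → Eis → Eis} (hχ : IsCubicSymbol χ) {a b c : Eis} (ha : P1 a) (hb : P1 b)
    (hc : P1 c) {r : Eis} (hr : PS r) (hrc : ∀ m, IsCoprime r m ↔ IsCoprime c m) (x : ℝ) :
    ∑' n : Eis, cx χ (a * b ^ 2 * c ^ 3) n * (gw x (Nm n) : ℂ) =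
      ∑ d ∈ divs r, (mob d : ℂ) * (psi χ a b d * vt χ a b (Nm d * x)) := by
  classical
  set g : Eis → ℂ := fun m => psi χ a b m * (gw x (Nm m) : ℂ) with hg
  have hgs : Summable g := (vt_summ hχ ha hb x).of_norm
  have h1 : ∀ m, cx χ (a * b ^ 2 * c ^ 3) m * (gw x (Nm m) : ℂ) =
        ∑ e ∈ divs r, (mob e : ℂ) * (if e ∣ m then g m else 0) := by
    intro m
    have e1 : ∑ e ∈ divs r, (mob e : ℂ) * (if e ∣ m then g m else 0) =
        ((∑ e ∈ (divs r).filter (fun e => e ∣ m), mob e : ℝ) : ℂ) * g m := by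
      push_cast
      rw [Finset.sum_mul, Finset.sum_filter]
      refine Finset.sum_congr rfl fun e _ => ?_
      split_ifs <;> simp
    rw [e1, sum_mob_coprime hr, cx_split hχ ha hb hc, hg]
    simp only [hrc]
    split_ifs <;> simp
  have h2 : ∀ e ∈ divs r, Summable (fun m => (mob e : ℂ) * (if e ∣ m then g m else 0)) := by
    intro e _
    refine Summable.mul_left _ ?_
    refine Summable.of_norm_bounded hgs.norm fun m => ?_
    split_ifs
    · exact le_rfl
    · simp
  refine (tsum_congr h1).trans ?_
  rw [Summable.tsum_finsetSum h2]
  refine Finset.sum_congr rfl fun e he => ?_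
  rw [tsum_mul_left]
  congr 1
  have he0 : e ≠ 0 := ((mem_divs hr.ne_zero).1 he).1.ne_zero
  have hNe := Nm_pos he0
  have h3 : ∑' m : Eis, (if e ∣ m then g m else 0) = ∑' m : Eis, g (e * m) := by
    have := (mul_right_injective₀ he0).tsum_eq (f := fun m : Eis => if e ∣ m then g m else 0)
      (by
        intro m hm
        rw [Function.mem_support] at hm
        have : e ∣ m := by by_contra hh; exact hm (if_neg hh)
        obtain ⟨k, rfl⟩ := this
        exact ⟨k, rfl⟩)
    rw [← this]
    exact tsum_congr fun m => by rw [if_pos (dvd_mul_right e m)]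
  rw [h3, vt, ← tsum_mul_left]
  refine tsum_congr fun m => ?_
  rw [hg]; beta_reduce
  rw [psi_mul hχ ha hb, Nm_mul, mul_assoc]
  have : gw x (Nm e * Nm m) = gw (Nm e * x) (Nm m) := by
    unfold gw
    by_cases hx : 0 < x
    · rw [if_pos hx, if_pos (by positivity)]; congr 1; ring
    · rw [if_neg hx, if_neg (by push Not at hx ⊢; nlinarith)]
  rw [this]

lemma vt_FE {χ : Eis → Eis → Eis} (hχ : IsCubicSymbol χ) {a b : Eis} (ha : PS a) (hb : PS b)
    (hab : IsCoprime a b) {y : ℝ} (hy : 0 < y) :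
    y * ‖vt χ a b y‖ ^ 2 = (4 * Real.pi ^ 2 / (3 * Nm (a * b)) / y) *
      ‖vt χ a b (4 * Real.pi ^ 2 / (3 * Nm (a * b)) / y)‖ ^ 2 := by
  have hpi := Real.pi_pos
  have hNa := Nm_pos ha.ne_zero
  have hNb := Nm_pos hb.ne_zero
  have hN := Nm_pos (mul_ne_zero ha.ne_zero hb.ne_zero)
  set y' := 4 * Real.pi ^ 2 / (3 * Nm (a * b)) / y with hy'
  have hy'0 : 0 < y' := by positivity
  have hper : Per (a * b) (fun x => cx χ a x * conj (cx χ b x)) := by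
    intro x y h
    simp only
    rw [cx_per hχ ha.1 x y ((dvd_mul_right a b).trans h),
      cx_per hχ hb.1 x y ((dvd_mul_left b a).trans h)]
  have hP := poisson_tw (mul_ne_zero ha.ne_zero hb.ne_zero) hper (s := y / Real.pi) (by positivity)
  have e1 : vt χ a b y = ∑' m : Eis, (fun x => cx χ a x * conj (cx χ b x)) m *
      (Real.exp (-(Real.pi * (y / Real.pi) * Nm m)) : ℂ) := by
    rw [vt]
    refine tsum_congr fun m => ?_
    rw [gw, if_pos hy, psi, show Real.pi * (y / Real.pi) * Nm m = Nm m * y by field_simp]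
  have e2 : ∑' k : Eis, (Real.exp (-(4 * Real.pi * Nm k / (3 * (y / Real.pi) * Nm (a * b)))) : ℂ) *
      fhat (a * b) (fun x => cx χ a x * conj (cx χ b x)) k =
      gam χ a * conj (gam χ b) * conj (vt χ a b y') := by
    rw [vt, Complex.conj_tsum, ← tsum_mul_left]
    refine tsum_congr fun k => ?_
    rw [gauss_two hχ ha.1 hb.1 ha.2 hb.2 hab, gw, if_pos hy'0, psi]
    have : 4 * Real.pi * Nm k / (3 * (y / Real.pi) * Nm (a * b)) = Nm k * y' := by
      rw [hy']; field_simp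
    rw [this, map_mul, map_mul, Complex.conj_conj, Complex.conj_ofReal]
    ring
  rw [e1, hP, e2, norm_mul, norm_mul, norm_mul, RCLike.norm_conj, RCLike.norm_conj, Complex.norm_real,
    mul_pow, mul_pow, mul_pow, gam_norm hχ ha.1 ha.2, gam_norm hχ hb.1 hb.2, ← Nm_mul,
    Real.norm_eq_abs, sq_abs, div_pow, mul_pow, mul_pow, Real.sq_sqrt (by norm_num)]
  have : y * (2 ^ 2 / (3 * (y / Real.pi) ^ 2 * Nm (a * b) ^ 2) * Nm (a * b)) = y' := by
    rw [hy']; field_simp; norm_num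
  rw [← this]; ring

end fesec

section foldsec
open ComplexConjugate MeasureTheory Set

lemma enorm_sq (z : ℂ) : ‖z‖ₑ ^ 2 = ENNReal.ofReal (‖z‖ ^ 2) := by
  rw [← ofReal_norm, ENNReal.ofReal_pow (norm_nonneg _)]

lemma lint_scale {D : ℝ} (hD : 1 ≤ D) (g : ℝ → ENNReal) :
    ∫⁻ x in Ioi (0:ℝ), g (D * x) ≤ ∫⁻ x in Ioi (0:ℝ), g x := by
  have hD0 : 0 < D := by linarith
  have him : (fun x : ℝ => D * x) '' Ioi 0 = Ioi 0 := by
    ext y; constructor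
    · rintro ⟨x, hx, rfl⟩; exact mul_pos hD0 hx
    · intro hy; exact ⟨y / D, div_pos hy hD0, by field_simp⟩
  have h := lintegral_image_eq_lintegral_abs_deriv_mul (s := Ioi (0:ℝ)) (f := fun x => D * x)
    (f' := fun _ => D) measurableSet_Ioi (fun x _ => by
      simpa using ((hasDerivAt_id x).const_mul D).hasDerivWithinAt)
      (fun x _ y _ h => mul_left_cancel₀ hD0.ne' h) g
  rw [him] at h
  rw [h]
  refine lintegral_mono fun x => ?_
  rw [abs_of_pos hD0]
  have : (1:ENNReal) ≤ ENNReal.ofReal D := by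
    rw [← ENNReal.ofReal_one]; exact ENNReal.ofReal_le_ofReal hD
  calc g (D * x) = 1 * g (D * x) := (one_mul _).symm
    _ ≤ _ := mul_le_mul_left this _

lemma fold {χ : Eis → Eis → Eis} (hχ : IsCubicSymbol χ) {a b : Eis} (ha : PS a) (hb : PS b)
    (hab : IsCoprime a b) {T0 : ℝ} (hT : T0 < 2 * Real.pi / Real.sqrt (3 * Nm (a * b))) :
    ∫⁻ z in Ioi (0:ℝ), ENNReal.ofReal (‖vt χ a b z‖ ^ 2 * Real.exp (z / 2)) ≤
      ENNReal.ofReal (1 + Real.exp 2) *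
        ∫⁻ z in Ioi T0, ENNReal.ofReal (‖vt χ a b z‖ ^ 2 * Real.exp (z / 2)) := by
  classical
  have hpi := Real.pi_pos
  have hN1 : 1 ≤ Nm (a * b) := one_le_Nm (mul_ne_zero ha.ne_zero hb.ne_zero)
  set R := Nm (a * b) with hR
  set T := 2 * Real.pi / Real.sqrt (3 * R) with hTd
  have hs : 0 < Real.sqrt (3 * R) := Real.sqrt_pos.2 (by positivity)
  have hT0 : 0 < T := by positivity
  have hT4 : T ≤ 4 := by
    rw [hTd, div_le_iff₀ hs]
    have h1 : (1.7:ℝ) ≤ Real.sqrt (3 * R) := Real.le_sqrt_of_sq_le (by nlinarith)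
    have := Real.pi_lt_d2
    nlinarith
  have hTc : T ^ 2 = 4 * Real.pi ^ 2 / (3 * R) := by
    rw [hTd, div_pow, Real.sq_sqrt (by positivity)]; ring
  set v : ℝ → ℝ := fun z => ‖vt χ a b z‖ ^ 2 with hv
  have hvm : Measurable v := ((vt_meas hχ ha.1 hb.1).norm).pow_const 2
  have hv0 : ∀ z, 0 ≤ v z := fun z => by positivity
  have hFE : ∀ z, 0 < z → z * v z = (T ^ 2 / z) * v (T ^ 2 / z) := by
    intro z hz
    rw [hTc]; exact vt_FE hχ ha hb hab hz
  change ∫⁻ z in Ioi (0:ℝ), ENNReal.ofReal (v z * Real.exp (z / 2)) ≤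
      ENNReal.ofReal (1 + Real.exp 2) * ∫⁻ z in Ioi T0, ENNReal.ofReal (v z * Real.exp (z / 2))
  clear_value v
  set G : ℝ → ENNReal := fun z => if T ≤ z then ENNReal.ofReal (z * v z) else 0 with hG
  have hGm : Measurable G := Measurable.ite measurableSet_Ici (by fun_prop) (by fun_prop)
  have hpt : ∀ z ∈ Ioi (0:ℝ), ENNReal.ofReal (v z * Real.exp (z / 2)) ≤
      ENNReal.ofReal (Real.exp 2) * (G (T ^ 2 / z) * ENNReal.ofReal z⁻¹) +
        ENNReal.ofReal (Real.exp (z / 2)) * (G z * ENNReal.ofReal z⁻¹) := by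
    intro z hz
    have hz : 0 < z := hz
    rw [hG]; beta_reduce
    by_cases hzT : T ≤ z
    · refine le_add_of_nonneg_of_le (by positivity) ?_
      rw [if_pos hzT, ← ENNReal.ofReal_mul (mul_nonneg hz.le (hv0 z)),
        ← ENNReal.ofReal_mul (Real.exp_pos _).le]
      refine ENNReal.ofReal_le_ofReal (le_of_eq ?_)
      field_simp
    · push Not at hzT
      refine le_add_of_le_of_nonneg ?_ (by positivity)
      have h1 : T ≤ T ^ 2 / z := by rw [le_div_iff₀ hz]; nlinarith
      rw [if_pos h1, ← hFE z hz, ← ENNReal.ofReal_mul (mul_nonneg hz.le (hv0 z)),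
        ← ENNReal.ofReal_mul (Real.exp_pos _).le]
      refine ENNReal.ofReal_le_ofReal ?_
      have h2 : Real.exp (z / 2) ≤ Real.exp 2 := Real.exp_le_exp.2 (by linarith)
      have h3 : z * v z * z⁻¹ = v z := by field_simp
      rw [h3, mul_comm]
      exact mul_le_mul_of_nonneg_right h2 (hv0 z)
  refine (setLIntegral_mono' measurableSet_Ioi hpt).trans ?_
  rw [lintegral_add_left (by fun_prop), lintegral_const_mul _ (by fun_prop), lint_inv (by positivity)]
  have h1 : ∫⁻ x in Ioi (0:ℝ), G x * ENNReal.ofReal x⁻¹ ≤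
      ∫⁻ x in Ioi (0:ℝ), ENNReal.ofReal (Real.exp (x / 2)) * (G x * ENNReal.ofReal x⁻¹) := by
    refine setLIntegral_mono' measurableSet_Ioi fun x hx => ?_
    have hx : 0 < x := hx
    have : (1:ENNReal) ≤ ENNReal.ofReal (Real.exp (x / 2)) := by
      rw [← ENNReal.ofReal_one]; exact ENNReal.ofReal_le_ofReal (Real.one_le_exp (by linarith))
    calc G x * ENNReal.ofReal x⁻¹ = 1 * (G x * ENNReal.ofReal x⁻¹) := (one_mul _).symm
      _ ≤ _ := mul_le_mul_left this _
  have h2 : ∫⁻ x in Ioi (0:ℝ), ENNReal.ofReal (Real.exp (x / 2)) * (G x * ENNReal.ofReal x⁻¹) ≤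
      ∫⁻ z in Ioi T0, ENNReal.ofReal (v z * Real.exp (z / 2)) := by
    rw [← lintegral_indicator measurableSet_Ioi, ← lintegral_indicator measurableSet_Ioi]
    refine lintegral_mono fun z => ?_
    by_cases hzT : T ≤ z
    · have hz : 0 < z := by linarith
      rw [indicator_of_mem (by exact hz), indicator_of_mem (show z ∈ Ioi T0 from lt_of_lt_of_le hT hzT), hG]
      beta_reduce
      rw [if_pos hzT, ← ENNReal.ofReal_mul (mul_nonneg hz.le (hv0 z)),
        ← ENNReal.ofReal_mul (Real.exp_pos _).le]
      refine ENNReal.ofReal_le_ofReal (le_of_eq ?_)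
      field_simp
    · have : (Ioi (0:ℝ)).indicator (fun x => ENNReal.ofReal (Real.exp (x / 2)) * (G x * ENNReal.ofReal x⁻¹)) z = 0 := by
        refine indicator_apply_eq_zero.2 fun _ => ?_
        rw [hG]; beta_reduce; rw [if_neg hzT]; simp
      rw [this]; exact zero_le
  calc _ ≤ (ENNReal.ofReal (Real.exp 2) * ∫⁻ z in Ioi T0, ENNReal.ofReal (v z * Real.exp (z / 2))) +
        ∫⁻ z in Ioi T0, ENNReal.ofReal (v z * Real.exp (z / 2)) :=
        add_le_add (mul_le_mul_right (h1.trans h2) _) h2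
    _ = _ := by
        rw [ENNReal.ofReal_add zero_le_one (Real.exp_pos _).le, ENNReal.ofReal_one, add_mul, one_mul, add_comm]

set_option maxHeartbeats 1000000 in
lemma A2_vt {δ : ℝ} (hδ : 0 < δ) : ∃ C : ℝ, 0 ≤ C ∧ ∀ χ : Eis → Eis → Eis, IsCubicSymbol χ →
    ∀ a b c : Eis, PS a → PS b → P1 c → IsCoprime a b → (9 : Eis) ∣ (a * b ^ 2 * c ^ 3) - 1 →
    a * b ^ 2 * c ^ 3 ≠ 1 → ∀ T0 : ℝ, T0 < 2 * Real.pi / Real.sqrt (3 * Nm (a * b)) →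
    ‖A₂ χ (a * b ^ 2 * c ^ 3)‖ₑ ≤
      ENNReal.ofReal (C * Nm (a * b ^ 2 * c ^ 3) ^ δ * ((divs c).card : ℝ) ^ 2) *
        ∫⁻ z in Ioi T0, ENNReal.ofReal (‖vt χ a b z‖ ^ 2 * Real.exp (z / 2)) := by
  classical
  obtain ⟨C, hC, h⟩ := lemA hδ
  refine ⟨C * (1 + Real.exp 2), by positivity, ?_⟩
  intro χ hχ a b c ha hb hc hab hq hq1 T0 hT
  set q := a * b ^ 2 * c ^ 3 with hqd
  have hqP := nine_P1 hq
  obtain ⟨r, hr, hrc, hrm⟩ := exists_rad c hc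
  set I := ∫⁻ z in Ioi T0, ENNReal.ofReal (‖vt χ a b z‖ ^ 2 * Real.exp (z / 2)) with hI
  have hsub : divs r ⊆ divs c := by
    intro d hd
    rw [mem_divs hr.ne_zero] at hd
    exact (mem_divs hc.ne_zero).2 ⟨hd.1, hd.2.trans hrc⟩
  have hcard : ((divs r).card : ℝ) ≤ (divs c).card := by exact_mod_cast Finset.card_le_card hsub
  have h1 : ∀ x : ℝ, ‖TH χ q x‖ ^ 2 ≤ (divs r).card * ∑ d ∈ divs r, ‖vt χ a b (Nm d * x)‖ ^ 2 := by
    intro x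
    have e1 := TH_le hχ hq hq1 x
    rw [hqd, theta_split hχ ha.1 hb.1 hc hr hrm] at e1
    have e2 : ‖TH χ q x‖ ≤ ∑ d ∈ divs r, ‖vt χ a b (Nm d * x)‖ := by
      refine e1.trans ((norm_sum_le _ _).trans (Finset.sum_le_sum fun d _ => ?_))
      rw [norm_mul, norm_mul, Complex.norm_real, Real.norm_eq_abs, abs_mob, one_mul]
      exact mul_le_of_le_one_left (norm_nonneg _) (psi_norm hχ ha.1 hb.1 d)
    exact (pow_le_pow_left₀ (norm_nonneg _) e2 2).trans sq_sum_le_card_mul_sum_sq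
  have h2 : ∫⁻ x in Ioi (0:ℝ), ‖TH χ q x‖ₑ ^ 2 * ENNReal.ofReal (Real.exp (x / 2)) ≤
      ENNReal.ofReal ((divs r).card) * ∑ d ∈ divs r, ∫⁻ x in Ioi (0:ℝ),
        ENNReal.ofReal (‖vt χ a b (Nm d * x)‖ ^ 2 * Real.exp (Nm d * x / 2)) := by
    have hm : ∀ d : Eis, Measurable fun x : ℝ =>
        ENNReal.ofReal (‖vt χ a b (Nm d * x)‖ ^ 2 * Real.exp (Nm d * x / 2)) := by
      intro d
      have := (vt_meas hχ ha.1 hb.1).comp (measurable_const_mul (Nm d))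
      exact ENNReal.measurable_ofReal.comp ((this.norm.pow_const 2).mul (by fun_prop))
    rw [← lintegral_finsetSum _ fun d _ => hm d,
      ← lintegral_const_mul _ (Finset.measurable_fun_sum _ fun d _ => hm d)]
    refine setLIntegral_mono' measurableSet_Ioi fun x hx => ?_
    have hx : 0 < x := hx
    rw [enorm_sq, ← ENNReal.ofReal_mul (by positivity), ← ENNReal.ofReal_sum_of_nonneg (fun d _ => by positivity),
      ← ENNReal.ofReal_mul (by positivity)]
    refine ENNReal.ofReal_le_ofReal ?_
    refine (mul_le_mul_of_nonneg_right (h1 x) (Real.exp_pos _).le).trans ?_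
    rw [mul_assoc, Finset.sum_mul]
    refine mul_le_mul_of_nonneg_left (Finset.sum_le_sum fun d hd => ?_) (by positivity)
    refine mul_le_mul_of_nonneg_left (Real.exp_le_exp.2 ?_) (by positivity)
    have := one_le_Nm ((mem_divs hr.ne_zero).1 hd).1.ne_zero
    nlinarith
  have h3 : ∀ d ∈ divs r, ∫⁻ x in Ioi (0:ℝ),
        ENNReal.ofReal (‖vt χ a b (Nm d * x)‖ ^ 2 * Real.exp (Nm d * x / 2)) ≤
        ENNReal.ofReal (1 + Real.exp 2) * I := by
    intro d hd
    have := one_le_Nm ((mem_divs hr.ne_zero).1 hd).1.ne_zero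
    exact (lint_scale this (fun z => ENNReal.ofReal (‖vt χ a b z‖ ^ 2 * Real.exp (z / 2)))).trans
      (fold hχ ha hb hab hT)
  have h4 := (mul_le_mul_right h2 (ENNReal.ofReal (C * Nm q ^ δ)))
  refine (h χ hχ q hqP).trans (h4.trans ?_)
  have h5 := Finset.sum_le_card_nsmul _ _ _ h3
  refine (mul_le_mul_right (mul_le_mul_right h5 _) _).trans ?_
  have hNq := Real.rpow_nonneg (Nm_nonneg q) δ
  generalize Nm q ^ δ = NN at hNq ⊢
  generalize ((divs r).card : ℕ) = n1 at hcard ⊢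
  generalize ((divs c).card : ℕ) = n2 at hcard ⊢
  clear_value I
  clear h h1 h2 h3 h4 h5
  rw [nsmul_eq_mul, ← ENNReal.ofReal_natCast, ← mul_assoc, ← mul_assoc, ← mul_assoc,
    ← ENNReal.ofReal_mul (by positivity), ← ENNReal.ofReal_mul (by positivity), ← ENNReal.ofReal_mul (by positivity)]
  refine mul_le_mul_left (ENNReal.ofReal_le_ofReal ?_) _
  have e : (n1 : ℝ) * n1 ≤ (n2 : ℝ) ^ 2 := by
    rw [pow_two]; exact mul_le_mul hcard hcard (by positivity) (by positivity)
  calc _ = (C * (1 + Real.exp 2) * NN) * ((n1 : ℝ) * n1) := by ring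
    _ ≤ _ := mul_le_mul_of_nonneg_left e (by positivity)

end foldsec

section lsapp
open ComplexConjugate MeasureTheory Set

lemma exp_half_bound {s : ℝ} (hs : 0 < s) : ∃ C : ℝ, 0 ≤ C ∧ ∀ u : ℝ, 0 < u →
    Real.exp (-(u / 2)) ≤ C * (u ^ (-s) * (1 + u)⁻¹) := by
  refine ⟨4 * (s ^ s * (1 / 4) ^ (-s)), by positivity, fun u hu => ?_⟩
  have h1 := exp_neg_le_rpow hs (show 0 < u / 4 by positivity)
  have h2 : 1 + u ≤ 4 * Real.exp (u / 4) := by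
    have := Real.add_one_le_exp (u / 4)
    linarith
  have h3 : (u / 4) ^ (-s) = (1 / 4) ^ (-s) * u ^ (-s) := by
    rw [← Real.mul_rpow (by norm_num) hu.le]; congr 1; ring
  rw [h3] at h1
  rw [← mul_assoc, le_mul_inv_iff₀ (by positivity)]
  calc Real.exp (-(u / 2)) * (1 + u) ≤ Real.exp (-(u / 2)) * (4 * Real.exp (u / 4)) :=
        mul_le_mul_of_nonneg_left h2 (Real.exp_pos _).le
    _ = 4 * Real.exp (-(u / 4)) := by
        rw [mul_left_comm, ← Real.exp_add]; congr 2; ring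
    _ ≤ 4 * (s ^ s * ((1 / 4) ^ (-s) * u ^ (-s))) := by linarith
    _ = _ := by ring

set_option maxHeartbeats 1000000 in
lemma LS_fin {ε : ℝ} (hε : 0 < ε) : ∃ C : ℝ, 0 ≤ C ∧ ∀ χ : Eis → Eis → Eis, IsCubicSymbol χ →
    ∀ M Q T0 Ce : ℝ, 1 ≤ M → 1 ≤ Q → 0 < T0 → T0 ≤ M → 0 ≤ Ce → ∀ B D : Eis → ℂ,
    (∀ β ∈ ps M, ‖B β‖ ≤ Ce * Nm β ^ (-(1/2) + ε)) → (∀ n, ‖D n‖ ≤ 1) →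
    ∀ z, T0 < z → ∀ s : Finset Eis, (∀ n ∈ s, n ≠ 0) →
    ∑ a ∈ ps Q, ‖(∑ β ∈ ps M, B β * cx χ a β) *
      ∑ n ∈ s, cx χ a n * (D n * ((Real.exp (z / 4) * gw z (Nm n) : ℝ) : ℂ))‖ ^ 2 ≤
      C * (Ce * M ^ (3 * ε) * z ^ (-(1/2 + 2 * ε))) ^ 2 * Q ^ ε * GQ Q (M / T0) := by
  classical
  obtain ⟨C4, hC4, hW⟩ := WLS hε
  obtain ⟨C2, hC2, hE⟩ := exp_half_bound (s := 1/2 + 2 * ε) (by positivity)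
  obtain ⟨C3, hC3, hdiv⟩ := divisor_bound hε
  refine ⟨C4 * (C2 * C3) ^ 2, by positivity, ?_⟩
  intro χ hχ M Q T0 Ce hM hQ hT0 hTM hCe B D hB hD z hz s hs
  have hz0 : 0 < z := hT0.trans hz
  have hL : 1 ≤ M / T0 := by rwa [one_le_div hT0]
  set L := M / T0 with hLd
  set P := (ps M) ×ˢ s with hP
  set E : Eis → ℂ := fun n => D n * ((Real.exp (z / 4) * gw z (Nm n) : ℝ) : ℂ) with hEd
  set S := P.image (fun p => p.1 * p.2) with hS
  set am : Eis → ℂ := fun m => ∑ p ∈ P.filter (fun p => p.1 * p.2 = m), B p.1 * E p.2 with ham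
  have hS0 : ∀ m ∈ S, m ≠ 0 := by
    intro m hm
    rw [hS, Finset.mem_image] at hm
    obtain ⟨p, hp, rfl⟩ := hm
    rw [hP, Finset.mem_product] at hp
    exact mul_ne_zero ((mem_ps.1 hp.1).1.ne_zero) (hs _ hp.2)
  have hpt : ∀ m ∈ S, ‖am m‖ ≤ (C2 * C3 * (Ce * M ^ (3 * ε) * z ^ (-(1/2 + 2 * ε)))) *
      (Nm m ^ (-(1/2 + ε)) * (1 + Nm m / L)⁻¹) := by
    intro m hm
    have hm0 := hS0 m hm
    have hNm := Nm_pos hm0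
    set bd := C2 * (Ce * M ^ (3 * ε) * z ^ (-(1/2 + 2 * ε))) *
      (Nm m ^ (-(1/2 + 2 * ε)) * (1 + Nm m / L)⁻¹) with hbd
    have hbd0 : 0 ≤ bd := by positivity
    have h1 : ∀ p ∈ P.filter (fun p => p.1 * p.2 = m), ‖B p.1 * E p.2‖ ≤ bd := by
      rintro ⟨β, n⟩ hp
      rw [Finset.mem_filter, hP, Finset.mem_product] at hp
      obtain ⟨⟨hβ, hn⟩, hmn⟩ := hp
      simp only at hβ hn hmn ⊢
      have hβM := (mem_ps.1 hβ).2
      have hβ1 := (mem_ps.1 hβ).1.one_le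
      have hn1 := one_le_Nm (hs n hn)
      have hβ0 : 0 < Nm β := by linarith
      have hn0 : 0 < Nm n := by linarith
      have e1 : ‖B β‖ ≤ Ce * M ^ (3 * ε) * Nm β ^ (-(1/2 + 2 * ε)) := by
        refine (hB β hβ).trans ?_
        rw [mul_assoc]
        refine mul_le_mul_of_nonneg_left ?_ hCe
        rw [show -(1/2 : ℝ) + ε = 3 * ε + -(1/2 + 2 * ε) by ring, Real.rpow_add hβ0]
        exact mul_le_mul_of_nonneg_right (Real.rpow_le_rpow hβ0.le hβM (by positivity)) (by positivity)
      have e2 : ‖E n‖ ≤ C2 * (z ^ (-(1/2 + 2 * ε)) * Nm n ^ (-(1/2 + 2 * ε)) * (1 + Nm m / L)⁻¹) := by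
        rw [hEd]; beta_reduce
        rw [norm_mul, Complex.norm_real, Real.norm_eq_abs, gw, if_pos hz0, ← Real.exp_add, abs_of_pos (Real.exp_pos _)]
        refine (mul_le_of_le_one_left (Real.exp_pos _).le (hD n)).trans ?_
        have f1 : Real.exp (z / 4 + -(Nm n * z)) ≤ Real.exp (-(Nm n * z / 2)) :=
          Real.exp_le_exp.2 (by nlinarith)
        refine f1.trans ((hE (Nm n * z) (by positivity)).trans ?_)
        rw [Real.mul_rpow hn0.le hz0.le, mul_comm (Nm n ^ _)]
        refine mul_le_mul_of_nonneg_left (mul_le_mul_of_nonneg_left ?_ (by positivity)) hC2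
        refine inv_anti₀ (by positivity) ?_
        have : Nm m / L ≤ Nm n * z := by
          rw [← hmn, Nm_mul, hLd, div_div_eq_mul_div, div_le_iff₀ (by linarith)]
          have : Nm β * Nm n * T0 ≤ M * Nm n * z := by gcongr
          linarith
        linarith
      rw [norm_mul]
      refine (mul_le_mul e1 e2 (norm_nonneg _) (by positivity)).trans (le_of_eq ?_)
      rw [hbd, ← hmn, Nm_mul, Real.mul_rpow hβ0.le hn0.le]; ring
    have h2 : ((P.filter (fun p => p.1 * p.2 = m)).card : ℝ) ≤ (divs m).card := by
      have : (P.filter (fun p => p.1 * p.2 = m)).card ≤ (divs m).card := by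
        refine Finset.card_le_card_of_injOn Prod.fst ?_ ?_
        · intro p hp
          have hp := Finset.mem_coe.1 hp
          rw [Finset.mem_filter, hP, Finset.mem_product] at hp
          exact Finset.mem_coe.2 ((mem_divs hm0).2 ⟨(mem_ps.1 hp.1.1).1.1, ⟨p.2, hp.2.symm⟩⟩)
        · intro p hp p' hp' h
          have hp := Finset.mem_coe.1 hp
          have hp' := Finset.mem_coe.1 hp'
          rw [Finset.mem_filter, hP, Finset.mem_product] at hp hp'
          refine Prod.ext h ?_
          have := hp.2.trans hp'.2.symm
          rw [h] at this
          exact mul_left_cancel₀ ((mem_ps.1 hp'.1.1).1.ne_zero) this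
      exact_mod_cast this
    have h3 : ‖am m‖ ≤ (P.filter (fun p => p.1 * p.2 = m)).card * bd := by
      rw [ham]; beta_reduce
      refine (norm_sum_le _ _).trans ?_
      rw [← nsmul_eq_mul]
      exact Finset.sum_le_card_nsmul _ _ _ h1
    refine h3.trans ((mul_le_mul_of_nonneg_right (h2.trans (hdiv m hm0)) hbd0).trans (le_of_eq ?_))
    rw [hbd, show -(1/2 + ε) = ε + -(1/2 + 2 * ε) by ring, Real.rpow_add hNm]; ring
  have hmain := hW χ hχ Q L _ hQ hL (by positivity) S hS0 am hpt
  refine le_trans (le_of_eq ?_) (hmain.trans (le_of_eq (by ring)))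
  refine Finset.sum_congr rfl fun a ha => ?_
  have haP := (mem_ps.1 ha).1.1
  congr 2
  have e1 : (∑ β ∈ ps M, B β * cx χ a β) * ∑ n ∈ s, cx χ a n * E n =
      ∑ p ∈ P, (B p.1 * E p.2) * cx χ a (p.1 * p.2) := by
    rw [hP, Finset.sum_product, Finset.sum_mul_sum]
    refine Finset.sum_congr rfl fun β _ => Finset.sum_congr rfl fun n _ => ?_
    rw [cx_mul hχ haP]; ring
  refine e1.trans ?_
  rw [← Finset.sum_fiberwise_of_maps_to (s := P) (t := S) (g := fun p => p.1 * p.2)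
    (fun p hp => Finset.mem_image_of_mem _ hp)]
  refine Finset.sum_congr rfl fun m _ => ?_
  rw [ham]; beta_reduce
  rw [Finset.sum_mul]
  refine Finset.sum_congr rfl fun p hp => ?_
  rw [(Finset.mem_filter.1 hp).2]

/-- theta function without the zero term -/
lemma LS_z {ε : ℝ} (hε : 0 < ε) : ∃ C : ℝ, 0 ≤ C ∧ ∀ χ : Eis → Eis → Eis, IsCubicSymbol χ →
    ∀ M Q T0 Ce : ℝ, 1 ≤ M → 1 ≤ Q → 0 < T0 → T0 ≤ M → 0 ≤ Ce → ∀ B : Eis → ℂ, ∀ b, P1 b →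
    (∀ β ∈ ps M, ‖B β‖ ≤ Ce * Nm β ^ (-(1/2) + ε)) →
    ∀ z, T0 < z →
    ∑ a ∈ (ps Q).filter (fun a => psi χ a b 0 = 0), ‖∑ β ∈ ps M, B β * cx χ a β‖ ^ 2 * (‖vt χ a b z‖ ^ 2 * Real.exp (z / 2)) ≤
      C * (Ce * M ^ (3 * ε) * z ^ (-(1/2 + 2 * ε))) ^ 2 * Q ^ ε * GQ Q (M / T0) := by
  classical
  obtain ⟨C, hC, h⟩ := LS_fin hε
  refine ⟨C, hC, ?_⟩
  intro χ hχ M Q T0 Ce hM hQ hT0 hTM hCe B b hb hB z hz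
  have hfin : ∀ s : Finset Eis, ∑ a ∈ (ps Q).filter (fun a => psi χ a b 0 = 0),
      ‖∑ β ∈ ps M, B β * cx χ a β‖ ^ 2 * (‖∑ n ∈ s, psi χ a b n * (gw z (Nm n) : ℂ)‖ ^ 2 * Real.exp (z / 2)) ≤
      C * (Ce * M ^ (3 * ε) * z ^ (-(1/2 + 2 * ε))) ^ 2 * Q ^ ε * GQ Q (M / T0) := by
    intro s
    have h1 := h χ hχ M Q T0 Ce hM hQ hT0 hTM hCe B (fun n => conj (cx χ b n)) hB
      (fun n => by rw [RCLike.norm_conj]; exact cx_norm_le hχ hb n) z hz (s.erase 0)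
      (fun n hn => Finset.ne_of_mem_erase hn)
    refine le_trans ?_ h1
    refine le_trans (le_of_eq ?_) (Finset.sum_le_sum_of_subset_of_nonneg (Finset.filter_subset (fun a => psi χ a b 0 = 0) (ps Q))
      (fun a _ _ => by positivity))
    refine Finset.sum_congr rfl fun a ha => ?_
    have ha0 := (Finset.mem_filter.1 ha).2
    have e1 : ∑ n ∈ s.erase 0, cx χ a n * (conj (cx χ b n) * ((Real.exp (z / 4) * gw z (Nm n) : ℝ) : ℂ)) =
        ((Real.exp (z / 4) : ℝ) : ℂ) * ∑ n ∈ s, psi χ a b n * (gw z (Nm n) : ℂ) := by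
      rw [Finset.mul_sum, ← Finset.sum_erase s (a := 0) (by rw [ha0]; simp)]
      refine Finset.sum_congr rfl fun n _ => ?_
      rw [psi]; push_cast; ring
    rw [e1, norm_mul, norm_mul, norm_exp_real, mul_pow, mul_pow, ← Real.exp_nat_mul]
    rw [show ((2:ℕ):ℝ) * (z / 4) = z / 2 by push_cast; ring]
    ring
  refine le_of_tendsto' (f := fun s : Finset Eis => ∑ a ∈ (ps Q).filter (fun a => psi χ a b 0 = 0),
      ‖∑ β ∈ ps M, B β * cx χ a β‖ ^ 2 * (‖∑ n ∈ s, psi χ a b n * (gw z (Nm n) : ℂ)‖ ^ 2 * Real.exp (z / 2)))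
      (x := Filter.atTop) ?_ hfin
  refine tendsto_finsetSum _ fun a ha => ?_
  have haP := (mem_ps.1 (Finset.mem_filter.1 ha).1).1.1
  have := (vt_summ hχ haP hb z).of_norm.hasSum
  exact ((this.norm.pow 2).mul_const _).const_mul _

set_option maxHeartbeats 1000000 in
lemma LS_int {ε : ℝ} (hε : 0 < ε) : ∃ C : ℝ, 0 ≤ C ∧ ∀ χ : Eis → Eis → Eis, IsCubicSymbol χ →
    ∀ M Q T0 Ce : ℝ, 1 ≤ M → 1 ≤ Q → 0 < T0 → T0 ≤ M → 0 ≤ Ce → ∀ B : Eis → ℂ, ∀ b, P1 b →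
    (∀ β ∈ ps M, ‖B β‖ ≤ Ce * Nm β ^ (-(1/2) + ε)) →
    ∑ a ∈ (ps Q).filter (fun a => psi χ a b 0 = 0), ENNReal.ofReal (‖∑ β ∈ ps M, B β * cx χ a β‖ ^ 2) *
      ∫⁻ z in Ioi T0, ENNReal.ofReal (‖vt χ a b z‖ ^ 2 * Real.exp (z / 2)) ≤
      ENNReal.ofReal (C * Ce ^ 2 * M ^ (6 * ε) * T0 ^ (-(4 * ε)) * Q ^ ε * GQ Q (M / T0)) := by
  classical
  obtain ⟨C, hC, h⟩ := LS_z hε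
  refine ⟨C * (4 * ε)⁻¹, by positivity, ?_⟩
  intro χ hχ M Q T0 Ce hM hQ hT0 hTM hCe B b hb hB
  have hmeas : ∀ a ∈ (ps Q).filter (fun a => psi χ a b 0 = 0),
      Measurable fun z => ENNReal.ofReal (‖vt χ a b z‖ ^ 2 * Real.exp (z / 2)) := by
    intro a ha
    have haP := (mem_ps.1 (Finset.mem_filter.1 ha).1).1.1
    exact ENNReal.measurable_ofReal.comp (((vt_meas hχ haP hb).norm.pow_const 2).mul (by fun_prop))
  have hGQ : 0 ≤ GQ Q (M / T0) := GQ_nonneg (by linarith) (by positivity)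
  have e1 : ∑ a ∈ (ps Q).filter (fun a => psi χ a b 0 = 0), ENNReal.ofReal (‖∑ β ∈ ps M, B β * cx χ a β‖ ^ 2) *
      ∫⁻ z in Ioi T0, ENNReal.ofReal (‖vt χ a b z‖ ^ 2 * Real.exp (z / 2)) =
      ∫⁻ z in Ioi T0, ∑ a ∈ (ps Q).filter (fun a => psi χ a b 0 = 0),
       ENNReal.ofReal (‖∑ β ∈ ps M, B β * cx χ a β‖ ^ 2) * ENNReal.ofReal (‖vt χ a b z‖ ^ 2 * Real.exp (z / 2)) := by
    rw [lintegral_finsetSum' _ (fun a ha => ((hmeas a ha).const_mul _).aemeasurable)]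
    refine Finset.sum_congr rfl fun a ha => ?_
    rw [lintegral_const_mul _ (hmeas a ha)]
  rw [e1]
  set K := C * (Ce * M ^ (3 * ε)) ^ 2 * Q ^ ε * GQ Q (M / T0) with hK
  have hK0 : 0 ≤ K := by positivity
  have e2 : ∀ z ∈ Ioi T0, ∑ a ∈ (ps Q).filter (fun a => psi χ a b 0 = 0),
       ENNReal.ofReal (‖∑ β ∈ ps M, B β * cx χ a β‖ ^ 2) * ENNReal.ofReal (‖vt χ a b z‖ ^ 2 * Real.exp (z / 2)) ≤
       ENNReal.ofReal (K * z ^ (-(1 + 4 * ε))) := by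
    intro z hz
    have hz0 : 0 < z := hT0.trans hz
    have := h χ hχ M Q T0 Ce hM hQ hT0 hTM hCe B b hb hB z hz
    have f : z ^ (-(1 + 4 * ε)) = (z ^ (-(1/2 + 2 * ε))) ^ 2 := by
      rw [← Real.rpow_natCast, ← Real.rpow_mul hz0.le]; congr 1; push_cast; ring
    rw [f]
    have g : ∑ a ∈ (ps Q).filter (fun a => psi χ a b 0 = 0),
       ENNReal.ofReal (‖∑ β ∈ ps M, B β * cx χ a β‖ ^ 2) * ENNReal.ofReal (‖vt χ a b z‖ ^ 2 * Real.exp (z / 2)) =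
       ENNReal.ofReal (∑ a ∈ (ps Q).filter (fun a => psi χ a b 0 = 0),
        ‖∑ β ∈ ps M, B β * cx χ a β‖ ^ 2 * (‖vt χ a b z‖ ^ 2 * Real.exp (z / 2))) := by
      rw [ENNReal.ofReal_sum_of_nonneg (fun a _ => by positivity)]
      refine Finset.sum_congr rfl fun a _ => ?_
      rw [← ENNReal.ofReal_mul (by positivity)]
    rw [g]
    refine ENNReal.ofReal_le_ofReal (this.trans (le_of_eq ?_))
    rw [hK]; ring
  refine (setLIntegral_mono' measurableSet_Ioi e2).trans ?_
  have hlt : -(1 + 4 * ε) < -1 := by linarith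
  have hInt := (integrableOn_Ioi_rpow_of_lt hlt hT0).const_mul K
  rw [← ofReal_integral_eq_lintegral_ofReal hInt (by
    refine (ae_restrict_iff' measurableSet_Ioi).2 (Filter.Eventually.of_forall fun z hz => ?_)
    have hz0 : 0 < z := hT0.trans hz
    exact mul_nonneg hK0 (Real.rpow_nonneg hz0.le _)), integral_const_mul, integral_Ioi_rpow_of_lt hlt hT0]
  refine ENNReal.ofReal_le_ofReal (le_of_eq ?_)
  have : (M ^ (3 * ε)) ^ 2 = M ^ (6 * ε) := by
    rw [← Real.rpow_natCast, ← Real.rpow_mul (by linarith)]; congr 1; push_cast; ring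
  rw [hK, mul_pow, this, show -(1 + 4 * ε) + 1 = -(4 * ε) by ring, neg_div_neg_eq, div_eq_mul_inv]
  ring

end lsapp

section blocksec
open ComplexConjugate MeasureTheory Set

open Classical in
lemma Moll_eq {χ : Eis → Eis → Eis} {M : ℝ} {lm : Eis → ℂ}
    (hl : ∀ β, lm β ≠ 0 → PS β ∧ Nm β ≤ M) (q : Eis) :
    Moll χ lm q = ∑ β ∈ ps M, lm β * (Real.sqrt (Nm β) : ℂ) * cx χ q β := by
  rw [Moll]
  refine finsum_eq_sum_of_support_subset _ ?_
  intro β hβ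
  rw [Function.mem_support] at hβ
  have : lm β ≠ 0 := fun h => hβ (by rw [h]; simp)
  exact Finset.mem_coe.2 (mem_ps.2 (hl β this))

lemma coeff_bound {ε Ce : ℝ} {lm : Eis → ℂ} (hb : ∀ β, ‖lm β‖ ≤ Ce * Nm β ^ (-1 + ε)) {β : Eis} (hβ : β ≠ 0) :
    ‖lm β * (Real.sqrt (Nm β) : ℂ)‖ ≤ Ce * Nm β ^ (-(1/2) + ε) := by
  have h0 := Nm_pos hβ
  rw [norm_mul, Complex.norm_real, Real.norm_of_nonneg (Real.sqrt_nonneg _)]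
  refine (mul_le_mul_of_nonneg_right (hb β) (Real.sqrt_nonneg _)).trans (le_of_eq ?_)
  rw [Real.sqrt_eq_rpow, mul_assoc, ← Real.rpow_add h0]
  congr 2; ring

open Classical in
/-- the block of moduli `a b² c³` with `b`, `c` fixed -/
def goodA (b c : Eis) (Q : ℝ) : Finset Eis :=
  (ps Q).filter (fun a => IsCoprime a b ∧ (9 : Eis) ∣ a * b ^ 2 * c ^ 3 - 1 ∧ a * b ≠ 1)

set_option maxHeartbeats 1000000 in
lemma block {ε : ℝ} (hε : 0 < ε) : ∃ C : ℝ, 0 ≤ C ∧ ∀ χ : Eis → Eis → Eis, IsCubicSymbol χ →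
    ∀ X M Ce : ℝ, 1 ≤ X → 1 ≤ M → 0 ≤ Ce → ∀ lm : Eis → ℂ, (∀ β, lm β ≠ 0 → PS β ∧ Nm β ≤ M) →
    (∀ β, ‖lm β‖ ≤ Ce * Nm β ^ (-1 + ε)) → ∀ b c, PS b → P1 c → 1 ≤ X / (Nm b ^ 2 * Nm c ^ 3) →
    ∑ a ∈ goodA b c (X / (Nm b ^ 2 * Nm c ^ 3)),
      ‖Moll χ lm (a * b ^ 2 * c ^ 3) ^ 2 * A₂ χ (a * b ^ 2 * c ^ 3)‖ ≤
      C * Ce ^ 2 * M ^ (6 * ε) * X ^ (6 * ε) *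
        GQ (X / (Nm b ^ 2 * Nm c ^ 3)) (M * Real.sqrt (X / (Nm b ^ 2 * Nm c ^ 3) * Nm b)) := by
  classical
  obtain ⟨C1, hC1, hA⟩ := A2_vt hε
  obtain ⟨C2, hC2, hLS⟩ := LS_int hε
  obtain ⟨C3, hC3, hdiv⟩ := divisor_bound hε
  refine ⟨C1 * C3 ^ 2 * C2, by positivity, ?_⟩
  intro χ hχ X M Ce hX hM hCe lm hl hlb b c hb hc hQ
  set Q := X / (Nm b ^ 2 * Nm c ^ 3) with hQd
  have hb1 := hb.one_le
  have hc1 := one_le_Nm hc.ne_zero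
  have hbp : 1 ≤ Nm b ^ 2 := one_le_pow₀ hb1
  have hcp : 1 ≤ Nm c ^ 3 := one_le_pow₀ hc1
  have hX0 : 0 < X := by linarith
  have hQX : Q * (Nm b ^ 2 * Nm c ^ 3) = X := by
    rw [hQd]; field_simp
  have hQ0 : 0 < Q := by linarith
  have hbc : Nm b ≤ Nm b ^ 2 * Nm c ^ 3 := by nlinarith
  have hbc1 : 1 ≤ Nm b ^ 2 * Nm c ^ 3 := by nlinarith
  have hQbX : Q * Nm b ≤ X := by
    rw [← hQX]; exact mul_le_mul_of_nonneg_left hbc hQ0.le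
  have hQleX : Q ≤ X := by
    rw [← hQX]; exact le_mul_of_one_le_right hQ0.le hbc1
  have hcX : Nm c ≤ X := by
    have : Nm c ≤ Nm c ^ 3 := le_self_pow₀ hc1 (by norm_num)
    nlinarith
  have hQb1 : 1 ≤ Q * Nm b := by nlinarith
  set sq := Real.sqrt (Q * Nm b) with hsq
  have hsq1 : 1 ≤ sq := Real.one_le_sqrt.2 hQb1
  have hsq2 : sq ^ 2 = Q * Nm b := Real.sq_sqrt (by linarith)
  set T0 := sq⁻¹ with hT0d
  have hT0 : 0 < T0 := by positivity
  have hT1 : T0 ≤ M := (inv_le_one_of_one_le₀ hsq1).trans hM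
  set B : Eis → ℂ := fun β => lm β * (Real.sqrt (Nm β) : ℂ) * (conj (cx χ b β) * (if IsCoprime c β then 1 else 0)) with hB
  have hBb : ∀ β ∈ ps M, ‖B β‖ ≤ Ce * Nm β ^ (-(1/2) + ε) := by
    intro β hβ
    have h1 := coeff_bound hlb (mem_ps.1 hβ).1.ne_zero
    refine le_trans ?_ h1
    rw [hB]; beta_reduce
    rw [norm_mul]
    refine mul_le_of_le_one_right (norm_nonneg _) ?_
    rw [norm_mul, RCLike.norm_conj]
    refine mul_le_one₀ (cx_norm_le hχ hb.1 _) (norm_nonneg _) ?_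
    split_ifs <;> simp
  have hMoll : ∀ a, P1 a → Moll χ lm (a * b ^ 2 * c ^ 3) = ∑ β ∈ ps M, B β * cx χ a β := by
    intro a ha
    rw [Moll_eq hl]
    refine Finset.sum_congr rfl fun β _ => ?_
    rw [cx_split hχ ha hb.1 hc, psi, hB]
    ring
  have hMT : M / T0 = M * sq := by rw [hT0d, div_inv_eq_mul]
  have hI := hLS χ hχ M Q T0 Ce hM hQ hT0 hT1 hCe B b hb.1 hBb
  rw [hMT] at hI
  have hGQ : 0 ≤ GQ Q (M * sq) := GQ_nonneg hQ0.le (by positivity)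
  set G := GQ Q (M * sq) with hG
  clear_value G
  set K := C1 * X ^ ε * (C3 * X ^ ε) ^ 2 with hK
  have hXe : 0 < X ^ ε := Real.rpow_pos_of_pos hX0 _
  have hK0 : 0 ≤ K := by positivity
  have hsum : ENNReal.ofReal (∑ a ∈ goodA b c Q,
      ‖Moll χ lm (a * b ^ 2 * c ^ 3) ^ 2 * A₂ χ (a * b ^ 2 * c ^ 3)‖) ≤
      ENNReal.ofReal K * ENNReal.ofReal (C2 * Ce ^ 2 * M ^ (6 * ε) * T0 ^ (-(4 * ε)) * Q ^ ε * G) := by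
    rw [ENNReal.ofReal_sum_of_nonneg (fun _ _ => norm_nonneg _)]
    refine le_trans ?_ (mul_le_mul_right hI _)
    rw [Finset.mul_sum]
    have hsub : goodA b c Q ⊆ (ps Q).filter (fun a => psi χ a b 0 = 0) := by
      intro a ha
      rw [goodA, Finset.mem_filter] at ha
      refine Finset.mem_filter.2 ⟨ha.1, ?_⟩
      rw [psi]
      by_cases h1 : a = 1
      · have h2 : b ≠ 1 := fun h => ha.2.2.2 (by rw [h1, h, one_mul])
        rw [cx_zero hχ hb.1 h2]; simp
      · rw [cx_zero hχ (mem_ps.1 ha.1).1.1 h1, zero_mul]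
    refine le_trans ?_ (Finset.sum_le_sum_of_subset hsub)
    refine Finset.sum_le_sum fun a ha => ?_
    rw [goodA, Finset.mem_filter] at ha
    obtain ⟨ha1, hab, h9, hab1⟩ := ha
    obtain ⟨haPS, haQ⟩ := mem_ps.1 ha1
    have hq1 : a * b ^ 2 * c ^ 3 ≠ 1 := by
      intro h
      have hau : IsUnit a := IsUnit.of_mul_eq_one (b ^ 2 * c ^ 3) (by rw [← h]; ring)
      have hbu : IsUnit b := IsUnit.of_mul_eq_one (a * b * c ^ 3) (by rw [← h]; ring)
      exact hab1 (by rw [P1_unit hau haPS.1, P1_unit hbu hb.1, one_mul])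
    have ha1' := haPS.one_le
    have hT : T0 < 2 * Real.pi / Real.sqrt (3 * Nm (a * b)) := by
      have hpi := Real.pi_gt_three
      have hR : 0 < Real.sqrt (3 * Nm (a * b)) := Real.sqrt_pos.2 (by rw [Nm_mul]; positivity)
      rw [hT0d, inv_lt_iff_one_lt_mul₀ (by positivity), div_mul_eq_mul_div, lt_div_iff₀ hR, one_mul]
      have : Real.sqrt (3 * Nm (a * b)) ≤ 2 * sq := by
        rw [Real.sqrt_le_left (by positivity), mul_pow, hsq2, Nm_mul]
        have : Nm a * Nm b ≤ Q * Nm b := mul_le_mul_of_nonneg_right haQ (by linarith)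
        nlinarith
      nlinarith
    have hA1 := hA χ hχ a b c haPS hb hc hab h9 hq1 T0 hT
    have hqX : Nm (a * b ^ 2 * c ^ 3) ≤ X := by
      rw [Nm_mul, Nm_mul, Nm_pow, Nm_pow, mul_assoc, ← hQX]
      exact mul_le_mul_of_nonneg_right haQ (by positivity)
    rw [hMoll a haPS.1, norm_mul, norm_pow, ENNReal.ofReal_mul (by positivity), ofReal_norm, mul_left_comm]
    refine mul_le_mul_right (hA1.trans (mul_le_mul_left (ENNReal.ofReal_le_ofReal ?_) _)) _
    rw [hK]
    have f1 : Nm (a * b ^ 2 * c ^ 3) ^ ε ≤ X ^ ε := Real.rpow_le_rpow (Nm_nonneg _) hqX hε.le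
    have f2 : ((divs c).card : ℝ) ≤ C3 * X ^ ε :=
      (hdiv c hc.ne_zero).trans (mul_le_mul_of_nonneg_left (Real.rpow_le_rpow (Nm_nonneg _) hcX hε.le) (by linarith))
    gcongr
  rw [← ENNReal.ofReal_mul hK0] at hsum
  have hT4 : T0 ^ (-(4 * ε)) ≤ X ^ (2 * ε) := by
    rw [hT0d, ← Real.rpow_neg_one, ← Real.rpow_mul (by positivity), hsq, Real.sqrt_eq_rpow,
      ← Real.rpow_mul (by positivity), show (1 / 2 : ℝ) * (-1 * -(4 * ε)) = 2 * ε by ring]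
    exact Real.rpow_le_rpow (by positivity) hQbX (by positivity)
  have hQe : Q ^ ε ≤ X ^ ε := Real.rpow_le_rpow hQ0.le hQleX hε.le
  have h := (ENNReal.ofReal_le_ofReal_iff (by positivity)).1 hsum
  refine h.trans ?_
  have hX2 : X ^ (6 * ε) = X ^ ε * (X ^ ε) ^ 2 * X ^ (2 * ε) * X ^ ε := by
    rw [← Real.rpow_natCast, ← Real.rpow_mul hX0.le, ← Real.rpow_add hX0, ← Real.rpow_add hX0, ← Real.rpow_add hX0]
    congr 1; push_cast; ring
  rw [hX2, hK]
  calc _ ≤ C1 * X ^ ε * (C3 * X ^ ε) ^ 2 * (C2 * Ce ^ 2 * M ^ (6 * ε) * X ^ (2 * ε) * X ^ ε * G) := by gcongr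
    _ = _ := by ring

set_option maxHeartbeats 1000000 in
lemma cubes {ε : ℝ} (hε : 0 < ε) : ∃ C : ℝ, 0 ≤ C ∧ ∀ χ : Eis → Eis → Eis, IsCubicSymbol χ →
    ∀ X M Ce : ℝ, 1 ≤ X → 1 ≤ M → 0 ≤ Ce → ∀ lm : Eis → ℂ, (∀ β, lm β ≠ 0 → PS β ∧ Nm β ≤ M) →
    (∀ β, ‖lm β‖ ≤ Ce * Nm β ^ (-1 + ε)) →
    ∑ c ∈ pone (X ^ (1/3 : ℝ)), ‖Moll χ lm (c ^ 3) ^ 2 * A₂ χ (c ^ 3)‖ ≤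
      C * Ce ^ 2 * M ^ (1 + 4 * ε) * X ^ (5/6 + 2 * ε) := by
  classical
  obtain ⟨C1, hC1, hA⟩ := A2_trivial hε
  have hZ := ZE_nonneg ε
  refine ⟨C1 * ZE ε ^ 3, by positivity, ?_⟩
  intro χ hχ X M Ce hX hM hCe lm hl hlb
  have hX0 : 0 < X := by linarith
  have hM0 : 0 < M := by linarith
  have hMoll : ∀ q, P1 q → ‖Moll χ lm q‖ ≤ Ce * M ^ (1/2 + 2 * ε) * ZE ε := by
    intro q hq
    rw [Moll_eq hl, ]
    have h1 : ∀ β ∈ ps M, ‖lm β * (Real.sqrt (Nm β) : ℂ) * cx χ q β‖ ≤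
        Ce * M ^ (1/2 + 2 * ε) * Nm β ^ (-(1 + ε)) := by
      intro β hβ
      have hβ' := mem_ps.1 hβ
      have h0 := Nm_pos hβ'.1.ne_zero
      rw [norm_mul]
      refine (mul_le_of_le_one_right (norm_nonneg _) (cx_norm_le hχ hq _)).trans ?_
      refine (coeff_bound hlb hβ'.1.ne_zero).trans ?_
      rw [show -(1/2 : ℝ) + ε = (1/2 + 2 * ε) + -(1 + ε) by ring, Real.rpow_add h0, ← mul_assoc]
      refine mul_le_mul_of_nonneg_right (mul_le_mul_of_nonneg_left ?_ hCe) (by positivity)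
      exact Real.rpow_le_rpow h0.le hβ'.2 (by positivity)
    refine (norm_sum_le _ _).trans ((Finset.sum_le_sum h1).trans ?_)
    rw [← Finset.mul_sum]
    exact mul_le_mul_of_nonneg_left (sum_le_ZE hε _) (by positivity)
  set Y := X ^ (1/3 : ℝ) with hY
  have hY0 : 0 < Y := by positivity
  have hY1 : 1 ≤ Y := Real.one_le_rpow hX (by norm_num)
  have hY3 : Y ^ 3 = X := by
    rw [hY, ← Real.rpow_natCast, ← Real.rpow_mul hX0.le]; norm_num
  have hpt : ∀ c ∈ pone Y, ‖Moll χ lm (c ^ 3) ^ 2 * A₂ χ (c ^ 3)‖ ≤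
      ((Ce * M ^ (1/2 + 2 * ε) * ZE ε) ^ 2 * (C1 * X ^ (1/2 + ε)) * Y) * (Nm c)⁻¹ := by
    intro c hc
    obtain ⟨hcP, hcY⟩ := mem_pone.1 hc
    have hc1 := one_le_Nm hcP.ne_zero
    rw [norm_mul, norm_pow]
    have e1 : ‖A₂ χ (c ^ 3)‖ ≤ C1 * X ^ (1/2 + ε) := by
      refine (hA χ hχ _ (hcP.pow 3)).trans (mul_le_mul_of_nonneg_left ?_ hC1)
      refine Real.rpow_le_rpow (Nm_nonneg _) ?_ (by positivity)
      rw [Nm_pow, ← hY3]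
      exact pow_le_pow_left₀ (Nm_nonneg _) hcY 3
    have e2 : 1 ≤ Y * (Nm c)⁻¹ := by
      rw [← div_eq_mul_inv, one_le_div (by linarith)]; exact hcY
    have e3 := pow_le_pow_left₀ (norm_nonneg _) (hMoll _ (hcP.pow 3)) 2
    have e4 := mul_le_mul e3 e1 (norm_nonneg _) (by positivity)
    refine e4.trans ?_
    rw [mul_assoc _ Y]
    exact le_mul_of_one_le_right (by positivity) e2
  refine (Finset.sum_le_sum hpt).trans ?_
  rw [← Finset.mul_sum]
  have hs : ∑ c ∈ pone Y, (Nm c)⁻¹ ≤ ZE ε * Y ^ ε := by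
    refine sum_inv_le hε hY0.le _ fun c hc => ?_
    obtain ⟨hcP, hcY⟩ := mem_pone.1 hc
    exact ⟨hcP.ne_zero, hcY⟩
  have hYX : Y ^ ε ≤ X ^ ε := by
    refine Real.rpow_le_rpow hY0.le ?_ hε.le
    rw [← hY3]; exact le_self_pow₀ hY1 (by norm_num)
  refine (mul_le_mul_of_nonneg_left (hs.trans (mul_le_mul_of_nonneg_left hYX hZ)) (by positivity)).trans (le_of_eq ?_)
  have hMM : M ^ (1 + 4 * ε) = (M ^ (1/2 + 2 * ε)) ^ 2 := by
    rw [← Real.rpow_natCast, ← Real.rpow_mul hM0.le]; congr 1; push_cast; ring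
  have hXX : X ^ (5/6 + 2 * ε) = X ^ (1/2 + ε) * Y * X ^ ε := by
    rw [hY, ← Real.rpow_add hX0, ← Real.rpow_add hX0]; congr 1; ring
  rw [hMM, hXX]; ring

end blocksec

section assembly

lemma Rep_P1 {x : Eis} (h : Rep x) (hl : ¬ lam ∣ x) : P1 x := by
  obtain ⟨k, c, hc, rfl⟩ := h
  rcases Nat.eq_zero_or_pos k with rfl | hk
  · rw [pow_zero, one_mul]; exact hc
  · exact absurd ((dvd_pow_self lam hk.ne').mul_right c) hl

lemma not_lam_dvd_of_coprime {x : Eis} (h : IsCoprime x 3) : ¬ lam ∣ x := fun h1 =>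
  lam_prime.not_isUnit (h.isUnit_of_dvd' h1 lam_dvd_three)

lemma abs_mu_le {μ : Eis → ℤ} (hμ : IsMoebius μ) : ∀ l, P1 l → |μ l| ≤ 1 := by
  apply P1.induction
  · rw [hμ.isUnit 1 isUnit_one]; simp
  · intro p a hp _ _ ih
    by_cases h : p ∣ a
    · rw [hμ.eq_zero (p * a)]
      · simp
      · intro hs
        exact hp.not_isUnit (hs p (mul_dvd_mul_left p h))
    · rw [hμ.prime_mul p a hp h, abs_neg]; exact ih

lemma RY_eq {μ : Eis → ℤ} {Y : ℝ} {q : Eis} (hq : P1 q) :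
    ∃ t ⊆ divs q, (∀ l ∈ t, P1 l ∧ l ^ 2 ∣ q ∧ Y < Nm l) ∧ RY μ Y q = ∑ l ∈ t, μ l := by
  classical
  refine ⟨(divs q).filter (fun l => Rep l ∧ l ^ 2 ∣ q ∧ Y < Nm l), Finset.filter_subset _ _, ?_, ?_⟩
  · intro l hl
    rw [Finset.mem_filter, mem_divs hq.ne_zero] at hl
    exact ⟨hl.1.1, hl.2.2⟩
  · rw [RY, ← finsum_mem_coe_finset]
    refine congrArg (fun s : Set Eis => ∑ᶠ l ∈ s, μ l) ?_
    ext l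
    refine ⟨fun h => ?_, fun h => ?_⟩
    · simp only [Set.mem_ofPred_eq] at h
      have hlq : l ∣ q := (dvd_pow_self l two_ne_zero).trans h.2.1
      have : P1 l := Rep_P1 h.1 fun h1 => hq.not_lam_dvd (h1.trans hlq)
      simp only [Finset.coe_filter, Set.mem_ofPred_eq]
      exact ⟨(mem_divs hq.ne_zero).2 ⟨this, hlq⟩, h⟩
    · simp only [Finset.coe_filter, Set.mem_ofPred_eq] at h
      exact h.2

lemma abs_RY_le {μ : Eis → ℤ} (hμ : IsMoebius μ) {Y : ℝ} {q : Eis} (hq : P1 q) :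
    |(RY μ Y q : ℝ)| ≤ (divs q).card := by
  obtain ⟨t, ht, h1, h2⟩ := RY_eq (μ := μ) (Y := Y) hq
  have h3 : |RY μ Y q| ≤ ((divs q).card : ℤ) := by
    rw [h2]
    refine (Finset.abs_sum_le_sum_abs _ _).trans ?_
    refine (Finset.sum_le_sum fun l hl => abs_mu_le hμ l (h1 l hl).1).trans ?_
    simp only [Finset.sum_const, nsmul_eq_mul, mul_one]
    exact_mod_cast Finset.card_le_card ht
  exact_mod_cast h3

lemma RY_ne_zero {μ : Eis → ℤ} (hμ : IsMoebius μ) {Y : ℝ} {q : Eis} (hq : P1 q)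
    (h : RY μ Y q ≠ 0) : ∃ l, PS l ∧ l ^ 2 ∣ q ∧ Y < Nm l := by
  obtain ⟨t, ht, h1, h2⟩ := RY_eq (μ := μ) (Y := Y) hq
  rw [h2] at h
  obtain ⟨l, hl, hl0⟩ := Finset.exists_ne_zero_of_sum_ne_zero h
  refine ⟨l, ⟨(h1 l hl).1, ?_⟩, (h1 l hl).2⟩
  by_contra hs
  exact hl0 (hμ.eq_zero l hs)

lemma dvd_bc {a b c l : Eis} (ha : PS a) (hl : PS l) (h : l ^ 2 ∣ a * b ^ 2 * c ^ 3) :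
    l ∣ b * c := by
  rw [pow_two, mul_assoc] at h
  have h1 : l ∣ b ^ 2 * c ^ 3 := ha.2.dvd_of_squarefree_of_mul_dvd_mul_right h
  exact hl.2.isRadical 3 (b * c) (h1.trans ⟨b, by ring⟩)

lemma GQ_bound {X M Y b c : ℝ} (hX : 1 ≤ X) (hM : 1 ≤ M) (hY : 1 ≤ Y) (hb : 1 ≤ b) (hc : 1 ≤ c)
    (hbc : Y ≤ b * c) (hQ : 1 ≤ X / (b ^ 2 * c ^ 3)) :
    GQ (X / (b ^ 2 * c ^ 3)) (M * Real.sqrt (X / (b ^ 2 * c ^ 3) * b)) ≤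
      2 * (X * (M / Y) ^ (2/3 : ℝ) + X ^ (5/6 : ℝ) * M) * (b⁻¹ * c⁻¹) := by
  have hX0 : 0 < X := by linarith
  have hM0 : 0 < M := by linarith
  have hY0 : 0 < Y := by linarith
  have hb0 : 0 < b := by linarith
  have hc0 : 0 < c := by linarith
  set Q := X / (b ^ 2 * c ^ 3) with hQd
  have hQX : Q * (b ^ 2 * c ^ 3) = X := by rw [hQd]; field_simp
  clear_value Q
  have hQ0 : 0 < Q := by linarith
  have hc3 : 1 ≤ c ^ 3 := one_le_pow₀ hc
  have hbX : b ^ 2 ≤ X := by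
    rw [← hQX]
    have : b ^ 2 ≤ b ^ 2 * c ^ 3 := le_mul_of_one_le_right (by positivity) hc3
    exact this.trans (le_mul_of_one_le_left (by positivity) hQ)
  set P := (M / Y) ^ (2/3 : ℝ) with hP
  have hP0 : 0 ≤ P := by positivity
  have hPY : Y⁻¹ ≤ P := by
    have h1 : Y⁻¹ ≤ (Y⁻¹) ^ (2/3 : ℝ) := by
      have := Real.rpow_le_rpow_of_exponent_ge (inv_pos.2 hY0) (inv_le_one_of_one_le₀ hY)
        (show (2/3 : ℝ) ≤ 1 by norm_num)
      rwa [Real.rpow_one] at this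
    refine h1.trans (Real.rpow_le_rpow (by positivity) ?_ (by norm_num))
    rw [div_eq_mul_inv]
    exact le_mul_of_one_le_left (by positivity) hM
  -- first term
  have t1 : Q * (b * c) ≤ X * P := by
    have e1 : Q * (b * c) * Y ≤ X := by
      rw [← hQX]
      have : b * c * Y ≤ b ^ 2 * c ^ 3 := by
        calc b * c * Y ≤ b * c * (b * c) := by gcongr
          _ = b ^ 2 * c ^ 2 * 1 := by ring
          _ ≤ b ^ 2 * c ^ 2 * c := by gcongr
          _ = _ := by ring
      calc Q * (b * c) * Y = Q * (b * c * Y) := by ring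
        _ ≤ _ := by gcongr
    calc Q * (b * c) = Q * (b * c) * Y * Y⁻¹ := by field_simp
      _ ≤ X * P := by gcongr
  -- second term
  have t2 : M * Real.sqrt (Q * b) * (b * c) ≤ X ^ (5/6 : ℝ) * M := by
    have e1 : Real.sqrt (Q * b) * (b * c) ≤ X ^ (5/6 : ℝ) := by
      refine le_of_sq_le_sq ?_ (by positivity)
      rw [mul_pow, Real.sq_sqrt (by positivity)]
      have e2 : (X ^ (5/6 : ℝ)) ^ 2 = X * X ^ (2/3 : ℝ) := by
        rw [← Real.rpow_natCast, ← Real.rpow_mul hX0.le]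
        nth_rewrite 2 [← Real.rpow_one X]
        rw [← Real.rpow_add hX0]; norm_num
      have e3 : b ≤ X ^ (2/3 : ℝ) := by
        have : b ≤ Real.sqrt X := Real.le_sqrt_of_sq_le hbX
        refine this.trans ?_
        rw [Real.sqrt_eq_rpow]
        exact Real.rpow_le_rpow_of_exponent_le hX (by norm_num)
      rw [e2]
      calc Q * b * (b * c) ^ 2 = Q * (b ^ 2 * c ^ 2 * 1) * b := by ring
        _ ≤ Q * (b ^ 2 * c ^ 2 * c) * b := by gcongr
        _ = X * b := by rw [← hQX]; ring
        _ ≤ _ := by gcongr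
    calc M * Real.sqrt (Q * b) * (b * c) = M * (Real.sqrt (Q * b) * (b * c)) := by ring
      _ ≤ M * X ^ (5/6 : ℝ) := by gcongr
      _ = _ := by ring
  -- third term
  have t3 : (Q * (M * Real.sqrt (Q * b))) ^ (2/3 : ℝ) * (b * c) ≤ X * P := by
    have e1 : (Q * (M * Real.sqrt (Q * b))) ^ (2/3 : ℝ) = M ^ (2/3 : ℝ) * (Q * b ^ (1/3 : ℝ)) := by
      rw [Real.sqrt_eq_rpow, Real.mul_rpow hQ0.le (by positivity), Real.mul_rpow hM0.le (by positivity),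
        ← Real.rpow_mul (by positivity), Real.mul_rpow hQ0.le hb0.le]
      have : Q ^ (2/3 : ℝ) * Q ^ ((1/2 : ℝ) * (2/3)) = Q := by
        rw [← Real.rpow_add hQ0]; norm_num
      calc _ = M ^ (2/3 : ℝ) * ((Q ^ (2/3 : ℝ) * Q ^ ((1/2 : ℝ) * (2/3))) * b ^ ((1/2 : ℝ) * (2/3))) := by ring
        _ = _ := by rw [this]; norm_num
    rw [e1, hP, Real.div_rpow hM0.le hY0.le, ← mul_div_assoc, le_div_iff₀ (by positivity)]
    have e2 : Y ^ (2/3 : ℝ) ≤ b ^ (2/3 : ℝ) * c := by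
      refine (Real.rpow_le_rpow hY0.le hbc (by norm_num)).trans ?_
      rw [Real.mul_rpow hb0.le hc0.le]
      gcongr
      have := Real.rpow_le_rpow_of_exponent_le hc (show (2/3 : ℝ) ≤ 1 by norm_num)
      rwa [Real.rpow_one] at this
    have e3 : b ^ (1/3 : ℝ) * b ^ (2/3 : ℝ) = b := by
      rw [← Real.rpow_add hb0]; norm_num
    calc M ^ (2/3 : ℝ) * (Q * b ^ (1/3 : ℝ)) * (b * c) * Y ^ (2/3 : ℝ)
        ≤ M ^ (2/3 : ℝ) * (Q * b ^ (1/3 : ℝ)) * (b * c) * (b ^ (2/3 : ℝ) * c) := by gcongr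
      _ = M ^ (2/3 : ℝ) * (Q * ((b ^ (1/3 : ℝ) * b ^ (2/3 : ℝ)) * b * c ^ 2 * 1)) := by ring
      _ = M ^ (2/3 : ℝ) * (Q * (b * b * c ^ 2 * 1)) := by rw [e3]
      _ ≤ M ^ (2/3 : ℝ) * (Q * (b * b * c ^ 2 * c)) := by gcongr
      _ = X * M ^ (2/3 : ℝ) := by rw [← hQX]; ring
  have hs : GQ Q (M * Real.sqrt (Q * b)) * (b * c) ≤ 2 * (X * P + X ^ (5/6 : ℝ) * M) := by
    rw [GQ, add_mul, add_mul]
    have : 0 ≤ X ^ (5/6 : ℝ) * M := by positivity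
    linarith
  rw [← mul_inv, ← div_eq_mul_inv, le_div_iff₀ (by positivity)]
  exact hs

set_option maxHeartbeats 1000000 in
lemma main_sum {ε : ℝ} (hε : 0 < ε) : ∃ C : ℝ, 0 ≤ C ∧ ∀ χ : Eis → Eis → Eis, IsCubicSymbol χ →
    ∀ X M Y Ce : ℝ, 1 ≤ X → 1 ≤ M → 1 ≤ Y → 0 ≤ Ce → ∀ lm : Eis → ℂ,
    (∀ β, lm β ≠ 0 → PS β ∧ Nm β ≤ M) → (∀ β, ‖lm β‖ ≤ Ce * Nm β ^ (-1 + ε)) →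
    ∀ S : Finset Eis, (∀ q ∈ S, 9 ∣ q - 1 ∧ Nm q ≤ X ∧ ∃ l, PS l ∧ l ^ 2 ∣ q ∧ Y < Nm l) →
    ∑ q ∈ S, ‖Moll χ lm q ^ 2 * A₂ χ q‖ ≤ C * Ce ^ 2 * M ^ (6 * ε) * X ^ (8 * ε) *
      (X * (M / Y) ^ (2/3 : ℝ) + X ^ (5/6 : ℝ) * M) := by
  classical
  obtain ⟨C1, hC1, hB⟩ := block hε
  obtain ⟨C2, hC2, hCu⟩ := cubes hε
  have hZ := ZE_nonneg ε
  refine ⟨2 * C1 * ZE ε ^ 2 + C2, by positivity, ?_⟩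
  intro χ hχ X M Y Ce hX hM hY hCe lm hl hlb S hS
  have hX0 : 0 < X := by linarith
  have hM0 : 0 < M := by linarith
  have hY0 : 0 < Y := by linarith
  set f : Eis → ℝ := fun q => ‖Moll χ lm q ^ 2 * A₂ χ q‖ with hf
  have hf0 : ∀ q, 0 ≤ f q := fun q => norm_nonneg _
  set W := X * (M / Y) ^ (2/3 : ℝ) + X ^ (5/6 : ℝ) * M with hW
  have hW0 : 0 ≤ W := by positivity
  have hW2 : X ^ (5/6 : ℝ) * M ≤ W := by
    rw [hW]; exact le_add_of_nonneg_left (by positivity)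
  rw [← Finset.sum_filter_add_sum_filter_not S (fun q => ∃ c ∈ pone (X ^ (1/3 : ℝ)), c ^ 3 = q)]
  have h1 : ∑ q ∈ S with ∃ c ∈ pone (X ^ (1/3 : ℝ)), c ^ 3 = q, f q ≤
      C2 * Ce ^ 2 * M ^ (6 * ε) * X ^ (8 * ε) * W := by
    have e1 := sum_cover {()} (fun _ => pone (X ^ (1/3 : ℝ))) (fun _ c => c ^ 3)
      (S.filter fun q => ∃ c ∈ pone (X ^ (1/3 : ℝ)), c ^ 3 = q) f hf0 (by
        intro q hq
        obtain ⟨c, hc, hcq⟩ := (Finset.mem_filter.1 hq).2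
        exact ⟨(), Finset.mem_singleton_self _, c, hc, hcq⟩)
    rw [Finset.sum_singleton] at e1
    refine e1.trans ((hCu χ hχ X M Ce hX hM hCe lm hl hlb).trans ?_)
    rw [Real.rpow_add hM0, Real.rpow_add hX0, Real.rpow_one]
    have e2 : M ^ (4 * ε) ≤ M ^ (6 * ε) := Real.rpow_le_rpow_of_exponent_le hM (by linarith)
    have e3 : X ^ (2 * ε) ≤ X ^ (8 * ε) := Real.rpow_le_rpow_of_exponent_le hX (by linarith)
    calc C2 * Ce ^ 2 * (M * M ^ (4 * ε)) * (X ^ (5/6 : ℝ) * X ^ (2 * ε))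
        = C2 * Ce ^ 2 * M ^ (4 * ε) * X ^ (2 * ε) * (X ^ (5/6 : ℝ) * M) := by ring
      _ ≤ C2 * Ce ^ 2 * M ^ (6 * ε) * X ^ (8 * ε) * W := by gcongr
  have h2 : ∑ q ∈ S with ¬ ∃ c ∈ pone (X ^ (1/3 : ℝ)), c ^ 3 = q, f q ≤
      2 * C1 * ZE ε ^ 2 * Ce ^ 2 * M ^ (6 * ε) * X ^ (8 * ε) * W := by
    set I := (pone X ×ˢ pone X).filter (fun i : Eis × Eis => PS i.1 ∧ Y ≤ Nm i.1 * Nm i.2 ∧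
      1 ≤ X / (Nm i.1 ^ 2 * Nm i.2 ^ 3)) with hI
    have e1 := sum_cover I (fun i => goodA i.1 i.2 (X / (Nm i.1 ^ 2 * Nm i.2 ^ 3)))
      (fun i a => a * i.1 ^ 2 * i.2 ^ 3)
      (S.filter fun q => ¬ ∃ c ∈ pone (X ^ (1/3 : ℝ)), c ^ 3 = q) f hf0 (by
        intro q hq
        obtain ⟨hqS, hqc⟩ := Finset.mem_filter.1 hq
        obtain ⟨h9, hqX, l, hl1, hl2, hl3⟩ := hS q hqS
        have hqP : P1 q := nine_P1 h9
        obtain ⟨a, b, c, ha, hb, hc, hab, rfl⟩ := cubic_decomp q hqP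
        have ha1 := ha.one_le
        have hb1 := hb.one_le
        have hc1 := one_le_Nm hc.ne_zero
        have hN : Nm a * (Nm b ^ 2 * Nm c ^ 3) ≤ X := by
          rw [← Nm_pow, ← Nm_pow, ← Nm_mul, ← Nm_mul, ← mul_assoc]; exact hqX
        have hD : 1 ≤ Nm b ^ 2 * Nm c ^ 3 := one_le_mul_of_one_le_of_one_le (one_le_pow₀ hb1) (one_le_pow₀ hc1)
        have hDX : Nm b ^ 2 * Nm c ^ 3 ≤ X := (le_mul_of_one_le_left (by linarith) ha1).trans hN
        have hbX : Nm b ≤ X := by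
          refine le_trans ?_ hDX
          exact (le_self_pow₀ hb1 (by norm_num)).trans (le_mul_of_one_le_right (by positivity) (one_le_pow₀ hc1))
        have hcX' : Nm c ^ 3 ≤ X := by
          refine le_trans ?_ hDX
          exact le_mul_of_one_le_left (by positivity) (one_le_pow₀ hb1)
        have hcX : Nm c ≤ X := (le_self_pow₀ hc1 (by norm_num)).trans hcX'
        refine ⟨(b, c), ?_, a, ?_, rfl⟩
        · rw [hI, Finset.mem_filter, Finset.mem_product, mem_pone, mem_pone]
          refine ⟨⟨⟨hb.1, hbX⟩, hc, hcX⟩, hb, ?_, ?_⟩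
          · rw [← Nm_mul]
            exact hl3.le.trans (Nm_le_of_dvd (dvd_bc ha hl1 hl2) (mul_ne_zero hb.ne_zero hc.ne_zero))
          · rw [le_div_iff₀ (by linarith), one_mul]; exact hDX
        · rw [goodA, Finset.mem_filter, mem_ps]
          refine ⟨⟨ha, ?_⟩, hab, h9, ?_⟩
          · rw [le_div_iff₀ (by linarith)]; exact hN
          · intro h
            apply hqc
            have e1 := P1_unit (IsUnit.of_mul_eq_one b h) ha.1
            have e2 := P1_unit (IsUnit.of_mul_eq_one a (by rw [mul_comm]; exact h)) hb.1
            refine ⟨c, mem_pone.2 ⟨hc, ?_⟩, by rw [e1, e2]; ring⟩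
            have h3 : Nm c = (Nm c ^ 3) ^ (1/3 : ℝ) := by
              rw [← Real.rpow_natCast, ← Real.rpow_mul (by linarith)]; norm_num
            rw [h3]
            exact Real.rpow_le_rpow (by positivity) hcX' (by norm_num))
    refine e1.trans ?_
    have e2 : ∀ i ∈ I, ∑ a ∈ goodA i.1 i.2 (X / (Nm i.1 ^ 2 * Nm i.2 ^ 3)), f (a * i.1 ^ 2 * i.2 ^ 3) ≤
        C1 * Ce ^ 2 * M ^ (6 * ε) * X ^ (6 * ε) * (2 * W) * ((Nm i.1)⁻¹ * (Nm i.2)⁻¹) := by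
      rintro ⟨b, c⟩ hi
      rw [hI, Finset.mem_filter, Finset.mem_product, mem_pone, mem_pone] at hi
      obtain ⟨⟨-, hc, -⟩, hb, hbc, hQ⟩ := hi
      refine (hB χ hχ X M Ce hX hM hCe lm hl hlb b c hb hc hQ).trans ?_
      have := GQ_bound hX hM hY hb.one_le (one_le_Nm hc.ne_zero) hbc hQ
      rw [mul_assoc (C1 * Ce ^ 2 * M ^ (6 * ε) * X ^ (6 * ε))]
      exact mul_le_mul_of_nonneg_left this (by positivity)
    refine (Finset.sum_le_sum e2).trans ?_
    rw [← Finset.mul_sum]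
    have e3 : ∑ x ∈ pone X, (Nm x)⁻¹ ≤ ZE ε * X ^ ε := by
      refine sum_inv_le hε hX0.le _ fun c hc => ?_
      obtain ⟨hcP, hcY⟩ := mem_pone.1 hc
      exact ⟨hcP.ne_zero, hcY⟩
    have e40 : 0 ≤ ∑ x ∈ pone X, (Nm x)⁻¹ := Finset.sum_nonneg fun x _ => inv_nonneg.2 (Nm_nonneg x)
    have e4 : ∑ i ∈ I, (Nm i.1)⁻¹ * (Nm i.2)⁻¹ ≤ (ZE ε * X ^ ε) * (ZE ε * X ^ ε) := by
      refine (Finset.sum_le_sum_of_subset_of_nonneg (Finset.filter_subset _ _) fun i _ _ =>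
        mul_nonneg (inv_nonneg.2 (Nm_nonneg _)) (inv_nonneg.2 (Nm_nonneg _))).trans ?_
      rw [Finset.sum_product]
      dsimp only
      rw [← Finset.sum_mul_sum]
      exact mul_le_mul e3 e3 e40 (by positivity)
    refine (mul_le_mul_of_nonneg_left e4 (by positivity)).trans (le_of_eq ?_)
    have e5 : X ^ (8 * ε) = X ^ (6 * ε) * X ^ ε * X ^ ε := by
      rw [← Real.rpow_add hX0, ← Real.rpow_add hX0]; congr 1; ring
    rw [e5]; ring
  refine (add_le_add h1 h2).trans (le_of_eq ?_)
  ring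

set_option maxHeartbeats 1000000 in
lemma final_bound
    (ε : ℝ) (hε : 0 < ε) (F : ℝ → ℝ) (hF : IsTestFn F) (Cl : ℝ → ℝ) :
    ∃ C : ℝ, ∀ (χ : Eis → Eis → Eis), IsCubicSymbol χ →
      ∀ (μ : Eis → ℤ), IsMoebius μ →
      ∀ (X Y M : ℝ), 2 ≤ X → 1 ≤ Y → 1 ≤ M → M ≤ X ^ (100 : ℝ) →
      ∀ lm : Eis → ℂ,
        (∀ b : Eis, lm b ≠ 0 → Rep b ∧ Squarefree b ∧ IsCoprime b 3 ∧ Nm b ≤ M) →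
        (∀ ε' : ℝ, 0 < ε' → ∀ b : Eis, ‖lm b‖ ≤ Cl ε' * Nm b ^ (-1 + ε')) →
        SR μ Y X F (fun q => (Moll χ lm q) ^ 2 * A₂ χ q)
          ≤ C * X ^ ε * (X * (M / Y) ^ ((2:ℝ)/3) + X ^ ((5:ℝ)/6) * M) := by
  classical
  set δ := ε / 1000 with hδd
  have hδ : 0 < δ := by positivity
  obtain ⟨C1, hC1, hm⟩ := main_sum hδ
  obtain ⟨C2, hC2, hdiv⟩ := divisor_bound hδ
  refine ⟨2 * C2 * C1 * |Cl δ| ^ 2, ?_⟩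
  intro χ hχ μ hμ X Y M hX hY hM hMX lm hl hlb
  have hX0 : 0 < X := by linarith
  have hX1 : 1 ≤ X := by linarith
  have hM0 : 0 < M := by linarith
  have hY0 : 0 < Y := by linarith
  set f : Eis → ℝ := fun q => ‖Moll χ lm q ^ 2 * A₂ χ q‖ with hf
  have hf0 : ∀ q, 0 ≤ f q := fun q => norm_nonneg _
  set t := (bl (2 * X)).filter (fun q => (9 : Eis) ∣ q - 1) with ht
  have hSR : SR μ Y X F (fun q => (Moll χ lm q) ^ 2 * A₂ χ q) =
      ∑ q ∈ t, |(RY μ Y q : ℝ)| * f q * F (Nm q / X) := by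
    rw [SR]
    refine finsum_mem_eq_sum_of_inter_support_eq _ ?_
    ext q
    simp only [Set.mem_inter_iff, Function.mem_support, ht, Finset.coe_filter, Set.mem_ofPred_eq, mem_bl]
    refine ⟨fun h => ⟨⟨?_, h.1⟩, h.2⟩, fun h => ⟨h.1.2, h.2⟩⟩
    have hFq : F (Nm q / X) ≠ 0 := fun h0 => h.2 (by rw [h0, mul_zero])
    have := (hF.supp _ hFq).2
    rw [div_lt_iff₀ hX0] at this
    exact this.le
  have hP : ∀ q ∈ t, P1 q ∧ Nm q ≤ 2 * X ∧ (9 : Eis) ∣ q - 1 := by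
    intro q hq
    rw [ht, Finset.mem_filter, mem_bl] at hq
    exact ⟨nine_P1 hq.2, hq.1, hq.2⟩
  set D := C2 * (2 * X) ^ δ with hD
  have hD0 : 0 ≤ D := by positivity
  have h1 : ∑ q ∈ t, |(RY μ Y q : ℝ)| * f q * F (Nm q / X) ≤ D * ∑ q ∈ t with RY μ Y q ≠ 0, f q := by
    have e0 : ∑ q ∈ t with RY μ Y q ≠ 0, |(RY μ Y q : ℝ)| * f q * F (Nm q / X) =
        ∑ q ∈ t, |(RY μ Y q : ℝ)| * f q * F (Nm q / X) := by
      refine Finset.sum_filter_of_ne fun q _ h h0 => h ?_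
      rw [h0]; simp
    rw [← e0, Finset.mul_sum]
    refine Finset.sum_le_sum fun q hq => ?_
    obtain ⟨hq1, hqX, -⟩ := hP q (Finset.mem_filter.1 hq).1
    have e1 : |(RY μ Y q : ℝ)| ≤ D := by
      refine (abs_RY_le hμ hq1).trans ((hdiv q hq1.ne_zero).trans ?_)
      rw [hD]
      have := Real.rpow_le_rpow (Nm_nonneg q) hqX hδ.le
      gcongr
    calc |(RY μ Y q : ℝ)| * f q * F (Nm q / X) ≤ |(RY μ Y q : ℝ)| * f q * 1 :=
          mul_le_mul_of_nonneg_left (hF.le_one _) (mul_nonneg (abs_nonneg _) (hf0 q))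
      _ ≤ D * f q := by rw [mul_one]; exact mul_le_mul_of_nonneg_right e1 (hf0 q)
  have h2 := hm χ hχ (2 * X) M Y |Cl δ| (by linarith) hM hY (abs_nonneg _) lm
    (fun β hβ => by
      obtain ⟨r1, r2, r3, r4⟩ := hl β hβ
      exact ⟨⟨Rep_P1 r1 (not_lam_dvd_of_coprime r3), r2⟩, r4⟩)
    (fun β => (hlb δ hδ β).trans (mul_le_mul_of_nonneg_right (le_abs_self _)
      (Real.rpow_nonneg (Nm_nonneg _) _)))
    (t.filter fun q => RY μ Y q ≠ 0) (fun q hq => by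
      obtain ⟨hqt, hR⟩ := Finset.mem_filter.1 hq
      obtain ⟨hq1, hqX, hq9⟩ := hP q hqt
      exact ⟨hq9, hqX, RY_ne_zero hμ hq1 hR⟩)
  rw [hSR]
  refine h1.trans ((mul_le_mul_of_nonneg_left h2 hD0).trans ?_)
  set P := (M / Y) ^ (2/3 : ℝ) with hPd
  have hP0 : 0 ≤ P := by positivity
  have k1 : (2 * X) ^ (5/6 : ℝ) ≤ 2 * X ^ (5/6 : ℝ) := by
    rw [Real.mul_rpow (by norm_num) hX0.le]
    have : (2 : ℝ) ^ (5/6 : ℝ) ≤ 2 ^ (1 : ℝ) :=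
      Real.rpow_le_rpow_of_exponent_le (by norm_num) (by norm_num)
    rw [Real.rpow_one] at this
    gcongr
  have k2 : 2 * X * P + (2 * X) ^ (5/6 : ℝ) * M ≤ 2 * (X * P + X ^ (5/6 : ℝ) * M) := by
    have := mul_le_mul_of_nonneg_right k1 hM0.le
    linarith
  have k3 : ∀ s : ℝ, 0 ≤ s → (2 * X) ^ s ≤ X ^ (2 * s) := by
    intro s hs
    rw [Real.rpow_mul hX0.le]
    refine Real.rpow_le_rpow (by positivity) ?_ hs
    rw [Real.rpow_two]; nlinarith
  have k4 : M ^ (6 * δ) ≤ X ^ (600 * δ) := by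
    refine (Real.rpow_le_rpow hM0.le hMX (by positivity)).trans (le_of_eq ?_)
    rw [← Real.rpow_mul hX0.le]; congr 1; ring
  have k5 := k3 δ hδ.le
  have k6 := k3 (8 * δ) (by positivity)
  have k7 : X ^ (2 * δ) * X ^ (600 * δ) * X ^ (2 * (8 * δ)) ≤ X ^ ε := by
    rw [← Real.rpow_add hX0, ← Real.rpow_add hX0]
    exact Real.rpow_le_rpow_of_exponent_le hX1 (by rw [hδd]; linarith)
  have hV : 0 ≤ X * P + X ^ (5/6 : ℝ) * M := by positivity
  calc D * (C1 * |Cl δ| ^ 2 * M ^ (6 * δ) * (2 * X) ^ (8 * δ) * (2 * X * P + (2 * X) ^ (5/6 : ℝ) * M))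
      ≤ (C2 * X ^ (2 * δ)) * (C1 * |Cl δ| ^ 2 * X ^ (600 * δ) * X ^ (2 * (8 * δ)) *
        (2 * (X * P + X ^ (5/6 : ℝ) * M))) := by
        rw [hD]; gcongr
    _ = 2 * C2 * C1 * |Cl δ| ^ 2 * (X ^ (2 * δ) * X ^ (600 * δ) * X ^ (2 * (8 * δ))) *
        (X * P + X ^ (5/6 : ℝ) * M) := by ring
    _ ≤ 2 * C2 * C1 * |Cl δ| ^ 2 * X ^ ε * (X * P + X ^ (5/6 : ℝ) * M) := by gcongr

end assembly

/-- Proposition 1.3: the bound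
`𝒮_R(|𝓜(q)² A₂(q)|; F) ≪ X^ε (X (M/Y)^{2/3} + X^{5/6} M)`,
the implied constant depending only on `ε`, `F`, and the constants `Cl` in the bound
on the mollifier coefficients. -/
theorem SR_second_moment_bound
    (ε : ℝ) (hε : 0 < ε) (F : ℝ → ℝ) (hF : IsTestFn F) (Cl : ℝ → ℝ) :
    ∃ C : ℝ, ∀ (χ : Eis → Eis → Eis), IsCubicSymbol χ →
      ∀ (μ : Eis → ℤ), IsMoebius μ →
      ∀ (X Y M : ℝ), 2 ≤ X → 1 ≤ Y → Y ≤ X ^ (100 : ℝ) → 1 ≤ M → M ≤ X ^ (100 : ℝ) →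
      ∀ lm : Eis → ℂ,
        (∀ b : Eis, lm b ≠ 0 → Rep b ∧ Squarefree b ∧ IsCoprime b 3 ∧ Nm b ≤ M) →
        (∀ ε' : ℝ, 0 < ε' → ∀ b : Eis, ‖lm b‖ ≤ Cl ε' * Nm b ^ (-1 + ε')) →
        SR μ Y X F (fun q => (Moll χ lm q) ^ 2 * A₂ χ q)
          ≤ C * X ^ ε * (X * (M / Y) ^ ((2:ℝ)/3) + X ^ ((5:ℝ)/6) * M) := by
  obtain ⟨C, hC⟩ := final_bound ε hε F hF Cl
  exact ⟨C, fun χ hχ μ hμ X Y M hX hY _ hM hMX lm hl hlb =>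
    hC χ hχ μ hμ X Y M hX hY hM hMX lm hl hlb⟩

end CubicPaper
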